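/- Let g be a root-reductive Lie algebra with splitting maximal toral subalgebra h and Dynkin Borel subalgebra b ⊇ h. Let M be an indecomposable object of the extended category O-bar and λ ∈ h* such that L(λ) is a composition factor of M. Then every composition factor of M is of the form L(μ) for some μ ∈ W[λ]·λ. -/

import Mathlib

noncomputable section
namespace Paper

variable (K : Type) [Field K] [IsAlgClosed K] [CharZero K]
variable (g : Type) [LieRing g] [LieAlgebra K g]

def adWeightSpace (h : LieSubalgebra K g) (α : Module.Dual K h) : Submodule K g where
  carrier := {x | ∀ H : h, ⁅(H : g), x⁆ = α H • x}
  add_mem' := by intro a b ha hb H; rw [lie_add, ha H, hb H, smul_add]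
  zero_mem' := by intro H; rw [lie_zero, smul_zero]
  smul_mem' := by intro c x hx H; rw [lie_smul, hx H, smul_comm]

def IsRootOf (h : LieSubalgebra K g) (α : Module.Dual K h) : Prop :=
  α ≠ 0 ∧ adWeightSpace K g h α ≠ ⊥

def IsToralIn (s t : LieSubalgebra K g) : Prop :=
  t ≤ s ∧ IsLieAbelian t ∧
    s.toSubmodule ≤ ⨆ α : Module.Dual K t, s.toSubmodule ⊓ adWeightSpace K g t α

def IsMaxToralIn (s t : LieSubalgebra K g) : Prop :=
  IsToralIn K g s t ∧ ∀ t' : LieSubalgebra K g, IsToralIn K g s t' → t ≤ t' → t' = t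

/-- A root-reductive Lie algebra `g` together with a splitting maximal toral subalgebra `h`
and a splitting Borel subalgebra `b ⊇ h` determined by a set `pos` of positive roots. -/
structure Setup where
  /-- the exhausting chain of finite-dimensional reductive subalgebras -/
  F : ℕ → LieSubalgebra K g
  F_mono : Monotone F
  F_exhaust : ∀ x : g, ∃ n, x ∈ F n
  F_findim : ∀ n, FiniteDimensional K (F n)
  /-- each `F n` is reductive: every abelian ideal is central -/
  F_reductive : ∀ n, ∀ I : LieIdeal K (F n), IsLieAbelian I → I ≤ LieAlgebra.center K (F n)
  /-- the nested chain of Cartan subalgebras witnessing the root inclusions -/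
  C : ℕ → LieSubalgebra K g
  C_mono : Monotone C
  C_le : ∀ n, C n ≤ F n
  C_cartan : ∀ n, (LieSubalgebra.comap (F n).incl (C n)).IsCartanSubalgebra
  /-- each inclusion `F n ↪ F (n+1)` is a root inclusion with respect to `C (n+1)`:
  every root space of `F n` relative to `C n` is a root space of `F (n+1)` -/
  C_rootIncl : ∀ n, ∀ α : Module.Dual K (C n), α ≠ 0 →
    (F n).toSubmodule ⊓ adWeightSpace K g (C n) α ≠ ⊥ →
    ∃ β : Module.Dual K (C (n + 1)),
      (F n).toSubmodule ⊓ adWeightSpace K g (C n) α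
        = (F (n + 1)).toSubmodule ⊓ adWeightSpace K g (C (n + 1)) β
  /-- the splitting maximal toral subalgebra -/
  h : LieSubalgebra K g
  h_maxToral : ∀ n, IsMaxToralIn K g (F n) (h ⊓ F n)
  /-- `g` is the direct sum of its `h`-weight spaces -/
  h_indep : iSupIndep fun α : Module.Dual K h => adWeightSpace K g h α
  h_span : (⨆ α : Module.Dual K h, adWeightSpace K g h α) = ⊤
  /-- the set `Δ⁺` of positive roots -/
  pos : Set (Module.Dual K h)
  pos_root : ∀ α ∈ pos, IsRootOf K g h α
  pos_add : ∀ α ∈ pos, ∀ β ∈ pos, IsRootOf K g h (α + β) → α + β ∈ pos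
  pos_polar : ∀ α : Module.Dual K h, IsRootOf K g h α → (α ∈ pos ↔ ¬(-α ∈ pos))
  neg_add : ∀ α β : Module.Dual K h, IsRootOf K g h α → IsRootOf K g h β →
    α ∉ pos → β ∉ pos → IsRootOf K g h (α + β) → α + β ∉ pos
  /-- the splitting Borel subalgebra -/
  b : LieSubalgebra K g
  b_eq : b.toSubmodule = h.toSubmodule ⊔ ⨆ α ∈ pos, adWeightSpace K g h α


variable {K g}

namespace Setup

variable (S : Setup K g)

/-- `h ∩ g_n`. -/
def hn (n : ℕ) : LieSubalgebra K g := S.h ⊓ S.F n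

/-- restriction of a functional on `h` to `h ∩ g_n`. -/
def resDual (n : ℕ) (lam : Module.Dual K S.h) : Module.Dual K (S.hn n) :=
  lam.comp (LieSubalgebra.inclusion (inf_le_left : S.hn n ≤ S.h)).toLinearMap

/-- the `α`-root space of `g_n` relative to `h ∩ g_n`. -/
def rootSpaceN (n : ℕ) (α : Module.Dual K (S.hn n)) : Submodule K g :=
  (S.F n).toSubmodule ⊓ adWeightSpace K g (S.hn n) α

/-- the set of `b`-positive roots of `g_n`. -/
def posRootsN (n : ℕ) : Set (Module.Dual K (S.hn n)) :=
  {α | α ≠ 0 ∧ S.rootSpaceN n α ≠ ⊥ ∧ S.rootSpaceN n α ≤ S.b.toSubmodule}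

/-- `ρ_n`, the half sum of the positive roots of `g_n` with respect to `b ∩ g_n`. -/
def rhoN (n : ℕ) : Module.Dual K (S.hn n) :=
  (2 : K)⁻¹ • ∑ᶠ α ∈ S.posRootsN n, α

/-- `α` is a simple `b`-positive root: it is positive and cannot be written as a sum of
two or more positive roots. -/
def IsSimpleRoot (α : Module.Dual K S.h) : Prop :=
  α ∈ S.pos ∧ ¬∃ s : Multiset (Module.Dual K S.h),
    2 ≤ Multiset.card s ∧ (∀ β ∈ s, β ∈ S.pos) ∧ s.sum = α

/-- `b` is a Dynkin Borel subalgebra: it is generated, as a Lie subalgebra, by `h` together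
with the simple root spaces. -/
def IsDynkin : Prop :=
  S.b = LieSubalgebra.lieSpan K g
    ((S.h : Set g) ∪ ⋃ α ∈ {α | S.IsSimpleRoot α}, (adWeightSpace K g S.h α : Set g))

/-- the partial order `≼` on `h^*`: `lam ≼ mu` iff `mu - lam` is a `ℤ≥0`-linear combination
of positive roots. -/
def wle (lam mu : Module.Dual K S.h) : Prop :=
  ∃ s : Multiset (Module.Dual K S.h), (∀ β ∈ s, β ∈ S.pos) ∧ mu - lam = s.sum

/-- `g` is locally semisimple: each `g_n` is a semisimple Lie algebra. -/
def IsLocallySemisimple : Prop := ∀ n, LieAlgebra.IsSemisimple K (S.F n)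

end Setup


/-- the universal enveloping algebra of `g`. -/
abbrev Env (K g : Type) [Field K] [LieRing g] [LieAlgebra K g] : Type :=
  UniversalEnvelopingAlgebra K g

namespace Setup

variable {K : Type} [Field K] [IsAlgClosed K] [CharZero K]
variable {g : Type} [LieRing g] [LieAlgebra K g]
variable (S : Setup K g)

/-- the nilpotent radical `n⁺ = ⨁_{α ∈ Δ⁺} g^α` of `b`, as a subspace of `g`. -/
def nplus : Submodule K g := ⨆ α ∈ S.pos, adWeightSpace K g S.h α

/-- the left ideal of `U(g)` generated by `n⁺` and the elements `H - lam(H)`, `H ∈ h`. -/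
def vermaIdeal (lam : Module.Dual K S.h) : Submodule (Env K g) (Env K g) :=
  Submodule.span (Env K g)
    ((UniversalEnvelopingAlgebra.ι K '' (S.nplus : Set g)) ∪
      Set.range fun H : S.h =>
        UniversalEnvelopingAlgebra.ι K (H : g) - algebraMap K (Env K g) (lam H))

/-- the Verma module `M(lam) = U(g)/I`. -/
abbrev Verma (lam : Module.Dual K S.h) : Type := Env K g ⧸ S.vermaIdeal lam

/-- the maximal proper submodule of the Verma module `M(lam)`,
i.e. the sum of all proper submodules. -/
def maxSub (lam : Module.Dual K S.h) : Submodule (Env K g) (S.Verma lam) :=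
  sSup {N : Submodule (Env K g) (S.Verma lam) | N ≠ ⊤}

/-- the simple module `L(lam)`, the unique simple quotient of `M(lam)`. -/
abbrev SimpleL (lam : Module.Dual K S.h) : Type := S.Verma lam ⧸ S.maxSub lam

/-- `H` is the coroot `h_α` of the root `α`:  `α(H) = 2` and `H ∈ [g^α, g^{-α}]`. -/
def IsCoroot (α : Module.Dual K S.h) (H : S.h) : Prop :=
  α H = 2 ∧ ∃ x ∈ adWeightSpace K g S.h α, ∃ y ∈ adWeightSpace K g S.h (-α),
    (H : g) = ⁅x, y⁆

/-- the dot-reflection `s_α · mu = mu - (mu + ρ)(h_α) α` associated to a root `α`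
with coroot `Hα`, relative to the half sum `ρ` of positive roots. -/
def dotReflect (ρ α : Module.Dual K S.h) (Hα : S.h) (mu : Module.Dual K S.h) :
    Module.Dual K S.h :=
  mu - ((mu + ρ) Hα) • α

/-- `ρ` is the global half sum of positive roots: its restriction to each `h ∩ g_n`
is the half sum `ρ_n` of positive roots of `g_n`. -/
def IsGlobalRho (ρ : Module.Dual K S.h) : Prop := ∀ n : ℕ, S.resDual n ρ = S.rhoN n

/-- `lam` is strongly linked to `mu` (relative to `ρ`). -/
inductive StronglyLinked (ρ : Module.Dual K S.h) :
    Module.Dual K S.h → Module.Dual K S.h → Prop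
  | refl (mu : Module.Dual K S.h) : StronglyLinked ρ mu mu
  | step {lam mu : Module.Dual K S.h} (α : Module.Dual K S.h) (Hα : S.h) :
      α ∈ S.pos → S.IsCoroot α Hα →
      S.wle (S.dotReflect ρ α Hα mu) mu →
      StronglyLinked ρ lam (S.dotReflect ρ α Hα mu) →
      StronglyLinked ρ lam mu

/-- `lam` is antidominant: `(lam + ρ)(h_α)` is not a positive integer
for any positive root `α`. -/
def IsAntidominant (ρ lam : Module.Dual K S.h) : Prop :=
  ∀ α ∈ S.pos, ∀ Hα : S.h, S.IsCoroot α Hα → ¬∃ k : ℕ, 0 < k ∧ (lam + ρ) Hα = (k : K)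

/-- `lam` is almost antidominant: `(lam + ρ)(h_α)` is a positive integer
for only finitely many positive roots `α`. -/
def IsAlmostAntidominant (ρ lam : Module.Dual K S.h) : Prop :=
  {α | α ∈ S.pos ∧ ∃ Hα : S.h, S.IsCoroot α Hα ∧
    ∃ k : ℕ, 0 < k ∧ (lam + ρ) Hα = (k : K)}.Finite

end Setup

namespace Setup

variable {K : Type} [Field K] [IsAlgClosed K] [CharZero K]
variable {g : Type} [LieRing g] [LieAlgebra K g]
variable (S : Setup K g)

/-- the reflection `s_α : mu ↦ mu - mu(h_α) α`, as a linear map on `h^*`. -/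
def reflectionMap (α : Module.Dual K S.h) (Hα : S.h) :
    Module.Dual K S.h →ₗ[K] Module.Dual K S.h where
  toFun mu := mu - mu Hα • α
  map_add' mu ν := by
    simp only [LinearMap.add_apply, add_smul]
    abel
  map_smul' c mu := by
    simp only [LinearMap.smul_apply, RingHom.id_apply, smul_sub, smul_smul, smul_eq_mul]

/-- the reflection `s_α` associated to a root `α` with coroot `Hα`,
as a linear automorphism of `h^*`. -/
def reflection (α : Module.Dual K S.h) (Hα : S.h) (h2 : α Hα = 2) :
    Module.Dual K S.h ≃ₗ[K] Module.Dual K S.h :=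
  LinearEquiv.ofInvolutive (S.reflectionMap α Hα) (by
    intro mu
    show S.reflectionMap α Hα (mu - mu Hα • α) = mu
    show (mu - mu Hα • α) - ((mu - mu Hα • α) Hα) • α = mu
    rw [LinearMap.sub_apply, LinearMap.smul_apply, h2, smul_eq_mul]
    module)

/-- the Weyl group of `g`, realized as the group of linear automorphisms of `h^*`
generated by the reflections in the roots. -/
def weylGroup : Subgroup (Module.Dual K S.h ≃ₗ[K] Module.Dual K S.h) :=
  Subgroup.closure
    {w | ∃ (α : Module.Dual K S.h) (Hα : S.h) (hc : S.IsCoroot α Hα),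
      IsRootOf K g S.h α ∧ w = S.reflection α Hα hc.1}

/-- the dot action `w · mu = w(mu + ρ) - ρ`. -/
def dotAct (ρ : Module.Dual K S.h) (w : Module.Dual K S.h ≃ₗ[K] Module.Dual K S.h)
    (mu : Module.Dual K S.h) : Module.Dual K S.h :=
  w (mu + ρ) - ρ

/-- the root lattice `Λ`, the `ℤ`-span of the roots in `h^*`. -/
def rootLattice : Submodule ℤ (Module.Dual K S.h) :=
  Submodule.span ℤ {α : Module.Dual K S.h | IsRootOf K g S.h α}

end Setup

variable {K : Type} [Field K] [IsAlgClosed K] [CharZero K]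
variable {g : Type} [LieRing g] [LieAlgebra K g]

lemma env_smul_comm {M : Type} [AddCommGroup M] [Module K M] [Module (Env K g) M]
    [IsScalarTower K (Env K g) M] (c : K) (r : Env K g) (m : M) :
    r • (c • m) = c • (r • m) := by
  rw [← algebraMap_smul (Env K g) c m, ← mul_smul, ← Algebra.commutes, mul_smul,
    algebraMap_smul]

namespace Setup

variable (S : Setup K g)

section Modules

variable (M : Type) [AddCommGroup M] [Module K M] [Module (Env K g) M]
  [IsScalarTower K (Env K g) M]

/-- the `lam`-weight space of a `U(g)`-module `M`. -/
def wtSpace (lam : Module.Dual K S.h) : Submodule K M where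
  carrier := {m | ∀ H : S.h, UniversalEnvelopingAlgebra.ι K (H : g) • m = lam H • m}
  add_mem' := by
    intro a b ha hb H
    rw [smul_add, ha H, hb H, smul_add]
  zero_mem' := by
    intro H
    rw [smul_zero, smul_zero]
  smul_mem' := by
    intro c x hx H
    rw [env_smul_comm, hx H, smul_comm]

/-- the support of `M`: the set of `h`-weights of `M`. -/
def support : Set (Module.Dual K S.h) := {lam | S.wtSpace M lam ≠ ⊥}

/-- `M` is an object of the extended category `O-bar`:  it is an `h`-weight module with
finite-dimensional weight spaces and `U(n⁺) ⬝ v` is finite dimensional for every `v ∈ M`. -/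
structure InO : Prop where
  indep : iSupIndep fun lam : Module.Dual K S.h => S.wtSpace M lam
  span : (⨆ lam : Module.Dual K S.h, S.wtSpace M lam) = ⊤
  finite : ∀ lam : Module.Dual K S.h, FiniteDimensional K (S.wtSpace M lam)
  locFin : ∀ v : M, ∃ N : Submodule K M, FiniteDimensional K N ∧ v ∈ N ∧
    ∀ x ∈ S.nplus, ∀ m ∈ N, UniversalEnvelopingAlgebra.ι K x • m ∈ N

end Modules

end Setup

/-- a `U(g)`-module is indecomposable if it is nonzero and is not the direct sum of two
nonzero submodules. -/
def Indecomposable (M : Type) [AddCommGroup M] [Module (Env K g) M] : Prop :=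
  (⊤ : Submodule (Env K g) M) ≠ ⊥ ∧
    ∀ N₁ N₂ : Submodule (Env K g) M, IsCompl N₁ N₂ → N₁ = ⊥ ∨ N₂ = ⊥

/-- the subquotient `N₂ / N₁` of a pair of submodules. -/
abbrev subQuot {M : Type} [AddCommGroup M] [Module (Env K g) M]
    (N₁ N₂ : Submodule (Env K g) M) : Type :=
  N₂ ⧸ (N₁.comap N₂.subtype)

namespace Setup

variable (S : Setup K g)

/-- A composition series of `M` with bounds `lam ≼ nu`: a finite filtration of `M` together
with a relevant index set `J` such that relevant subquotients are simple modules `L(ξ)` with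
`lam ≼ ξ ≼ nu`, and irrelevant subquotients either have no weights in the interval
`[lam, nu]` or are simple modules `L(ξ)` with `ξ ≻ lam` and `ξ ⋠ nu`. -/
structure CompSeries (lam nu : Module.Dual K S.h) (M : Type) [AddCommGroup M] [Module K M]
    [Module (Env K g) M] [IsScalarTower K (Env K g) M] where
  k : ℕ
  c : Fin (k + 1) → Submodule (Env K g) M
  mono : Monotone c
  bot : c 0 = ⊥
  top : c (Fin.last k) = ⊤
  J : Finset (Fin k)
  rel : ∀ j ∈ J, ∃ ξ : Module.Dual K S.h, S.wle lam ξ ∧ S.wle ξ nu ∧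
    Nonempty (subQuot (c j.castSucc) (c j.succ) ≃ₗ[Env K g] S.SimpleL ξ)
  irrel : ∀ j : Fin k, j ∉ J →
    (∀ mu : Module.Dual K S.h, S.wle lam mu → S.wle mu nu →
        S.wtSpace (subQuot (c j.castSucc) (c j.succ)) mu = ⊥) ∨
    (∃ ξ : Module.Dual K S.h, S.wle lam ξ ∧ ξ ≠ lam ∧ ¬S.wle ξ nu ∧
        Nonempty (subQuot (c j.castSucc) (c j.succ) ≃ₗ[Env K g] S.SimpleL ξ))

/-- the `j`-th subquotient of a composition series. -/
abbrev CompSeries.quot {S : Setup K g} {lam nu : Module.Dual K S.h} {M : Type}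
    [AddCommGroup M] [Module K M] [Module (Env K g) M] [IsScalarTower K (Env K g) M]
    (T : S.CompSeries lam nu M) (j : Fin T.k) : Type :=
  subQuot (T.c j.castSucc) (T.c j.succ)

/-- the number of times the simple module `L(mu)` occurs in the composition series `T`. -/
noncomputable def CompSeries.mult {S : Setup K g} {lam nu : Module.Dual K S.h} {M : Type}
    [AddCommGroup M] [Module K M] [Module (Env K g) M] [IsScalarTower K (Env K g) M]
    (T : S.CompSeries lam nu M) (mu : Module.Dual K S.h) : ℕ :=
  Nat.card {j : Fin T.k // j ∈ T.J ∧ Nonempty (T.quot j ≃ₗ[Env K g] S.SimpleL mu)}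

/-- `L(mu)` is a composition factor of `M`: it occurs in some composition series of `M`
with bounds `lam ≼ mu ≼ nu`. -/
def IsCompFactor (M : Type) [AddCommGroup M] [Module K M] [Module (Env K g) M]
    [IsScalarTower K (Env K g) M] (mu : Module.Dual K S.h) : Prop :=
  ∃ (lam nu : Module.Dual K S.h) (T : S.CompSeries lam nu M),
    S.wle lam mu ∧ S.wle mu nu ∧
    ∃ j ∈ T.J, Nonempty (T.quot j ≃ₗ[Env K g] S.SimpleL mu)

end Setup

/-- A generalized composition series of `M`: a family of submodules indexed by a totally
ordered set `(J, <)`, strictly increasing, with trivial intersection, union equal to `M`,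
and all subquotients `M_j / M_{<j}` simple. -/
structure GenCompSeries (M : Type) [AddCommGroup M] [Module (Env K g) M] where
  J : Type
  lt : J → J → Prop
  linear : IsLinearOrder J lt
  c : J → Submodule (Env K g) M
  strict : ∀ {i j : J}, lt i j → c i < c j
  iInf_bot : (⨅ j, c j) = ⊥
  iSup_top : (⨆ j, c j) = ⊤
  simple : ∀ j : J,
    IsSimpleModule (Env K g) (subQuot (⨆ i : {i : J // lt i j}, c i) (c j))

/-- the subquotient `M_j / M_{<j}` of a generalized composition series. -/
abbrev GenCompSeries.quot {M : Type} [AddCommGroup M] [Module (Env K g) M]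
    (T : GenCompSeries (K := K) (g := g) M) (j : T.J) : Type :=
  subQuot (⨆ i : {i : T.J // T.lt i j}, T.c i) (T.c j)

set_option linter.unusedSectionVars false

section Closure

lemma map_mem_of_mem_span {V W : Type} [AddCommGroup V] [Module K V] [AddCommGroup W] [Module K W]
    (f : V →ₗ[K] W) {s : Set V} {P : Submodule K W} (h : ∀ x ∈ s, f x ∈ P) {x : V}
    (hx : x ∈ Submodule.span K s) : f x ∈ P :=
  (Submodule.span_le (p := P.comap f)).2 h hx

lemma map_mem_of_mem_iSup {V W ι : Type} [AddCommGroup V] [Module K V] [AddCommGroup W]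
    [Module K W] (f : V →ₗ[K] W) {p : ι → Submodule K V} {P : Submodule K W}
    (h : ∀ i, ∀ x ∈ p i, f x ∈ P) {x : V} (hx : x ∈ ⨆ i, p i) : f x ∈ P :=
  (iSup_le h : _ ≤ P.comap f) hx

variable {L : Type} [LieRing L] [LieAlgebra K L]

lemma lie_mem_of_mem_span {s : Set L} {P : Submodule K L} {y : L} (h : ∀ x ∈ s, ⁅y, x⁆ ∈ P) {x : L}
    (hx : x ∈ Submodule.span K s) : ⁅y, x⁆ ∈ P :=
  map_mem_of_mem_span (LieAlgebra.ad K L y : L →ₗ[K] L) h hx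

lemma lie_mem_of_mem_iSup {ι : Type} {p : ι → Submodule K L} {P : Submodule K L} {y : L}
    (h : ∀ i, ∀ x ∈ p i, ⁅y, x⁆ ∈ P) {x : L} (hx : x ∈ ⨆ i, p i) : ⁅y, x⁆ ∈ P :=
  map_mem_of_mem_iSup (LieAlgebra.ad K L y : L →ₗ[K] L) h hx

/-- The stabiliser of a subspace in a Lie algebra. -/
def stab (Y : Submodule K L) : LieSubalgebra K L where
  carrier := {x | ∀ y ∈ Y, ⁅x, y⁆ ∈ Y}
  add_mem' {a b} ha hb y hy := by rw [add_lie]; exact Y.add_mem (ha y hy) (hb y hy)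
  zero_mem' y _ := by rw [zero_lie]; exact Y.zero_mem
  smul_mem' c a ha y hy := by rw [smul_lie]; exact Y.smul_mem c (ha y hy)
  lie_mem' {a b} ha hb y hy := by
    change ⁅⁅a, b⁆, y⁆ ∈ Y
    rw [lie_lie]
    exact Y.sub_mem (ha _ (hb y hy)) (hb _ (ha y hy))

/-- Simultaneous eigenvectors with distinct eigenvalues are independent. -/
lemma eigen_sum_eq_zero {V X : Type} [AddCommGroup V] [Module K V] [AddCommGroup X] [Module K X]
    (A : X → V →ₗ[K] V) (s : Finset (Module.Dual K X)) (v : Module.Dual K X → V)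
    (hv : ∀ mu ∈ s, ∀ H, A H (v mu) = mu H • v mu) (h0 : ∑ mu ∈ s, v mu = 0) :
    ∀ mu ∈ s, v mu = 0 := by
  classical
  induction s using Finset.induction_on generalizing v with
  | empty => simp
  | insert nu s hnu ih =>
    have hall : ∀ mu ∈ s, v mu = 0 := by
      intro mu hmu
      have hne : mu ≠ nu := fun h => hnu (h ▸ hmu)
      obtain ⟨H, hH⟩ : ∃ H, mu H ≠ nu H := by
        by_contra! hcon
        exact hne (LinearMap.ext hcon)
      have key := ih (fun ka => (ka H - nu H) • v ka)
        (fun ka hka H' => by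
          rw [map_smul, hv ka (Finset.mem_insert_of_mem hka), smul_comm]) (by
          have h1 : A H (∑ ka ∈ insert nu s, v ka) - nu H • (∑ ka ∈ insert nu s, v ka) = 0 := by
            rw [h0]; simp
          rw [map_sum, Finset.smul_sum, ← Finset.sum_sub_distrib,
            Finset.sum_insert hnu, hv nu (Finset.mem_insert_self _ _) H, sub_self, zero_add] at h1
          rw [← h1]
          refine Finset.sum_congr rfl fun ka hka => ?_
          rw [hv ka (Finset.mem_insert_of_mem hka) H, sub_smul]) mu hmu
      exact (smul_eq_zero.1 key).resolve_left (sub_ne_zero.2 hH)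
    intro mu hmu
    rcases Finset.mem_insert.1 hmu with rfl | hmu
    · rw [Finset.sum_insert hnu, Finset.sum_eq_zero hall, add_zero] at h0
      exact h0
    · exact hall mu hmu

end Closure

section OreAd

attribute [local instance] LieRing.ofAssociativeRing

/-- The commutator `X ↦ F X - X F` as an additive map. -/
def commMap {U : Type} [Ring U] (F : U) : U →+ U :=
  AddMonoidHom.mulLeft F - AddMonoidHom.mulRight F

lemma commMap_apply {U : Type} [Ring U] (F X : U) : commMap F X = F * X - X * F := rfl

/-- `F` acts locally nilpotently on `U` by commutators. -/
def LocAdNilp {U : Type} [Ring U] (F : U) : Prop := ∀ X : U, ∃ n : ℕ, (commMap F)^[n] X = 0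

lemma commMap_mul {U : Type} [Ring U] (F X Y : U) :
    commMap F (X * Y) = commMap F X * Y + X * commMap F Y := by
  simp only [commMap_apply]; noncomm_ring

lemma commMap_iterate_mul_eq_zero {U : Type} [Ring U] (F : U) (m n : ℕ) :
    ∀ X Y : U, (commMap F)^[m] X = 0 → (commMap F)^[n] Y = 0 →
      (commMap F)^[m + n] (X * Y) = 0 := by
  induction h : m + n generalizing m n with
  | zero =>
    intro X Y hX hY
    obtain rfl : m = 0 := by omega
    simp only [Function.iterate_zero, id] at hX ⊢
    simp [hX]
  | succ k ih =>
    intro X Y hX hY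
    rw [Function.iterate_succ_apply, commMap_mul, iterate_map_add]
    have h1 : (commMap F)^[k] (commMap F X * Y) = 0 := by
      rcases m with _ | m
      · simp only [Function.iterate_zero, id] at hX
        simp [hX]
      · exact ih m n (by omega) _ _ (by rwa [Function.iterate_succ_apply] at hX) hY
    have h2 : (commMap F)^[k] (X * commMap F Y) = 0 := by
      rcases n with _ | n
      · simp only [Function.iterate_zero, id] at hY
        simp [hY]
      · exact ih m n (by omega) _ _ hX (by rwa [Function.iterate_succ_apply] at hY)
    rw [h1, h2, add_zero]

lemma LocAdNilp.exists_pow_mul {U : Type} [Ring U] {F : U} (hF : LocAdNilp F) (X : U) :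
    ∃ (n : ℕ) (Y : U), F ^ n * X = Y * F := by
  obtain ⟨n, hn⟩ := hF X
  refine ⟨n, ?_⟩
  induction n generalizing X with
  | zero => exact ⟨0, by simpa using hn⟩
  | succ n ih =>
    rw [Function.iterate_succ_apply] at hn
    obtain ⟨Y, hY⟩ := ih _ hn
    refine ⟨Y + F ^ n * X, ?_⟩
    rw [commMap_apply, mul_sub, ← mul_assoc, ← mul_assoc] at hY
    rw [add_mul, ← hY, pow_succ]
    noncomm_ring

lemma LocAdNilp.exists_pow_mul_pow {U : Type} [Ring U] {F : U} (hF : LocAdNilp F) (X : U)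
    (m : ℕ) : ∃ (n : ℕ) (Y : U), F ^ n * X = Y * F ^ m := by
  induction m generalizing X with
  | zero => exact ⟨0, X, by simp⟩
  | succ m ih =>
    obtain ⟨n, Y, hY⟩ := hF.exists_pow_mul X
    obtain ⟨n', Y', hY'⟩ := ih Y
    refine ⟨n' + n, Y', ?_⟩
    rw [pow_add, mul_assoc, hY, ← mul_assoc, hY', pow_succ, mul_assoc]

lemma LocAdNilp.exists_mul_pow {U : Type} [Ring U] {F : U} (hF : LocAdNilp F) (X : U) :
    ∃ (n : ℕ) (Y : U), X * F ^ n = F * Y := by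
  obtain ⟨n, hn⟩ := hF X
  refine ⟨n, ?_⟩
  induction n generalizing X with
  | zero => exact ⟨0, by simpa using hn⟩
  | succ n ih =>
    rw [Function.iterate_succ_apply] at hn
    obtain ⟨Y, hY⟩ := ih _ hn
    refine ⟨X * F ^ n - Y, ?_⟩
    rw [commMap_apply, sub_mul] at hY
    rw [mul_sub, ← hY, pow_succ']
    noncomm_ring

lemma LocAdNilp.exists_pow_mul_eq_zero {U : Type} [Ring U] {F : U} (hF : LocAdNilp F) (X : U)
    (m : ℕ) (h : X * F ^ m = 0) : ∃ n : ℕ, F ^ n * X = 0 := by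
  have one : ∀ X : U, X * F = 0 → ∃ n : ℕ, F ^ n * X = 0 := by
    intro X h
    obtain ⟨n, hn⟩ := hF X
    refine ⟨n, ?_⟩
    induction n generalizing X with
    | zero => simpa using hn
    | succ n ih =>
      have h2 := ih (F * X) (by rw [mul_assoc, h, mul_zero]) (by
        rwa [Function.iterate_succ_apply, commMap_apply, h, sub_zero] at hn)
      rwa [pow_succ, mul_assoc]
  induction m generalizing X with
  | zero => exact ⟨0, by simpa using h⟩
  | succ m ih' =>
    rw [pow_succ', ← mul_assoc] at h
    obtain ⟨n, hn⟩ := ih' _ h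
    rw [← mul_assoc] at hn
    obtain ⟨n', hn'⟩ := one _ hn
    exact ⟨n' + n, by rw [pow_add, mul_assoc, hn']⟩

/-- The powers of a locally ad-nilpotent element form a left Ore set. -/
@[reducible] def LocAdNilp.oreSet {U : Type} [Ring U] {F : U} (hF : LocAdNilp F) :
    OreLocalization.OreSet (Submonoid.powers F) where
  ore_right_cancel := by
    rintro r₁ r₂ ⟨_, m, rfl⟩ h
    obtain ⟨n, hn⟩ := hF.exists_pow_mul_eq_zero (r₁ - r₂) m
      (by rw [sub_mul]; exact sub_eq_zero.2 h)
    exact ⟨⟨F ^ n, n, rfl⟩, by rwa [mul_sub, sub_eq_zero] at hn⟩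
  oreNum X s := (hF.exists_pow_mul_pow X s.2.choose).choose_spec.choose
  oreDenom X s := ⟨F ^ (hF.exists_pow_mul_pow X s.2.choose).choose, _, rfl⟩
  ore_eq X s := by
    have := (hF.exists_pow_mul_pow X s.2.choose).choose_spec.choose_spec
    exact this.trans (congrArg _ s.2.choose_spec)

/-- Localization of a module at a locally ad-nilpotent element. -/
lemma LocAdNilp.exists_localization {U : Type} [Ring U] {F : U} (hF : LocAdNilp F)
    (R : Type) [AddCommGroup R] [Module U R] :
    ∃ (Q : Type) (_ : AddCommGroup Q) (_ : Module U Q) (j : R →ₗ[U] Q),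
      Function.Bijective (fun q : Q => F • q) ∧ (∀ r, j r = 0 → ∃ n : ℕ, F ^ n • r = 0) := by
  let _ := hF.oreSet
  refine ⟨OreLocalization (Submonoid.powers F) R, inferInstance, inferInstance,
    { toFun := fun r => OreLocalization.oreDiv r 1, map_add' := ?_, map_smul' := ?_ }, ?_, ?_⟩
  · intro x y; exact OreLocalization.add_oreDiv.symm
  · intro X x
    exact (OreLocalization.smul_oreDiv_one X x).symm
  · let s : Submonoid.powers F := ⟨F, 1, pow_one F⟩
    have hs : ∀ q : OreLocalization (Submonoid.powers F) R,
        F • q = (OreLocalization.oreDiv F (1 : Submonoid.powers F)) • q := by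
      intro q; rw [OreLocalization.oreDiv_one_smul]
    have e1 : (OreLocalization.oreDiv (1:U) s) *
        (OreLocalization.oreDiv F (1 : Submonoid.powers F)) = 1 :=
      OreLocalization.mul_inv (1 : Submonoid.powers F) s
    have e2 : (OreLocalization.oreDiv F (1 : Submonoid.powers F)) *
        (OreLocalization.oreDiv (1:U) s) = 1 :=
      OreLocalization.mul_inv s (1 : Submonoid.powers F)
    refine Function.bijective_iff_has_inverse.2
      ⟨fun q => (OreLocalization.oreDiv (1:U) s) • q, fun q => ?_, fun q => ?_⟩
    · simp only [hs]
      rw [← mul_smul, e1, one_smul]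
    · simp only [hs]
      rw [← mul_smul, e2, one_smul]
  · intro r hr
    have hr' : OreLocalization.oreDiv r (1 : Submonoid.powers F) =
        OreLocalization.oreDiv (0 : R) 1 := by
      rw [OreLocalization.zero_oreDiv]; exact hr
    rw [OreLocalization.oreDiv_eq_iff] at hr'
    obtain ⟨⟨_, n, rfl⟩, v, h1, h2⟩ := hr'
    refine ⟨n, ?_⟩
    simp only [smul_zero, Submonoid.coe_one, mul_one] at h1 h2
    change F ^ n = v at h2
    rw [h2]; exact h1.symm

lemma Env.induction {p : Env K g → Prop} (hs : ∀ c : K, p (algebraMap K _ c))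
    (hi : ∀ x : g, p (UniversalEnvelopingAlgebra.ι K x))
    (ha : ∀ X Y, p X → p Y → p (X + Y)) (hm : ∀ X Y, p X → p Y → p (X * Y))
    (X : Env K g) : p X := by
  let s : Subalgebra K (Env K g) :=
    { carrier := {X | p X}
      mul_mem' := fun {a b} h1 h2 => hm a b h1 h2
      add_mem' := fun {a b} h1 h2 => ha a b h1 h2
      algebraMap_mem' := hs }
  let φ : g →ₗ⁅K⁆ s :=
    { toFun := fun x => ⟨UniversalEnvelopingAlgebra.ι K x, hi x⟩
      map_add' := fun x y => Subtype.ext (map_add _ x y)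
      map_smul' := fun c x => Subtype.ext (map_smul _ c x)
      map_lie' := fun {x y} => Subtype.ext (LieHom.map_lie _ x y) }
  have h : s.val.comp (UniversalEnvelopingAlgebra.lift K φ) = AlgHom.id K _ := by
    apply UniversalEnvelopingAlgebra.hom_ext
    ext x
    simp [φ]
  have := congrArg (fun F : Env K g →ₐ[K] Env K g => F X) h
  simp only [AlgHom.comp_apply, AlgHom.id_apply] at this
  rw [← this]
  exact (UniversalEnvelopingAlgebra.lift K φ X).2

lemma env_iota_lie (x y : g) :
    UniversalEnvelopingAlgebra.ι K x * UniversalEnvelopingAlgebra.ι K y =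
      UniversalEnvelopingAlgebra.ι K y * UniversalEnvelopingAlgebra.ι K x +
        UniversalEnvelopingAlgebra.ι K ⁅x, y⁆ := by
  rw [LieHom.map_lie, LieRing.of_associative_ring_bracket]; abel

lemma locAdNilp_iota {x : g} (hx : IsNilpotent (LieAlgebra.ad K g x)) :
    LocAdNilp (UniversalEnvelopingAlgebra.ι K x) := by
  obtain ⟨n, hn⟩ := hx
  refine Env.induction ?_ ?_ ?_ ?_
  · intro c
    exact ⟨1, by simp [commMap_apply, Algebra.commutes]⟩
  · intro y
    have : ∀ m, (commMap (UniversalEnvelopingAlgebra.ι K x))^[m]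
        (UniversalEnvelopingAlgebra.ι K y) =
          UniversalEnvelopingAlgebra.ι K (((LieAlgebra.ad K g x) ^ m) y) := by
      intro m
      induction m with
      | zero => simp
      | succ m ih =>
        rw [Function.iterate_succ_apply', ih, commMap_apply, env_iota_lie, pow_succ']
        simp
    exact ⟨n, by rw [this, hn]; simp⟩
  · rintro X Y ⟨n, hn⟩ ⟨m, hm⟩
    refine ⟨m + n, ?_⟩
    rw [iterate_map_add, Function.iterate_add_apply, hn, add_comm m n,
      Function.iterate_add_apply, hm, iterate_map_zero, iterate_map_zero, add_zero]
  · rintro X Y ⟨n, hn⟩ ⟨m, hm⟩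
    exact ⟨n + m, commMap_iterate_mul_eq_zero _ _ _ _ _ hn hm⟩
end OreAd

section ChevBasics

attribute [local instance] LieRing.ofAssociativeRing

local notation "𝔦" => UniversalEnvelopingAlgebra.ι K

/-- `G` is the positive definite Gram matrix of the functionals `a i`, `i ∈ s`, with
symmetrizing scalars `d i`. -/
def IsGram {K g I : Type} [Field K] [LieRing g] [LieAlgebra K g] {h : LieSubalgebra K g}
    (a : I → Module.Dual K h) (hc : I → h) (s : Finset I) (d : I → ℚ) (G : I → I → ℚ) : Prop :=
  (∀ i ∈ s, 0 < d i) ∧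
  (∀ i ∈ s, ∀ j ∈ s, ((G i j : ℚ) : K) = (d i : K) * a j (hc i)) ∧
  (∀ i j, G i j = G j i) ∧
  (∀ c : I → ℚ, 0 ≤ ∑ i ∈ s, ∑ j ∈ s, c i * G i j * c j) ∧
  (∀ c : I → ℚ, ∑ i ∈ s, ∑ j ∈ s, c i * G i j * c j = 0 → ∀ i ∈ s, c i = 0)

/-- An element of the left ideal generated by the `e i` which commutes with the `f i`, `i ∈ s`, up
to the terms that a partial Casimir element produces. -/
def HasCasimir (K : Type) {g I : Type} [Field K] [LieRing g] [LieAlgebra K g] (e f c : I → g)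
    (s : Finset I) (d : I → ℚ) : Prop :=
  ∃ C ∈ Submodule.span (Env K g) (Set.range fun i => UniversalEnvelopingAlgebra.ι K (e i)),
    ∀ i ∈ s, C * UniversalEnvelopingAlgebra.ι K (f i) =
      UniversalEnvelopingAlgebra.ι K (f i) * C + (d i : K) •
        (UniversalEnvelopingAlgebra.ι K (f i) * UniversalEnvelopingAlgebra.ι K (c i))

/-- Chevalley-type generators `e i`, `f i` of `g` relative to an abelian subalgebra `h`, with the
finite-rank Casimir-type elements used in place of a global Casimir operator. -/
structure ChevData (K g : Type) [Field K] [LieRing g] [LieAlgebra K g] where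
  h : LieSubalgebra K g
  I : Type
  a : I → Module.Dual K h
  e : I → g
  f : I → g
  hc : I → h
  h_comm : ∀ H H' : h, ⁅(H : g), (H' : g)⁆ = 0
  he : ∀ (H : h) (i : I), ⁅(H : g), e i⁆ = a i H • e i
  hf : ∀ (H : h) (i : I), ⁅(H : g), f i⁆ = -(a i H • f i)
  ef : ∀ i, ⁅e i, f i⁆ = hc i
  ef_ne : ∀ i j, i ≠ j → ⁅e i, f j⁆ = 0
  a_hc : ∀ i, a i (hc i) = 2
  gen : LieSubalgebra.lieSpan K g ((h : Set g) ∪ Set.range e ∪ Set.range f) = ⊤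
  nil_e : ∀ i, IsNilpotent (LieAlgebra.ad K g (e i))
  nil_f : ∀ i, IsNilpotent (LieAlgebra.ad K g (f i))
  indep : LinearIndependent K a
  casimir : ∀ s : Finset I, ∃ (d : I → ℚ) (G : I → I → ℚ), IsGram a hc s d G ∧
    HasCasimir K e f (fun i => hc i) s d ∧ HasCasimir K f e (fun i => ((-hc i : h) : g)) s d

/-- The opposite data, with the roles of `e` and `f` exchanged. -/
def ChevData.op (D : ChevData K g) : ChevData K g where
  h := D.h
  I := D.I
  a i := -D.a i
  e := D.f
  f := D.e
  hc i := -D.hc i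
  h_comm := D.h_comm
  he H i := by rw [D.hf]; simp
  hf H i := by rw [D.he]; simp
  ef i := by rw [← lie_skew, D.ef]; simp
  ef_ne i j hij := by rw [← lie_skew, D.ef_ne j i hij.symm, neg_zero]
  a_hc i := by simp [D.a_hc]
  gen := by rw [Set.union_right_comm]; exact D.gen
  nil_e := D.nil_f
  nil_f := D.nil_e
  indep := by
    have := D.indep
    rw [linearIndependent_iff'] at this ⊢
    intro s c hc i hi
    refine this s c ?_ i hi
    simpa using hc
  casimir s := by
    obtain ⟨d, G, ⟨h1, h2, h3⟩, h4, h5⟩ := D.casimir s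
    exact ⟨d, G, ⟨h1, fun i hi j hj => by rw [h2 i hi j hj]; simp, h3⟩, h5, by simpa using h4⟩

variable {R : Type} [AddCommGroup R] [Module K R] [Module (Env K g) R]
  [IsScalarTower K (Env K g) R]

lemma iota_smul_comm (x y : g) (v : R) : 𝔦 x • 𝔦 y • v = 𝔦 y • 𝔦 x • v + 𝔦 ⁅x, y⁆ • v := by
  rw [← mul_smul, env_iota_lie, add_smul, mul_smul]

lemma iota_smul_smul (c : K) (x : g) (v : R) : 𝔦 (c • x) • v = c • 𝔦 x • v := by
  rw [map_smul, smul_assoc]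

/-- A `K`-subspace stable under `g` is stable under the enveloping algebra. -/
lemma env_smul_mem {N : Submodule K R} (hN : ∀ (x : g), ∀ v ∈ N, 𝔦 x • v ∈ N)
    (X : Env K g) {v : R} (hv : v ∈ N) : X • v ∈ N := by
  revert v
  refine Env.induction (p := fun X => ∀ {v : R}, v ∈ N → X • v ∈ N) ?_ ?_ ?_ ?_ X
  · intro c v hv
    rw [algebraMap_smul]; exact N.smul_mem c hv
  · intro x v hv; exact hN x v hv
  · intro X Y hX hY v hv
    rw [add_smul]; exact N.add_mem (hX hv) (hY hv)
  · intro X Y hX hY v hv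
    rw [mul_smul]; exact hX (hY hv)

/-- The weight space of a `U(g)`-module for a subalgebra `h`. -/
def hWt (h : LieSubalgebra K g) (R : Type) [AddCommGroup R] [Module K R] [Module (Env K g) R]
    [IsScalarTower K (Env K g) R] (mu : Module.Dual K h) : Submodule K R where
  carrier := {v | ∀ H : h, 𝔦 (H : g) • v = mu H • v}
  add_mem' := by
    intro a b ha hb H
    rw [smul_add, ha H, hb H, smul_add]
  zero_mem' := by
    intro H
    rw [smul_zero, smul_zero]
  smul_mem' := by
    intro c x hx H
    rw [env_smul_comm, hx H, smul_comm]

lemma hWt_sum_eq_zero {h : LieSubalgebra K g} (s : Finset (Module.Dual K h))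
    (v : Module.Dual K h → R) (hv : ∀ mu ∈ s, v mu ∈ hWt h R mu) (h0 : ∑ mu ∈ s, v mu = 0) :
    ∀ mu ∈ s, v mu = 0 :=
  eigen_sum_eq_zero (fun H : h => Algebra.lsmul K K R (𝔦 (H : g))) s v hv h0

/-- A weight vector in the span of weight vectors lies in the span of those of its weight. -/
lemma mem_span_of_weight {h : LieSubalgebra K g} {J : Type} (x : J → R) (wt : J → Module.Dual K h)
    (hx : ∀ j, x j ∈ hWt h R (wt j)) {mu : Module.Dual K h} {u : R} (hu : u ∈ hWt h R mu)
    (hus : u ∈ Submodule.span K (Set.range x)) :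
    u ∈ Submodule.span K (x '' {j | wt j = mu}) := by
  classical
  obtain ⟨c, rfl⟩ := Finsupp.mem_span_range_iff_exists_finsupp.1 hus
  set T : Finset (Module.Dual K h) := insert mu (c.support.image wt) with hT
  let p : Module.Dual K h → R := fun ka => ∑ j ∈ c.support with wt j = ka, c j • x j
  have hp : ∀ ka, p ka ∈ hWt h R ka := by
    intro ka
    refine Submodule.sum_mem _ fun j hj => Submodule.smul_mem _ _ ?_
    rw [← (Finset.mem_filter.1 hj).2]; exact hx j
  have hsum : ∑ ka ∈ T, p ka = c.sum fun j b => b • x j := by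
    rw [Finsupp.sum, ← Finset.sum_fiberwise_of_maps_to (t := T) (g := wt)]
    intro j hj
    exact Finset.mem_insert_of_mem (Finset.mem_image_of_mem _ hj)
  set u := c.sum fun j b => b • x j with hudef
  have h0 := hWt_sum_eq_zero T (fun ka => p ka - if ka = mu then u else 0)
    (fun ka _ => by
      by_cases hk : ka = mu
      · subst hk; simpa using Submodule.sub_mem _ (hp ka) hu
      · simpa [hk] using hp ka)
    (by rw [Finset.sum_sub_distrib, hsum]; simp [hT]) mu (Finset.mem_insert_self _ _)
  simp only [if_true, sub_eq_zero] at h0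
  rw [← h0]
  refine Submodule.sum_mem _ fun j hj => Submodule.smul_mem _ _ (Submodule.subset_span ?_)
  exact ⟨j, (Finset.mem_filter.1 hj).2, rfl⟩

namespace ChevData

variable (D : ChevData K g)

/-- `v` is a singular vector of weight `mu` (possibly zero). -/
def Sing (v : R) (mu : Module.Dual K D.h) : Prop :=
  v ∈ hWt D.h R mu ∧ ∀ i, 𝔦 (D.e i) • v = 0

/-- A nonzero singular vector of weight `mu` occurs in a module generated by a singular vector
of weight `lam`. -/
def Link (lam mu : Module.Dual K D.h) : Prop :=
  ∃ (R : Type) (_ : AddCommGroup R) (_ : Module K R) (_ : Module (Env K g) R)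
    (_ : IsScalarTower K (Env K g) R) (w u : R),
    D.Sing w lam ∧ D.Sing u mu ∧ u ≠ 0 ∧ u ∈ Submodule.span (Env K g) {w}

/-- The dot reflection in a simple root. -/
def sdot (i : D.I) (mu : Module.Dual K D.h) : Module.Dual K D.h :=
  mu - (mu (D.hc i) + 1) • D.a i

lemma sdot_apply_hc (i : D.I) (mu : Module.Dual K D.h) :
    D.sdot i mu (D.hc i) = -mu (D.hc i) - 2 := by
  simp only [sdot, LinearMap.sub_apply, LinearMap.smul_apply, D.a_hc, smul_eq_mul]; ring

lemma sdot_sdot (i : D.I) (mu : Module.Dual K D.h) : D.sdot i (D.sdot i mu) = mu := by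
  conv_lhs => rw [sdot, sdot_apply_hc, sdot]
  module

/-- A subspace stable under the generators is stable under `g`. -/
lemma iota_smul_mem {N : Submodule K R} (hH : ∀ (H : D.h), ∀ v ∈ N, 𝔦 (H : g) • v ∈ N)
    (he : ∀ i, ∀ v ∈ N, 𝔦 (D.e i) • v ∈ N) (hf : ∀ i, ∀ v ∈ N, 𝔦 (D.f i) • v ∈ N) (x : g) :
    ∀ v ∈ N, 𝔦 x • v ∈ N := by
  have hx : x ∈ LieSubalgebra.lieSpan K g ((D.h : Set g) ∪ Set.range D.e ∪ Set.range D.f) := by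
    rw [D.gen]; trivial
  induction hx using LieSubalgebra.lieSpan_induction with
  | mem x hx =>
    rcases hx with (hx | ⟨i, rfl⟩) | ⟨i, rfl⟩
    · exact hH ⟨x, hx⟩
    · exact he i
    · exact hf i
  | zero => intro v _; simp
  | add x y _ _ h1 h2 => intro v hv; rw [map_add, add_smul]; exact N.add_mem (h1 v hv) (h2 v hv)
  | smul c x _ h1 => intro v hv; rw [iota_smul_smul]; exact N.smul_mem _ (h1 v hv)
  | lie x y _ _ h1 h2 =>
    intro v hv
    have := iota_smul_comm (K := K) x y v
    rw [← sub_eq_iff_eq_add'] at this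
    rw [← this]
    exact N.sub_mem (h1 _ (h2 v hv)) (h2 _ (h1 v hv))

lemma f_smul_mem {mu : Module.Dual K D.h} {v : R} (hv : v ∈ hWt D.h R mu) (i : D.I) :
    𝔦 (D.f i) • v ∈ hWt D.h R (mu - D.a i) := by
  intro H
  rw [iota_smul_comm, hv H, D.hf, map_neg, neg_smul, iota_smul_smul, env_smul_comm]
  simp only [LinearMap.sub_apply]
  generalize 𝔦 (D.f i) • v = q
  module

lemma e_smul_mem {mu : Module.Dual K D.h} {v : R} (hv : v ∈ hWt D.h R mu) (i : D.I) :
    𝔦 (D.e i) • v ∈ hWt D.h R (mu + D.a i) := by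
  intro H
  rw [iota_smul_comm, hv H, D.he, iota_smul_smul, env_smul_comm]
  simp only [LinearMap.add_apply]
  generalize 𝔦 (D.e i) • v = q
  module

/-- The word `f_{i₁} ⋯ f_{iₖ} w`. -/
def word (w : R) (l : List D.I) : R := l.foldr (fun i v => 𝔦 (D.f i) • v) w

/-- The sum of the simple roots occurring in a word. -/
def lwt (l : List D.I) : Module.Dual K D.h := (l.map D.a).sum

lemma word_mem {lam : Module.Dual K D.h} {w : R} (hw : w ∈ hWt D.h R lam) (l : List D.I) :
    D.word w l ∈ hWt D.h R (lam - D.lwt l) := by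
  induction l with
  | nil => simpa [lwt, word] using hw
  | cons i l ih =>
    have := D.f_smul_mem ih i
    rw [sub_sub] at this
    simpa [lwt, word, add_comm] using this

lemma e_word_mem {lam : Module.Dual K D.h} {w : R} (hw : D.Sing w lam) (l : List D.I) (j : D.I) :
    𝔦 (D.e j) • D.word w l ∈ Submodule.span K (Set.range (D.word w)) := by
  induction l with
  | nil => rw [word, List.foldr_nil, hw.2]; exact Submodule.zero_mem _
  | cons i l ih =>
    change 𝔦 (D.e j) • 𝔦 (D.f i) • D.word w l ∈ _
    rw [iota_smul_comm]
    refine Submodule.add_mem _ ?_ ?_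
    · have : Submodule.span K (Set.range (D.word w)) ≤
          (Submodule.span K (Set.range (D.word w))).comap (Algebra.lsmul K K R (𝔦 (D.f i))) := by
        rw [Submodule.span_le]
        rintro _ ⟨l', rfl⟩
        exact Submodule.subset_span ⟨i :: l', rfl⟩
      exact this ih
    · by_cases hij : j = i
      · subst hij
        rw [D.ef, D.word_mem hw.1 l (D.hc j)]
        exact Submodule.smul_mem _ _ (Submodule.subset_span ⟨l, rfl⟩)
      · rw [D.ef_ne j i hij]; simp

lemma mem_span_words {lam : Module.Dual K D.h} {w : R} (hw : D.Sing w lam) {u : R}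
    (hu : u ∈ Submodule.span (Env K g) {w}) : u ∈ Submodule.span K (Set.range (D.word w)) := by
  obtain ⟨X, rfl⟩ := Submodule.mem_span_singleton.1 hu
  have aux : ∀ Y : Env K g, (∀ l, Y • D.word w l ∈ Submodule.span K (Set.range (D.word w))) →
      ∀ v ∈ Submodule.span K (Set.range (D.word w)),
        Y • v ∈ Submodule.span K (Set.range (D.word w)) := by
    intro Y hY v hv
    have : Submodule.span K (Set.range (D.word w)) ≤
        (Submodule.span K (Set.range (D.word w))).comap (Algebra.lsmul K K R Y) := by
      rw [Submodule.span_le]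
      rintro _ ⟨l', rfl⟩
      exact hY l'
    exact this hv
  refine env_smul_mem (D.iota_smul_mem (fun H => aux _ fun l => ?_) (fun i => aux _ fun l => ?_)
    (fun i => aux _ fun l => ?_)) X (Submodule.subset_span ⟨[], rfl⟩)
  · rw [D.word_mem hw.1 l H]
    exact Submodule.smul_mem _ _ (Submodule.subset_span ⟨l, rfl⟩)
  · exact D.e_word_mem hw l i
  · exact Submodule.subset_span ⟨i :: l, rfl⟩

lemma mem_span_words_of_weight {lam mu : Module.Dual K D.h} {w : R} (hw : D.Sing w lam) {u : R}
    (hu : u ∈ Submodule.span (Env K g) {w}) (hmu : u ∈ hWt D.h R mu) :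
    u ∈ Submodule.span K (D.word w '' {l | lam - D.lwt l = mu}) :=
  mem_span_of_weight (D.word w) (fun l => lam - D.lwt l) (D.word_mem hw.1) hmu
    (D.mem_span_words hw hu)

lemma exists_word {lam mu : Module.Dual K D.h} {w : R} (hw : D.Sing w lam) {u : R}
    (hu : u ∈ Submodule.span (Env K g) {w}) (hmu : u ∈ hWt D.h R mu) (h0 : u ≠ 0) :
    ∃ l : List D.I, mu = lam - D.lwt l := by
  have := D.mem_span_words_of_weight hw hu hmu
  by_contra! hcon
  have hem : {l | lam - D.lwt l = mu} = ∅ := by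
    ext l; simpa using fun h => hcon l h.symm
  rw [hem] at this
  simp at this
  exact h0 this

end ChevData
end ChevBasics

section Move

attribute [local instance] LieRing.ofAssociativeRing

local notation "𝔦" => UniversalEnvelopingAlgebra.ι K

namespace ChevData

variable (D : ChevData K g)
variable {R : Type} [AddCommGroup R] [Module K R] [Module (Env K g) R]
  [IsScalarTower K (Env K g) R]

lemma e_f_pow_smul {mu : Module.Dual K D.h} {u : R} (hu : D.Sing u mu) (i : D.I) (n : ℕ) :
    𝔦 (D.e i) • (𝔦 (D.f i)) ^ (n + 1) • u =
      (((n : K) + 1) * (mu (D.hc i) - n)) • (𝔦 (D.f i)) ^ n • u := by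
  have hwt : ∀ n : ℕ, (𝔦 (D.f i)) ^ n • u ∈ hWt D.h R (mu - (n : K) • D.a i) := by
    intro n
    induction n with
    | zero => simpa using hu.1
    | succ n ih =>
      rw [pow_succ', mul_smul]
      have := D.f_smul_mem ih i
      rwa [sub_sub, show (n : K) • D.a i + D.a i = ((n + 1 : ℕ) : K) • D.a i by
        push_cast; module] at this
  induction n with
  | zero =>
    rw [pow_succ', pow_zero, mul_one, one_smul, iota_smul_comm, hu.2, smul_zero, D.ef, hu.1]
    simp
  | succ n ih =>
    rw [pow_succ', mul_smul, iota_smul_comm, ih, D.ef, hwt (n + 1) (D.hc i), env_smul_comm,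
      ← mul_smul (𝔦 (D.f i)), ← pow_succ', ← add_smul]
    congr 1
    simp only [LinearMap.sub_apply, LinearMap.smul_apply, D.a_hc, smul_eq_mul]
    push_cast; ring

lemma f_pow_smul_ne_zero {mu : Module.Dual K D.h} {u : R} (hu : D.Sing u mu) (h0 : u ≠ 0)
    (i : D.I) (hmu : ∀ n : ℕ, mu (D.hc i) ≠ n) (n : ℕ) : (𝔦 (D.f i)) ^ n • u ≠ 0 := by
  induction n with
  | zero => simpa using h0
  | succ n ih =>
    intro h
    have := D.e_f_pow_smul hu i n
    rw [h, smul_zero] at this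
    rcases smul_eq_zero.1 this.symm with h1 | h1
    · rcases mul_eq_zero.1 h1 with h2 | h2
      · exact (by exact_mod_cast Nat.succ_ne_zero n : (n : K) + 1 ≠ 0) h2
      · exact hmu n (sub_eq_zero.1 h2)
    · exact ih h1

/-- A module with the action twisted by an automorphism. -/
def Twist (_ : g ≃ₗ⁅K⁆ g) (R : Type) : Type := R

instance (σ : g ≃ₗ⁅K⁆ g) : AddCommGroup (Twist σ R) := inferInstanceAs (AddCommGroup R)
instance (σ : g ≃ₗ⁅K⁆ g) : Module K (Twist σ R) := inferInstanceAs (Module K R)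

/-- The algebra endomorphism of `U(g)` induced by an automorphism of `g`. -/
def envMap (σ : g ≃ₗ⁅K⁆ g) : Env K g →ₐ[K] Env K g :=
  UniversalEnvelopingAlgebra.lift K ((UniversalEnvelopingAlgebra.ι K).comp (σ : g →ₗ⁅K⁆ g))

lemma envMap_iota (σ : g ≃ₗ⁅K⁆ g) (x : g) : envMap σ (𝔦 x) = 𝔦 (σ x) := by
  rw [envMap, UniversalEnvelopingAlgebra.lift_ι_apply]; rfl

lemma envMap_surjective (σ : g ≃ₗ⁅K⁆ g) : Function.Surjective (envMap (K := K) σ) := by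
  intro X
  refine Env.induction (p := fun X => ∃ Y, envMap σ Y = X) ?_ ?_ ?_ ?_ X
  · intro c; exact ⟨algebraMap K _ c, AlgHom.commutes _ _⟩
  · intro x; exact ⟨𝔦 (σ.symm x), by rw [envMap_iota, LieEquiv.apply_symm_apply]⟩
  · rintro _ _ ⟨Y, rfl⟩ ⟨Z, rfl⟩; exact ⟨Y + Z, map_add _ _ _⟩
  · rintro _ _ ⟨Y, rfl⟩ ⟨Z, rfl⟩; exact ⟨Y * Z, map_mul _ _ _⟩

instance (σ : g ≃ₗ⁅K⁆ g) : Module (Env K g) (Twist σ R) :=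
  Module.compHom R (envMap (K := K) σ).toRingHom

instance (σ : g ≃ₗ⁅K⁆ g) : IsScalarTower K (Env K g) (Twist σ R) where
  smul_assoc c X v := by
    change envMap σ (c • X) • (show R from v) = c • (envMap σ X • (show R from v))
    rw [map_smul, smul_assoc]

lemma link_of_twist (σ : g ≃ₗ⁅K⁆ g) {lam mu : Module.Dual K D.h} (w u : R)
    (hw : ∀ H : D.h, 𝔦 (σ H) • w = lam H • w) (hw' : ∀ i, 𝔦 (σ (D.e i)) • w = 0)
    (hu : ∀ H : D.h, 𝔦 (σ H) • u = mu H • u) (hu' : ∀ i, 𝔦 (σ (D.e i)) • u = 0)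
    (h0 : u ≠ 0) (hmem : u ∈ Submodule.span (Env K g) {w}) : D.Link lam mu := by
  refine ⟨Twist σ R, inferInstance, inferInstance, inferInstance, inferInstance, w, u,
    ⟨fun H => ?_, fun i => ?_⟩, ⟨fun H => ?_, fun i => ?_⟩, h0, ?_⟩
  · exact (congrArg (· • w) (envMap_iota σ (H : g))).trans (hw H)
  · exact (congrArg (· • w) (envMap_iota σ (D.e i))).trans (hw' i)
  · exact (congrArg (· • u) (envMap_iota σ (H : g))).trans (hu H)
  · exact (congrArg (· • u) (envMap_iota σ (D.e i))).trans (hu' i)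
  · obtain ⟨X, rfl⟩ := Submodule.mem_span_singleton.1 hmem
    obtain ⟨Y, rfl⟩ := envMap_surjective σ X
    exact Submodule.mem_span_singleton.2 ⟨Y, rfl⟩

omit [IsAlgClosed K] in
lemma exists_exp_ad {x : g} (hx : IsNilpotent (LieAlgebra.ad K g x)) :
    ∃ τ : g ≃ₗ⁅K⁆ g, ∀ (y : g) (k : ℕ), ((LieAlgebra.ad K g x) ^ k) y = 0 →
      τ y = ∑ n ∈ Finset.range k, ((n.factorial : K))⁻¹ • ((LieAlgebra.ad K g x) ^ n) y := by
  let _ : Module ℚ g := Module.compHom g (algebraMap ℚ K)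
  have hq : ∀ (q : ℚ) (y : g), q • y = (q : K) • y := fun q y => by
    change (algebraMap ℚ K q) • y = _
    simp
  let _ : LieAlgebra ℚ g := { lie_smul := fun q y z => by rw [hq, hq, lie_smul] }
  have heq : (LieDerivation.ad K g x).toLinearMap = LieAlgebra.ad K g x :=
    LinearMap.ext fun z => LieDerivation.ad_apply_apply K g x z
  have hx' : IsNilpotent (LieDerivation.ad K g x).toLinearMap := heq ▸ hx
  refine ⟨LieDerivation.exp (LieDerivation.ad K g x) hx', fun y k hk => ?_⟩
  have h0 : LieDerivation.exp (LieDerivation.ad K g x) hx' y =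
      IsNilpotent.exp (LieAlgebra.ad K g x) y := by
    rw [LieDerivation.exp_map_apply]
    exact congrArg (fun T : Module.End K g => IsNilpotent.exp T y) heq
  refine (show _ = _ from h0).trans ?_
  have := IsNilpotent.exp_smul_eq_sum (A := Module.End K g) (a := LieAlgebra.ad K g x) (m := y)
    (k := k) hk hx
  refine this.trans (Finset.sum_congr rfl fun n _ => ?_)
  rw [hq]
  simp

/-- The automorphism of `g` lifting a simple reflection. -/
lemma exists_sigma (i : D.I) : ∃ σ : g ≃ₗ⁅K⁆ g,
    (∀ H : D.h, σ H = (H : g) - D.a i H • (D.hc i : g)) ∧ σ (D.e i) = -D.f i ∧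
    ∀ j, j ≠ i → σ (D.e j) ∈
      Submodule.span K (Set.range fun k : ℕ => ((LieAlgebra.ad K g (D.e i)) ^ k) (D.e j)) := by
  obtain ⟨E, hE⟩ := exists_exp_ad (D.nil_e i)
  have hnf : IsNilpotent (LieAlgebra.ad K g (-D.f i)) := by
    rw [map_neg]; exact (D.nil_f i).neg
  obtain ⟨Φ, hΦ⟩ := exists_exp_ad hnf
  have eH : ∀ H : D.h, ⁅D.e i, (H : g)⁆ = -(D.a i H • D.e i) := fun H => by
    rw [← lie_skew, D.he]
  have fH : ∀ H : D.h, ⁅D.f i, (H : g)⁆ = D.a i H • D.f i := fun H => by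
    rw [← lie_skew, D.hf, neg_neg]
  have fe : ⁅D.f i, D.e i⁆ = -(D.hc i : g) := by rw [← lie_skew, D.ef]
  have EH : ∀ H : D.h, E H = (H : g) - D.a i H • D.e i := fun H => by
    rw [hE H 2 (by simp [pow_two, eH])]
    simp [Finset.sum_range_succ, eH, sub_eq_add_neg]
  have Ee : E (D.e i) = D.e i := by
    rw [hE _ 1 (by simp)]; simp
  have Ef : E (D.f i) = D.f i + D.hc i - D.e i := by
    rw [hE _ 3 (by simp [pow_succ, eH, D.ef])]
    simp [Finset.sum_range_succ, pow_succ, eH, D.ef, D.a_hc, Nat.factorial]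
    abel
  have ΦH : ∀ H : D.h, Φ H = (H : g) - D.a i H • D.f i := fun H => by
    rw [hΦ H 2 (by simp [pow_two, fH])]
    simp [Finset.sum_range_succ, fH, sub_eq_add_neg]
  have Φf : Φ (D.f i) = D.f i := by
    rw [hΦ _ 1 (by simp)]; simp
  have Φe : Φ (D.e i) = D.e i + D.hc i - D.f i := by
    rw [hΦ _ 3 (by simp [pow_succ, fH, fe])]
    simp [Finset.sum_range_succ, pow_succ, fH, fe, D.a_hc, Nat.factorial]
    abel
  refine ⟨(E.trans Φ).trans E, fun H => ?_, ?_, fun j hj => ?_⟩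
  · simp only [LieEquiv.trans_apply, EH, map_sub, map_smul, ΦH, Φe, Ee, Ef, map_add, D.a_hc]
    module
  · simp only [LieEquiv.trans_apply, EH, map_sub, map_smul, Φe, Ee, Ef, map_add, D.a_hc]
    module
  · set P := Submodule.span K
      (Set.range fun k : ℕ => ((LieAlgebra.ad K g (D.e i)) ^ k) (D.e j)) with hP
    have hk : ∀ k, ((LieAlgebra.ad K g (D.e i)) ^ k) (D.e j) ∈ P :=
      fun k => Submodule.subset_span ⟨k, rfl⟩
    have he : ∀ y ∈ P, LieAlgebra.ad K g (D.e i) y ∈ P := by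
      refine fun y => map_mem_of_mem_span _ ?_
      rintro _ ⟨k, rfl⟩
      simpa [pow_succ'] using hk (k + 1)
    have hh : ∀ k, ⁅(D.hc i : g), ((LieAlgebra.ad K g (D.e i)) ^ k) (D.e j)⁆ ∈ P := by
      have : ∀ k, ∃ c : K, ⁅(D.hc i : g), ((LieAlgebra.ad K g (D.e i)) ^ k) (D.e j)⁆ =
          c • ((LieAlgebra.ad K g (D.e i)) ^ k) (D.e j) := by
        intro k
        induction k with
        | zero => exact ⟨_, D.he _ _⟩
        | succ k ih =>
          obtain ⟨c, hc⟩ := ih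
          refine ⟨2 + c, ?_⟩
          rw [pow_succ', Module.End.mul_apply, LieAlgebra.ad_apply, leibniz_lie, hc, D.he, D.a_hc,
            smul_lie, lie_smul, add_smul]
      intro k
      obtain ⟨c, hc⟩ := this k
      rw [hc]; exact P.smul_mem _ (hk k)
    have hf : ∀ y ∈ P, LieAlgebra.ad K g (-D.f i) y ∈ P := by
      refine fun y => map_mem_of_mem_span _ ?_
      rintro _ ⟨k, rfl⟩
      rw [map_neg, LinearMap.neg_apply]
      refine P.neg_mem ?_
      induction k with
      | zero =>
        simp only [pow_zero, Module.End.one_apply, LieAlgebra.ad_apply]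
        rw [← lie_skew, D.ef_ne j i hj]; simp
      | succ k ih =>
        simp only [pow_succ', Module.End.mul_apply, LieAlgebra.ad_apply] at ih ⊢
        rw [leibniz_lie, fe, neg_lie]
        exact P.add_mem (P.neg_mem (hh k)) (he _ ih)
    have stab : ∀ (T : Module.End K g) (τ : g ≃ₗ⁅K⁆ g), (∀ y ∈ P, T y ∈ P) → IsNilpotent T →
        (∀ (y : g) (k : ℕ), (T ^ k) y = 0 →
          τ y = ∑ n ∈ Finset.range k, ((n.factorial : K))⁻¹ • (T ^ n) y) → ∀ y ∈ P, τ y ∈ P := by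
      intro T τ hT hn hτ y hy
      obtain ⟨N, hN⟩ := hn
      rw [hτ y N (by rw [hN]; rfl)]
      have hpow : ∀ n : ℕ, (T ^ n) y ∈ P := fun n => by
        induction n with
        | zero => exact hy
        | succ n ih => rw [pow_succ']; exact hT _ ih
      exact P.sum_mem fun n _ => P.smul_mem _ (hpow n)
    rw [LieEquiv.trans_apply, LieEquiv.trans_apply]
    exact stab _ E he (D.nil_e i) hE _ (stab _ Φ hf hnf hΦ _ (stab _ E he (D.nil_e i) hE _ (hk 0)))

end ChevData
end Move

section MoveStep

attribute [local instance] LieRing.ofAssociativeRing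

local notation "𝔦" => UniversalEnvelopingAlgebra.ι K

namespace ChevData

variable (D : ChevData K g)
variable {R : Type} [AddCommGroup R] [Module K R] [Module (Env K g) R]
  [IsScalarTower K (Env K g) R]

lemma exists_coeff (j : D.I) : ∃ p : Module.Dual K D.h →ₗ[K] K,
    ∀ i, p (D.a i) = (Finsupp.single i (1 : K)) j := by
  let p0 := (Finsupp.lapply j : (D.I →₀ K) →ₗ[K] K).comp D.indep.repr
  obtain ⟨p, hp⟩ := LinearMap.exists_extend p0
  refine ⟨p, fun i => ?_⟩
  have := LinearMap.congr_fun hp ⟨D.a i, Submodule.subset_span ⟨i, rfl⟩⟩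
  rw [LinearMap.comp_apply, Submodule.subtype_apply] at this
  rw [this, LinearMap.comp_apply, D.indep.repr_eq_single i _ rfl]
  rfl

open Classical in
lemma count_eq_of_lwt {l l' : List D.I} (h : D.lwt l = D.lwt l') (i : D.I) :
    l.count i = l'.count i := by
  obtain ⟨p, hp⟩ := D.exists_coeff i
  have key : ∀ l : List D.I, p (D.lwt l) = (l.count i : K) := by
    intro l
    induction l with
    | nil => simp [lwt]
    | cons j l ih =>
      rw [lwt, List.map_cons, List.sum_cons, map_add, hp, ← lwt, ih, List.count_cons]
      by_cases hj : j = i <;> simp [hj, add_comm]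
  have := key l
  rw [h, key l'] at this
  exact_mod_cast this.symm

lemma lwt_append (l l' : List D.I) : D.lwt (l ++ l') = D.lwt l + D.lwt l' := by
  simp [lwt]

lemma lwt_replicate (n : ℕ) (i : D.I) : D.lwt (List.replicate n i) = (n : K) • D.a i := by
  simp [lwt, Nat.cast_smul_eq_nsmul]

section Inverse

variable {D}
variable {i : D.I}
variable {G : R →ₗ[K] R} 
  (hFG : ∀ v : R, UniversalEnvelopingAlgebra.ι K (D.f i) • G v = v)
  (hGF : ∀ v : R, G (UniversalEnvelopingAlgebra.ι K (D.f i) • v) = v)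
include hFG hGF

lemma inv_mem {nu : Module.Dual K D.h} {v : R} (hv : v ∈ hWt D.h R nu) :
    G v ∈ hWt D.h R (nu + D.a i) := by
  intro H
  rw [← hGF (𝔦 (H : g) • G v)]
  have := iota_smul_comm (K := K) (D.f i) (H : g) (G v)
  rw [this, hFG, hv H, ← lie_skew, D.hf, neg_neg, iota_smul_smul, hFG, ← add_smul, map_smul]
  rfl

lemma inv_pow_mem {nu : Module.Dual K D.h} {v : R} (hv : v ∈ hWt D.h R nu) (k : ℕ) :
    (G ^ k) v ∈ hWt D.h R (nu + (k : K) • D.a i) := by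
  induction k with
  | zero => simpa using hv
  | succ k ih =>
    rw [pow_succ', Module.End.mul_apply]
    have := inv_mem hFG hGF ih
    rwa [add_assoc, show (k : K) • D.a i + D.a i = ((k + 1 : ℕ) : K) • D.a i by
      push_cast; module] at this

lemma e_inv_pow {nu : Module.Dual K D.h} {v : R} (hv : D.Sing v nu) (k : ℕ) :
    𝔦 (D.e i) • (G ^ k) v = (-(k * (nu (D.hc i) + 1 + k) : K)) • (G ^ (k + 1)) v := by
  induction k with
  | zero => simp [-UniversalEnvelopingAlgebra.ι_apply, hv.2]
  | succ k ih =>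
    have hm := inv_pow_mem hFG hGF hv.1 (k + 1)
    have h1 := iota_smul_comm (K := K) (D.e i) (D.f i) ((G ^ (k + 1)) v)
    have h2 : 𝔦 (D.f i) • (G ^ (k + 1)) v = (G ^ k) v := by
      rw [pow_succ', Module.End.mul_apply, hFG]
    rw [h2, ih, D.ef, hm (D.hc i)] at h1
    have h3 := congrArg G h1
    rw [map_add, hGF, map_smul, map_smul, ← Module.End.mul_apply, ← pow_succ',
      ← sub_eq_iff_eq_add, ← sub_smul] at h3
    rw [← h3]
    congr 1
    simp only [LinearMap.add_apply, LinearMap.smul_apply, D.a_hc, smul_eq_mul]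
    push_cast; ring

lemma e_ne_inv_pow {nu : Module.Dual K D.h} {v : R} (hv : D.Sing v nu) {j : D.I} (hj : j ≠ i)
    (k : ℕ) : 𝔦 (D.e j) • (G ^ k) v = 0 := by
  induction k with
  | zero => simpa using hv.2 j
  | succ k ih =>
    have h1 := iota_smul_comm (K := K) (D.e j) (D.f i) ((G ^ (k + 1)) v)
    rw [D.ef_ne j i hj, map_zero, zero_smul, add_zero] at h1
    have h2 : 𝔦 (D.f i) • (G ^ (k + 1)) v = (G ^ k) v := by
      rw [pow_succ', Module.End.mul_apply, hFG]
    rw [h2, ih] at h1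
    rw [← hGF (𝔦 (D.e j) • (G ^ (k + 1)) v), ← h1, map_zero]

lemma ad_e_inv_pow {nu : Module.Dual K D.h} {v : R} (hv : D.Sing v nu) {j : D.I} (hj : j ≠ i)
    (n : ℕ) : ∀ k : ℕ, 𝔦 (((LieAlgebra.ad K g (D.e i)) ^ n) (D.e j)) • (G ^ k) v = 0 := by
  induction n with
  | zero => intro k; exact e_ne_inv_pow hFG hGF hv hj k
  | succ n ih =>
    intro k
    have h1 := iota_smul_comm (K := K) (D.e i) (((LieAlgebra.ad K g (D.e i)) ^ n) (D.e j))
      ((G ^ k) v)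
    rw [ih k, smul_zero, e_inv_pow hFG hGF hv, env_smul_comm, ih (k + 1), smul_zero,
      zero_add] at h1
    rw [pow_succ', Module.End.mul_apply, LieAlgebra.ad_apply, ← h1]

lemma twisted_vanish {nu : Module.Dual K D.h} {v : R} (hv : D.Sing v nu) {j : D.I} (hj : j ≠ i)
    {y : g} (hy : y ∈ Submodule.span K
      (Set.range fun k : ℕ => ((LieAlgebra.ad K g (D.e i)) ^ k) (D.e j))) :
    𝔦 y • G v = 0 := by
  refine map_mem_of_mem_span (P := ⊥)
    ((LinearMap.toSpanSingleton (Env K g) R (G v)).restrictScalars K ∘ₗ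
      (𝔦 : g →ₗ⁅K⁆ Env K g).toLinearMap) ?_ hy
  rintro _ ⟨k, rfl⟩
  simpa using ad_e_inv_pow hFG hGF hv hj k 1

lemma twisted_weight {nu : Module.Dual K D.h} {v : R} (hv : v ∈ hWt D.h R nu) (H : D.h) :
    𝔦 ((H : g) - D.a i H • (D.hc i : g)) • G v = D.sdot i nu H • G v := by
  have hm := inv_mem hFG hGF hv
  rw [map_sub, sub_smul, iota_smul_smul, hm H, hm (D.hc i), smul_smul, ← sub_smul]
  congr 1
  simp only [sdot, LinearMap.add_apply, LinearMap.sub_apply, LinearMap.smul_apply, D.a_hc,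
    smul_eq_mul]
  ring

lemma inv_pow_sing {nu : Module.Dual K D.h} {v : R} (hv : D.Sing v nu) {k : ℕ}
    (hk : nu (D.hc i) + 1 + k = 0) : D.Sing ((G ^ k) v) (D.sdot i nu) := by
  refine ⟨?_, fun j => ?_⟩
  · have := inv_pow_mem hFG hGF hv.1 k
    rwa [show nu + (k : K) • D.a i = D.sdot i nu by
      rw [sdot, eq_neg_of_add_eq_zero_left hk]; module] at this
  · by_cases hj : j = i
    · subst hj; rw [e_inv_pow hFG hGF hv, hk]; simp
    · exact e_ne_inv_pow hFG hGF hv hj k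

lemma inv_ne_zero {v : R} (hv : v ≠ 0) (k : ℕ) : (G ^ k) v ≠ 0 := by
  induction k with
  | zero => simpa using hv
  | succ k ih =>
    intro h
    apply ih
    rw [pow_succ', Module.End.mul_apply] at h
    rw [← hFG ((G ^ k) v), h, smul_zero]

lemma f_pow_inv_pow (k : ℕ) : ∀ v : R, 𝔦 (D.f i) ^ k • (G ^ k) v = v := by
  induction k with
  | zero => simp
  | succ k ih =>
    intro v
    rw [pow_succ (𝔦 (D.f i)), mul_smul, pow_succ' G, Module.End.mul_apply, hFG, ih]

lemma move_core {lam mu : Module.Dual K D.h} {w u : R} (hw : D.Sing w lam) (hu : D.Sing u mu)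
    (h0 : u ≠ 0) (hmem : u ∈ Submodule.span (Env K g) {w})
    (hlam : ∀ k : ℕ, lam (D.hc i) + 1 + (k + 1 : ℕ) ≠ 0) :
    ∃ lam', (lam' = lam ∨ lam' = D.sdot i lam) ∧ D.Link lam' (D.sdot i mu) := by
  set N := Submodule.span (Env K g) {w} with hN
  by_cases hGu : G u ∈ N
  · refine ⟨lam, Or.inl rfl, ?_⟩
    have hex : ∃ k : ℕ, (G ^ k) u ∉ N := by
      by_contra! hcon
      obtain ⟨l0, hl0⟩ := D.exists_word hw hmem hu.1 h0
      obtain ⟨l, hl⟩ := D.exists_word hw (hcon (l0.length + 1))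
        (inv_pow_mem hFG hGF hu.1 (l0.length + 1)) (inv_ne_zero hFG hGF h0 _)
      have heq : D.lwt (l ++ List.replicate (l0.length + 1) i) = D.lwt l0 := by
        rw [lwt_append, lwt_replicate]
        rw [hl0] at hl
        rw [← sub_eq_zero, ← sub_eq_zero.2 hl]; abel
      classical
      have := D.count_eq_of_lwt heq i
      rw [List.count_append, List.count_replicate_self] at this
      have h2 := List.count_le_length (a := i) (l := l0)
      omega
    classical
    obtain ⟨k, hk, hmin⟩ : ∃ k : ℕ, (G ^ k) u ∉ N ∧ ∀ m < k, (G ^ m) u ∈ N :=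
      ⟨Nat.find hex, Nat.find_spec hex, fun m hm => not_not.1 (Nat.find_min hex hm)⟩
    obtain _ | _ | n := k
    · exact absurd (by simpa using hmem) hk
    · exact absurd (by simpa using hGu) hk
    have hn := hmin (n + 1) (by omega)
    have h1 := e_inv_pow hFG hGF hu (n + 1)
    have h2 : mu (D.hc i) + 1 + (n + 1 : ℕ) = 0 := by
      by_contra hne
      apply hk
      have hc : -(((n + 1 : ℕ) : K) * (mu (D.hc i) + 1 + (n + 1 : ℕ))) ≠ 0 :=
        neg_ne_zero.2 (mul_ne_zero (by exact_mod_cast Nat.succ_ne_zero n) hne)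
      have h3 : (-(((n + 1 : ℕ) : K) * (mu (D.hc i) + 1 + (n + 1 : ℕ)))) • (G ^ (n + 2)) u ∈
          N.restrictScalars K := by
        rw [← h1]; exact N.smul_mem _ hn
      exact (Submodule.smul_mem_iff (N.restrictScalars K) hc).1 h3
    exact ⟨R, _, _, _, inferInstance, w, _, hw, inv_pow_sing hFG hGF hu h2,
      inv_ne_zero hFG hGF h0 _, hn⟩
  · refine ⟨D.sdot i lam, Or.inr rfl, ?_⟩
    obtain ⟨σ, hσH, hσi, hσj⟩ := D.exists_sigma i
    have hwN : w ∈ N := Submodule.subset_span rfl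
    have hvan : ∀ {nu : Module.Dual K D.h} {v : R}, D.Sing v nu → v ∈ N → ∀ j,
        𝔦 (σ (D.e j)) • (N.mkQ (G v)) = 0 := by
      intro nu v hv hvN j
      rw [← map_smul, Submodule.mkQ_apply, Submodule.Quotient.mk_eq_zero]
      by_cases hj : j = i
      · subst hj
        rw [hσi, map_neg, neg_smul, hFG]
        exact N.neg_mem hvN
      · rw [twisted_vanish hFG hGF hv hj (hσj j hj)]; exact N.zero_mem
    have hwt : ∀ {nu : Module.Dual K D.h} {v : R}, D.Sing v nu → ∀ H : D.h,
        𝔦 (σ H) • (N.mkQ (G v)) = D.sdot i nu H • N.mkQ (G v) := by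
      intro nu v hv H
      rw [← map_smul, hσH, twisted_weight hFG hGF hv.1]
      rfl
    refine D.link_of_twist σ (N.mkQ (G w)) (N.mkQ (G u)) (hwt hw) (hvan hw hwN) (hwt hu)
      (hvan hu hmem) ?_ ?_
    · rwa [Submodule.mkQ_apply, Ne, Submodule.Quotient.mk_eq_zero]
    · have hpw : ∀ n : ℕ, N.mkQ ((G ^ (n + 1)) w) ∈
          Submodule.span (Env K g) {N.mkQ (G w)} := by
        intro n
        induction n with
        | zero => exact Submodule.subset_span (by simp)
        | succ n ih =>
          have h1 := e_inv_pow hFG hGF hw (n + 1)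
          have hc : -(((n + 1 : ℕ) : K) * (lam (D.hc i) + 1 + (n + 1 : ℕ))) ≠ 0 :=
            neg_ne_zero.2 (mul_ne_zero (by exact_mod_cast Nat.succ_ne_zero n) (hlam n))
          refine (Submodule.smul_mem_iff ((Submodule.span (Env K g)
            {N.mkQ (G w)}).restrictScalars K) hc).1 ?_
          have h2 := congrArg N.mkQ h1
          rw [map_smul] at h2
          have h3 := Submodule.smul_mem _ (𝔦 (D.e i)) ih
          rw [h2] at h3
          exact h3
      obtain ⟨X, hX⟩ := Submodule.mem_span_singleton.1 hmem
      obtain ⟨n, Y, hY⟩ := (locAdNilp_iota (D.nil_f i)).exists_mul_pow X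
      have hu' : G u = Y • (G ^ n) w := by
        rw [← hGF (Y • (G ^ n) w), ← mul_smul, ← hY, mul_smul, f_pow_inv_pow hFG hGF, hX]
      obtain _ | n := n
      · exact absurd (by rw [hu']; exact N.smul_mem _ (by simpa using hwN)) hGu
      · rw [hu', map_smul]
        exact Submodule.smul_mem _ _ (hpw n)

lemma move_inverse {lam mu : Module.Dual K D.h} {w u : R} (hw : D.Sing w lam) (hu : D.Sing u mu)
    (h0 : u ≠ 0) (hmem : u ∈ Submodule.span (Env K g) {w}) :
    ∃ lam', (lam' = lam ∨ lam' = D.sdot i lam) ∧ D.Link lam' (D.sdot i mu) := by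
  by_cases h : ∃ m : ℕ, lam (D.hc i) + 1 + (m + 1 : ℕ) = 0
  · obtain ⟨m, hm⟩ := h
    have hw' := inv_pow_sing hFG hGF hw hm
    obtain ⟨lam', h1, h2⟩ := move_core hFG hGF hw' hu h0 (by
      refine (Submodule.span_singleton_le_iff_mem _ _).2 ?_ hmem
      exact Submodule.mem_span_singleton.2 ⟨_, f_pow_inv_pow hFG hGF (m + 1) w⟩) (by
      intro k hk
      rw [sdot_apply_hc] at hk
      have : ((m + k + 2 : ℕ) : K) = 0 := by
        push_cast at hm hk ⊢
        linear_combination hk + hm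
      exact absurd this (by exact_mod_cast (by omega : m + k + 2 ≠ 0)))
    rw [sdot_sdot] at h1
    exact ⟨lam', h1.symm, h2⟩
  · push Not at h
    exact move_core hFG hGF hw hu h0 hmem h

end Inverse

lemma Link.move {lam mu : Module.Dual K D.h} (h : D.Link lam mu) (i : D.I)
    (hmu : ∀ n : ℕ, mu (D.hc i) ≠ n) :
    ∃ lam', (lam' = lam ∨ lam' = D.sdot i lam) ∧ D.Link lam' (D.sdot i mu) := by
  obtain ⟨R, _, _, _, _, w, u, hw, hu, h0, hmem⟩ := h
  obtain ⟨Q, _, _, j, hb, hj⟩ := (locAdNilp_iota (D.nil_f i)).exists_localization R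
  let _ : Module K Q := Module.compHom Q (algebraMap K (Env K g))
  have _ : IsScalarTower K (Env K g) Q := ⟨fun c X v => by
    change (c • X) • v = algebraMap K (Env K g) c • X • v
    rw [Algebra.smul_def, mul_smul]⟩
  have hjK : ∀ (c : K) (v : R), j (c • v) = c • j v := fun c v => by
    rw [← algebraMap_smul (Env K g) c v, map_smul, algebraMap_smul]
  let L := LinearEquiv.ofBijective (Algebra.lsmul K K Q (𝔦 (D.f i))) hb
  have hs : ∀ {nu : Module.Dual K D.h} {v : R}, D.Sing v nu → D.Sing (j v) nu := by
    intro nu v hv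
    exact ⟨fun H => by rw [← map_smul, hv.1 H, hjK], fun k => by rw [← map_smul, hv.2, map_zero]⟩
  refine move_inverse (G := (L.symm : Q →ₗ[K] Q)) (fun v => L.apply_symm_apply v)
    (fun v => L.symm_apply_apply v) (hs hw) (hs hu) ?_ ?_
  · intro h
    obtain ⟨n, hn⟩ := hj u h
    exact D.f_pow_smul_ne_zero hu h0 i hmu n hn
  · obtain ⟨X, rfl⟩ := Submodule.mem_span_singleton.1 hmem
    exact Submodule.mem_span_singleton.2 ⟨X, (map_smul j X w).symm⟩

end ChevData
end MoveStep

section LinkOrbit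

attribute [local instance] LieRing.ofAssociativeRing

local notation "𝔦" => UniversalEnvelopingAlgebra.ι K

section Quadratic

variable {I : Type}

/-- The bilinear form of a square array restricted to a finite set of indices. -/
def finForm (s : Finset I) (G : I → I → ℚ) (u v : I → ℚ) : ℚ :=
  ∑ i ∈ s, ∑ j ∈ s, u i * G i j * v j

variable {s : Finset I} {G : I → I → ℚ}

lemma finForm_add_left (u u' v : I → ℚ) :
    finForm s G (u + u') v = finForm s G u v + finForm s G u' v := by
  simp only [finForm, Pi.add_apply, add_mul, Finset.sum_add_distrib]

lemma finForm_add_right (u v v' : I → ℚ) :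
    finForm s G u (v + v') = finForm s G u v + finForm s G u v' := by
  simp only [finForm, Pi.add_apply, mul_add, Finset.sum_add_distrib]

lemma finForm_comm (hG : ∀ i j, G i j = G j i) (u v : I → ℚ) :
    finForm s G u v = finForm s G v u := by
  rw [finForm, Finset.sum_comm, finForm]
  refine Finset.sum_congr rfl fun i _ => Finset.sum_congr rfl fun j _ => ?_
  rw [hG j i]; ring

lemma finForm_single_left [DecidableEq I] {i : I} (hi : i ∈ s) (r : ℚ) (v : I → ℚ) :
    finForm s G (Pi.single i r) v = r * ∑ j ∈ s, G i j * v j := by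
  rw [finForm, Finset.sum_eq_single i, Finset.mul_sum]
  · simp [mul_assoc]
  · intro j _ hj; simp [hj]
  · exact fun h => absurd hi h

lemma finForm_solve (hdef : ∀ c : I → ℚ, finForm s G c c = 0 → ∀ i ∈ s, c i = 0) (y : I → ℚ) :
    ∃ z : I → ℚ, ∀ i ∈ s, ∑ j ∈ s, G i j * z j = y i := by
  classical
  let L : (s → ℚ) →ₗ[ℚ] (s → ℚ) := Matrix.mulVecLin (fun i j => G i j)
  have hL : ∀ (v : s → ℚ) (i : s), L v i = ∑ j : s, G i j * v j := fun v i => rfl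
  have hinj : Function.Injective L := by
    rw [← LinearMap.ker_eq_bot, LinearMap.ker_eq_bot']
    intro v hv
    let c : I → ℚ := fun i => if h : i ∈ s then v ⟨i, h⟩ else 0
    have hc : ∀ i : s, c i = v i := fun i => by simp [c]
    have h0 : finForm s G c c = 0 := by
      rw [finForm, ← Finset.sum_coe_sort]
      refine Finset.sum_eq_zero fun i _ => ?_
      have := congrFun hv i
      rw [hL] at this
      rw [← Finset.sum_coe_sort]
      simp only [hc, mul_assoc, ← Finset.mul_sum]
      rw [this]; simp
    funext i
    rw [← hc i, hdef c h0 i i.2]; rfl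
  obtain ⟨v, hv⟩ := (LinearMap.injective_iff_surjective.1 hinj) (fun i : s => y i)
  refine ⟨fun i => if h : i ∈ s then v ⟨i, h⟩ else 0, fun i hi => ?_⟩
  have := congrFun hv ⟨i, hi⟩
  rw [hL] at this
  simp only at this
  rw [← this, ← Finset.sum_coe_sort]
  refine Finset.sum_congr rfl fun j _ => ?_
  simp

lemma finForm_bound (hG : ∀ i j, G i j = G j i) (hpos : ∀ c : I → ℚ, 0 ≤ finForm s G c c)
    (hdef : ∀ c : I → ℚ, finForm s G c c = 0 → ∀ i ∈ s, c i = 0) (q : ℚ) :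
    ∃ b : I → ℚ, ∀ z : I → ℚ, finForm s G z z = q → ∀ i ∈ s, z i ≤ b i := by
  classical
  choose w hw using fun i => finForm_solve hdef (Pi.single i (1 : ℚ))
  refine ⟨fun i => (q + finForm s G (w i) (w i)) / 2, fun z hz i hi => ?_⟩
  have h1 := hpos (z + fun j => -w i j)
  have hneg : ∀ u v : I → ℚ, finForm s G u (fun j => -v j) = -finForm s G u v := by
    intro u v; simp [finForm]
  have hzw : finForm s G z (w i) = z i := by
    rw [finForm, Finset.sum_congr rfl (g := fun k => z k * (Pi.single i (1 : ℚ) : I → ℚ) k)]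
    · rw [Finset.sum_eq_single i]
      · simp
      · intro j _ hj; simp [hj]
      · exact fun h => absurd hi h
    · intro k hk
      rw [← hw i k hk, Finset.mul_sum]
      exact Finset.sum_congr rfl fun j _ => by ring
  rw [finForm_add_left, finForm_add_right, finForm_add_right, hneg, hneg,
    finForm_comm hG (fun j => -w i j), hneg, finForm_comm hG (fun j => -w i j) (w i), hneg,
    hzw, hz] at h1
  linarith

end Quadratic

namespace ChevData

variable (D : ChevData K g)

/-- The orbit relation of the dot action. -/
def Orb : Module.Dual K D.h → Module.Dual K D.h → Prop :=
  Relation.ReflTransGen fun x y => ∃ i, y = D.sdot i x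

lemma Orb.symm {x y : Module.Dual K D.h} (h : D.Orb x y) : D.Orb y x := by
  induction h with
  | refl => exact Relation.ReflTransGen.refl
  | tail _ hbc ih =>
    obtain ⟨i, rfl⟩ := hbc
    exact Relation.ReflTransGen.head ⟨i, (D.sdot_sdot i _).symm⟩ ih

lemma Orb.trans {x y z : Module.Dual K D.h} (h : D.Orb x y) (h' : D.Orb y z) : D.Orb x z :=
  Relation.ReflTransGen.trans h h'

lemma e_ne_zero (i : D.I) : D.e i ≠ 0 := by
  intro h
  have h1 := D.ef i
  rw [h, zero_lie] at h1
  have h2 := D.a_hc i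
  rw [show D.hc i = 0 from Subtype.ext h1.symm, map_zero] at h2
  exact two_ne_zero h2.symm

lemma cartan_int (i j : D.I) : ∃ z : ℤ, D.a j (D.hc i) = z := by
  by_cases hij : i = j
  · subst hij; exact ⟨2, by rw [D.a_hc]; norm_num⟩
  set v : ℕ → g := fun k => ((LieAlgebra.ad K g (D.e i)) ^ k) (D.e j) with hv
  have hv1 : ∀ k, v (k + 1) = ⁅D.e i, v k⁆ := fun k => by
    simp only [hv, pow_succ', Module.End.mul_apply, LieAlgebra.ad_apply]
  have hh : ∀ k, ⁅(D.hc i : g), v k⁆ = (D.a j (D.hc i) + 2 * k) • v k := by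
    intro k
    induction k with
    | zero => simpa [hv] using D.he (D.hc i) j
    | succ k ih =>
      rw [hv1, leibniz_lie, ih, D.he, D.a_hc, smul_lie, lie_smul, ← add_smul]
      congr 1; push_cast; ring
  have fe : ⁅D.f i, D.e i⁆ = -(D.hc i : g) := by rw [← lie_skew, D.ef]
  have hf : ∀ k, ⁅D.f i, v (k + 1)⁆ = (-((k + 1) * (D.a j (D.hc i) + k) : K)) • v k := by
    intro k
    induction k with
    | zero =>
      rw [hv1, leibniz_lie, fe, neg_lie, hh]
      have : ⁅D.f i, v 0⁆ = 0 := by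
        simp only [hv, pow_zero, Module.End.one_apply]
        rw [← lie_skew, D.ef_ne j i (Ne.symm hij), neg_zero]
      rw [this, lie_zero]
      simp
    | succ k ih =>
      rw [hv1 (k + 1), leibniz_lie, fe, neg_lie, hh, ih, lie_smul, ← hv1,
        ← neg_smul, ← add_smul]
      congr 1; push_cast; ring
  obtain ⟨N, hN⟩ := D.nil_e i
  have hex : ∃ n, v n = 0 := ⟨N, by simp only [hv, hN]; rfl⟩
  classical
  obtain ⟨n, hn, hmin⟩ : ∃ n, v n = 0 ∧ ∀ m < n, v m ≠ 0 :=
    ⟨Nat.find hex, Nat.find_spec hex, fun m hm => Nat.find_min hex hm⟩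
  obtain _ | n := n
  · exact absurd hn (by simpa [hv] using D.e_ne_zero j)
  have h1 := hf n
  rw [hn, lie_zero] at h1
  rcases smul_eq_zero.1 h1.symm with h2 | h2
  · rcases mul_eq_zero.1 (neg_eq_zero.1 h2) with h3 | h3
    · exact absurd h3 (by exact_mod_cast Nat.succ_ne_zero n)
    · exact ⟨-n, by rw [eq_neg_of_add_eq_zero_left h3]; simp⟩
  · exact absurd h2 (hmin n (Nat.lt_succ_self n))

/-- A vector in the left ideal spanned by the `e i` kills singular vectors. -/
lemma span_e_smul {R : Type} [AddCommGroup R] [Module K R] [Module (Env K g) R]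
    [IsScalarTower K (Env K g) R] {mu : Module.Dual K D.h} {u : R} (hu : D.Sing u mu)
    {C : Env K g} (hC : C ∈ Submodule.span (Env K g) (Set.range fun i => 𝔦 (D.e i))) :
    C • u = 0 := by
  refine (Submodule.span_le (p := LinearMap.ker (LinearMap.toSpanSingleton (Env K g) R u))).2 ?_ hC
  rintro _ ⟨i, rfl⟩
  exact hu.2 i

open Classical in
lemma lwt_eq_sum {s : Finset D.I} {l : List D.I} (hl : ∀ i ∈ l, i ∈ s) :
    D.lwt l = ∑ i ∈ s, (l.count i : K) • D.a i := by
  induction l with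
  | nil => simp [lwt]
  | cons i l ih =>
    rw [lwt, List.map_cons, List.sum_cons, ← lwt,
      ih fun j hj => hl j (List.mem_cons_of_mem _ hj)]
    simp only [List.count_cons, Nat.cast_add, add_smul, Finset.sum_add_distrib]
    rw [add_comm, add_right_inj, Finset.sum_eq_single i]
    · simp
    · intro j _ hj; simp [hj.symm]
    · exact fun h => absurd (hl i List.mem_cons_self) h

open Classical in
/-- The equation satisfied by linked weights, from the action of a Casimir-type element. -/
lemma Link.casimir_eq {lam mu : Module.Dual K D.h} (h : D.Link lam mu) {s : Finset D.I}
    {d : D.I → ℚ} {G : D.I → D.I → ℚ}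
    (hG : ∀ i ∈ s, ∀ j ∈ s, ((G i j : ℚ) : K) = (d i : K) * D.a j (D.hc i))
    (hsym : ∀ i j, G i j = G j i) {C : Env K g}
    (hC : C ∈ Submodule.span (Env K g) (Set.range fun i => 𝔦 (D.e i)))
    (hCf : ∀ i ∈ s, C * 𝔦 (D.f i) = 𝔦 (D.f i) * C + (d i : K) • (𝔦 (D.f i) * 𝔦 (D.hc i : g)))
    {l₀ : List D.I} (hl₀ : ∀ i ∈ l₀, i ∈ s) (hmu : mu = lam - D.lwt l₀) :
    2 * (∑ i ∈ s, (l₀.count i : K) * (d i * (mu (D.hc i) + 1))) +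
      ((finForm s G (fun i => l₀.count i) (fun i => l₀.count i) : ℚ) : K) = 0 := by
  obtain ⟨R, _, _, _, _, w, u, hw, hu, h0, hmem⟩ := h
  have hpair : ∀ l : List D.I, (∀ i ∈ l, i ∈ s) → ∀ i ∈ s,
      (d i : K) * D.lwt l (D.hc i) = ∑ j ∈ s, (l.count j : K) * G i j := by
    intro l hl i hi
    rw [D.lwt_eq_sum hl, LinearMap.sum_apply, Finset.mul_sum]
    refine Finset.sum_congr rfl fun j hj => ?_
    rw [hG i hi j hj, LinearMap.smul_apply, smul_eq_mul]; ring
  -- the eigenvalue on words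
  have hword : ∀ l : List D.I, (∀ i ∈ l, i ∈ s) →
      (2 : K) • C • D.word w l = (2 * (∑ i ∈ s, (l.count i : K) * (d i * (lam (D.hc i) + 1))) -
        ((finForm s G (fun i => l.count i) (fun i => l.count i) : ℚ) : K)) • D.word w l := by
    intro l
    induction l with
    | nil =>
      intro _
      simp [word, D.span_e_smul hw hC, finForm]
    | cons i l ih =>
      intro hl
      have hi := hl i List.mem_cons_self
      have hl' : ∀ j ∈ l, j ∈ s := fun j hj => hl j (List.mem_cons_of_mem _ hj)
      have h1 := ih hl'
      change (2 : K) • C • 𝔦 (D.f i) • D.word w l = _ • 𝔦 (D.f i) • D.word w l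
      rw [← mul_smul C, hCf i hi, add_smul, mul_smul, smul_assoc, mul_smul, smul_add,
        ← env_smul_comm, h1, env_smul_comm, D.word_mem hw.1 l (D.hc i), env_smul_comm, smul_smul,
        smul_smul, ← add_smul]
      congr 1
      have hcount : (fun j => ((List.count j (i :: l) : ℕ) : ℚ)) =
          (fun j => (l.count j : ℚ)) + Pi.single i 1 := by
        funext j
        rw [Pi.add_apply, List.count_cons, Nat.cast_add]
        by_cases hj : i = j
        · subst hj; simp
        · simp [hj, Ne.symm hj]
      have hsum : ∑ j ∈ s, ((List.count j (i :: l) : ℕ) : K) * (d j * (lam (D.hc j) + 1)) =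
          ∑ j ∈ s, (l.count j : K) * (d j * (lam (D.hc j) + 1)) +
            d i * (lam (D.hc i) + 1) := by
        simp only [List.count_cons, Nat.cast_add, add_mul, Finset.sum_add_distrib]
        rw [add_right_inj, Finset.sum_eq_single i]
        · simp
        · intro j _ hj; simp [hj.symm]
        · exact fun h => absurd hi h
      have hii : (G i i : K) = d i * 2 := by rw [hG i hi i hi, D.a_hc]
      rw [hcount, hsum, finForm_add_left, finForm_add_right, finForm_add_right,
        finForm_comm hsym _ (Pi.single i 1), finForm_single_left hi, finForm_single_left hi]
      have hs1 : ∑ j ∈ s, G i j * (Pi.single i 1 : D.I → ℚ) j = G i i := by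
        rw [Finset.sum_eq_single i]
        · simp
        · intro j _ hj; simp [hj]
        · exact fun h => absurd hi h
      have hs2 : (((∑ j ∈ s, G i j * (l.count j : ℚ) : ℚ)) : K) =
          (d i : K) * D.lwt l (D.hc i) := by
        rw [hpair l hl' i hi]
        push_cast
        exact Finset.sum_congr rfl fun j _ => mul_comm _ _
      rw [hs1]
      push_cast at hs2 ⊢
      rw [hs2, hii, LinearMap.sub_apply]
      ring
  have hspan := D.mem_span_words_of_weight hw hmem hu.1
  set χ : K := 2 * (∑ i ∈ s, (l₀.count i : K) * (d i * (lam (D.hc i) + 1))) -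
        ((finForm s G (fun i => l₀.count i) (fun i => l₀.count i) : ℚ) : K) with hχ
  have hall : ∀ v ∈ Submodule.span K (D.word w '' {l | lam - D.lwt l = mu}),
      (2 : K) • C • v = χ • v := by
    intro v hv
    induction hv using Submodule.span_induction with
    | mem v hv =>
      obtain ⟨l, hl, rfl⟩ := hv
      have hll : D.lwt l = D.lwt l₀ := by
        rw [hmu] at hl; exact sub_right_injective hl
      have hc : ∀ i, l.count i = l₀.count i := D.count_eq_of_lwt hll
      have hls : ∀ i ∈ l, i ∈ s := fun i hi =>
        hl₀ i (List.count_pos_iff.1 (hc i ▸ List.count_pos_iff.2 hi))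
      rw [hword l hls]
      simp only [hc, hχ]
    | zero => simp
    | add y z _ _ h1 h2 => rw [smul_add, smul_add, smul_add, h1, h2]
    | smul c y _ h1 => rw [env_smul_comm, smul_comm, h1, smul_comm]
  have h2 := hall u hspan
  rw [D.span_e_smul hu hC, smul_zero] at h2
  have h3 := (smul_eq_zero.1 h2.symm).resolve_right h0
  rw [← h3, hχ, hmu]
  have h4 : ((finForm s G (fun i => l₀.count i) (fun i => l₀.count i) : ℚ) : K) =
      ∑ i ∈ s, (l₀.count i : K) * (d i * D.lwt l₀ (D.hc i)) := by
    rw [finForm]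
    push_cast
    refine Finset.sum_congr rfl fun i hi => ?_
    rw [hpair l₀ hl₀ i hi, Finset.mul_sum]
    exact Finset.sum_congr rfl fun j _ => by ring
  rw [h4]
  simp only [LinearMap.sub_apply, mul_add, mul_sub, Finset.sum_add_distrib,
    Finset.sum_sub_distrib]
  ring

end ChevData
end LinkOrbit

section LinkTheorem

namespace ChevData

variable (D : ChevData K g)

omit [IsAlgClosed K] in
/-- A rational-valued additive functional on `K` which is positive on positive rationals and
integral on finitely many given elements. -/
lemma exists_integral_functional {I : Type} (s : Finset I) (x : I → K) :
    ∃ (t : K →ₗ[ℚ] ℚ) (n : ℕ), 0 < n ∧ t 1 = n ∧ ∀ i ∈ s, ∃ z : ℤ, t (x i) = z := by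
  obtain ⟨t, ht⟩ := LinearMap.exists_leftInverse_of_injective
    (Algebra.linearMap ℚ K) (LinearMap.ker_eq_bot.2 (algebraMap ℚ K).injective)
  have ht1 : t 1 = 1 := by simpa using LinearMap.congr_fun ht 1
  refine ⟨((∏ i ∈ s, (t (x i)).den : ℕ) : ℚ) • t, ∏ i ∈ s, (t (x i)).den,
    Finset.prod_pos fun i _ => (t (x i)).den_pos, by simp [ht1], fun i hi => ?_⟩
  obtain ⟨m, hm⟩ := Finset.dvd_prod_of_mem (fun i => (t (x i)).den) hi
  refine ⟨(m : ℤ) * (t (x i)).num, ?_⟩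
  rw [LinearMap.smul_apply, hm, smul_eq_mul]
  push_cast
  rw [mul_comm ((t (x i)).den : ℚ), mul_assoc, Rat.den_mul_eq_num]

lemma sum_mul_add_single {I : Type} [DecidableEq I] {s : Finset I} {i : I} (hi : i ∈ s)
    (b Z : I → ℚ) (r : ℚ) :
    ∑ j ∈ s, b j * (Z + (Pi.single i r : I → ℚ)) j = ∑ j ∈ s, b j * Z j + b i * r := by
  simp only [Pi.add_apply, mul_add, Finset.sum_add_distrib]
  congr 1
  rw [Finset.sum_eq_single i, Pi.single_eq_same]
  · intro k _ hk; rw [Pi.single_eq_of_ne hk, mul_zero]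
  · exact fun h => absurd hi h

lemma finForm_add_single {I : Type} [DecidableEq I] {s : Finset I} {G : I → I → ℚ}
    (hsym : ∀ i j, G i j = G j i) {i : I} (hi : i ∈ s) (Z : I → ℚ) (r : ℚ) :
    finForm s G (Z + Pi.single i r) (Z + Pi.single i r) =
      finForm s G Z Z + 2 * (r * ∑ j ∈ s, G i j * Z j) + r * r * G i i := by
  rw [finForm_add_left, finForm_add_right, finForm_comm hsym Z (Pi.single i r),
    finForm_single_left hi, finForm_single_left hi, sum_mul_add_single hi]
  ring

/-- Linked weights lie in the same orbit of the dot action. -/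
theorem Link.orb {lam mu : Module.Dual K D.h} (h : D.Link lam mu) : D.Orb lam mu := by
  classical
  have hex : ∀ {lam mu : Module.Dual K D.h}, D.Link lam mu → ∃ l, mu = lam - D.lwt l := by
    rintro lam mu ⟨R, _, _, _, _, w, u, hw, hu, h0, hmem⟩
    exact D.exists_word hw hmem hu.1 h0
  obtain ⟨l₀, hl₀⟩ := hex h
  set s : Finset D.I := l₀.toFinset with hs
  obtain ⟨d, G, ⟨hd, hG, hsym, hpos, hdef⟩, ⟨C, hC, hCf⟩, -⟩ := D.casimir s
  obtain ⟨t, n, hn, ht1, htint⟩ := exists_integral_functional s fun i => mu (D.hc i) + 1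
  have htq : ∀ q : ℚ, t (q : K) = q * n := by
    intro q
    rw [show (q : K) = q • (1 : K) by rw [Rat.smul_def, mul_one], map_smul, ht1, smul_eq_mul]
  have htm : ∀ (q : ℚ) (x : K), t ((q : K) * x) = q * t x := by
    intro q x
    rw [← Rat.smul_def, map_smul, smul_eq_mul]
  have hii : ∀ i ∈ s, G i i = d i * 2 := by
    intro i hi
    have := hG i hi i hi
    rw [D.a_hc] at this
    exact_mod_cast this
  obtain ⟨z₀, hz₀⟩ := finForm_solve (s := s) (G := G) hdef
    (fun i => d i * t (mu (D.hc i) + 1))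
  obtain ⟨b, hb⟩ := finForm_bound (s := s) (G := G) hsym hpos hdef (finForm s G z₀ z₀)
  choose p hp using D.exists_coeff
  -- the states reachable by moves
  let P : (Module.Dual K D.h) → (Module.Dual K D.h) → (D.I → ℤ) → Prop := fun lam' mu' c =>
    D.Link lam' mu' ∧ D.Orb lam lam' ∧ D.Orb mu mu' ∧ (∀ j ∉ s, p j (lam' - mu') = 0) ∧
    (∀ i ∈ s, ∃ z : ℤ, t (mu' (D.hc i) + 1) = z) ∧
    (∀ i ∈ s, ∑ j ∈ s, G i j * (z₀ + fun k => (c k : ℚ)) j = d i * t (mu' (D.hc i) + 1)) ∧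
    finForm s G (z₀ + fun k => (c k : ℚ)) (z₀ + fun k => (c k : ℚ)) = finForm s G z₀ z₀
  have hplwt : ∀ (l : List D.I) (j : D.I), p j (D.lwt l) = l.count j := by
    intro l j
    induction l with
    | nil => simp [lwt]
    | cons i l ih =>
      rw [lwt, List.map_cons, List.sum_cons, ← lwt, map_add, ih, hp, List.count_cons]
      by_cases hj : i = j
      · subst hj; simp [add_comm]
      · simp [hj]
  have hstart : P lam mu 0 := by
    refine ⟨h, Relation.ReflTransGen.refl, Relation.ReflTransGen.refl, fun j hj => ?_, htint,
      fun i hi => ?_, ?_⟩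
    · rw [hl₀, sub_sub_cancel, hplwt, List.count_eq_zero.2 fun h => hj (List.mem_toFinset.2 h)]
      simp
    · rw [← hz₀ i hi]; simp
    · simp only [Pi.zero_apply, Int.cast_zero]
      rw [show z₀ + (fun _ => (0 : ℚ)) = z₀ from add_zero z₀]
  obtain ⟨m, ⟨lam', mu', c, hP, hm⟩, hmax⟩ := Int.exists_greatest_of_bdd
    (P := fun m => ∃ lam' mu' c, P lam' mu' c ∧ m = ∑ i ∈ s, c i)
    ⟨⌈∑ i ∈ s, (b i - z₀ i)⌉, by
      rintro m ⟨lam', mu', c, hP, rfl⟩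
      have h1 : ((∑ i ∈ s, c i : ℤ) : ℚ) ≤ ∑ i ∈ s, (b i - z₀ i) := by
        push_cast
        refine Finset.sum_le_sum fun i hi => ?_
        have := hb _ hP.2.2.2.2.2.2 i hi
        rw [Pi.add_apply] at this
        linarith
      exact_mod_cast h1.trans (Int.le_ceil _)⟩ ⟨_, lam, mu, 0, hstart, rfl⟩
  obtain ⟨hL, ho1, ho2, hps, hint, hzc, hq⟩ := hP
  -- at a maximal state, no move is possible
  have hdom : ∀ i ∈ s, 0 ≤ t (mu' (D.hc i) + 1) := by
    intro i hi
    by_contra! hneg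
    obtain ⟨z, hz⟩ := hint i hi
    have hnat : ∀ k : ℕ, mu' (D.hc i) ≠ k := by
      intro k hk
      rw [hk, show ((k : K) + 1) = ((k + 1 : ℚ) : K) by push_cast; rfl, htq] at hneg
      have : (0 : ℚ) ≤ (k + 1) * n := by positivity
      linarith
    obtain ⟨lam'', hlam'', hL'⟩ := hL.move D i hnat
    have hz0 : z < 0 := by rw [hz] at hneg; exact_mod_cast hneg
    have hne : ∀ j ∉ s, i ≠ j := fun j hj hij => hj (hij ▸ hi)
    have hadd : (z₀ + fun k => ((c + Pi.single i (-z) : D.I → ℤ) k : ℚ)) =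
        (z₀ + fun k => (c k : ℚ)) + Pi.single i (-z : ℚ) := by
      funext k
      by_cases hk : k = i
      · subst hk; simp [add_assoc]
      · simp [hk]
    have hpsd : ∀ (x : Module.Dual K D.h), ∀ j ∉ s, p j (D.sdot i x) = p j x := by
      intro x j hj
      rw [sdot, map_sub, map_smul, hp, Finsupp.single_eq_of_ne (hne j hj).symm, smul_zero, sub_zero]
    have hnew : P lam'' (D.sdot i mu') (c + Pi.single i (-z)) := by
      refine ⟨hL', ?_, ho2.tail ⟨i, rfl⟩, fun j hj => ?_, fun j hj => ?_, fun j hj => ?_, ?_⟩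
      · rcases hlam'' with rfl | rfl
        · exact ho1
        · exact ho1.tail ⟨i, rfl⟩
      · have h1 := hps j hj
        rw [map_sub] at h1 ⊢
        rw [hpsd mu' j hj]
        rcases hlam'' with rfl | rfl
        · exact h1
        · rw [hpsd lam' j hj]; exact h1
      · obtain ⟨y, hy⟩ := hint j hj
        obtain ⟨q, hq⟩ := D.cartan_int j i
        refine ⟨y - q * z, ?_⟩
        have : D.sdot i mu' (D.hc j) + 1 =
            (mu' (D.hc j) + 1) - ((q : ℚ) : K) * (mu' (D.hc i) + 1) := by
          simp only [sdot, LinearMap.sub_apply, LinearMap.smul_apply, smul_eq_mul, hq]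
          push_cast; ring
        rw [this, map_sub, htm, hy, hz]; push_cast; rfl
      · obtain ⟨q, hq⟩ := D.cartan_int j i
        have : D.sdot i mu' (D.hc j) + 1 =
            (mu' (D.hc j) + 1) - ((q : ℚ) : K) * (mu' (D.hc i) + 1) := by
          simp only [sdot, LinearMap.sub_apply, LinearMap.smul_apply, smul_eq_mul, hq]
          push_cast; ring
        have hGq : G j i = d j * q := by
          have := hG j hj i hi
          rw [hq] at this
          exact_mod_cast this
        rw [hadd, this, map_sub, htm, hz, mul_sub, ← hzc j hj]
        generalize (z₀ + fun k => (c k : ℚ)) = Z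
        rw [sum_mul_add_single hi, hGq]; ring
      · have hzi := hzc i hi
        rw [hadd]
        revert hq hzi
        generalize (z₀ + fun k => (c k : ℚ)) = Z
        intro hq hzi
        rw [finForm_add_single hsym hi, hzi, hz, hq, hii i hi]; ring
    have := hmax _ ⟨_, _, _, hnew, rfl⟩
    rw [hm] at this
    simp only [Pi.add_apply, Finset.sum_add_distrib] at this
    rw [Finset.sum_pi_single' , if_pos hi] at this
    omega
  -- the remaining link is trivial
  obtain ⟨l, hl⟩ := hex hL
  have hls : ∀ i ∈ l, i ∈ s := by
    intro i hi
    by_contra his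
    have h1 := hps i his
    rw [hl, sub_sub_cancel, hplwt] at h1
    exact (List.count_pos_iff.2 hi).ne' (by exact_mod_cast h1)
  have key := hL.casimir_eq D hG hsym hC hCf hls hl
  have key2 := congrArg t key
  rw [map_zero, map_add, htq] at key2
  have h1 : t (2 * ∑ i ∈ s, (l.count i : K) * (d i * (mu' (D.hc i) + 1))) =
      2 * ∑ i ∈ s, (l.count i : ℚ) * (d i * t (mu' (D.hc i) + 1)) := by
    rw [show (2 : K) = ((2 : ℚ) : K) by norm_cast, htm, map_sum]
    congr 1
    refine Finset.sum_congr rfl fun i _ => ?_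
    rw [show ((l.count i : ℕ) : K) = ((l.count i : ℚ) : K) by norm_cast, htm, htm]
  rw [h1] at key2
  have h2 : 0 ≤ ∑ i ∈ s, (l.count i : ℚ) * (d i * t (mu' (D.hc i) + 1)) :=
    Finset.sum_nonneg fun i hi => mul_nonneg (Nat.cast_nonneg _)
      (mul_nonneg (hd i hi).le (hdom i hi))
  have h3 : finForm s G (fun i => (l.count i : ℚ)) (fun i => l.count i) = 0 := by
    have h4 := hpos fun i => (l.count i : ℚ)
    have hn' : (0 : ℚ) < n := by exact_mod_cast hn
    change 0 ≤ finForm s G _ _ at h4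
    by_contra hne
    have := mul_pos (lt_of_le_of_ne h4 (Ne.symm hne)) hn'
    linarith
  have h4 := hdef _ h3
  have hnil : l = [] := by
    refine List.eq_nil_iff_forall_not_mem.2 fun i hi => ?_
    exact (List.count_pos_iff.2 hi).ne' (by exact_mod_cast h4 i (hls i hi))
  rw [hnil, lwt, List.map_nil, List.sum_nil, sub_zero] at hl
  rw [hl] at ho2
  exact ho1.trans D (ho2.symm D)

end ChevData
end LinkTheorem

section Triangular

variable {h I L : Type} [AddCommGroup h] [Module K h] [LieRing L] [LieAlgebra K L]

/-- The relations between Chevalley generators `T H`, `E i`, `F i`. -/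
structure TriRel (T : h →ₗ[K] L) (E F : I → L) (a : I → Module.Dual K h) (hc : I → h) : Prop where
  tt : ∀ H H', ⁅T H, T H'⁆ = 0
  te : ∀ H i, ⁅T H, E i⁆ = a i H • E i
  tf : ∀ H i, ⁅T H, F i⁆ = -(a i H • F i)
  ef : ∀ i, ⁅E i, F i⁆ = T (hc i)
  ef_ne : ∀ i j, i ≠ j → ⁅E i, F j⁆ = 0

/-- Iterated brackets `⁅X i₁, ⁅X i₂, …⁆⁆`. -/
def nest (X : I → L) : List I → L
  | [] => 0
  | [i] => X i
  | i :: j :: l => ⁅X i, nest X (j :: l)⁆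

variable (K) in
/-- The span of the iterated brackets. -/
def nestSpan (X : I → L) : Submodule K L := Submodule.span K (Set.range (nest X))

lemma nest_mem (X : I → L) (l : List I) : nest X l ∈ nestSpan K X :=
  Submodule.subset_span ⟨l, rfl⟩

lemma lie_nest_mem (X : I → L) (i : I) : ∀ l : List I, ⁅X i, nest X l⁆ ∈ nestSpan K X
  | [] => by rw [nest, lie_zero]; exact Submodule.zero_mem _
  | j :: l => nest_mem X (i :: j :: l)

lemma lie_nestSpan_mem (X : I → L) (i : I) {x : L} (hx : x ∈ nestSpan K X) :
    ⁅X i, x⁆ ∈ nestSpan K X := by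
  refine lie_mem_of_mem_span ?_ hx
  rintro _ ⟨l, rfl⟩
  exact lie_nest_mem X i l

namespace TriRel

variable {T : h →ₗ[K] L} {E F : I → L} {a : I → Module.Dual K h} {hc : I → h}

lemma symm (hT : TriRel T E F a hc) : TriRel T F E (fun i => -a i) (fun i => -hc i) where
  tt := hT.tt
  te H i := by rw [hT.tf]; simp
  tf H i := by rw [hT.te]; simp
  ef i := by rw [← lie_skew, hT.ef]; simp
  ef_ne i j hij := by rw [← lie_skew, hT.ef_ne j i hij.symm, neg_zero]

lemma t_nest (hT : TriRel T E F a hc) (H : h) : ∀ l : List I,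
    ⁅T H, nest E l⁆ = (l.map a).sum H • nest E l
  | [] => by simp [nest]
  | [i] => by simp [nest, hT.te]
  | i :: j :: l => by
    rw [nest, leibniz_lie, hT.te, t_nest hT H (j :: l), lie_smul, smul_lie, ← add_smul,
      List.map_cons (l := j :: l), List.sum_cons (l := List.map a (j :: l)), LinearMap.add_apply]

lemma t_nestSpan (hT : TriRel T E F a hc) (H : h) {x : L} (hx : x ∈ nestSpan K E) :
    ⁅T H, x⁆ ∈ nestSpan K E := by
  refine lie_mem_of_mem_span ?_ hx
  rintro _ ⟨l, rfl⟩
  rw [hT.t_nest]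
  exact Submodule.smul_mem _ _ (nest_mem E l)

lemma f_nest (hT : TriRel T E F a hc) (j : I) : ∀ l : List I,
    ⁅F j, nest E l⁆ ∈ LinearMap.range T ⊔ nestSpan K E
  | [] => by rw [nest, lie_zero]; exact Submodule.zero_mem _
  | [i] => by
    refine Submodule.mem_sup_left ?_
    rw [nest, ← lie_skew]
    by_cases hij : i = j
    · subst hij; rw [hT.ef]; exact ⟨-hc i, map_neg _ _⟩
    · rw [hT.ef_ne i j hij, neg_zero]; exact Submodule.zero_mem _
  | i :: k :: l => by
    rw [nest, leibniz_lie]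
    refine Submodule.add_mem _ (Submodule.mem_sup_right ?_) ?_
    · rw [← lie_skew (F j) (E i)]
      by_cases hij : i = j
      · subst hij
        rw [hT.ef, neg_lie]
        exact Submodule.neg_mem _ (hT.t_nestSpan _ (nest_mem E _))
      · rw [hT.ef_ne i j hij, neg_zero, zero_lie]; exact Submodule.zero_mem _
    · obtain ⟨_, ⟨H, rfl⟩, x, hx, hsum⟩ := Submodule.mem_sup.1 (f_nest hT j (k :: l))
      rw [← hsum, lie_add, ← lie_skew, hT.te]
      exact Submodule.mem_sup_right (Submodule.add_mem _
        (Submodule.neg_mem _ (Submodule.smul_mem _ _ (nest_mem E [i]))) (lie_nestSpan_mem E i hx))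

lemma f_nestSpan (hT : TriRel T E F a hc) (j : I) {x : L} (hx : x ∈ nestSpan K E) :
    ⁅F j, x⁆ ∈ LinearMap.range T ⊔ nestSpan K E := by
  refine lie_mem_of_mem_span ?_ hx
  rintro _ ⟨l, rfl⟩
  exact hT.f_nest j l

/-- The triangular decomposition of the subalgebra generated by `T H`, `E i`, `F i`. -/
lemma triangular (hT : TriRel T E F a hc) {x : L}
    (hx : x ∈ LieSubalgebra.lieSpan K L (Set.range T ∪ Set.range E ∪ Set.range F)) :
    ∃ y ∈ nestSpan K F, ∃ (H : h), ∃ z ∈ nestSpan K E, x = y + T H + z := by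
  set B := nestSpan K F ⊔ (LinearMap.range T ⊔ nestSpan K E) with hB
  have htB : ∀ H, T H ∈ B := fun H => Submodule.mem_sup_right (Submodule.mem_sup_left ⟨H, rfl⟩)
  have hfB : nestSpan K F ≤ B := le_sup_left
  have heB : nestSpan K E ≤ B := le_sup_right.trans le_sup_right
  have hteB : LinearMap.range T ⊔ nestSpan K E ≤ B := le_sup_right
  have htfB : LinearMap.range T ⊔ nestSpan K F ≤ B := sup_le (le_sup_left.trans hteB) hfB
  have hsplit : ∀ w ∈ B, ∃ y ∈ nestSpan K F, ∃ (H : h), ∃ z ∈ nestSpan K E, w = y + T H + z := by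
    intro w hw
    obtain ⟨y, hy, w', hw', rfl⟩ := Submodule.mem_sup.1 hw
    obtain ⟨_, ⟨H, rfl⟩, z, hz, rfl⟩ := Submodule.mem_sup.1 hw'
    exact ⟨y, hy, H, z, hz, (add_assoc _ _ _).symm⟩
  have hle : LieSubalgebra.lieSpan K L (Set.range T ∪ Set.range E ∪ Set.range F) ≤
      { B ⊓ (stab B).toSubmodule with
        lie_mem' := fun hx hy => ⟨hx.2 _ hy.1, (stab B).lie_mem hx.2 hy.2⟩ } := by
    rw [LieSubalgebra.lieSpan_le]
    rintro _ ((⟨H, rfl⟩ | ⟨i, rfl⟩) | ⟨i, rfl⟩)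
    · refine ⟨htB H, fun w hw => ?_⟩
      obtain ⟨y, hy, H', z, hz, rfl⟩ := hsplit w hw
      rw [lie_add, lie_add, hT.tt, add_zero]
      exact B.add_mem (hfB (hT.symm.t_nestSpan H hy)) (heB (hT.t_nestSpan H hz))
    · refine ⟨heB (nest_mem E [i]), fun w hw => ?_⟩
      obtain ⟨y, hy, H', z, hz, rfl⟩ := hsplit w hw
      rw [lie_add, lie_add, ← lie_skew (E i) (T H'), hT.te]
      exact B.add_mem (B.add_mem (htfB (hT.symm.f_nestSpan i hy))
        (B.neg_mem (B.smul_mem _ (heB (nest_mem E [i]))))) (heB (lie_nestSpan_mem E i hz))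
    · refine ⟨hfB (nest_mem F [i]), fun w hw => ?_⟩
      obtain ⟨y, hy, H', z, hz, rfl⟩ := hsplit w hw
      rw [lie_add, lie_add, ← lie_skew (F i) (T H'), hT.tf, neg_neg]
      exact B.add_mem (B.add_mem (hfB (lie_nestSpan_mem F i hy))
        (B.smul_mem _ (hfB (nest_mem F [i])))) (hteB (hT.f_nestSpan i hz))
  exact hsplit x (hle hx).1

end TriRel

/-- The weight spaces of `L` for the operators `⁅T H, ·⁆`. -/
def adWt (T : h →ₗ[K] L) (mu : Module.Dual K h) : Submodule K L where
  carrier := {x | ∀ H, ⁅T H, x⁆ = mu H • x}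
  add_mem' := by intro x y hx hy H; rw [lie_add, hx H, hy H, smul_add]
  zero_mem' := by intro H; rw [lie_zero, smul_zero]
  smul_mem' := by intro c x hx H; rw [lie_smul, hx H, smul_comm]

lemma iSupIndep_adWt (T : h →ₗ[K] L) : iSupIndep (adWt T) := by
  classical
  rw [iSupIndep_iff_finsetSum_eq_zero_imp_eq_zero]
  intro s v hv h0
  exact eigen_sum_eq_zero (fun H => (LieAlgebra.ad K L (T H) : L →ₗ[K] L)) s v hv h0

namespace TriRel

variable {T : h →ₗ[K] L} {E F : I → L} {a : I → Module.Dual K h} {hc : I → h}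

lemma nestSpan_le (hT : TriRel T E F a hc) :
    nestSpan K E ≤ ⨆ mu ∈ {mu | ∃ l : List I, l ≠ [] ∧ (l.map a).sum = mu}, adWt T mu := by
  rw [nestSpan, Submodule.span_le]
  rintro _ ⟨l, rfl⟩
  by_cases hl : l = []
  · subst hl; exact Submodule.zero_mem _
  · exact (le_iSup₂_of_le (f := fun mu _ => adWt T mu) (l.map a).sum ⟨l, hl, rfl⟩ le_rfl)
      fun H => hT.t_nest H l

/-- The sum in the triangular decomposition is direct. -/
lemma eq_zero_of_sum (hT : TriRel T E F a hc) (ha : LinearIndependent K a) {y z : L} {H : h}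
    (hy : y ∈ nestSpan K F) (hz : z ∈ nestSpan K E) (h0 : y + T H + z = 0) :
    y = 0 ∧ T H = 0 ∧ z = 0 := by
  obtain ⟨p, hp⟩ : ∃ p : Module.Dual K h →ₗ[K] K, ∀ i, p (a i) = 1 := by
    obtain ⟨p, hp⟩ := LinearMap.exists_extend
      ((Finsupp.linearCombination K fun _ : I => (1 : K)).comp (ha.repr : Submodule.span K (Set.range a) →ₗ[K] I →₀ K))
    refine ⟨p, fun i => ?_⟩
    have := LinearMap.congr_fun hp ⟨a i, Submodule.subset_span ⟨i, rfl⟩⟩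
    rw [LinearMap.comp_apply, Submodule.subtype_apply] at this
    rw [this, LinearMap.comp_apply, ha.repr_eq_single i _ rfl]
    simp
  have hpl : ∀ l : List I, p (l.map a).sum = l.length := by
    intro l
    induction l with
    | nil => simp
    | cons i l ih => rw [List.map_cons, List.sum_cons, map_add, ih, hp]; simp [add_comm]
  have hnl : ∀ l : List I, (l.map fun i => -a i).sum = -(l.map a).sum := by
    intro l
    induction l with
    | nil => simp
    | cons i l ih => simp [ih, add_comm]
  have hlen : ∀ l : List I, l ≠ [] → 0 < l.length := fun l hl => List.length_pos_iff.2 hl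
  set A := {mu | ∃ l : List I, l ≠ [] ∧ (l.map a).sum = mu}
  set B := {mu | ∃ l : List I, l ≠ [] ∧ (l.map fun i => -a i).sum = mu}
  have hy' : y ∈ ⨆ mu ∈ B, adWt T mu := hT.symm.nestSpan_le hy
  have hz' : z ∈ ⨆ mu ∈ A, adWt T mu := hT.nestSpan_le hz
  have hH : T H ∈ ⨆ mu ∈ ({0} : Set (Module.Dual K h)), adWt T mu := by
    rw [iSup_singleton]
    intro H'
    rw [hT.tt]; simp
  have hdis : ∀ X Y : Set (Module.Dual K h), Disjoint X Y →
      Disjoint (⨆ mu ∈ X, adWt T mu) (⨆ mu ∈ Y, adWt T mu) := fun X Y h =>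
    (iSupIndep_adWt T).disjoint_biSup_biSup h
  have h1 : z = 0 := by
    refine Submodule.disjoint_def.1 (hdis A (B ∪ {0}) ?_) z hz' ?_
    · rw [Set.disjoint_left]
      rintro mu ⟨l, hl, rfl⟩ (⟨l', hl', h⟩ | h)
      · have := congrArg p h
        rw [hnl, map_neg, hpl, hpl, neg_eq_iff_add_eq_zero] at this
        have h2 : l'.length + l.length = 0 := by exact_mod_cast this
        have := hlen l hl
        omega
      · have := congrArg p (Set.mem_singleton_iff.1 h)
        rw [hpl, map_zero] at this
        exact (hlen l hl).ne' (by exact_mod_cast this)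
    · rw [show z = -(y + T H) by rw [eq_neg_iff_add_eq_zero, ← h0]; abel]
      refine Submodule.neg_mem _ (Submodule.add_mem _ ?_ ?_)
      · exact (biSup_mono fun mu h => Or.inl h :
          (⨆ mu ∈ B, adWt T mu) ≤ ⨆ mu ∈ B ∪ {0}, adWt T mu) hy'
      · exact (biSup_mono fun mu h => Or.inr h :
          (⨆ mu ∈ ({0} : Set _), adWt T mu) ≤ ⨆ mu ∈ B ∪ {0}, adWt T mu) hH
  rw [h1, add_zero] at h0
  have h2 : y = 0 := by
    refine Submodule.disjoint_def.1 (hdis B {0} ?_) y hy' ?_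
    · rw [Set.disjoint_left]
      rintro mu ⟨l, hl, rfl⟩ h
      have := congrArg p (Set.mem_singleton_iff.1 h)
      rw [hnl, map_neg, hpl, map_zero, neg_eq_zero] at this
      exact (hlen l hl).ne' (by exact_mod_cast this)
    · rw [show y = -T H from eq_neg_of_add_eq_zero_left h0]
      exact Submodule.neg_mem _ hH
  exact ⟨h2, by rwa [h2, zero_add] at h0, h1⟩

end TriRel

end Triangular

section HighestWeight

attribute [local instance] LieRing.ofAssociativeRing

local notation "𝔦" => UniversalEnvelopingAlgebra.ι K

namespace ChevData

variable (D : ChevData K g) (lam : Module.Dual K D.h)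

/-- Prepending a letter to words. -/
def wordF (i : D.I) : Module.End K (List D.I →₀ K) :=
  Finsupp.lmapDomain K K (List.cons i)

/-- The action of `h` on words applied to a vector of weight `lam`. -/
def wordH (H : D.h) : Module.End K (List D.I →₀ K) :=
  Finsupp.lsum K fun l => ((lam - D.lwt l) H) • Finsupp.lsingle l

open Classical in
/-- The formal result of applying `e j` to a word. -/
def wordEAux (j : D.I) : List D.I → (List D.I →₀ K)
  | [] => 0
  | i :: l => D.wordF i (wordEAux j l) +
      if j = i then Finsupp.single l ((lam - D.lwt l) (D.hc j)) else 0

/-- The action of `e j` on words applied to a singular vector of weight `lam`. -/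
def wordE (j : D.I) : Module.End K (List D.I →₀ K) :=
  Finsupp.lsum K fun l => (LinearMap.toSpanSingleton K _ (D.wordEAux lam j l))

@[simp] lemma wordF_single (i : D.I) (l : List D.I) (c : K) :
    D.wordF i (Finsupp.single l c) = Finsupp.single (i :: l) c := by
  simp [wordF]

@[simp] lemma wordH_single (H : D.h) (l : List D.I) (c : K) :
    D.wordH lam H (Finsupp.single l c) = (lam - D.lwt l) H • Finsupp.single l c := by
  simp [wordH]

@[simp] lemma wordE_single (j : D.I) (l : List D.I) (c : K) :
    D.wordE lam j (Finsupp.single l c) = c • D.wordEAux lam j l := by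
  simp [wordE]

lemma lwt_cons (i : D.I) (l : List D.I) : D.lwt (i :: l) = D.a i + D.lwt l := by
  simp [lwt]

lemma wordH_wordF (H : D.h) (i : D.I) (v : List D.I →₀ K) :
    D.wordH lam H (D.wordF i v) = D.wordF i (D.wordH lam H v) - D.a i H • D.wordF i v := by
  induction v using Finsupp.induction_linear with
  | zero => simp
  | add v w hv hw => simp only [map_add, hv, hw, smul_add]; abel
  | single l c =>
    rw [wordF_single, wordH_single, wordH_single, map_smul, wordF_single, lwt_cons]
    simp only [LinearMap.sub_apply, LinearMap.add_apply]
    module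

lemma wordH_wordEAux (H : D.h) (j : D.I) (l : List D.I) :
    D.wordH lam H (D.wordEAux lam j l) = (lam - D.lwt l + D.a j) H • D.wordEAux lam j l := by
  induction l with
  | nil => simp [wordEAux]
  | cons i l ih =>
    rw [wordEAux, map_add, wordH_wordF, ih, map_smul, smul_add, lwt_cons]
    simp only [LinearMap.sub_apply, LinearMap.add_apply]
    split_ifs with hij
    · subst hij
      rw [wordH_single]
      simp only [LinearMap.sub_apply]
      module
    · simp only [map_zero, smul_zero]
      module

lemma wordE_wordF_ne {i j : D.I} (hij : j ≠ i) (v : List D.I →₀ K) :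
    D.wordE lam j (D.wordF i v) = D.wordF i (D.wordE lam j v) := by
  induction v using Finsupp.induction_linear with
  | zero => simp
  | add v w hv hw => simp only [map_add, hv, hw]
  | single l c => simp [wordEAux, hij]

lemma wordE_wordF_self (i : D.I) (v : List D.I →₀ K) :
    D.wordE lam i (D.wordF i v) = D.wordF i (D.wordE lam i v) + D.wordH lam (D.hc i) v := by
  induction v using Finsupp.induction_linear with
  | zero => simp
  | add v w hv hw => simp only [map_add, hv, hw]; abel
  | single l c =>
    rw [wordF_single, wordE_single, wordE_single, wordH_single, wordEAux, if_pos rfl, smul_add,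
      map_smul, Finsupp.smul_single, Finsupp.smul_single, smul_eq_mul, smul_eq_mul, mul_comm]

lemma wordH_add (H H' : D.h) : D.wordH lam (H + H') = D.wordH lam H + D.wordH lam H' := by
  refine Finsupp.lhom_ext fun l c => ?_
  simp only [wordH_single, LinearMap.add_apply, map_add, add_smul]

lemma wordH_smul (c : K) (H : D.h) : D.wordH lam (c • H) = c • D.wordH lam H := by
  refine Finsupp.lhom_ext fun l b => ?_
  simp only [wordH_single, LinearMap.smul_apply, map_smul, smul_assoc]

/-- The generators of `g` together with their actions on words. -/
def wordT : D.h →ₗ[K] g × Module.End K (List D.I →₀ K) where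
  toFun H := ((H : g), D.wordH lam H)
  map_add' H H' := by rw [wordH_add]; rfl
  map_smul' c H := by rw [wordH_smul]; rfl

lemma triRel_word : TriRel (D.wordT lam) (fun i => (D.e i, D.wordE lam i))
    (fun i => (D.f i, D.wordF i)) D.a D.hc where
  tt H H' := by
    refine Prod.ext (D.h_comm H H') (Finsupp.lhom_ext fun l c => ?_)
    simp only [wordT, LinearMap.coe_mk, AddHom.coe_mk, LieAlgebra.Prod.bracket_apply,
      LieRing.of_associative_ring_bracket, LinearMap.sub_apply, Module.End.mul_apply,
      wordH_single, map_smul, Prod.snd_zero, LinearMap.zero_apply]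
    module
  te H i := by
    refine Prod.ext (D.he H i) (Finsupp.lhom_ext fun l c => ?_)
    simp only [wordT, LinearMap.coe_mk, AddHom.coe_mk, LieAlgebra.Prod.bracket_apply,
      LieRing.of_associative_ring_bracket, LinearMap.sub_apply, Module.End.mul_apply,
      wordH_single, wordE_single, map_smul, wordH_wordEAux, LinearMap.add_apply,
      Prod.smul_mk, LinearMap.smul_apply]
    module
  tf H i := by
    refine Prod.ext (D.hf H i) (LinearMap.ext fun v => ?_)
    simp only [wordT, LinearMap.coe_mk, AddHom.coe_mk, LieAlgebra.Prod.bracket_apply,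
      LieRing.of_associative_ring_bracket, LinearMap.sub_apply, Module.End.mul_apply,
      wordH_wordF, Prod.smul_mk, LinearMap.smul_apply, Prod.snd_neg,
      LinearMap.neg_apply]
    module
  ef i := by
    refine Prod.ext (D.ef i) (LinearMap.ext fun v => ?_)
    simp only [wordT, LinearMap.coe_mk, AddHom.coe_mk, LieAlgebra.Prod.bracket_apply,
      LieRing.of_associative_ring_bracket, LinearMap.sub_apply, Module.End.mul_apply,
      wordE_wordF_self]
    module
  ef_ne i j hij := by
    refine Prod.ext (D.ef_ne i j hij) (LinearMap.ext fun v => ?_)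
    simp only [LieAlgebra.Prod.bracket_apply,
      LieRing.of_associative_ring_bracket, LinearMap.sub_apply, Module.End.mul_apply,
      D.wordE_wordF_ne lam hij, sub_self, Prod.snd_zero, LinearMap.zero_apply]

lemma wordF_apply_nil (i : D.I) (v : List D.I →₀ K) : D.wordF i v [] = 0 := by
  rw [wordF, Finsupp.lmapDomain_apply, Finsupp.mapDomain_of_notMem_range]
  rintro ⟨l, hl⟩
  exact List.cons_ne_nil _ _ hl

lemma word_nest_f (v : List D.I →₀ K) : ∀ l : List D.I,
    (nest (fun i => (D.f i, D.wordF i)) l : g × Module.End K (List D.I →₀ K)).2 v [] = 0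
  | [] => by simp [nest]
  | [i] => D.wordF_apply_nil i v
  | i :: j :: l => by
    rw [nest, LieAlgebra.Prod.bracket_apply, LieRing.of_associative_ring_bracket]
    simp only [LinearMap.sub_apply, Module.End.mul_apply, Finsupp.sub_apply]
    rw [word_nest_f _ (j :: l), sub_zero]
    exact D.wordF_apply_nil i _

lemma word_nest_e (c : K) : ∀ l : List D.I,
    (nest (fun i => (D.e i, D.wordE lam i)) l : g × Module.End K (List D.I →₀ K)).2
      (Finsupp.single [] c) = 0
  | [] => by simp [nest]
  | [i] => by simp [nest, wordEAux]
  | i :: j :: l => by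
    rw [nest, LieAlgebra.Prod.bracket_apply, LieRing.of_associative_ring_bracket]
    simp only [LinearMap.sub_apply, Module.End.mul_apply]
    rw [word_nest_e c (j :: l)]
    simp [wordEAux]

/-- The Lie algebra generated by the generators of `g` together with their actions on words. -/
def wordLie : LieSubalgebra K (g × Module.End K (List D.I →₀ K)) :=
  LieSubalgebra.lieSpan K _ (Set.range (D.wordT lam) ∪
    Set.range (fun i => (D.e i, D.wordE lam i)) ∪ Set.range fun i => (D.f i, D.wordF i))

lemma nestSpan_e_eq_zero {X : g × Module.End K (List D.I →₀ K)}
    (hX : X ∈ nestSpan K (fun i => (D.e i, D.wordE lam i))) (h0 : X.1 = 0)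
    (hsum : ∀ (y z : g × Module.End K (List D.I →₀ K)) (H : D.h),
      y ∈ nestSpan K (fun i => (D.f i, D.wordF i)) →
      z ∈ nestSpan K (fun i => (D.e i, D.wordE lam i)) → (y + D.wordT lam H + z).1 = 0 →
      y.1 = 0 ∧ H = 0 ∧ z.1 = 0) : X.2 = 0 := by
  have key : ∀ (l : List D.I) (X : g × Module.End K (List D.I →₀ K)),
      X ∈ nestSpan K (fun i => (D.e i, D.wordE lam i)) → X.1 = 0 → ∀ c,
      X.2 (Finsupp.single l c) = 0 := by
    intro l
    induction l with
    | nil =>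
      intro X hX h0' c
      refine map_mem_of_mem_span (P := ⊥) (LinearMap.applyₗ (Finsupp.single ([] : List D.I) c) ∘ₗ
        LinearMap.snd K g (Module.End K (List D.I →₀ K))) ?_ hX
      rintro _ ⟨l, rfl⟩
      exact D.word_nest_e lam c l
    | cons i l ih =>
      intro X hX h0 c
      have hb : ⁅((D.f i, D.wordF i) : g × Module.End K (List D.I →₀ K)), X⁆ ∈
          LinearMap.range (D.wordT lam) ⊔ nestSpan K (fun i => (D.e i, D.wordE lam i)) :=
        (D.triRel_word lam).f_nestSpan i hX
      obtain ⟨_, ⟨H, rfl⟩, z, hz, hHz⟩ := Submodule.mem_sup.1 hb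
      have h1 : (0 + D.wordT lam H + z).1 = 0 := by
        rw [zero_add, hHz, LieAlgebra.Prod.bracket_apply, h0, lie_zero]
      obtain ⟨-, hH, hz1⟩ := hsum 0 z H (Submodule.zero_mem _) hz h1
      have h2 := ih z hz hz1 c
      rw [hH, map_zero, zero_add] at hHz
      rw [hHz, LieAlgebra.Prod.bracket_apply, LieRing.of_associative_ring_bracket] at h2
      simp only [LinearMap.sub_apply, Module.End.mul_apply, ih X hX h0 c, map_zero,
        zero_sub, neg_eq_zero, wordF_single] at h2
      exact h2
  exact Finsupp.lhom_ext fun l c => key l X hX h0 c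

lemma triRel : TriRel D.h.subtype D.e D.f D.a D.hc where
  tt := D.h_comm
  te := D.he
  tf := D.hf
  ef := D.ef
  ef_ne := D.ef_ne

lemma fst_nest_mem {X : D.I → g × Module.End K (List D.I →₀ K)} {Y : D.I → g}
    (hXY : ∀ i, (X i).1 = Y i)
    {x : g × Module.End K (List D.I →₀ K)} (hx : x ∈ nestSpan K X) :
    x.1 ∈ nestSpan K Y := by
  have hn : ∀ l : List D.I, (nest X l).1 = nest Y l := by
    intro l
    induction l with
    | nil => rfl
    | cons i l ih =>
      cases l with
      | nil => exact hXY i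
      | cons j l => rw [nest, nest, LieAlgebra.Prod.bracket_apply, ih, hXY]
  refine map_mem_of_mem_span (LinearMap.fst K g (Module.End K (List D.I →₀ K))) ?_ hx
  rintro _ ⟨l, rfl⟩
  rw [LinearMap.fst_apply, hn]
  exact nest_mem _ l

lemma wordLie_apply_nil {X : g × Module.End K (List D.I →₀ K)} (hX : X ∈ D.wordLie lam)
    (h0 : X.1 = 0) (v : List D.I →₀ K) : X.2 v [] = 0 := by
  have hsum : ∀ (y z : g × Module.End K (List D.I →₀ K)) (H : D.h),
      y ∈ nestSpan K (fun i => (D.f i, D.wordF i)) →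
      z ∈ nestSpan K (fun i => (D.e i, D.wordE lam i)) → (y + D.wordT lam H + z).1 = 0 →
      y.1 = 0 ∧ H = 0 ∧ z.1 = 0 := by
    intro y z H hy hz h
    have hy1 : y.1 ∈ nestSpan K D.f :=
      D.fst_nest_mem (X := fun i => (D.f i, D.wordF i)) (fun _ => rfl) hy
    have hz1 : z.1 ∈ nestSpan K D.e :=
      D.fst_nest_mem (X := fun i => (D.e i, D.wordE lam i)) (fun _ => rfl) hz
    have h' : y.1 + D.h.subtype H + z.1 = 0 := h
    generalize y.1 = y1 at *
    generalize z.1 = z1 at *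
    obtain ⟨h1, h2, h3⟩ := D.triRel.eq_zero_of_sum D.indep hy1 hz1 h'
    exact ⟨h1, Subtype.ext h2, h3⟩
  obtain ⟨y, hy, H, z, hz, rfl⟩ := (D.triRel_word lam).triangular hX
  obtain ⟨h1, rfl, h3⟩ := hsum y z H hy hz h0
  have hz2 := D.nestSpan_e_eq_zero lam hz h3 hsum
  have hy2 : y.2 v [] = 0 := by
    refine map_mem_of_mem_span (P := ⊥) (Finsupp.lapply [] ∘ₗ LinearMap.applyₗ v ∘ₗ
      LinearMap.snd K g (Module.End K (List D.I →₀ K))) ?_ hy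
    rintro _ ⟨l, rfl⟩
    exact D.word_nest_f v l
  simp [hz2, hy2]

/-- Every weight is the weight of a nonzero singular vector in some module. -/
theorem exists_sing : ∃ (V : Type) (_ : AddCommGroup V) (_ : Module K V)
    (_ : Module (Env K g) V) (_ : IsScalarTower K (Env K g) V) (w : V),
    D.Sing w lam ∧ w ≠ 0 := by
  set G := D.wordLie lam with hG
  set N : Submodule K (List D.I →₀ K) :=
    Submodule.span K {v | ∃ X ∈ G, X.1 = 0 ∧ ∃ v', X.2 v' = v} with hN
  have hNX : ∀ X ∈ G, N ≤ N.comap X.2 := by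
    intro X hX
    rw [hN, Submodule.span_le]
    rintro _ ⟨Y, hY, hY0, v, rfl⟩
    have h1 : X.2 (Y.2 v) = (⁅X, Y⁆).2 v + Y.2 (X.2 v) := by
      rw [LieAlgebra.Prod.bracket_apply, LieRing.of_associative_ring_bracket]
      simp [Module.End.mul_apply]
    change X.2 (Y.2 v) ∈ N
    rw [h1]
    refine N.add_mem (Submodule.subset_span ⟨_, G.lie_mem hX hY, ?_, v, rfl⟩)
      (Submodule.subset_span ⟨Y, hY, hY0, _, rfl⟩)
    rw [LieAlgebra.Prod.bracket_apply, hY0, lie_zero]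
  have hsurj : ∀ x : g, ∃ X ∈ G, X.1 = x := by
    have h : (⊤ : LieSubalgebra K g) ≤ G.map (LieHom.fst K g _) := by
      rw [← D.gen, LieSubalgebra.lieSpan_le]
      rintro x ((hx | ⟨i, rfl⟩) | ⟨i, rfl⟩)
      · exact ⟨D.wordT lam ⟨x, hx⟩, LieSubalgebra.subset_lieSpan (Or.inl (Or.inl ⟨_, rfl⟩)), rfl⟩
      · exact ⟨(D.e i, D.wordE lam i),
          LieSubalgebra.subset_lieSpan (Or.inl (Or.inr ⟨_, rfl⟩)), rfl⟩
      · exact ⟨(D.f i, D.wordF i), LieSubalgebra.subset_lieSpan (Or.inr ⟨_, rfl⟩), rfl⟩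
    exact fun x => h (LieSubalgebra.mem_top x)
  choose s hsG hs using hsurj
  have hwd : ∀ X Y, X ∈ G → Y ∈ G → X.1 = Y.1 → ∀ v, N.mkQ (X.2 v) = N.mkQ (Y.2 v) := by
    intro X Y hX hY h v
    rw [← sub_eq_zero, ← map_sub, Submodule.mkQ_apply, Submodule.Quotient.mk_eq_zero]
    exact Submodule.subset_span ⟨X - Y, G.sub_mem hX hY, by rw [Prod.fst_sub, h, sub_self], v, rfl⟩
  let φ : g → Module.End K ((List D.I →₀ K) ⧸ N) := fun x => N.mapQ N (s x).2 (hNX _ (hsG x))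
  have hφ : ∀ x, ∀ X ∈ G, X.1 = x → ∀ v, φ x (N.mkQ v) = N.mkQ (X.2 v) := by
    intro x X hX hXx v
    exact hwd _ _ (hsG x) hX ((hs x).trans hXx.symm) v
  have hext : ∀ A B : Module.End K ((List D.I →₀ K) ⧸ N),
      (∀ v, A (N.mkQ v) = B (N.mkQ v)) → A = B := by
    intro A B h
    refine LinearMap.ext fun q => ?_
    obtain ⟨v, rfl⟩ := N.mkQ_surjective q
    exact h v
  let Φ : g →ₗ⁅K⁆ Module.End K ((List D.I →₀ K) ⧸ N) :=
    { toFun := φ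
      map_add' := fun x y => hext _ _ fun v => by
        rw [hφ (x + y) (s x + s y) (G.add_mem (hsG x) (hsG y)) (by rw [Prod.fst_add, hs, hs])]
        rw [Prod.snd_add, LinearMap.add_apply, map_add]; rfl
      map_smul' := fun c x => hext _ _ fun v => by
        rw [hφ (c • x) (c • s x) (G.smul_mem c (hsG x)) (by rw [Prod.smul_fst, hs])]
        rw [Prod.smul_snd, LinearMap.smul_apply, map_smul]; rfl
      map_lie' := fun {x y} => hext _ _ fun v => by
        rw [hφ ⁅x, y⁆ ⁅s x, s y⁆ (G.lie_mem (hsG x) (hsG y))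
          (by rw [LieAlgebra.Prod.bracket_apply, hs, hs])]
        rw [LieAlgebra.Prod.bracket_apply, LieRing.of_associative_ring_bracket,
          LieRing.of_associative_ring_bracket, LinearMap.sub_apply, map_sub]; rfl }
  let ψ : Env K g →ₐ[K] Module.End K ((List D.I →₀ K) ⧸ N) := UniversalEnvelopingAlgebra.lift K Φ
  let _ : Module (Env K g) ((List D.I →₀ K) ⧸ N) := Module.compHom _ ψ.toRingHom
  have hsm : ∀ (X : Env K g) (q : (List D.I →₀ K) ⧸ N), X • q = ψ X q := fun _ _ => rfl
  have hsx : ∀ (x : g) (X : g × Module.End K (List D.I →₀ K)), X ∈ G → X.1 = x → ∀ v,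
      𝔦 x • N.mkQ v = N.mkQ (X.2 v) := by
    intro x X hX hXx v
    rw [hsm, UniversalEnvelopingAlgebra.lift_ι_apply]
    exact hφ x X hX hXx v
  have : IsScalarTower K (Env K g) ((List D.I →₀ K) ⧸ N) :=
    IsScalarTower.of_algebraMap_smul fun c q => by
      rw [hsm, AlgHom.commutes, Module.algebraMap_end_apply]
  refine ⟨_, inferInstance, inferInstance, inferInstance, inferInstance,
    N.mkQ (Finsupp.single [] 1), ⟨fun H => ?_, fun i => ?_⟩, fun h0 => ?_⟩
  · rw [hsx (H : g) (D.wordT lam H) (LieSubalgebra.subset_lieSpan (Or.inl (Or.inl ⟨_, rfl⟩))) rfl]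
    rw [← map_smul]
    simp [wordT, lwt]
  · rw [hsx (D.e i) (D.e i, D.wordE lam i) (LieSubalgebra.subset_lieSpan (Or.inl (Or.inr ⟨_, rfl⟩))) rfl]
    simp [wordEAux]
  · rw [Submodule.mkQ_apply, Submodule.Quotient.mk_eq_zero] at h0
    have : N ≤ LinearMap.ker (Finsupp.lapply (R := K) (M := K) ([] : List D.I)) := by
      rw [hN, Submodule.span_le]
      rintro _ ⟨X, hX, hX0, v, rfl⟩
      exact D.wordLie_apply_nil lam hX hX0 v
    have := this h0
    simp at this

end ChevData
end HighestWeight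

section WeightModules

attribute [local instance] LieRing.ofAssociativeRing

local notation "𝔦" => UniversalEnvelopingAlgebra.ι K

variable {R : Type} [AddCommGroup R] [Module K R] [Module (Env K g) R]
  [IsScalarTower K (Env K g) R]
variable {R' : Type} [AddCommGroup R'] [Module K R'] [Module (Env K g) R']
  [IsScalarTower K (Env K g) R'] {h : LieSubalgebra K g}

lemma hWt_map (φ : R →ₗ[Env K g] R') {mu : Module.Dual K h} {v : R} (hv : v ∈ hWt h R mu) :
    φ v ∈ hWt h R' mu := by
  intro H
  rw [← map_smul φ, hv H, ← algebraMap_smul (Env K g), map_smul φ, algebraMap_smul]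

lemma mem_hWt_coe {N : Submodule (Env K g) R} {mu : Module.Dual K h} {v : N} :
    v ∈ hWt h N mu ↔ (v : R) ∈ hWt h R mu := by
  refine ⟨fun hv H => ?_, fun hv H => ?_⟩
  · exact congrArg Subtype.val (hv H)
  · exact Subtype.ext (hv H)

/-- The weight components of an element of a submodule belong to the submodule. -/
lemma comp_mem (N : Submodule (Env K g) R) {s : Finset (Module.Dual K h)}
    {v : Module.Dual K h → R} (hv : ∀ mu ∈ s, v mu ∈ hWt h R mu) (hs : ∑ mu ∈ s, v mu ∈ N) :
    ∀ mu ∈ s, v mu ∈ N := by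
  intro mu hmu
  rw [← Submodule.Quotient.mk_eq_zero]
  refine hWt_sum_eq_zero (R := R ⧸ N) s (fun mu => N.mkQ (v mu))
    (fun mu hmu => hWt_map N.mkQ (hv mu hmu)) ?_ mu hmu
  rw [← map_sum, Submodule.mkQ_apply, Submodule.Quotient.mk_eq_zero]
  exact hs

lemma exists_wt_sum {x : R} (hx : x ∈ ⨆ mu, hWt h R mu) :
    ∃ (s : Finset (Module.Dual K h)) (v : Module.Dual K h → R),
      (∀ mu, v mu ∈ hWt h R mu) ∧ ∑ mu ∈ s, v mu = x := by
  obtain ⟨f, hf, rfl⟩ := (Submodule.mem_iSup_iff_exists_finsupp _ _).1 hx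
  exact ⟨f.support, f, hf, rfl⟩

/-- If a weight vector is a sum of two elements of submodules, the summands may be chosen to be
weight vectors. -/
lemma exists_add_of_mem_sup {N N' : Submodule (Env K g) R} (hR : (⨆ mu, hWt h R mu) = ⊤)
    {mu : Module.Dual K h} {u : R} (hu : u ∈ hWt h R mu) (huN : u ∈ N ⊔ N') :
    ∃ x ∈ N, ∃ y ∈ N', x ∈ hWt h R mu ∧ y ∈ hWt h R mu ∧ x + y = u := by
  classical
  obtain ⟨x, hx, y, hy, rfl⟩ := Submodule.mem_sup.1 huN
  obtain ⟨s, v, hv, rfl⟩ := exists_wt_sum (h := h) (x := x) (hR ▸ Submodule.mem_top)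
  obtain ⟨t, w, hw, rfl⟩ := exists_wt_sum (h := h) (x := y) (hR ▸ Submodule.mem_top)
  have hx' := comp_mem N (fun mu _ => hv mu) hx
  have hy' := comp_mem N' (fun mu _ => hw mu) hy
  set v' : Module.Dual K h → R := fun mu => if mu ∈ s then v mu else 0 with hv'
  set w' : Module.Dual K h → R := fun mu => if mu ∈ t then w mu else 0 with hw'
  have hvw : ∀ mu, v' mu ∈ hWt h R mu ∧ v' mu ∈ N := fun mu => by
    by_cases hm : mu ∈ s
    · simp only [hv', hm, if_true]; exact ⟨hv mu, hx' mu hm⟩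
    · simp only [hv', hm, if_false]; exact ⟨zero_mem _, zero_mem _⟩
  have hww : ∀ mu, w' mu ∈ hWt h R mu ∧ w' mu ∈ N' := fun mu => by
    by_cases hm : mu ∈ t
    · simp only [hw', hm, if_true]; exact ⟨hw mu, hy' mu hm⟩
    · simp only [hw', hm, if_false]; exact ⟨zero_mem _, zero_mem _⟩
  refine ⟨v' mu, (hvw mu).2, w' mu, (hww mu).2, (hvw mu).1, (hww mu).1, ?_⟩
  set S : Finset (Module.Dual K h) := insert mu (s ∪ t) with hS
  have e1 : ∑ nu ∈ S, v' nu = ∑ nu ∈ s, v nu := by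
    rw [← Finset.sum_subset (s₁ := s) (s₂ := S)]
    · exact Finset.sum_congr rfl fun nu hnu => by simp [hv', hnu]
    · intro nu hnu; simp [hS, hnu]
    · intro nu _ hnu; simp [hv', hnu]
  have e2 : ∑ nu ∈ S, w' nu = ∑ nu ∈ t, w nu := by
    rw [← Finset.sum_subset (s₁ := t) (s₂ := S)]
    · exact Finset.sum_congr rfl fun nu hnu => by simp [hw', hnu]
    · intro nu hnu; simp [hS, hnu]
    · intro nu _ hnu; simp [hw', hnu]
  rw [← e1, ← e2] at hu ⊢
  have := hWt_sum_eq_zero S (fun nu => v' nu + w' nu -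
      if nu = mu then (∑ nu ∈ S, v' nu + ∑ nu ∈ S, w' nu) else 0)
    (fun nu _ => by
      by_cases hnu : nu = mu
      · subst hnu
        simpa using Submodule.sub_mem _ (Submodule.add_mem _ (hvw nu).1 (hww nu).1) hu
      · simpa [hnu] using Submodule.add_mem _ (hvw nu).1 (hww nu).1)
    (by rw [Finset.sum_sub_distrib, Finset.sum_add_distrib]; simp [hS]) mu (by simp [hS])
  simpa [sub_eq_zero] using this

lemma iSup_hWt_coe (hR : (⨆ mu, hWt h R mu) = ⊤) (N : Submodule (Env K g) R) :
    (⨆ mu, hWt h N mu) = ⊤ := by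
  rw [eq_top_iff]
  rintro ⟨x, hx⟩ -
  obtain ⟨s, v, hv, rfl⟩ := exists_wt_sum (h := h) (x := x) (hR ▸ Submodule.mem_top)
  have hN := comp_mem N (fun mu _ => hv mu) hx
  have : (⟨∑ mu ∈ s, v mu, hx⟩ : N) = ∑ mu ∈ s.attach, ⟨v mu, hN mu mu.2⟩ := by
    refine Subtype.ext ?_
    rw [AddSubmonoidClass.coe_finsetSum]
    exact (Finset.sum_attach s v).symm
  rw [this]
  refine Submodule.sum_mem _ fun mu _ => ?_
  exact Submodule.mem_iSup_of_mem (mu : Module.Dual K h) (mem_hWt_coe.2 (hv mu))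

lemma finite_hWt_coe {mu : Module.Dual K h} [FiniteDimensional K (hWt h R mu)]
    (N : Submodule (Env K g) R) : FiniteDimensional K (hWt h N mu) := by
  let φ : hWt h N mu →ₗ[K] hWt h R mu :=
    { toFun := fun v => ⟨((v : N) : R), mem_hWt_coe.1 v.2⟩
      map_add' := fun _ _ => rfl
      map_smul' := fun _ _ => rfl }
  refine FiniteDimensional.of_injective φ fun v w hvw => ?_
  exact Subtype.ext (Subtype.ext (congrArg (fun z : hWt h R mu => (z : R)) hvw))

section DualModule

variable (K R) in
/-- The full dual of a module over the enveloping algebra. -/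
def EnvDual : Type := Module.Dual K R

instance : AddCommGroup (EnvDual K R) := inferInstanceAs (AddCommGroup (Module.Dual K R))
instance : Module K (EnvDual K R) := inferInstanceAs (Module K (Module.Dual K R))

/-- The functional underlying an element of `EnvDual`. -/
def EnvDual.ap : EnvDual K R ≃ₗ[K] Module.Dual K R := LinearEquiv.refl K _

variable (K g R) in
/-- The contragredient action of `g`. -/
def dualHom : g →ₗ⁅K⁆ Module.End K (Module.Dual K R) where
  toFun x := -(Algebra.lsmul K K R (𝔦 x)).dualMap
  map_add' x y := by
    refine LinearMap.ext fun ψ => LinearMap.ext fun m => ?_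
    simp [-UniversalEnvelopingAlgebra.ι_apply, add_comm]
  map_smul' c x := by
    refine LinearMap.ext fun ψ => LinearMap.ext fun m => ?_
    simp [-UniversalEnvelopingAlgebra.ι_apply]
  map_lie' {x y} := by
    refine LinearMap.ext fun ψ => LinearMap.ext fun m => ?_
    rw [LieRing.of_associative_ring_bracket]
    have := iota_smul_comm (K := K) x y m
    simp only [LinearMap.neg_apply, LinearMap.dualMap_apply, LinearMap.sub_apply,
      Module.End.mul_apply, Algebra.lsmul_coe, neg_neg, map_neg]
    rw [this, map_add]
    abel

instance : Module (Env K g) (EnvDual K R) :=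
  Module.compHom (Module.Dual K R) (UniversalEnvelopingAlgebra.lift K (dualHom K g R)).toRingHom

lemma envDual_iota (x : g) (ψ : EnvDual K R) (m : R) :
    (EnvDual.ap (𝔦 x • ψ)) m = - (EnvDual.ap ψ) (𝔦 x • m) := by
  have : 𝔦 x • ψ = UniversalEnvelopingAlgebra.lift K (dualHom K g R) (𝔦 x) ψ := rfl
  rw [this, UniversalEnvelopingAlgebra.lift_ι_apply]
  rfl

instance : IsScalarTower K (Env K g) (EnvDual K R) :=
  IsScalarTower.of_algebraMap_smul fun c ψ => by
    have : algebraMap K (Env K g) c • ψ =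
      UniversalEnvelopingAlgebra.lift K (dualHom K g R) (algebraMap K (Env K g) c) ψ := rfl
    rw [this, AlgHom.commutes]; rfl

/-- Every right translate of a functional belongs to the submodule it generates. -/
lemma exists_envDual (X : Env K g) : ∃ Y : Env K g, ∀ (ψ : EnvDual K R) (m : R),
    (EnvDual.ap (Y • ψ)) m = (EnvDual.ap ψ) (X • m) := by
  refine Env.induction (p := fun X => ∃ Y : Env K g, ∀ (ψ : EnvDual K R) (m : R),
    (EnvDual.ap (Y • ψ)) m = (EnvDual.ap ψ) (X • m)) ?_ ?_ ?_ ?_ X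
  · intro c
    refine ⟨algebraMap K _ c, fun ψ m => ?_⟩
    rw [algebraMap_smul, algebraMap_smul, map_smul, map_smul]; rfl
  · intro x
    refine ⟨-𝔦 x, fun ψ m => ?_⟩
    rw [neg_smul]
    change -((EnvDual.ap (𝔦 x • ψ)) m) = _
    rw [envDual_iota, neg_neg]
  · rintro X X' ⟨Y, hY⟩ ⟨Y', hY'⟩
    refine ⟨Y + Y', fun ψ m => ?_⟩
    rw [add_smul, add_smul, map_add, map_add, ← hY, ← hY']; rfl
  · rintro X X' ⟨Y, hY⟩ ⟨Y', hY'⟩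
    refine ⟨Y' * Y, fun ψ m => ?_⟩
    rw [mul_smul, hY', hY, mul_smul]

end DualModule

end WeightModules

section DualLink

attribute [local instance] LieRing.ofAssociativeRing

local notation "𝔦" => UniversalEnvelopingAlgebra.ι K

variable {R : Type} [AddCommGroup R] [Module K R] [Module (Env K g) R]
  [IsScalarTower K (Env K g) R]

lemma envDual_apply_eq_zero {h : LieSubalgebra K g} {nu mu : Module.Dual K h}
    {ψ : EnvDual K R} (hψ : ψ ∈ hWt h (EnvDual K R) nu) {v : R} (hv : v ∈ hWt h R mu)
    (hne : nu ≠ -mu) : (EnvDual.ap ψ) v = 0 := by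
  obtain ⟨H, hH⟩ : ∃ H, nu H ≠ (-mu) H := by
    by_contra! hcon
    exact hne (LinearMap.ext hcon)
  have h1 := envDual_iota (K := K) (H : g) ψ v
  rw [hψ H, hv H, map_smul, map_smul] at h1
  change nu H * (EnvDual.ap ψ) v = -(mu H * (EnvDual.ap ψ) v) at h1
  have h2 : (nu H - (-mu) H) * (EnvDual.ap ψ) v = 0 := by
    rw [sub_mul, h1, LinearMap.neg_apply]; ring
  exact (mul_eq_zero.1 h2).resolve_left (sub_ne_zero.2 hH)

namespace ChevData

variable (D : ChevData K g)

lemma lwt_cons_ne_zero (i : D.I) (l : List D.I) : D.lwt (i :: l) ≠ 0 := by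
  intro h
  have := D.count_eq_of_lwt (l := i :: l) (l' := []) (by rw [h]; simp [lwt]) i
  simp at this

/-- A weight vector generated by a singular vector cannot have a weight that is higher by a
simple root. -/
lemma eq_zero_of_weight_add {mu : Module.Dual K D.h} {u v : R} (hu : D.Sing u mu) {i : D.I}
    (hv : v ∈ Submodule.span (Env K g) {u}) (hvm : v ∈ hWt D.h R (mu + D.a i)) : v = 0 := by
  by_contra hv0
  obtain ⟨l, hl⟩ := D.exists_word hu hv hvm hv0
  refine D.lwt_cons_ne_zero i l ?_
  rw [lwt_cons, ← sub_eq_zero.2 hl]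
  abel

/-- Singular vectors in quotients of a module with a cogenerating lowest weight functional are
linked for the opposite data. -/
theorem op_link_of_functional (hR : (⨆ mu, hWt D.h R mu) = ⊤)
    (hfin : ∀ mu, FiniteDimensional K (hWt D.h R mu)) (A : Submodule (Env K g) R)
    (φ : Module.Dual K R) {ka mu : Module.Dual K D.h}
    (hφ : ∀ nu, nu ≠ ka → ∀ v ∈ hWt D.h R nu, φ v = 0) (hφf : ∀ i v, φ (𝔦 (D.f i) • v) = 0)
    (hA : ∀ v, (∀ X : Env K g, φ (X • v) = 0) → v ∈ A) {u : R} (hu : u ∈ hWt D.h R mu)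
    (huA : u ∉ A) (heu : ∀ i, 𝔦 (D.e i) • u ∈ A) (htop : A ⊔ Submodule.span (Env K g) {u} = ⊤) :
    D.op.Link (-ka) (-mu) := by
  have hφs : D.op.Sing (EnvDual.ap.symm φ) (-ka) := by
    refine ⟨fun H => LinearMap.ext fun v => ?_, fun i => LinearMap.ext fun v => ?_⟩
    · refine (envDual_iota (H : g) _ v).trans ?_
      change -φ (𝔦 (H : g) • v) = (-ka) H * φ v
      change D.h at H
      have hv : v ∈ ⨆ mu, hWt D.h R mu := hR ▸ Submodule.mem_top
      induction hv using Submodule.iSup_induction' with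
      | mem nu v hv =>
        rw [hv H, map_smul, smul_eq_mul]
        by_cases hnu : nu = ka
        · subst hnu; rw [LinearMap.neg_apply]; ring
        · rw [hφ nu hnu v hv]; ring
      | zero => simp
      | add x y _ _ h1 h2 => rw [smul_add, map_add, map_add, neg_add, h1, h2, mul_add]
    · refine (envDual_iota (D.f i) _ v).trans ?_
      exact (congrArg Neg.neg (hφf i v)).trans neg_zero
  set P := Submodule.span (Env K g) {(EnvDual.ap.symm φ)} with hP
  obtain ⟨θ, hθu, hθA⟩ : ∃ θ : Module.Dual K (hWt D.h R mu), θ ⟨u, hu⟩ ≠ 0 ∧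
      ∀ v : hWt D.h R mu, (v : R) ∈ A → θ v = 0 := by
    obtain ⟨θ, h1, h2⟩ := Submodule.exists_le_ker_of_notMem
      (p := (A.restrictScalars K).comap (hWt D.h R mu).subtype) (v := ⟨u, hu⟩) huA
    exact ⟨θ, h1, fun v hv => h2 hv⟩
  obtain ⟨ψ₁, hψ₁P, hψ₁⟩ : ∃ ψ₁ ∈ P, ∀ v : hWt D.h R mu,
      (EnvDual.ap ψ₁) v = θ v := by
    set J : Submodule K (Module.Dual K (hWt D.h R mu)) :=
      (P.restrictScalars K).map (hWt D.h R mu).subtype.dualMap with hJ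
    have hθJ : θ ∈ J := by
      have := hfin mu
      rw [← Subspace.dualCoannihilator_dualAnnihilator_eq (W := J), Submodule.mem_dualAnnihilator]
      intro v hv
      refine hθA v (hA v fun X => ?_)
      obtain ⟨Y, hY⟩ := exists_envDual (R := R) X
      rw [Submodule.mem_dualCoannihilator] at hv
      have h1 := hv _ (Submodule.mem_map_of_mem (f := (hWt D.h R mu).subtype.dualMap)
        (show (Y • (EnvDual.ap.symm φ)) ∈ P.restrictScalars K from
          P.smul_mem Y (Submodule.mem_span_singleton_self _)))
      exact (hY φ v).symm.trans h1
    obtain ⟨ψ₁, h1, h2⟩ := hθJ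
    exact ⟨ψ₁, h1, fun v => LinearMap.congr_fun h2 v⟩
  have hψ₁s : ψ₁ ∈ ⨆ nu : Module.Dual K D.h, hWt D.h (EnvDual K R) nu := by
    have := D.op.mem_span_words hφs hψ₁P
    refine Submodule.span_le.2 ?_ this
    rintro _ ⟨l, rfl⟩
    exact Submodule.mem_iSup_of_mem (ι := Module.Dual K D.h) (p := hWt D.h (EnvDual K R)) _
      (D.op.word_mem hφs.1 l)
  obtain ⟨s, c, hc, hcs⟩ := exists_wt_sum hψ₁s
  have hcP := comp_mem P (fun nu _ => hc nu) (hcs ▸ hψ₁P)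
  have hcmu : ∀ v : hWt D.h R mu, -mu ∈ s ∧ (EnvDual.ap (c (-mu))) v = θ v ∨
      -mu ∉ s ∧ θ v = 0 := by
    intro v
    have h1 : θ v = ∑ nu ∈ s, (EnvDual.ap (c nu)) v := by
      rw [← hψ₁, ← hcs]
      rw [map_sum, LinearMap.sum_apply]
    by_cases hs : -mu ∈ s
    · refine Or.inl ⟨hs, ?_⟩
      rw [h1, Finset.sum_eq_single (-mu)]
      · intro nu _ hnu; exact envDual_apply_eq_zero (hc nu) v.2 hnu
      · intro h; exact absurd hs h
    · refine Or.inr ⟨hs, ?_⟩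
      rw [h1]
      refine Finset.sum_eq_zero fun nu hnu => envDual_apply_eq_zero (hc nu) v.2 ?_
      rintro rfl; exact hs hnu
  have hs : -mu ∈ s := (hcmu ⟨u, hu⟩).elim (fun h => h.1) fun h => absurd h.2 hθu
  have hψ : ∀ v : hWt D.h R mu, (EnvDual.ap (c (-mu))) v = θ v := fun v =>
    (hcmu v).elim (fun h => h.2) fun h => absurd hs h.1
  refine ⟨EnvDual K R, inferInstance, inferInstance, inferInstance, inferInstance, φ, c (-mu), hφs,
    ⟨hc _, fun i => LinearMap.ext fun v => ?_⟩, fun h0 => ?_, hcP _ hs⟩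
  · refine (envDual_iota (D.f i) _ v).trans ?_
    change -(EnvDual.ap (c (-mu))) (𝔦 (D.f i) • v) = 0
    rw [neg_eq_zero]
    have hv : v ∈ ⨆ mu, hWt D.h R mu := hR ▸ Submodule.mem_top
    induction hv using Submodule.iSup_induction' with
    | zero => rw [smul_zero, map_zero]
    | add x y _ _ h1 h2 => rw [smul_add, map_add, h1, h2, add_zero]
    | mem nu v hv =>
      have hfv := D.f_smul_mem hv i
      by_cases hnu : nu - D.a i = mu
      · subst hnu
        refine (hψ ⟨_, hfv⟩).trans (hθA _ (A.smul_mem _ ?_))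
        rw [← Submodule.Quotient.mk_eq_zero]
        have hus : D.Sing (A.mkQ u) (nu - D.a i) := by
          refine ⟨hWt_map A.mkQ hu, fun j => ?_⟩
          rw [← map_smul, Submodule.mkQ_apply, Submodule.Quotient.mk_eq_zero]
          exact heu j
        refine D.eq_zero_of_weight_add hus (i := i) (v := A.mkQ v) ?_ ?_
        · obtain ⟨x, hx, y, hy, rfl⟩ := Submodule.mem_sup.1 (htop ▸ Submodule.mem_top (x := v))
          rw [map_add, Submodule.mkQ_apply, Submodule.mkQ_apply, (Submodule.Quotient.mk_eq_zero A).2 hx, zero_add]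
          obtain ⟨X, rfl⟩ := Submodule.mem_span_singleton.1 hy
          rw [map_smul A.mkQ]
          exact Submodule.smul_mem _ _ (Submodule.mem_span_singleton_self _)
        · have := hWt_map A.mkQ hv
          rwa [sub_add_cancel]
      · refine envDual_apply_eq_zero (hc _) hfv fun h => hnu (neg_injective h).symm
  · refine hθu ?_
    rw [← hψ]
    exact by rw [h0, map_zero, LinearMap.zero_apply]

end ChevData
end DualLink

section Blocks

attribute [local instance] LieRing.ofAssociativeRing

local notation "𝔦" => UniversalEnvelopingAlgebra.ι K

variable {R : Type} [AddCommGroup R] [Module K R] [Module (Env K g) R]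
  [IsScalarTower K (Env K g) R]

/-- The largest submodule in the kernel of a functional. -/
def perp (φ : Module.Dual K R) : Submodule (Env K g) R where
  carrier := {v | ∀ X : Env K g, φ (X • v) = 0}
  add_mem' := by
    intro a b ha hb X
    rw [smul_add, map_add, ha X, hb X, add_zero]
  zero_mem' := by
    intro X
    rw [smul_zero, map_zero]
  smul_mem' := by
    intro Y x hx X
    rw [← mul_smul]; exact hx _

namespace ChevData

variable (D : ChevData K g)

/-- Two weights are in the same block if they are conjugate under the dot action of the group
generated by the simple reflections and differ by an element of the root lattice. -/
def Blk (lam mu : Module.Dual K D.h) : Prop :=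
  D.Orb lam mu ∧ mu - lam ∈ Submodule.span ℤ (Set.range D.a)

variable {D} in
lemma Blk.symm {lam mu : Module.Dual K D.h} (h : D.Blk lam mu) : D.Blk mu lam :=
  ⟨h.1.symm D, by rw [← neg_sub]; exact Submodule.neg_mem _ h.2⟩

variable {D} in
lemma Blk.trans {lam mu nu : Module.Dual K D.h} (h : D.Blk lam mu) (h' : D.Blk mu nu) :
    D.Blk lam nu :=
  ⟨h.1.trans D h'.1, by rw [← sub_add_sub_cancel']; exact Submodule.add_mem _ h.2 h'.2⟩

lemma Blk.refl (lam : Module.Dual K D.h) : D.Blk lam lam :=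
  ⟨Relation.ReflTransGen.refl, by rw [sub_self]; exact Submodule.zero_mem _⟩

lemma lwt_mem_span (l : List D.I) : D.lwt l ∈ Submodule.span ℤ (Set.range D.a) := by
  induction l with
  | nil => exact Submodule.zero_mem _
  | cons i l ih =>
    rw [lwt_cons]
    exact Submodule.add_mem _ (Submodule.subset_span ⟨i, rfl⟩) ih

variable {D} in
lemma Link.blk {lam mu : Module.Dual K D.h} (h : D.Link lam mu) : D.Blk lam mu := by
  refine ⟨h.orb D, ?_⟩
  obtain ⟨R, _, _, _, _, w, u, hw, hu, h0, hmem⟩ := h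
  obtain ⟨l, rfl⟩ := D.exists_word hw hmem hu.1 h0
  rw [sub_sub_cancel_left]
  exact Submodule.neg_mem _ (D.lwt_mem_span l)

lemma neg_op_sdot (i : D.I) (x : Module.Dual K D.h) :
    -(D.op.sdot i x : Module.Dual K D.h) = D.sdot i (-x) := by
  change -(x - (x (-D.hc i) + 1) • -D.a i) = (-x) - ((-x) (D.hc i) + 1) • D.a i
  rw [map_neg, LinearMap.neg_apply]
  module

lemma orb_of_op {lam mu : Module.Dual K D.h} (h : D.op.Orb lam mu) : D.Orb (-lam) (-mu) := by
  induction h with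
  | refl => exact Relation.ReflTransGen.refl
  | tail _ hbc ih =>
    obtain ⟨i, rfl⟩ := hbc
    exact Relation.ReflTransGen.tail ih ⟨i, D.neg_op_sdot i _⟩

lemma blk_of_op_link {lam mu : Module.Dual K D.h} (h : D.op.Link (-lam) (-mu)) :
    D.Blk lam mu := by
  have h1 := h.blk
  have h2 := D.orb_of_op h1.1
  rw [neg_neg, neg_neg] at h2
  refine ⟨h2, ?_⟩
  have h3 : Submodule.span ℤ (Set.range fun i => -D.a i) ≤
      Submodule.span ℤ (Set.range D.a) := by
    rw [Submodule.span_le]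
    rintro _ ⟨i, rfl⟩
    exact Submodule.neg_mem _ (Submodule.subset_span ⟨i, rfl⟩)
  have h6 : (-mu - -lam : Module.Dual K D.h) ∈
      Submodule.span ℤ (Set.range fun i => -D.a i) := h1.2
  have h4 := Submodule.neg_mem _ (h3 h6)
  have h5 : -(-mu - -lam) = mu - lam := by abel
  rwa [h5] at h4

variable (R) in
/-- The conditions defining the extended category `O`, in terms of the generators. -/
structure Adm : Prop where
  span : (⨆ mu, hWt D.h R mu) = ⊤
  finite : ∀ mu, FiniteDimensional K (hWt D.h R mu)
  locFin : ∀ v : R, ∃ N : Submodule K R, FiniteDimensional K N ∧ v ∈ N ∧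
    ∀ i, ∀ m ∈ N, 𝔦 (D.e i) • m ∈ N

/-- The product of the raising operators in a word. -/
def ePr (l : List D.I) : Env K g := (l.map fun i => 𝔦 (D.e i)).prod

/-- The product of the lowering operators in a word. -/
def fPr (l : List D.I) : Env K g := (l.map fun i => 𝔦 (D.f i)).prod

lemma ePr_cons_smul (i : D.I) (l : List D.I) (v : R) :
    D.ePr (i :: l) • v = 𝔦 (D.e i) • D.ePr l • v := by
  rw [ePr, List.map_cons, List.prod_cons, mul_smul]; rfl

lemma fPr_cons_smul (i : D.I) (l : List D.I) (v : R) :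
    D.fPr (i :: l) • v = 𝔦 (D.f i) • D.fPr l • v := by
  rw [fPr, List.map_cons, List.prod_cons, mul_smul]; rfl

lemma ePr_nil_smul (v : R) : D.ePr [] • v = v := one_smul _ v

lemma fPr_nil_smul (v : R) : D.fPr [] • v = v := one_smul _ v

lemma ePr_smul_mem {ka : Module.Dual K D.h} {v : R} (hv : v ∈ hWt D.h R ka) (l : List D.I) :
    D.ePr l • v ∈ hWt D.h R (ka + D.lwt l) := by
  induction l with
  | nil => rw [ePr_nil_smul]; simpa [lwt] using hv
  | cons i l ih =>
    rw [ePr_cons_smul, lwt_cons, add_comm (D.a i), ← add_assoc]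
    exact D.e_smul_mem ih i

lemma fPr_smul_mem {ka : Module.Dual K D.h} {v : R} (hv : v ∈ hWt D.h R ka) (l : List D.I) :
    D.fPr l • v ∈ hWt D.h R (ka - D.lwt l) := by
  induction l with
  | nil => rw [fPr_nil_smul]; simpa [lwt] using hv
  | cons i l ih =>
    rw [fPr_cons_smul, lwt_cons, add_comm (D.a i), ← sub_sub]
    exact D.f_smul_mem ih i

lemma exists_height : ∃ p : Module.Dual K D.h →ₗ[K] K, ∀ l, p (D.lwt l) = l.length := by
  obtain ⟨p, hp⟩ := LinearMap.exists_extend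
    ((Finsupp.linearCombination K fun _ : D.I => (1 : K)).comp
      (D.indep.repr : Submodule.span K (Set.range D.a) →ₗ[K] D.I →₀ K))
  have hpa : ∀ i, p (D.a i) = 1 := by
    intro i
    have := LinearMap.congr_fun hp ⟨D.a i, Submodule.subset_span ⟨i, rfl⟩⟩
    rw [LinearMap.comp_apply, Submodule.subtype_apply] at this
    rw [this, LinearMap.comp_apply, D.indep.repr_eq_single i _ rfl]
    simp
  refine ⟨p, fun l => ?_⟩
  induction l with
  | nil => simp [lwt]
  | cons i l ih => rw [lwt_cons, map_add, hpa, ih, List.length_cons]; push_cast; ring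

lemma span_singleton_le {ka : Module.Dual K D.h} {a : R} (ha : a ∈ hWt D.h R ka) {u : R}
    (hu : u ∈ Submodule.span (Env K g) {a}) : u ∈ Submodule.span K
      (Set.range fun l : List D.I × List D.I => D.fPr l.1 • D.ePr l.2 • a) := by
  obtain ⟨X, rfl⟩ := Submodule.mem_span_singleton.1 hu
  set N := Submodule.span K
      (Set.range fun l : List D.I × List D.I => D.fPr l.1 • D.ePr l.2 • a) with hN
  have aux : ∀ Y : Env K g, (∀ l l' : List D.I, Y • D.fPr l • D.ePr l' • a ∈ N) →
      ∀ v ∈ N, Y • v ∈ N := by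
    intro Y hY v hv
    have : N ≤ N.comap (Algebra.lsmul K K R Y) := by
      rw [hN, Submodule.span_le]
      rintro _ ⟨l, rfl⟩
      exact hY l.1 l.2
    exact this hv
  have haN : a ∈ N := Submodule.subset_span ⟨([], []), by
    change D.fPr [] • D.ePr [] • a = a
    rw [fPr_nil_smul, ePr_nil_smul]⟩
  have hf : ∀ i, ∀ v ∈ N, 𝔦 (D.f i) • v ∈ N := fun i => aux _ fun l l' => by
    rw [← fPr_cons_smul]
    exact Submodule.subset_span ⟨(i :: l, l'), rfl⟩
  refine env_smul_mem (D.iota_smul_mem (fun H => aux _ fun l l' => ?_)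
    (fun j => aux _ fun l l' => ?_) hf) X haN
  · rw [D.fPr_smul_mem (D.ePr_smul_mem ha l') l H]
    exact Submodule.smul_mem _ _ (Submodule.subset_span ⟨(l, l'), rfl⟩)
  · induction l with
    | nil =>
      rw [fPr_nil_smul, ← ePr_cons_smul, ← fPr_nil_smul D (D.ePr (j :: l') • a)]
      exact Submodule.subset_span ⟨([], j :: l'), rfl⟩
    | cons i l ih =>
      rw [fPr_cons_smul, iota_smul_comm]
      refine Submodule.add_mem _ (hf i _ ih) ?_
      by_cases hij : j = i
      · subst hij
        rw [D.ef, D.fPr_smul_mem (D.ePr_smul_mem ha l') l (D.hc j)]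
        exact Submodule.smul_mem _ _ (Submodule.subset_span ⟨(l, l'), rfl⟩)
      · rw [D.ef_ne j i hij]; simp

variable {D}

lemma Adm.finite_raise (hA : D.Adm R) (ka : Module.Dual K D.h) :
    {nu | ∃ l, D.lwt l = nu ∧ ∃ v ∈ hWt D.h R ka, D.ePr l • v ≠ 0}.Finite := by
  have key : ∀ v ∈ hWt D.h R ka, {nu | ∃ l, D.lwt l = nu ∧ D.ePr l • v ≠ 0}.Finite := by
    intro v hv
    obtain ⟨N, hNf, hvN, hN⟩ := hA.locFin v
    set S := {nu | ∃ l, D.lwt l = nu ∧ D.ePr l • v ≠ 0} with hS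
    choose l hl using fun nu : S => nu.2
    have hlN : ∀ l : List D.I, D.ePr l • v ∈ N := by
      intro l
      induction l with
      | nil => rwa [ePr_nil_smul]
      | cons i l ih => rw [ePr_cons_smul]; exact hN i _ ih
    have hind : LinearIndependent K fun nu : S => (⟨D.ePr (l nu) • v, hlN _⟩ : N) := by
      classical
      rw [linearIndependent_iff']
      intro s c hc nu hnu
      have h1 := congrArg N.subtype hc
      rw [map_sum, map_zero] at h1
      have h2 := hWt_sum_eq_zero (R := R) (s.image fun nu : S => ka + nu.1)
        (fun mu => if h : mu - ka ∈ S then c ⟨_, h⟩ • D.ePr (l ⟨_, h⟩) • v else 0) ?_ ?_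
        (ka + nu) (Finset.mem_image_of_mem _ hnu)
      · have h3 : ka + nu.1 - ka = nu.1 := by abel
        simp only [h3, Subtype.coe_eta, Subtype.coe_prop, dite_true] at h2
        exact (smul_eq_zero.1 h2).resolve_right (hl nu).2
      · intro mu hmu
        obtain ⟨nu, -, rfl⟩ := Finset.mem_image.1 hmu
        have h3 : ka + nu.1 - ka = nu.1 := by abel
        simp only [h3, Subtype.coe_eta, Subtype.coe_prop, dite_true]
        have := D.ePr_smul_mem hv (l nu)
        rw [(hl nu).1] at this
        exact Submodule.smul_mem _ _ this
      · rw [Finset.sum_image (fun x _ y _ hxy => Subtype.ext (add_left_cancel hxy))]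
        refine Eq.trans (Finset.sum_congr rfl fun nu _ => ?_) h1
        have h3 : ka + nu.1 - ka = nu.1 := by abel
        simp only [h3, Subtype.coe_eta, Subtype.coe_prop, dite_true]
        rfl
    have := hind.finite
    exact Set.toFinite S
  have := hA.finite ka
  let b := Module.finBasis K (hWt D.h R ka)
  refine (Set.finite_iUnion fun j => key _ (b j).2).subset ?_
  rintro nu ⟨l, hl, v, hv, h0⟩
  by_contra hcon
  simp only [Set.mem_iUnion, Set.mem_ofPred_eq, not_exists, not_and, not_not] at hcon
  refine h0 ?_
  have h1 : (Algebra.lsmul K K R (D.ePr l)).comp (hWt D.h R ka).subtype = 0 :=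
    b.ext fun j => hcon j l hl
  exact LinearMap.congr_fun h1 ⟨v, hv⟩

lemma Adm.exists_max (hA : D.Adm R) {ka : Module.Dual K D.h} {a : R} (ha : a ∈ hWt D.h R ka)
    {A : Submodule (Env K g) R} (haA : a ∉ A) :
    ∃ l, D.ePr l • a ∉ A ∧ ∀ l', l.length < l'.length → D.ePr l' • a ∈ A := by
  obtain ⟨p, hp⟩ := D.exists_height
  have hfin : {n : ℕ | ∃ l, l.length = n ∧ D.ePr l • a ∉ A}.Finite := by
    refine (((hA.finite_raise ka).image p).preimage
      (Nat.cast_injective (R := K)).injOn).subset ?_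
    rintro n ⟨l, rfl, hl⟩
    refine ⟨D.lwt l, ⟨l, rfl, a, ha, fun h => hl (h ▸ A.zero_mem)⟩, hp l⟩
  obtain ⟨n, ⟨l, rfl, hl⟩, hmax⟩ := hfin.exists_maximal ⟨0, [], rfl, by rwa [ePr_nil_smul]⟩
  refine ⟨l, hl, fun l' hl' => ?_⟩
  by_contra hcon
  exact absurd (hmax ⟨l', rfl, hcon⟩ hl'.le) (not_le.2 hl')

/-- A submodule not containing `N` admits a primitive vector in `N`. -/
lemma Adm.exists_prim (hA : D.Adm R) {N A : Submodule (Env K g) R} (hNA : ¬N ≤ A) :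
    ∃ mu, ∃ u ∈ N, u ∈ hWt D.h R mu ∧ u ∉ A ∧ ∀ i, 𝔦 (D.e i) • u ∈ A := by
  obtain ⟨x, hx, hxA⟩ := SetLike.not_le_iff_exists.1 hNA
  obtain ⟨s, v, hv, rfl⟩ := exists_wt_sum (h := D.h) (x := x) (hA.span ▸ Submodule.mem_top)
  have hN := comp_mem N (fun mu _ => hv mu) hx
  obtain ⟨ka, hka, hvA⟩ : ∃ ka ∈ s, v ka ∉ A := by
    by_contra! hcon
    exact hxA (Submodule.sum_mem _ hcon)
  obtain ⟨l, hl, hmax⟩ := hA.exists_max (hv ka) hvA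
  refine ⟨_, _, N.smul_mem (D.ePr l) (hN ka hka), D.ePr_smul_mem (hv ka) l, hl, fun i => ?_⟩
  rw [← ePr_cons_smul]
  exact hmax _ (by simp)

variable (D)

/-- All primitive weights of `N` relative to `L` lie in `c`. -/
def IsPure (c : Set (Module.Dual K D.h)) (L N : Submodule (Env K g) R) : Prop :=
  ∀ A : Submodule (Env K g) R, L ≤ A → ∀ mu, ∀ u ∈ N, u ∈ hWt D.h R mu → u ∉ A →
    (∀ i, 𝔦 (D.e i) • u ∈ A) → mu ∈ c

variable {D} {c : Set (Module.Dual K D.h)}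

lemma IsPure.sup (hR : (⨆ mu, hWt D.h R mu) = ⊤) {L N₁ N₂ : Submodule (Env K g) R}
    (h₁ : D.IsPure c L N₁) (h₂ : D.IsPure c N₁ N₂) : D.IsPure c L (N₁ ⊔ N₂) := by
  intro A hA mu u hu hmu huA heu
  obtain ⟨n₁, hn₁, n₂, hn₂, hw₁, hw₂, rfl⟩ := exists_add_of_mem_sup hR hmu hu
  by_cases hcase : n₂ ∈ A ⊔ N₁
  · have hu' : n₁ + n₂ ∈ A ⊔ N₁ := Submodule.add_mem _ (Submodule.mem_sup_right hn₁) hcase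
    obtain ⟨a, ha, n, hn, hwa, hwn, han⟩ := exists_add_of_mem_sup hR hmu hu'
    refine h₁ A hA mu n hn hwn (fun h => huA (han ▸ A.add_mem ha h)) fun i => ?_
    have : n = n₁ + n₂ - a := by rw [← han]; abel
    rw [this, smul_sub]
    exact A.sub_mem (heu i) (A.smul_mem _ ha)
  · refine h₂ (A ⊔ N₁) le_sup_right mu n₂ hn₂ hw₂ hcase fun i => ?_
    have : n₂ = n₁ + n₂ - n₁ := by abel
    rw [this, smul_sub]
    exact Submodule.sub_mem _ (Submodule.mem_sup_left (heu i))
      (Submodule.mem_sup_right (N₁.smul_mem _ hn₁))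

lemma IsPure.mono {L L' N : Submodule (Env K g) R} (h : D.IsPure c L N) (hL : L ≤ L') :
    D.IsPure c L' N := fun A hA => h A (hL.trans hA)

lemma IsPure.inf {L N : Submodule (Env K g) R} (h : D.IsPure c L N) :
    D.IsPure c (L ⊓ N) N := by
  intro A hA mu u hu hmu huA heu
  refine h ((A ⊓ N) ⊔ L) le_sup_right mu u hu hmu (fun hcon => huA ?_) fun i =>
    Submodule.mem_sup_left ⟨heu i, N.smul_mem _ hu⟩
  obtain ⟨x, hx, y, hy, rfl⟩ := Submodule.mem_sup.1 hcon
  have : y ∈ N := by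
    have := N.sub_mem hu hx.2
    rwa [add_sub_cancel_left] at this
  exact A.add_mem hx.1 (hA ⟨hy, this⟩)

lemma isPure_span_singleton (hc : ∀ x y, D.Blk x y → x ∈ c → y ∈ c)
    {L : Submodule (Env K g) R} {ka : Module.Dual K D.h} (hka : ka ∈ c) {a : R}
    (ha : a ∈ hWt D.h R ka) (hea : ∀ i, 𝔦 (D.e i) • a ∈ L) :
    D.IsPure c L (Submodule.span (Env K g) {a}) := by
  intro A hA mu u hu hmu huA heu
  refine hc ka mu (Link.blk ⟨R ⧸ A, inferInstance, inferInstance, inferInstance, inferInstance,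
    A.mkQ a, A.mkQ u, ⟨hWt_map _ ha, fun i => ?_⟩, ⟨hWt_map _ hmu, fun i => ?_⟩, ?_, ?_⟩) hka
  · rw [← map_smul, Submodule.mkQ_apply, Submodule.Quotient.mk_eq_zero]
    exact hA (hea i)
  · rw [← map_smul, Submodule.mkQ_apply, Submodule.Quotient.mk_eq_zero]
    exact heu i
  · rwa [Submodule.mkQ_apply, Ne, Submodule.Quotient.mk_eq_zero]
  · obtain ⟨X, rfl⟩ := Submodule.mem_span_singleton.1 hu
    rw [map_smul A.mkQ]
    exact Submodule.smul_mem _ _ (Submodule.mem_span_singleton_self _)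

lemma isPure_perp (hc : ∀ x y, D.Blk x y → x ∈ c → y ∈ c) (hR : (⨆ mu, hWt D.h R mu) = ⊤)
    (hfin : ∀ mu, FiniteDimensional K (hWt D.h R mu)) {Y : Submodule (Env K g) R}
    {φ : Module.Dual K R} {ka : Module.Dual K D.h} (hka : ka ∈ c)
    (hφ : ∀ nu, nu ≠ ka → ∀ v ∈ hWt D.h R nu, φ v = 0)
    (hφf : ∀ i, ∀ v ∈ Y, φ (𝔦 (D.f i) • v) = 0) :
    D.IsPure c (perp φ) Y := by
  intro A hA mu u hu hmu huA heu
  refine hc ka mu (D.blk_of_op_link ?_) hka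
  set B := (A ⊓ Y) ⊔ Submodule.span (Env K g) {u} with hB
  have huB : u ∈ B := Submodule.mem_sup_right (Submodule.mem_span_singleton_self u)
  have hBY : B ≤ Y := sup_le inf_le_right ((Submodule.span_singleton_le_iff_mem _ _).2 hu)
  refine D.op_link_of_functional (R := B) (iSup_hWt_coe hR B)
    (fun nu => by have := hfin nu; exact finite_hWt_coe B) (A.comap B.subtype)
    (φ.comp (B.restrictScalars K).subtype) (fun nu hnu v hv => hφ nu hnu v (mem_hWt_coe.1 hv))
    (fun i v => hφf i v (hBY v.2)) (fun v hv => hA hv) (u := ⟨u, huB⟩) (mem_hWt_coe.2 hmu) huA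
    heu ?_
  rw [eq_top_iff]
  rintro ⟨b, hb⟩ -
  obtain ⟨x, hx, y, hy, rfl⟩ := Submodule.mem_sup.1 hb
  obtain ⟨X, rfl⟩ := Submodule.mem_span_singleton.1 hy
  refine Submodule.mem_sup.2 ⟨⟨x, Submodule.mem_sup_left hx⟩, hx.1, X • ⟨u, huB⟩,
    Submodule.smul_mem _ _ (Submodule.mem_span_singleton_self _), rfl⟩

lemma Adm.le_of_isPure (hA : D.Adm R) {A N : Submodule (Env K g) R}
    (h : D.IsPure c A N) (h' : D.IsPure cᶜ A N) : N ≤ A := by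
  by_contra hcon
  obtain ⟨mu, u, huN, hu, huA, heu⟩ := hA.exists_prim hcon
  exact h' A le_rfl mu u huN hu huA heu (h A le_rfl mu u huN hu huA heu)

end ChevData
end Blocks

section Decomposition

attribute [local instance] LieRing.ofAssociativeRing

local notation "𝔦" => UniversalEnvelopingAlgebra.ι K

variable {R : Type} [AddCommGroup R] [Module K R] [Module (Env K g) R]
  [IsScalarTower K (Env K g) R]

namespace ChevData

variable (D : ChevData K g)

variable (R) in
/-- The largest submodule with all primitive weights in `c`. -/
def core (c : Set (Module.Dual K D.h)) : Submodule (Env K g) R :=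
  sSup {N | D.IsPure c ⊥ N}

variable {D} {c : Set (Module.Dual K D.h)}

lemma le_core {N : Submodule (Env K g) R} (h : D.IsPure c ⊥ N) : N ≤ D.core R c :=
  le_sSup h

lemma isPure_core (hR : (⨆ mu, hWt D.h R mu) = ⊤) : D.IsPure c ⊥ (D.core R c) := by
  intro A hA mu u hu hmu huA heu
  have hdir : DirectedOn (· ≤ ·) {N : Submodule (Env K g) R | D.IsPure c ⊥ N} := by
    intro N hN N' hN'
    exact ⟨N ⊔ N', IsPure.sup hR hN (IsPure.mono hN' bot_le), le_sup_left, le_sup_right⟩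
  have hne : {N : Submodule (Env K g) R | D.IsPure c ⊥ N}.Nonempty := by
    refine ⟨⊥, ?_⟩
    intro B _ nu v hv _ hvB
    rw [(Submodule.mem_bot _).1 hv] at hvB
    exact absurd B.zero_mem hvB
  obtain ⟨N, hN, huN⟩ := (Submodule.mem_sSup_of_directed hne hdir).1 hu
  exact hN A hA mu u huN hmu huA heu

lemma core_no_prim (hA : D.Adm R) (hc : ∀ x y, D.Blk x y → x ∈ c → y ∈ c)
    {ka : Module.Dual K D.h} (hka : ka ∈ c) {a : R} (ha : a ∈ hWt D.h R ka)
    (haT : a ∉ D.core R c ⊔ D.core R cᶜ)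
    (hea : ∀ i, 𝔦 (D.e i) • a ∈ D.core R c ⊔ D.core R cᶜ) : False := by
  classical
  have hc' : ∀ x y, D.Blk x y → x ∈ cᶜ → y ∈ cᶜ := fun x y hxy hx hy => hx (hc y x hxy.symm hy)
  have hfd := hA.finite
  set Xi := (hA.finite_raise ka).toFinset.image (ka + ·) with hXi
  let m : R → ℕ := fun a => ∑ xi ∈ Xi, Module.finrank K
    ((Submodule.span (Env K g) {a}).restrictScalars K ⊓ hWt D.h R xi : Submodule K R)
  obtain ⟨n, hn⟩ : ∃ n, m a = n := ⟨_, rfl⟩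
  induction n using Nat.strong_induction_on generalizing a with
  | _ n ih =>
  have hac : a ∉ D.core R c := fun h => haT (Submodule.mem_sup_left h)
  obtain ⟨l₀, hl₀, hmax⟩ := hA.exists_max ha hac
  set w := D.ePr l₀ • a with hw
  have hww : w ∈ hWt D.h R (ka + D.lwt l₀) := D.ePr_smul_mem ha l₀
  have hXi₀ : ka + D.lwt l₀ ∈ Xi := by
    refine Finset.mem_image_of_mem _ ((hA.finite_raise ka).mem_toFinset.2 ⟨l₀, rfl, a, ha, ?_⟩)
    exact fun h => hl₀ (by rw [hw, h]; exact Submodule.zero_mem _)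
  have hk₀ : ka + D.lwt l₀ ∈ cᶜ := by
    intro hcon
    refine hl₀ (le_core (IsPure.sup hA.span (isPure_core hA.span)
      (isPure_span_singleton hc hcon hww fun i => ?_))
      (Submodule.mem_sup_right (Submodule.mem_span_singleton_self w)))
    rw [hw, ← ePr_cons_smul]
    exact hmax _ (by simp)
  set Y := Submodule.span (Env K g) {a} with hY
  have haY : a ∈ Y := Submodule.mem_span_singleton_self a
  have hYw : ∀ i, ∀ v ∈ Y, v ∈ hWt D.h R (ka + D.lwt l₀ + D.a i) → v ∈ D.core R c := by
    intro i v hv hvw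
    obtain ⟨p, hp⟩ := D.exists_height
    have h1 := mem_span_of_weight _ (fun l : List D.I × List D.I => ka + D.lwt l.2 - D.lwt l.1)
      (fun l => D.fPr_smul_mem (D.ePr_smul_mem ha l.2) l.1) hvw (D.span_singleton_le ha hv)
    refine (Submodule.span_le (p := (D.core R c).restrictScalars K)).2 ?_ h1
    rintro _ ⟨l, hl, rfl⟩
    refine (D.core R c).smul_mem _ (hmax _ ?_)
    have h2 : D.lwt l.2 = D.lwt (i :: l₀) + D.lwt l.1 := by
      rw [lwt_cons]
      have h3 : ka + D.lwt l.2 - D.lwt l.1 = ka + D.lwt l₀ + D.a i := hl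
      rw [sub_eq_iff_eq_add, add_assoc, add_assoc] at h3
      rw [add_left_cancel h3]
      abel
    have h4 := congrArg p h2
    rw [map_add, hp, hp, hp] at h4
    have h5 : l.2.length = (i :: l₀).length + l.1.length := by exact_mod_cast h4
    rw [List.length_cons] at h5
    omega
  obtain ⟨φ, hφw, hφ⟩ := Submodule.exists_le_ker_of_notMem (p := (D.core R c).restrictScalars K ⊔
      ⨆ nu : {nu // nu ≠ ka + D.lwt l₀}, hWt D.h R nu.1) (v := w) (by
    intro hcon
    obtain ⟨t, ht, s, hs, hts⟩ := Submodule.mem_sup.1 hcon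
    obtain ⟨f, hf, hfs⟩ := (Submodule.mem_iSup_iff_exists_finsupp _ _).1 hs
    let v : Module.Dual K D.h → R := fun nu =>
      if h : nu ≠ ka + D.lwt l₀ then -f ⟨nu, h⟩ else w
    have hv : ∀ nu, v nu ∈ hWt D.h R nu := by
      intro nu
      by_cases h : nu = ka + D.lwt l₀
      · subst h; simpa [v] using hww
      · simp only [v, ne_eq, h, not_false_eq_true, dite_true]
        exact Submodule.neg_mem _ (hf ⟨nu, h⟩)
    have h1 := comp_mem (D.core R c) (s := insert (ka + D.lwt l₀) (f.support.map
      (Function.Embedding.subtype _))) (v := v) (fun nu _ => hv nu) (by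
        rw [Finset.sum_insert (by simp), Finset.sum_map]
        have h2 : ∀ x ∈ f.support, v (Function.Embedding.subtype _ x) = -f x := by
          intro x _
          simp [v, x.2]
        rw [Finset.sum_congr rfl h2, Finset.sum_neg_distrib]
        have h3 : ∑ x ∈ f.support, f x = s := hfs
        rw [h3]
        have h4 : v (ka + D.lwt l₀) + -s = t := by
          simp only [v, ne_eq, not_true, dite_false]
          rw [← hts]; abel
        rw [h4]; exact ht) _ (Finset.mem_insert_self _ _)
    simp only [v, ne_eq, not_true, dite_false] at h1
    exact hl₀ h1)
  have hφc : ∀ v ∈ D.core R c, φ v = 0 := fun v hv => hφ (Submodule.mem_sup_left hv)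
  have hφn : ∀ nu, nu ≠ ka + D.lwt l₀ → ∀ v ∈ hWt D.h R nu, φ v = 0 := fun nu hnu v hv =>
    hφ (Submodule.mem_sup_right (Submodule.mem_iSup_of_mem
      (p := fun nu : {nu // nu ≠ ka + D.lwt l₀} => hWt D.h R nu.1) ⟨nu, hnu⟩ hv))
  have hφf : ∀ i, ∀ v ∈ Y, φ (𝔦 (D.f i) • v) = 0 := by
    intro i v hv
    obtain ⟨s, u, hu, rfl⟩ := exists_wt_sum (h := D.h) (x := v) (hA.span ▸ Submodule.mem_top)
    have huY := comp_mem Y (fun mu _ => hu mu) hv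
    rw [Finset.smul_sum, map_sum]
    refine Finset.sum_eq_zero fun nu hnu => ?_
    by_cases h : nu = ka + D.lwt l₀ + D.a i
    · exact hφc _ ((D.core R c).smul_mem _ (hYw i _ (huY nu hnu) (h ▸ hu nu)))
    · refine hφn (nu - D.a i) (fun h' => h ?_) _ (D.f_smul_mem (hu nu) i)
      rw [← h', sub_add_cancel]
  have hp1 := (isPure_perp hc' hA.span hA.finite hk₀ hφn hφf).inf
  have hp2 := (isPure_span_singleton hc hka ha hea).inf
  have hYA := hA.le_of_isPure (hp2.mono (le_sup_right (a := perp φ ⊓ Y)))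
    (hp1.mono le_sup_left)
  obtain ⟨x, hx, t, ht, hxw, htw, hxt⟩ := exists_add_of_mem_sup hA.span ha (hYA haY)
  have hxa : x = a - t := by rw [← hxt]; abel
  refine ih (m x) ?_ hxw (fun h => haT (hxt ▸ Submodule.add_mem _ h ht.1)) (fun i => ?_) rfl
  · have hle : Submodule.span (Env K g) {x} ≤ Y :=
      (Submodule.span_singleton_le_iff_mem _ _).2 hx.2
    have hle' : Submodule.span (Env K g) {x} ≤ perp φ :=
      (Submodule.span_singleton_le_iff_mem _ _).2 hx.1
    rw [← hn]
    refine Finset.sum_lt_sum (fun xi _ => ?_) ⟨_, hXi₀, ?_⟩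
    · have := hfd xi
      exact Submodule.finrank_mono (inf_le_inf_right _ hle)
    · have := hfd (ka + D.lwt l₀)
      refine Submodule.finrank_lt_finrank_of_lt (lt_of_le_of_ne (inf_le_inf_right _ hle) ?_)
      intro heq
      have h1 : w ∈ (Y.restrictScalars K ⊓ hWt D.h R (ka + D.lwt l₀) : Submodule K R) :=
        ⟨Y.smul_mem _ haY, hww⟩
      rw [← heq] at h1
      have h2 := hle' h1.1 1
      rw [one_smul] at h2
      exact hφw h2
  · rw [hxa, smul_sub]
    exact Submodule.sub_mem _ (hea i) (Submodule.smul_mem _ _ ht.1)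

lemma core_sup_compl (hA : D.Adm R) (hc : ∀ x y, D.Blk x y → x ∈ c → y ∈ c) :
    D.core R c ⊔ D.core R cᶜ = ⊤ := by
  by_contra hne
  obtain ⟨ka, y, -, hy, hyT, hey⟩ := hA.exists_prim (N := ⊤) (fun h => hne (top_le_iff.1 h))
  by_cases hk : ka ∈ c
  · exact core_no_prim hA hc hk hy hyT hey
  · have hc' : ∀ x y, D.Blk x y → x ∈ cᶜ → y ∈ cᶜ :=
      fun x y hxy hx hy => hx (hc y x hxy.symm hy)
    refine core_no_prim hA hc' hk hy ?_ fun i => ?_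
    · rwa [compl_compl, sup_comm]
    · rw [compl_compl, sup_comm]; exact hey i

variable (R D) in
/-- The weights of primitive vectors in subquotients of `R`. -/
def PrimWt (mu : Module.Dual K D.h) : Prop :=
  ∃ (A : Submodule (Env K g) R) (u : R), u ∈ hWt D.h R mu ∧ u ∉ A ∧ ∀ i, 𝔦 (D.e i) • u ∈ A

/-- All primitive weights of an indecomposable module are in the same block. -/
theorem PrimWt.blk (hA : D.Adm R)
    (hind : ∀ N₁ N₂ : Submodule (Env K g) R, IsCompl N₁ N₂ → N₁ = ⊥ ∨ N₂ = ⊥)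
    {lam mu : Module.Dual K D.h} (hlam : D.PrimWt R lam) (hmu : D.PrimWt R mu) :
    D.Blk lam mu := by
  set c : Set (Module.Dual K D.h) := {x | D.Blk lam x} with hcdef
  have hc : ∀ x y, D.Blk x y → x ∈ c → y ∈ c := fun x y hxy hx => Blk.trans hx hxy
  have hsup := core_sup_compl hA hc
  have h1 : D.IsPure c ⊥ (D.core R c) := isPure_core hA.span
  have h2 : D.IsPure cᶜ ⊥ (D.core R cᶜ) := isPure_core hA.span
  have hinf : D.core R c ⊓ D.core R cᶜ ≤ ⊥ := hA.le_of_isPure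
    (fun B hB nu v hv => h1 B hB nu v hv.1) (fun B hB nu v hv => h2 B hB nu v hv.2)
  rcases hind _ _ ⟨disjoint_iff_inf_le.2 hinf, codisjoint_iff.2 hsup⟩ with h | h
  · rw [h, bot_sup_eq] at hsup
    obtain ⟨A, u, hu, huA, heu⟩ := hlam
    exact absurd (Blk.refl D lam) (h2 A bot_le lam u (hsup ▸ Submodule.mem_top) hu huA heu)
  · rw [h, sup_bot_eq] at hsup
    obtain ⟨A, u, hu, huA, heu⟩ := hmu
    exact h1 A bot_le mu u (hsup ▸ Submodule.mem_top) hu huA heu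

end ChevData
end Decomposition

section SlTwo

variable {V : Type} [AddCommGroup V] [Module K V]

/-- Operators `H, E, F` satisfying the relations of `sl₂`, with `E` and `F` nilpotent on every
eigenvector of `H`. -/
structure SlTwo (H E F : Module.End K V) : Prop where
  ef : ∀ v, E (F v) = F (E v) + H v
  he : ∀ v, H (E v) = E (H v) + (2 : K) • E v
  hf : ∀ v, H (F v) = F (H v) - (2 : K) • F v
  nE : ∀ (v : V) (m : K), H v = m • v → ∃ k : ℕ, (E ^ k) v = 0
  nF : ∀ (v : V) (m : K), H v = m • v → ∃ k : ℕ, (F ^ k) v = 0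

omit [IsAlgClosed K] in
lemma exists_pow_eq_zero_of_shift {H E : Module.End K V} {c : K} (hc : c ≠ 0)
    (he : ∀ v, H (E v) = E (H v) + c • E v) {v : V} {m : K} (hv : H v = m • v)
    {W : Submodule K V} [FiniteDimensional K W] (hvW : v ∈ W) (hW : ∀ w ∈ W, E w ∈ W) :
    ∃ k : ℕ, (E ^ k) v = 0 := by
  by_contra! hne
  have hmem : ∀ k : ℕ, (E ^ k) v ∈ W := by
    intro k
    induction k with
    | zero => simpa using hvW
    | succ k ih => rw [pow_succ', Module.End.mul_apply]; exact hW _ ih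
  have hwt : ∀ k : ℕ, H ((E ^ k) v) = (m + c * k) • (E ^ k) v := by
    intro k
    induction k with
    | zero => simp [hv]
    | succ k ih =>
      rw [pow_succ', Module.End.mul_apply, he, ih, map_smul, ← add_smul]
      congr 1; push_cast; ring
  have hinj : Function.Injective fun k : ℕ => m + c * (k : K) := by
    intro a b hab
    have : c * (a : K) = c * b := by simpa using hab
    exact_mod_cast mul_left_cancel₀ hc this
  have hli : LinearIndependent K fun k : ℕ => (E ^ k) v := by
    refine Module.End.eigenvectors_linearIndependent' H (fun k : ℕ => m + c * (k : K)) hinj _ ?_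
    intro k
    exact ⟨Module.End.mem_eigenspace_iff.mpr (hwt k), hne k⟩
  have hli' : LinearIndependent K fun k : ℕ => (⟨(E ^ k) v, hmem k⟩ : W) := by
    refine LinearIndependent.of_comp W.subtype ?_
    exact hli
  exact Set.infinite_univ.not_finite (Set.finite_univ_iff.mpr hli'.finite)

namespace SlTwo

variable {H E F : Module.End K V}

omit [IsAlgClosed K] in
lemma symm (t : SlTwo H E F) : SlTwo (-H) F E where
  ef v := by rw [t.ef]; simp
  he v := by simp only [LinearMap.neg_apply, map_neg, t.hf]; abel
  hf v := by simp only [LinearMap.neg_apply, map_neg, t.he]; abel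
  nE v m h := t.nF v (-m) (by rw [neg_smul, ← h, LinearMap.neg_apply, neg_neg])
  nF v m h := t.nE v (-m) (by rw [neg_smul, ← h, LinearMap.neg_apply, neg_neg])

omit [IsAlgClosed K] in
lemma H_E_pow (t : SlTwo H E F) {v : V} {m : K} (hv : H v = m • v) (k : ℕ) :
    H ((E ^ k) v) = (m + 2 * k) • (E ^ k) v := by
  induction k with
  | zero => simp [hv]
  | succ k ih =>
    rw [pow_succ', Module.End.mul_apply, t.he, ih, map_smul, ← add_smul]
    congr 1; push_cast; ring

omit [IsAlgClosed K] in
lemma H_F_pow (t : SlTwo H E F) {v : V} {m : K} (hv : H v = m • v) (k : ℕ) :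
    H ((F ^ k) v) = (m - 2 * k) • (F ^ k) v := by
  have := t.symm.H_E_pow (v := v) (m := -m) (by simp [hv]) k
  rw [LinearMap.neg_apply, neg_eq_iff_eq_neg, ← neg_smul] at this
  rw [this]; congr 1; ring

omit [IsAlgClosed K] in
/-- `E F^{k+1} v = F^{k+1} E v + (k+1)(m-k) F^k v` on an `H`-eigenvector. -/
lemma E_F_pow (t : SlTwo H E F) {v : V} {m : K} (hv : H v = m • v) (k : ℕ) :
    E ((F ^ (k + 1)) v) = (F ^ (k + 1)) (E v) + ((k + 1) * (m - k)) • (F ^ k) v := by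
  induction k with
  | zero => simp [t.ef, hv]
  | succ k ih =>
    have hp : ∀ (j : ℕ) (w : V), (F ^ (j + 1)) w = F ((F ^ j) w) := fun j w => by
      rw [pow_succ', Module.End.mul_apply]
    rw [hp (k + 1) v, t.ef, ih, t.H_F_pow hv, map_add, map_smul, hp (k + 1) (E v), add_assoc,
      ← hp k v, ← add_smul]
    congr 2; push_cast; ring

omit [IsAlgClosed K] in
/-- A highest weight is a natural number. -/
lemma nat_of_E (t : SlTwo H E F) {v : V} {m : K} (hv : H v = m • v) (hE : E v = 0)
    (h0 : v ≠ 0) : ∃ n : ℕ, m = n ∧ (F ^ n) v ≠ 0 ∧ (F ^ (n + 1)) v = 0 := by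
  obtain ⟨n, hn, hn'⟩ := Nat.exists_not_and_succ_of_not_zero_of_exists
    (p := fun k => (F ^ k) v = 0) (by simpa using h0) (t.nF v m hv)
  refine ⟨n, ?_, hn, hn'⟩
  have h := t.E_F_pow hv n
  rw [hn', hE, map_zero, map_zero, zero_add, eq_comm, smul_eq_zero_iff_left hn, mul_eq_zero] at h
  exact sub_eq_zero.mp (h.resolve_left (Nat.cast_add_one_ne_zero n))

omit [IsAlgClosed K] in
lemma int_of_ne (t : SlTwo H E F) {v : V} {m : K} (hv : H v = m • v) (h0 : v ≠ 0) :
    ∃ n : ℤ, m = n := by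
  obtain ⟨k, hk, hk'⟩ := Nat.exists_not_and_succ_of_not_zero_of_exists
    (p := fun k => (E ^ k) v = 0) (by simpa using h0) (t.nE v m hv)
  obtain ⟨n, hn, -⟩ := t.nat_of_E (t.H_E_pow hv k)
    (by rwa [pow_succ', Module.End.mul_apply] at hk') hk
  refine ⟨n - 2 * k, ?_⟩
  push_cast
  rw [← hn]; ring

omit [IsAlgClosed K] in
/-- `F^r` is injective on the `r`-eigenspace of `H`. -/
lemma eq_zero_of_F_pow (t : SlTwo H E F) {v : V} {r : ℕ} (hv : H v = (r : K) • v)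
    (hF : (F ^ r) v = 0) : v = 0 := by
  obtain ⟨j, hj⟩ := t.nE v r hv
  induction j generalizing v r with
  | zero => simpa using hj
  | succ j ih =>
    have hEv : E v = 0 := by
      refine ih (v := E v) (r := r + 2) ?_ ?_ ?_
      · rw [t.he, hv, map_smul, ← add_smul]; push_cast; rfl
      · have h := t.E_F_pow hv (r + 1)
        have h1 : (F ^ (r + 1)) v = 0 := by rw [pow_succ', Module.End.mul_apply, hF, map_zero]
        have h2 : (F ^ (r + 1 + 1)) v = 0 := by
          rw [pow_succ', Module.End.mul_apply, h1, map_zero]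
        rw [h1, h2, map_zero, smul_zero, add_zero] at h
        exact h.symm
      · rwa [pow_succ, Module.End.mul_apply] at hj
    by_contra h0
    obtain ⟨n, hn, hn1, -⟩ := t.nat_of_E hv hEv h0
    have : r = n := by exact_mod_cast hn
    subst this
    exact hn1 hF

omit [IsAlgClosed K] in
/-- The range of `F` on eigenvectors contains no nonzero vector killed by `E`. -/
lemma F_eq_zero (t : SlTwo H E F) {v : V} {m : K} (hv : H v = m • v) (h : E (F v) = 0) :
    F v = 0 := by
  by_contra h0
  have h1 : H (F v) = (m - 2) • F v := by rw [t.hf, hv, map_smul, ← sub_smul]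
  obtain ⟨n, hn, -, hn2⟩ := t.nat_of_E h1 h h0
  have hm : m = ((n + 2 : ℕ) : K) := by push_cast; rw [← hn]; ring
  rw [hm] at hv
  refine h0 ?_
  rw [t.eq_zero_of_F_pow hv, map_zero]
  rwa [pow_succ, Module.End.mul_apply]

omit [IsAlgClosed K] in
/-- On a lowest weight vector of weight `-r`, the operator `F^k E^k` is a nonzero scalar
for `k ≤ r`. -/
lemma F_pow_E_pow (t : SlTwo H E F) {v : V} {r : ℕ} (hv : H v = -(r : K) • v) (hF : F v = 0)
    {k : ℕ} (hk : k ≤ r) : ∃ c : K, c ≠ 0 ∧ (F ^ k) ((E ^ k) v) = c • v := by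
  induction k with
  | zero => exact ⟨1, one_ne_zero, by simp⟩
  | succ k ih =>
    obtain ⟨c, hc, h⟩ := ih (by omega)
    refine ⟨((k + 1) * (r - k)) * c, ?_, ?_⟩
    · refine mul_ne_zero (mul_ne_zero (Nat.cast_add_one_ne_zero k) ?_) hc
      rw [sub_ne_zero]
      have : r ≠ k := by omega
      exact_mod_cast this
    · have h1 := t.symm.E_F_pow (v := v) (m := r) (by simp [hv]) k
      rw [hF, map_zero, zero_add] at h1
      rw [pow_succ F, Module.End.mul_apply, h1, map_smul, h, smul_smul]

omit [IsAlgClosed K] in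
lemma eq_zero_of_E_pow (t : SlTwo H E F) {v : V} {r : ℕ} (hv : H v = -(r : K) • v)
    (hE : (E ^ r) v = 0) : v = 0 :=
  t.symm.eq_zero_of_F_pow (v := v) (r := r) (by simp [hv]) hE

omit [IsAlgClosed K] in
lemma E_eq_zero (t : SlTwo H E F) {v : V} {m : K} (hv : H v = m • v) (h : F (E v) = 0) :
    E v = 0 :=
  t.symm.F_eq_zero (v := v) (m := -m) (by simp [hv]) h

end SlTwo

omit [IsAlgClosed K] in
lemma SlTwo.of_finiteDimensional [FiniteDimensional K V] {H E F : Module.End K V}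
    (ef : ∀ v, E (F v) = F (E v) + H v)
    (he : ∀ v, H (E v) = E (H v) + (2 : K) • E v)
    (hf : ∀ v, H (F v) = F (H v) - (2 : K) • F v) : SlTwo H E F where
  ef := ef
  he := he
  hf := hf
  nE v m h := exists_pow_eq_zero_of_shift (W := ⊤) two_ne_zero he h trivial fun _ _ => trivial
  nF v m h := exists_pow_eq_zero_of_shift (W := ⊤) (c := -2) (by simp)
    (fun v => by rw [hf, neg_smul, sub_eq_add_neg]) h trivial fun _ _ => trivial

end SlTwo

section RadicalStep
variable {L : Type} [LieRing L] [LieAlgebra K L] [FiniteDimensional K L]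

/-- An abelian-ideal argument based on Lie's theorem: if every abelian ideal is central, a solvable
ideal whose second derived ideal is central has central derived ideal. -/
lemma lie_le_center_of_lie_lie_le_center
    (hab : ∀ I : LieIdeal K L, IsLieAbelian I → I ≤ LieAlgebra.center K L)
    (E : LieIdeal K L) [LieAlgebra.IsSolvable E]
    (hD : ⁅⁅E, E⁆, ⁅E, E⁆⁆ ≤ LieAlgebra.center K L) : ⁅E, E⁆ ≤ LieAlgebra.center K L := by
  by_contra hcon
  set Z := LieAlgebra.center K L with hZ
  have hZc : ∀ z ∈ Z, ∀ x : L, ⁅x, z⁆ = 0 := fun z hz x =>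
    (LieModule.mem_maxTrivSubmodule _ _ _ z).1 hz x
  let M : LieSubmodule K L (L ⧸ Z) := LieSubmodule.map (LieSubmodule.Quotient.mk' Z) ⁅E, E⁆
  have hMn : Nontrivial M := by
    obtain ⟨d, hd, hdZ⟩ := Set.not_subset.1 hcon
    refine ⟨⟨⟨_, LieSubmodule.mem_map_of_mem hd⟩, 0, fun h => hdZ ?_⟩⟩
    have := congrArg Subtype.val h
    exact (LieSubmodule.Quotient.mk_eq_zero Z).1 this
  obtain ⟨χ, hχ⟩ := LieModule.exists_nontrivial_weightSpace_of_isSolvable K E M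
  let P : LieSubmodule K L M := LieModule.weightSpaceOfIsLieTower K M χ
  let I : LieIdeal K L := (LieSubmodule.map M.incl P).comap (LieSubmodule.Quotient.mk' Z) ⊓ ⁅E, E⁆
  have hI : ∀ w ∈ I, ∀ x : E, ⁅(x : L), w⁆ - χ x • w ∈ Z := by
    rintro w ⟨hw, -⟩ x
    obtain ⟨m, hm, hmw⟩ := (LieSubmodule.mem_map _).1 (LieSubmodule.mem_comap.1 hw)
    have h1 : ⁅(x : L), m⁆ = χ x • m := (LieModule.mem_weightSpace (χ : E → K) m).1 hm x
    have h2 := congrArg Subtype.val h1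
    have h3 : LieSubmodule.Quotient.mk' Z w = m.1 := hmw.symm
    refine (LieSubmodule.Quotient.mk_eq_zero Z).1 ?_
    change LieSubmodule.Quotient.mk' Z _ = 0
    rw [map_sub, map_smul, LieModuleHom.map_lie, h3, sub_eq_zero]
    exact h2
  have hIa : IsLieAbelian I := by
    refine ⟨fun w w' => Subtype.ext ?_⟩
    change ⁅(w : L), (w' : L)⁆ = 0
    have hww : ⁅(w : L), (w' : L)⁆ ∈ Z := hD (LieSubmodule.lie_mem_lie w.2.2 w'.2.2)
    have hbr : ∀ (x : E), ∀ v ∈ I, ∃ z ∈ Z, ⁅(x : L), v⁆ = χ x • v + z := fun x v hv =>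
      ⟨_, hI v hv x, by abel⟩
    by_cases h0 : ∃ x, χ x ≠ 0
    · obtain ⟨x, hx⟩ := h0
      obtain ⟨z, hz, e1⟩ := hbr x w w.2
      obtain ⟨z', hz', e2⟩ := hbr x w' w'.2
      have h1 := hZc _ hww (x : L)
      rw [leibniz_lie, e1, e2] at h1
      have h2 : ⁅z, (w' : L)⁆ = 0 := by rw [← lie_skew, hZc z hz, neg_zero]
      simp only [add_lie, smul_lie, lie_add, lie_smul, h2, hZc z' hz', add_zero] at h1
      have h3 : (2 * χ x) • ⁅(w : L), (w' : L)⁆ = 0 := by rw [two_mul, add_smul]; exact h1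
      exact (smul_eq_zero.1 h3).resolve_left (mul_ne_zero two_ne_zero hx)
    · push Not at h0
      have hcen : ∀ x : E, ⁅(x : L), (w' : L)⁆ ∈ Z := fun x => by
        have := hI w' w'.2 x; rwa [h0 x, zero_smul, sub_zero] at this
      have hspan : (⁅E, E⁆ : LieIdeal K L).toSubmodule ≤
          LinearMap.ker ((LieAlgebra.ad K L (w' : L)) : L →ₗ[K] L) := by
        rw [LieSubmodule.lieIdeal_oper_eq_linear_span', Submodule.span_le]
        rintro _ ⟨x, hx, y, hy, rfl⟩
        change ⁅(w' : L), ⁅x, y⁆⁆ = 0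
        have hx' : ⁅(w' : L), x⁆ ∈ Z := by
          rw [← lie_skew]; exact neg_mem (hcen ⟨x, hx⟩)
        have hy' : ⁅(w' : L), y⁆ ∈ Z := by
          rw [← lie_skew]; exact neg_mem (hcen ⟨y, hy⟩)
        rw [leibniz_lie, hZc _ hy', ← lie_skew, hZc _ hx', neg_zero, add_zero]
      have := hspan w.2.2
      rw [← lie_skew]
      exact neg_eq_zero.2 this
  obtain ⟨⟨m, hm0⟩⟩ : Nonempty {m : P // m ≠ 0} := by
    have : Nontrivial P := hχ
    exact ⟨⟨_, (exists_ne (0 : P)).choose_spec⟩⟩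
  obtain ⟨d, hd, hdm⟩ := (LieSubmodule.mem_map _).1 m.1.2
  have hdI : d ∈ I := ⟨LieSubmodule.mem_comap.2 ((LieSubmodule.mem_map _).2 ⟨m.1, m.2, hdm.symm⟩), hd⟩
  have hdZ := hab I hIa hdI
  refine hm0 (Subtype.ext (Subtype.ext ?_))
  exact hdm.symm.trans ((LieSubmodule.Quotient.mk_eq_zero Z).2 hdZ)

/-- If every abelian ideal is central, the derived ideal of the radical is central. -/
lemma lie_radical_le_center
    (hab : ∀ I : LieIdeal K L, IsLieAbelian I → I ≤ LieAlgebra.center K L) :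
    ⁅LieAlgebra.radical K L, LieAlgebra.radical K L⁆ ≤ LieAlgebra.center K L := by
  set R := LieAlgebra.radical K L
  have hle : ∀ k, LieAlgebra.derivedSeriesOfIdeal K L k R ≤ R := fun k =>
    LieAlgebra.derivedSeriesOfIdeal_le_self R k
  have hsol : LieAlgebra.IsSolvable R := LieAlgebra.radicalIsSolvable K L
  obtain ⟨k, hk⟩ := (LieAlgebra.isSolvable_iff K R).1 hsol
  rw [LieIdeal.derivedSeries_eq_bot_iff] at hk
  have main : ∀ m, LieAlgebra.derivedSeriesOfIdeal K L (m + 1) R ≤ LieAlgebra.center K L →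
      LieAlgebra.derivedSeriesOfIdeal K L 1 R ≤ LieAlgebra.center K L := by
    intro m
    induction m with
    | zero => exact fun h => h
    | succ m ih =>
      intro h
      apply ih
      have hs : LieAlgebra.IsSolvable (LieAlgebra.derivedSeriesOfIdeal K L m R) :=
        (LieAlgebra.LieIdeal.solvable_iff_le_radical K L _).2 (hle m)
      rw [LieAlgebra.derivedSeriesOfIdeal_succ]
      apply lie_le_center_of_lie_lie_le_center hab
      rw [← LieAlgebra.derivedSeriesOfIdeal_succ, ← LieAlgebra.derivedSeriesOfIdeal_succ]
      exact h
  have := main k (by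
    rw [LieAlgebra.derivedSeriesOfIdeal_succ, hk, LieSubmodule.bot_lie]; exact bot_le)
  rwa [LieAlgebra.derivedSeriesOfIdeal_succ, LieAlgebra.derivedSeriesOfIdeal_zero] at this
end RadicalStep

section Oddness
variable {V : Type} [AddCommGroup V] [Module K V]

/-- A commuting space of operators has a common eigenvector in every nonzero invariant
subspace. -/
lemma exists_common_eigenvector [FiniteDimensional K V] (A : Set (Module.End K V))
    (hcomm : ∀ a ∈ A, ∀ b ∈ A, ∀ v, a (b v) = b (a v)) (N : Submodule K V) (hN : N ≠ ⊥)
    (hinv : ∀ a ∈ A, ∀ v ∈ N, a v ∈ N) :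
    ∃ v ∈ N, v ≠ 0 ∧ ∀ a ∈ A, ∃ c : K, a v = c • v := by
  obtain ⟨P, ⟨hP0, hPN, hPi⟩, hmin⟩ := (wellFounded_lt (α := Submodule K V)).has_min
    {P | P ≠ ⊥ ∧ P ≤ N ∧ ∀ a ∈ A, ∀ v ∈ P, a v ∈ P} ⟨N, hN, le_rfl, hinv⟩
  obtain ⟨v, hv, hv0⟩ := Submodule.exists_mem_ne_zero_of_ne_bot hP0
  refine ⟨v, hPN hv, hv0, fun a ha => ?_⟩
  have : Nontrivial P := Submodule.nontrivial_iff_ne_bot.2 hP0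
  obtain ⟨c, hc⟩ := Module.End.exists_eigenvalue (a.restrict (hPi a ha))
  obtain ⟨w, hw⟩ := hc.exists_hasEigenvector
  have hw1 : a w.1 = c • w.1 := congrArg Subtype.val hw.apply_eq_smul
  let Q : Submodule K V := P ⊓ Module.End.eigenspace a c
  have hQ : Q = P := by
    by_contra hne
    refine hmin Q ⟨fun h => ?_, inf_le_left.trans hPN, ?_⟩ (lt_of_le_of_ne inf_le_left hne)
    · have : w.1 ∈ Q := ⟨w.2, Module.End.mem_eigenspace_iff.2 hw1⟩
      rw [h, Submodule.mem_bot] at this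
      exact hw.2 (Subtype.ext this)
    · rintro b hb u ⟨hu, hu'⟩
      refine ⟨hPi b hb u hu, Module.End.mem_eigenspace_iff.2 ?_⟩
      rw [hcomm a ha b hb, Module.End.mem_eigenspace_iff.1 hu', map_smul]
  rw [← hQ] at hv
  exact ⟨c, Module.End.mem_eigenspace_iff.1 hv.2⟩

/-- Images of `v` under products of operators in `A` that lower the eigenvalue of `X`. -/
inductive LowWord (A : Submodule K (Module.End K V)) (X : Module.End K V) (n : ℤ) (v : V) :
    ℤ → V → Prop
  | base : LowWord A X n v n v
  | step (a : Module.End K V) (ha : a ∈ A) (c : ℤ) (hc : c < 0)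
      (hX : ∀ u, X (a u) = a (X u) + ((2 * c : ℤ) : K) • a u) (m : ℤ) (u : V)
      (hu : LowWord A X n v m u) : LowWord A X n v (m + c) (a u)

variable {A : Submodule K (Module.End K V)} {X E F : Module.End K V} {n : ℤ} {v : V}

lemma LowWord.apply (hv : X v = ((2 * n : ℤ) : K) • v) {m : ℤ} {u : V}
    (hu : LowWord A X n v m u) : X u = ((2 * m : ℤ) : K) • u := by
  induction hu with
  | base => exact hv
  | step a ha c hc hX m u hu ih =>
    rw [hX, ih, map_smul, ← add_smul]; congr 1; push_cast; ring

lemma LowWord.le {m : ℤ} {u : V} (hu : LowWord A X n v m u) : m < n ∨ u = v := by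
  have : m ≤ n ∧ (m < n ∨ u = v) := by
    induction hu with
    | base => exact ⟨le_rfl, .inr rfl⟩
    | step a ha c hc hX m u hu ih => exact ⟨by omega, .inl (by omega)⟩
  exact this.2

/-- If all weights of `ad X` on the acting operators are even, and an invariant
alternating form has no isotropic invariant subspaces, then `X` has no even eigenvalues. -/
theorem no_even_eigenvector [FiniteDimensional K V] {W : Type} [AddCommGroup W] [Module K W]
    (hA : ∀ a ∈ A, ∀ b ∈ A, a * b - b * a ∈ A)
    (hE : E ∈ A) (hF : F ∈ A) (t : SlTwo X E F)
    (hgen : A ≤ Submodule.span K {a | a ∈ A ∧ ∃ c : ℤ,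
      ∀ u, X (a u) = a (X u) + ((2 * c : ℤ) : K) • a u})
    (hcomm : ∀ a ∈ A, ∀ b ∈ A, (∀ u, X (a u) = a (X u)) → (∀ u, X (b u) = b (X u)) →
      ∀ u, a (b u) = b (a u))
    (ω : V →ₗ[K] V →ₗ[K] W) (halt : ∀ u, ω u u = 0) (hX : X ∈ A)
    (hinv : ∀ a ∈ A, ∀ u w, ω (a u) w = - ω u (a w))
    (hiso : ∀ N : Submodule K V, (∀ a ∈ A, ∀ u ∈ N, a u ∈ N) → (∀ u ∈ N, ∀ w ∈ N, ω u w = 0) →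
      N = ⊥)
    (n : ℤ) (v : V) (hv : X v = ((2 * n : ℤ) : K) • v) : v = 0 := by
  by_contra hv0
  let Vn : ℤ → Submodule K V := fun m => Module.End.eigenspace X ((2 * m : ℤ) : K)
  have hmem : ∀ {m : ℤ} {u : V}, u ∈ Vn m ↔ X u = ((2 * m : ℤ) : K) • u :=
    Module.End.mem_eigenspace_iff
  have hinj : Function.Injective fun m : ℤ => ((2 * m : ℤ) : K) := fun a b h => by
    have : (2 * a : ℤ) = 2 * b := Int.cast_injective h
    omega
  have hfin : {m : ℤ | Vn m ≠ ⊥}.Finite := by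
    have h1 := (Module.End.eigenspaces_iSupIndep X)
    have h2 := WellFoundedGT.finite_ne_bot_of_iSupIndep (h1.comp hinj)
    exact h2
  obtain ⟨N, hN, hmax⟩ := Set.exists_max_image _ id hfin
    ⟨n, fun h => hv0 ((Submodule.mem_bot K).1 (h ▸ hmem.2 hv))⟩
  have hbig : ∀ m : ℤ, N < m → ∀ u, X u = ((2 * m : ℤ) : K) • u → u = 0 := fun m hm u hu => by
    by_contra h0
    exact absurd (hmax m fun h => h0 ((Submodule.mem_bot K).1 (h ▸ hmem.2 hu))) (not_le.2 hm)
  have hshift : ∀ (a : Module.End K V) (c : ℤ),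
      (∀ u, X (a u) = a (X u) + ((2 * c : ℤ) : K) • a u) → ∀ (m : ℤ) u,
      X u = ((2 * m : ℤ) : K) • u → X (a u) = ((2 * (m + c) : ℤ) : K) • a u :=
    fun a c h m u hu => by rw [h, hu, map_smul, ← add_smul]; congr 1; push_cast; ring
  obtain ⟨w, hwN, hw0, hwA⟩ := exists_common_eigenvector
    {a | a ∈ A ∧ ∀ u, X (a u) = a (X u)} (fun a ha b hb => hcomm a ha.1 b hb.1 ha.2 hb.2)
    (Vn N) hN fun a ha u hu => hmem.2 (by rw [ha.2, hmem.1 hu, map_smul])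
  have hw := hmem.1 hwN
  have hEs : ∀ u, X (E u) = E (X u) + ((2 * 1 : ℤ) : K) • E u := by simpa using t.he
  have hFs : ∀ u, X (F u) = F (X u) + ((2 * (-1) : ℤ) : K) • F u := by
    simpa [sub_eq_add_neg] using t.hf
  have hN0 : 0 ≤ N := by
    obtain ⟨k, hk, -⟩ := t.nat_of_E hw (hbig (N + 1) (by omega) _ (hshift E 1 hEs N w hw)) hw0
    have : (2 * N : ℤ) = k := by exact_mod_cast hk
    omega
  obtain ⟨r, rfl⟩ := Int.eq_ofNat_of_zero_le hN0
  set P : Submodule K V := Submodule.span K {u | ∃ m, LowWord A X r w m u} with hP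
  have hstep : ∀ a ∈ A, ∀ c : ℤ, c < 0 → (∀ u, X (a u) = a (X u) + ((2 * c : ℤ) : K) • a u) →
      ∀ u ∈ P, a u ∈ P := by
    refine fun a ha c hc hX u => map_mem_of_mem_span a ?_
    rintro u ⟨m, hm⟩
    exact Submodule.subset_span ⟨_, hm.step a ha c hc hX⟩
  have hwP : w ∈ P := Submodule.subset_span ⟨_, .base⟩
  have hhom : ∀ (m : ℤ) u, LowWord A X r w m u → ∀ b ∈ A, ∀ d : ℤ,
      (∀ u, X (b u) = b (X u) + ((2 * d : ℤ) : K) • b u) → b u ∈ P := by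
    intro m u hu
    induction hu with
    | base =>
      intro b hb d hd
      rcases lt_trichotomy d 0 with h | h | h
      · exact hstep b hb d h hd w hwP
      · subst h
        obtain ⟨c, hc⟩ := hwA b ⟨hb, by simpa using hd⟩
        rw [hc]; exact P.smul_mem _ hwP
      · rw [hbig (r + d) (by omega) _ (hshift b d hd r w hw)]; exact zero_mem _
    | step a ha c hc hXa m u hu ih =>
      intro b hb d hd
      have h1 : b (a u) = (b * a - a * b) u + a (b u) := by simp
      rw [h1]
      refine add_mem (ih _ (hA b hb a ha) (d + c) fun u => ?_) (hstep a ha c hc hXa _ (ih b hb d hd))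
      simp only [LinearMap.sub_apply, Module.End.mul_apply, hXa, hd, map_add, map_smul, map_sub]
      push_cast
      module
  have hPinv : ∀ a ∈ A, ∀ u ∈ P, a u ∈ P := by
    refine fun a ha u => map_mem_of_mem_span a ?_
    rintro u ⟨m, hm⟩
    refine map_mem_of_mem_span (LinearMap.applyₗ u) ?_ (hgen ha)
    rintro a ⟨ha, c, hc⟩
    exact hhom m u hm a ha c hc
  have htop : ∀ y ∈ P, X y = ((2 * (r : ℤ) : ℤ) : K) • y → ∃ c : K, y = c • w := by
    have hle : P ≤ Submodule.span K {w} ⊔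
        ⨆ μ : K, ⨆ _ : μ ≠ ((2 * (r : ℤ) : ℤ) : K), Module.End.eigenspace X μ := by
      refine Submodule.span_le.2 ?_
      rintro u ⟨m, hm⟩
      rcases hm.le with h | rfl
      · refine Submodule.mem_sup_right (Submodule.mem_iSup_of_mem ((2 * m : ℤ) : K)
          (Submodule.mem_iSup_of_mem (fun h' => ?_) (hmem.2 (hm.apply hw))))
        have := hinj h'; omega
      · exact Submodule.mem_sup_left (Submodule.mem_span_singleton_self _)
    intro y hy hyX
    obtain ⟨y1, hy1, y2, hy2, rfl⟩ := Submodule.mem_sup.1 (hle hy)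
    obtain ⟨c, rfl⟩ := Submodule.mem_span_singleton.1 hy1
    refine ⟨c, ?_⟩
    have hy2' : y2 ∈ Module.End.eigenspace X ((2 * (r : ℤ) : ℤ) : K) := by
      have : y2 = (c • w + y2) - c • w := by abel
      rw [this]
      exact sub_mem (Module.End.mem_eigenspace_iff.2 hyX)
        (Submodule.smul_mem _ _ (Module.End.mem_eigenspace_iff.2 hw))
    rw [Submodule.disjoint_def.1 (Module.End.eigenspaces_iSupIndep X _) y2 hy2' hy2, add_zero]
  have hskew : ∀ u w, ω u w = - ω w u := fun u w => by
    have := halt (u + w)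
    simp only [map_add, LinearMap.add_apply, halt, zero_add, add_zero] at this
    exact eq_neg_of_add_eq_zero_left (by rwa [add_comm])
  have hpowP : ∀ k : ℕ, ∀ u ∈ P, (E ^ k) u ∈ P := fun k => by
    induction k with
    | zero => exact fun u hu => by simpa using hu
    | succ k ih =>
      intro u hu
      rw [pow_succ', Module.End.mul_apply]
      exact hPinv E hE _ (ih u hu)
  have hFω : ∀ (k : ℕ) u z, ω u ((F ^ k) z) = (-1 : K) ^ k • ω ((F ^ k) u) z := fun k => by
    induction k with
    | zero => simp
    | succ k ih =>
      intro u z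
      have h1 : ω u ((F ^ (k + 1)) z) = (-1 : K) ^ k • ω ((F ^ k) u) (F z) := by
        rw [pow_succ, Module.End.mul_apply, ← ih]
      rw [h1, pow_succ' F, Module.End.mul_apply, hinv F hF, pow_succ, mul_neg_one, neg_smul,
        smul_neg, neg_neg]
  have hself : ω w ((F ^ (2 * r)) w) = 0 := by
    have h1 := hFω (2 * r) w w
    rw [Even.neg_one_pow ⟨r, two_mul r⟩, one_smul, hskew ((F ^ (2 * r)) w)] at h1
    rw [eq_neg_iff_add_eq_zero, ← two_smul K] at h1
    exact (smul_eq_zero.1 h1).resolve_left two_ne_zero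
  have hzero : ∀ u ∈ P, ω w u = 0 := by
    refine fun u hu => (Submodule.mem_bot K).1 (map_mem_of_mem_span (ω w) ?_ hu)
    rintro u ⟨m, hm⟩
    rw [Submodule.mem_bot]
    have hu := hm.apply hw
    by_cases hmr : m = -(r : ℤ)
    · subst hmr
      have hu' : X u = -((2 * r : ℕ) : K) • u := by rw [hu]; push_cast; congr 1; ring
      have hFu : F u = 0 := by
        refine t.eq_zero_of_E_pow (r := 2 * r + 2) ?_ ?_
        · rw [hshift F (-1) hFs _ u hu]; congr 1; push_cast; ring
        · refine hbig (r + 1) (by omega) _ ?_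
          rw [t.H_E_pow (hshift F (-1) hFs _ u hu)]; congr 1; push_cast; ring
      obtain ⟨c, hc, hcu⟩ := t.F_pow_E_pow hu' hFu (le_refl (2 * r))
      obtain ⟨k, hk⟩ := htop _ (hpowP (2 * r) u (Submodule.subset_span ⟨_, hm⟩)) (by
        rw [t.H_E_pow hu']; congr 1; push_cast; ring)
      rw [hk, map_smul] at hcu
      have : u = (c⁻¹ * k) • (F ^ (2 * r)) w := by
        rw [mul_smul, hcu, smul_smul, inv_mul_cancel₀ hc, one_smul]
      rw [this, map_smul, hself, smul_zero]
    · have h1 := hinv X hX w u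
      rw [hw, hu, map_smul, map_smul, LinearMap.smul_apply, ← sub_eq_zero, sub_neg_eq_add,
        ← add_smul] at h1
      refine (smul_eq_zero.1 h1).resolve_left fun h => hmr ?_
      have : (2 * (r : ℤ) + 2 * m : ℤ) = 0 := by exact_mod_cast h
      omega
  have hPbot : P = ⊥ := by
    refine hiso P hPinv fun u hu z hz =>
      (Submodule.mem_bot K).1 (map_mem_of_mem_span (ω.flip z) ?_ hu)
    rintro u ⟨m, hm⟩
    rw [Submodule.mem_bot, LinearMap.flip_apply]
    induction hm generalizing z with
    | base => exact hzero z hz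
    | step a ha c hc hXa m u hu ih => rw [hinv a ha, ih _ (hPinv a ha z hz), neg_zero]
  exact hw0 ((Submodule.mem_bot K).1 (hPbot ▸ hwP))
end Oddness

section Principal
variable {L : Type} [LieRing L] [LieAlgebra K L] [FiniteDimensional K L]

open LieAlgebra LieAlgebra.IsKilling in
/-- A principal `sl₂`-triple adapted to a Cartan subalgebra of a semisimple Lie algebra. -/
theorem exists_principal [LieAlgebra.IsKilling K L] (H : LieSubalgebra K L)
    [H.IsCartanSubalgebra] :
    ∃ x e f : L, x ∈ H ∧ ⁅e, f⁆ = x ∧ ⁅x, e⁆ = (2 : K) • e ∧ ⁅x, f⁆ = -((2 : K) • f) ∧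
      (∀ y, ⁅x, y⁆ = 0 → y ∈ H) ∧
      Submodule.span K {l : L | ∃ c : ℤ, ⁅x, l⁆ = ((2 * c : ℤ) : K) • l} = ⊤ := by
  classical
  have htri : LieModule.IsTriangularizable K H L := inferInstance
  obtain ⟨b⟩ := RootPairing.nonempty_base (rootSystem H)
  have hsl : ∀ i : b.support, ∃ h e f : L, IsSl2Triple h e f ∧ e ∈ rootSpace H i.1.1 ∧
      f ∈ rootSpace H (-i.1.1) := fun i =>
    exists_isSl2Triple_of_weight_isNonZero (LieSubalgebra.isNonZero_coe_root i.1)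
  choose hh e f ht he hf using hsl
  obtain ⟨x, hx⟩ : ∃ x : H, ∀ i : b.support, (i.1.1 : H → K) x = 2 := by
    obtain ⟨x, hx⟩ := (Module.evalEquiv K H).surjective (b.toWeightBasis.constr K fun _ => (2 : K))
    refine ⟨x, fun i => ?_⟩
    have := LinearMap.congr_fun hx (b.toWeightBasis i)
    rw [Module.Basis.constr_basis] at this
    simpa using this
  have hbr : ∀ (χ : H → K) (y : L), y ∈ rootSpace H χ → ⁅(x : L), y⁆ = χ x • y :=
    fun χ y hy => lie_eq_smul_of_mem_rootSpace hy x
  have hev : ∀ α : H.root, ∃ c : ℤ, c ≠ 0 ∧ (α.1 : H → K) x = ((2 * c : ℤ) : K) := by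
    intro α
    have key : ∀ φ ∈ AddSubmonoid.closure ((rootSystem H).root '' b.support),
        ∃ c : ℕ, φ x = ((2 * c : ℕ) : K) ∧ (c = 0 → φ = 0) := by
      intro φ hφ
      induction hφ using AddSubmonoid.closure_induction with
      | mem φ h =>
        obtain ⟨i, hi, rfl⟩ := h
        exact ⟨1, by simpa using hx ⟨i, hi⟩, by simp⟩
      | zero => exact ⟨0, by simp, by simp⟩
      | add φ ψ _ _ h h' =>
        obtain ⟨c, hc, hc'⟩ := h
        obtain ⟨d, hd, hd'⟩ := h'
        refine ⟨c + d, by rw [LinearMap.add_apply, hc, hd]; push_cast; ring, fun h0 => ?_⟩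
        rw [hc' (by omega), hd' (by omega), add_zero]
    have hne : (rootSystem H).root α ≠ 0 := (rootSystem H).ne_zero α
    rcases b.root_mem_or_neg_mem α with h | h
    · obtain ⟨c, hc, hc'⟩ := key _ h
      refine ⟨c, fun h0 => hne (hc' (by exact_mod_cast h0)), ?_⟩
      have : (rootSystem H).root α x = (α.1 : H → K) x := rfl
      rw [← this, hc]; push_cast; rfl
    · obtain ⟨c, hc, hc'⟩ := key _ h
      refine ⟨-c, fun h0 => hne (neg_eq_zero.1 (hc' (by omega))), ?_⟩
      have : -((α.1 : H → K) x) = ((2 * c : ℕ) : K) := hc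
      push_cast at this ⊢
      linear_combination -this
  have hcor : ∀ i, hh i = (coroot i.1.1 : H) := fun i =>
    IsSl2Triple.h_eq_coroot (LieSubalgebra.isNonZero_coe_root i.1) (ht i) (he i) (hf i)
  have hefij : ∀ i j, i ≠ j → ⁅e i, f j⁆ = 0 := by
    intro i j hij
    have h1 : ⁅e i, f j⁆ ∈ rootSpace H ((i.1.1 : H → K) + (-j.1.1 : LieModule.Weight K H L)) :=
      lie_mem_genWeightSpace_of_mem_genWeightSpace (he i) (hf j)
    by_contra h0
    have hχ : rootSpace H ((i.1.1 : H → K) + (-j.1.1 : LieModule.Weight K H L)) ≠ ⊥ := fun h => by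
      rw [h] at h1; exact h0 ((LieSubmodule.mem_bot _).1 h1)
    let w : LieModule.Weight K H L := ⟨_, hχ⟩
    have hw0 : w.IsNonZero := fun hw => by
      have h2 : (i.1.1 : H → K) = j.1.1 := by
        have h3 : (i.1.1 : H → K) + (-j.1.1 : LieModule.Weight K H L) = 0 := hw
        rw [LieModule.Weight.coe_neg] at h3
        exact add_neg_eq_zero.1 h3
      exact hij (Subtype.ext (Subtype.ext (DFunLike.coe_injective h2)))
    refine b.sub_notMem_range_root i.2 j.2 ⟨⟨w, by simpa using hw0⟩, ?_⟩
    ext y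
    change (i.1.1 : H → K) y + (-j.1.1 : LieModule.Weight K H L) y = i.1.1 y - j.1.1 y
    rw [LieModule.Weight.coe_neg, Pi.neg_apply, sub_eq_add_neg]
  obtain ⟨c, hc⟩ : ∃ c : b.support → K, ∑ i, c i • hh i = x := by
    refine ⟨b.toCoweightBasis.repr x, ?_⟩
    have := congrArg (Subtype.val : H → L) (b.toCoweightBasis.sum_repr x)
    rw [← this, AddSubmonoidClass.coe_finsetSum]
    refine Finset.sum_congr rfl fun i _ => ?_
    rw [hcor]
    simp
  have hdec : ⨆ χ : LieModule.Weight K H L, (LieModule.genWeightSpace L χ).toSubmodule = ⊤ := by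
    rw [← LieSubmodule.top_toSubmodule (R := K) (L := H),
      ← LieModule.iSup_genWeightSpace_eq_top' K H L, LieSubmodule.iSup_toSubmodule]
  refine ⟨x, ∑ i, e i, ∑ i, c i • f i, x.2, ?_, ?_, ?_, ?_, ?_⟩
  · rw [sum_lie]
    rw [← hc]
    refine Finset.sum_congr rfl fun i _ => ?_
    rw [lie_sum, Finset.sum_eq_single i, lie_smul, (ht i).lie_e_f]
    · intro j _ hj; rw [lie_smul, hefij i j hj.symm, smul_zero]
    · simp
  · rw [lie_sum, Finset.smul_sum]
    exact Finset.sum_congr rfl fun i _ => by rw [hbr _ _ (he i), hx]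
  · rw [lie_sum, Finset.smul_sum, ← Finset.sum_neg_distrib]
    refine Finset.sum_congr rfl fun i _ => ?_
    rw [lie_smul, hbr _ _ (hf i), Pi.neg_apply, hx]
    module
  · intro y hy
    have hle : (⊤ : Submodule K L) ≤ H.toSubmodule ⊔
        ⨆ μ : K, ⨆ _ : μ ≠ 0, Module.End.eigenspace (LieAlgebra.ad K L (x : L)) μ := by
      rw [← hdec]
      refine iSup_le fun χ l hl => ?_
      by_cases h0 : χ.IsZero
      · refine Submodule.mem_sup_left ?_
        have h1 : l ∈ (rootSpace H (0 : H → K)) := h0 ▸ hl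
        rwa [← LieSubmodule.mem_toSubmodule, ← LieAlgebra.coe_zeroRootSubalgebra,
          LieAlgebra.zeroRootSubalgebra_eq_of_is_cartan] at h1
      · obtain ⟨c, hc0, hc⟩ := hev ⟨χ, by simpa using h0⟩
        refine Submodule.mem_sup_right (Submodule.mem_iSup_of_mem ((2 * c : ℤ) : K)
          (Submodule.mem_iSup_of_mem (by simpa using hc0) (Module.End.mem_eigenspace_iff.2 ?_)))
        rw [LieAlgebra.ad_apply, hbr _ _ hl, ← hc]
    obtain ⟨y1, hy1, y2, hy2, rfl⟩ := Submodule.mem_sup.1 (hle (Submodule.mem_top (x := y)))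
    have h1 : ⁅(x : L), y1⁆ = 0 := by
      have := trivial_lie_zero H H x ⟨y1, hy1⟩
      exact congrArg Subtype.val this
    rw [lie_add, h1, zero_add] at hy
    have hy2' : y2 ∈ Module.End.eigenspace (LieAlgebra.ad K L (x : L)) 0 :=
      Module.End.mem_eigenspace_iff.2 (by rw [zero_smul]; exact hy)
    rw [Submodule.disjoint_def.1 (Module.End.eigenspaces_iSupIndep _ 0) y2 hy2' hy2, add_zero]
    exact hy1
  · rw [eq_top_iff, ← hdec]
    refine iSup_le fun χ l hl => Submodule.subset_span ?_
    by_cases h0 : χ.IsZero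
    · exact ⟨0, by rw [hbr _ _ hl, h0]; simp⟩
    · obtain ⟨c, -, hc⟩ := hev ⟨χ, by simpa using h0⟩
      exact ⟨c, by rw [hbr _ _ hl, ← hc]⟩
end Principal

section QuotientBySolvableRadical

/-- Graded pieces lift along a linear map that respects the grading. -/
theorem exists_mem_of_iSupIndep {ι M N : Type} [AddCommGroup M] [Module K M] [AddCommGroup N]
    [Module K N] (f : M →ₗ[K] N) (W : ι → Submodule K M) (W' : ι → Submodule K N)
    (hW : ⨆ i, W i = ⊤) (hW' : iSupIndep W') (hf : ∀ i, ∀ m ∈ W i, f m ∈ W' i)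
    (i : ι) (m : M) (hm : f m ∈ W' i) : ∃ m' ∈ W i, f m' = f m := by
  have h1 : m ∈ W i ⊔ ⨆ (j) (_ : j ≠ i), W j := by
    have : (⨆ j, W j) ≤ W i ⊔ ⨆ (j) (_ : j ≠ i), W j := by
      refine iSup_le fun j => ?_
      by_cases hj : j = i
      · subst hj; exact le_sup_left
      · exact le_trans (le_iSup₂_of_le j hj le_rfl) le_sup_right
    rw [hW] at this
    exact this trivial
  obtain ⟨y, hy, z, hz, rfl⟩ := Submodule.mem_sup.1 h1
  refine ⟨y, hy, ?_⟩
  have hz' : f z ∈ ⨆ (j) (_ : j ≠ i), W' j := by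
    have : (⨆ (j) (_ : j ≠ i), W j) ≤ (⨆ (j) (_ : j ≠ i), W' j).comap f :=
      iSup₂_le fun j hj m hm => Submodule.mem_comap.2
        ((le_iSup₂_of_le (f := fun j (_ : j ≠ i) => W' j) j hj le_rfl) (hf j m hm))
    exact this hz
  have hz0 : f z ∈ W' i := by
    have := (W' i).sub_mem hm (hf i y hy)
    simpa using this
  have := (Submodule.disjoint_def.1 (hW' i)) _ hz0 hz'
  rw [map_add, this, add_zero]

variable {L : Type} [LieRing L] [LieAlgebra K L] [FiniteDimensional K L]

theorem isKilling_quotient_radical : LieAlgebra.IsKilling K (L ⧸ LieAlgebra.radical K L) := by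
  rw [← LieAlgebra.hasTrivialRadical_iff_isKilling,
    LieAlgebra.hasTrivialRadical_iff_no_abelian_ideals]
  intro I hI
  let π : L →ₗ⁅K⁆ (L ⧸ LieAlgebra.radical K L) := LieHom.mk (LieSubmodule.Quotient.mk' (LieAlgebra.radical K L)).toLinearMap
    (fun {x y} => LieSubmodule.Quotient.mk_bracket _ _ _)
  have hJ : I.comap π ≤ LieAlgebra.radical K L := by
    rw [← LieAlgebra.LieIdeal.solvable_iff_le_radical]
    obtain ⟨k, hk⟩ := (LieAlgebra.isSolvable_iff K (LieAlgebra.radical K L)).1 inferInstance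
    rw [LieIdeal.derivedSeries_eq_bot_iff] at hk
    have h1 : LieAlgebra.derivedSeriesOfIdeal K L 1 (I.comap π) ≤ LieAlgebra.radical K L := by
      rw [LieAlgebra.derivedSeriesOfIdeal_succ, LieAlgebra.derivedSeriesOfIdeal_zero,
        LieSubmodule.lieIdeal_oper_eq_span, LieSubmodule.lieSpan_le]
      rintro _ ⟨a, b, rfl⟩
      have ha := LieIdeal.mem_comap.1 a.2
      have hb := LieIdeal.mem_comap.1 b.2
      have h0 : ⁅(⟨π a, ha⟩ : I), (⟨π b, hb⟩ : I)⁆ = 0 := trivial_lie_zero I I _ _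
      have h2 : π ⁅(a : L), (b : L)⁆ = 0 := by
        rw [LieHom.map_lie]
        exact congrArg Subtype.val h0
      exact (LieSubmodule.Quotient.mk_eq_zero _).1 h2
    have h2 : LieAlgebra.derivedSeriesOfIdeal K L (k + 1) (I.comap π) = ⊥ := by
      rw [LieAlgebra.derivedSeriesOfIdeal_add]
      exact le_bot_iff.1 (le_trans (LieAlgebra.derivedSeriesOfIdeal_mono h1 k) hk.le)
    exact LieAlgebra.IsSolvable.mk (R := K) ((LieIdeal.derivedSeries_eq_bot_iff _ _).2 h2)
  rw [eq_bot_iff]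
  intro y hy
  obtain ⟨l, rfl⟩ := LieSubmodule.Quotient.surjective_mk' (LieAlgebra.radical K L) y
  have : l ∈ LieAlgebra.radical K L := hJ (LieIdeal.mem_comap.2 hy)
  exact (LieSubmodule.mem_bot _).2 ((LieSubmodule.Quotient.mk_eq_zero _).2 this)

/-- A semisimple Lie algebra is perfect. -/
theorem span_lie_eq_top [LieAlgebra.IsKilling K L] :
    Submodule.span K {l : L | ∃ a b : L, ⁅a, b⁆ = l} = ⊤ := by
  by_contra h
  obtain ⟨ξ, hξ, hle⟩ := Submodule.exists_le_ker_of_lt_top _ (lt_top_iff_ne_top.2 h)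
  have hnd := LieAlgebra.IsKilling.killingForm_nondegenerate K L
  obtain ⟨y, rfl⟩ := (LinearMap.BilinForm.toDual (killingForm K L) hnd).surjective ξ
  have h0 : ∀ a b, killingForm K L y ⁅a, b⁆ = 0 := fun a b =>
    hle (Submodule.subset_span ⟨a, b, rfl⟩)
  have hc : ∀ a : L, ⁅y, a⁆ = 0 := by
    intro a
    apply (LinearMap.BilinForm.toDual (killingForm K L) hnd).injective
    rw [map_zero]
    ext b
    change killingForm K L ⁅y, a⁆ b = 0
    rw [LieModule.traceForm_apply_lie_apply]
    exact h0 a b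
  have hy : y = 0 := by
    have h1 : y ∈ LieAlgebra.center K L := fun a => by rw [← lie_skew, hc, neg_zero]
    rw [LieAlgebra.center_eq_bot] at h1
    exact (LieSubmodule.mem_bot _).1 h1
  exact hξ (by rw [hy, map_zero])

theorem lie_eq_zero_of_lie_lie {t y : L}
    (ht : ⨆ μ : K, (LieAlgebra.ad K L t).eigenspace μ = ⊤) (h : ⁅t, ⁅t, y⁆⁆ = 0) : ⁅t, y⁆ = 0 := by
  obtain ⟨y', hy', he⟩ := exists_mem_of_iSupIndep (LieAlgebra.ad K L t)
    (fun μ : K => (LieAlgebra.ad K L t).eigenspace μ)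
    (fun μ : K => (LieAlgebra.ad K L t).eigenspace μ) ht
    (Module.End.eigenspaces_iSupIndep _) (fun μ m hm => by
      rw [Module.End.mem_eigenspace_iff] at hm ⊢
      rw [hm, map_smul, hm]) 0 y (by
      rw [Module.End.mem_eigenspace_iff]
      simpa using h)
  rw [Module.End.mem_eigenspace_iff, zero_smul] at hy'
  rw [hy'] at he
  exact he.symm

/-- A Cartan subalgebra containing a given ad-semisimple element. -/
theorem exists_cartan_centralizing (t : L)
    (ht : ⨆ μ : K, (LieAlgebra.ad K L t).eigenspace μ = ⊤) :
    ∃ H : LieSubalgebra K L, H.IsCartanSubalgebra ∧ ∀ y ∈ H, ⁅t, y⁆ = 0 := by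
  let C : LieSubalgebra K L :=
    { carrier := {y | ⁅t, y⁆ = 0}
      add_mem' := fun {a b} ha hb => by
        change ⁅t, a + b⁆ = 0
        rw [lie_add, show ⁅t, a⁆ = 0 from ha, show ⁅t, b⁆ = 0 from hb, add_zero]
      zero_mem' := lie_zero t
      smul_mem' := fun c a ha => by
        change ⁅t, c • a⁆ = 0
        rw [lie_smul, show ⁅t, a⁆ = 0 from ha, smul_zero]
      lie_mem' := fun {a b} ha hb => by
        change ⁅t, ⁅a, b⁆⁆ = 0
        rw [leibniz_lie, show ⁅t, a⁆ = 0 from ha, show ⁅t, b⁆ = 0 from hb, zero_lie, lie_zero,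
          add_zero] }
  have hCm : ∀ y, y ∈ C ↔ ⁅t, y⁆ = 0 := fun y => Iff.rfl
  have : Infinite K := inferInstance
  obtain ⟨x, hx⟩ := LieAlgebra.exists_isCartanSubalgebra_engel K C
  set H' := LieSubalgebra.engel K x with hH'
  have htC : t ∈ C := lie_self t
  have htH : (⟨t, htC⟩ : C) ∈ H' := by
    rw [← hx.self_normalizing, LieSubalgebra.mem_normalizer_iff]
    intro y hy
    have : ⁅(⟨t, htC⟩ : C), y⁆ = 0 := Subtype.ext y.2
    rw [this]
    exact H'.zero_mem
  refine ⟨H'.map C.incl, ⟨?_, ?_⟩, ?_⟩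
  · have h2 := hx.nilpotent
    let φ : H' →ₗ⁅K⁆ H'.map C.incl :=
      { toFun := fun y => ⟨y.1.1, y.1, y.2, rfl⟩
        map_add' := fun _ _ => rfl
        map_smul' := fun _ _ => rfl
        map_lie' := rfl }
    refine Function.Surjective.lieAlgebra_isNilpotent (f := φ) ?_
    rintro ⟨_, y, hy, rfl⟩
    exact ⟨⟨y, hy⟩, rfl⟩
  · refine le_antisymm ?_ (LieSubalgebra.le_normalizer _)
    intro n hn
    rw [LieSubalgebra.mem_normalizer_iff] at hn
    have h1 : ⁅t, n⁆ ∈ C := by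
      obtain ⟨z, -, hz⟩ := hn t ⟨⟨t, htC⟩, htH, rfl⟩
      have : ⁅n, t⁆ ∈ C := hz ▸ z.2
      rw [← lie_skew]
      exact C.neg_mem this
    have hnC : n ∈ C := lie_eq_zero_of_lie_lie ht h1
    refine ⟨⟨n, hnC⟩, ?_, rfl⟩
    change _ ∈ H'
    rw [← hx.self_normalizing, LieSubalgebra.mem_normalizer_iff]
    intro y hy
    obtain ⟨z, hz, hz'⟩ := hn y ⟨y, hy, rfl⟩
    have : z = ⁅(⟨n, hnC⟩ : C), y⁆ := Subtype.ext hz'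
    rw [← this]
    exact hz
  · rintro _ ⟨y, -, rfl⟩
    exact y.2

end QuotientBySolvableRadical

section Grading
variable {L : Type} [LieRing L] [LieAlgebra K L] [FiniteDimensional K L]

/-- The elements on which `ad x` acts by the scalar `c` modulo the radical. -/
def eigenMod (x : L) (c : K) : Submodule K L where
  carrier := {l | ⁅x, l⁆ - c • l ∈ LieAlgebra.radical K L}
  add_mem' {a b} ha hb := by
    have := (LieAlgebra.radical K L).add_mem ha hb
    change ⁅x, a + b⁆ - c • (a + b) ∈ LieAlgebra.radical K L
    rw [lie_add, smul_add, add_sub_add_comm]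
    exact this
  zero_mem' := by simp
  smul_mem' d a ha := by
    have := (LieAlgebra.radical K L).smul_mem d ha
    change ⁅x, d • a⁆ - c • d • a ∈ LieAlgebra.radical K L
    rw [lie_smul, smul_comm c d, ← smul_sub]
    exact this

theorem mem_eigenMod {x : L} {c : K} {l : L} :
    l ∈ eigenMod x c ↔ ⁅x, l⁆ - c • l ∈ LieAlgebra.radical K L := Iff.rfl

theorem mem_eigenMod_iff {x : L} {c : K} {l : L} :
    l ∈ eigenMod x c ↔
      (LieAlgebra.ad K (L ⧸ LieAlgebra.radical K L)
        (LieSubmodule.Quotient.mk (N := LieAlgebra.radical K L) x))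
        (LieSubmodule.Quotient.mk (N := LieAlgebra.radical K L) l) =
      c • (LieSubmodule.Quotient.mk (N := LieAlgebra.radical K L) l) := by
  rw [mem_eigenMod, ← LieSubmodule.Quotient.mk_eq_zero (LieAlgebra.radical K L), map_sub,
    sub_eq_zero]
  rfl

theorem iSup_eigenMod {ι : Type} [Nonempty ι] (x : L) (c : ι → K)
    (h : ⨆ i, (LieAlgebra.ad K (L ⧸ LieAlgebra.radical K L)
      (LieSubmodule.Quotient.mk (N := LieAlgebra.radical K L) x)).eigenspace (c i) = ⊤) :
    ⨆ i, eigenMod x (c i) = ⊤ := by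
  set R := LieAlgebra.radical K L
  let π : L →ₗ[K] L ⧸ R := (LieSubmodule.Quotient.mk' R).toLinearMap
  have hsur : Function.Surjective π := LieSubmodule.Quotient.surjective_mk' R
  have h1 : ∀ i, eigenMod x (c i) = ((LieAlgebra.ad K (L ⧸ R)
      (LieSubmodule.Quotient.mk (N := R) x)).eigenspace (c i)).comap π := by
    intro i
    ext l
    rw [mem_eigenMod_iff, Submodule.mem_comap, Module.End.mem_eigenspace_iff]
    rfl
  simp_rw [h1]
  have hmap : Submodule.map π (⨆ i, Submodule.comap π ((LieAlgebra.ad K (L ⧸ R)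
      (LieSubmodule.Quotient.mk (N := R) x)).eigenspace (c i))) = ⊤ := by
    rw [Submodule.map_iSup]
    simp_rw [Submodule.map_comap_eq_of_surjective hsur]
    exact h
  have hker : LinearMap.ker π ≤ ⨆ i, Submodule.comap π ((LieAlgebra.ad K (L ⧸ R)
      (LieSubmodule.Quotient.mk (N := R) x)).eigenspace (c i)) := by
    inhabit ι
    exact le_iSup_of_le default (fun z hz => by
      rw [Submodule.mem_comap, LinearMap.mem_ker.1 hz]; exact Submodule.zero_mem _)
  rw [← Submodule.comap_map_eq_self hker, hmap, Submodule.comap_top]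

theorem exists_grading (t : L) (ht : ⨆ μ : K, (LieAlgebra.ad K L t).eigenspace μ = ⊤) :
    ∃ x e f : L, ⁅t, x⁆ = 0 ∧ ⁅e, f⁆ - x ∈ LieAlgebra.radical K L ∧
      ⁅x, e⁆ - (2 : K) • e ∈ LieAlgebra.radical K L ∧
      ⁅x, f⁆ + (2 : K) • f ∈ LieAlgebra.radical K L ∧
      (⨆ c : ℤ, eigenMod x ((2 * c : ℤ) : K) = ⊤) ∧
      (∀ y, ⁅x, y⁆ ∈ LieAlgebra.radical K L → ⨆ μ : K, eigenMod y μ = ⊤) ∧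
      (∀ y y', ⁅x, y⁆ ∈ LieAlgebra.radical K L → ⁅x, y'⁆ ∈ LieAlgebra.radical K L →
        ⁅y, y'⁆ ∈ LieAlgebra.radical K L) ∧
      Submodule.span K {l : L | ∃ a b : L, ⁅a, b⁆ = l} ⊔
        (LieAlgebra.radical K L).toSubmodule = ⊤ := by
  set R := LieAlgebra.radical K L with hR
  have hK : LieAlgebra.IsKilling K (L ⧸ R) := isKilling_quotient_radical
  let π : L →ₗ[K] L ⧸ R := (LieSubmodule.Quotient.mk' R).toLinearMap
  have hsur : Function.Surjective π := LieSubmodule.Quotient.surjective_mk' R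
  have hπ0 : ∀ l, π l = 0 ↔ l ∈ R := fun l => LieSubmodule.Quotient.mk_eq_zero R
  have hπb : ∀ a b, π ⁅a, b⁆ = ⁅π a, π b⁆ := fun a b => LieSubmodule.Quotient.mk_bracket _ _ _
  have htπ : ∀ μ : K, ∀ m ∈ (LieAlgebra.ad K L t).eigenspace μ,
      π m ∈ (LieAlgebra.ad K (L ⧸ R) (π t)).eigenspace μ := by
    intro μ m hm
    rw [Module.End.mem_eigenspace_iff, LieAlgebra.ad_apply] at hm ⊢
    rw [← hπb, hm, map_smul]
  have ht' : ⨆ μ : K, (LieAlgebra.ad K (L ⧸ R) (π t)).eigenspace μ = ⊤ := by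
    rw [eq_top_iff, ← LinearMap.range_eq_top.2 hsur, ← Submodule.map_top, ← ht, Submodule.map_iSup]
    exact iSup_mono fun μ => Submodule.map_le_iff_le_comap.2 (htπ μ)
  obtain ⟨H, hH, hHt⟩ := exists_cartan_centralizing (π t) ht'
  obtain ⟨x', e', f', hx'H, hef, hxe, hxf, hxc, hgen⟩ := exists_principal (K := K) H
  obtain ⟨e, rfl⟩ := hsur e'
  obtain ⟨f, rfl⟩ := hsur f'
  obtain ⟨x0, rfl⟩ := hsur x'
  obtain ⟨x, hx, hxx⟩ := exists_mem_of_iSupIndep π _ _ ht (Module.End.eigenspaces_iSupIndep _) htπ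
    0 x0 (by rw [Module.End.mem_eigenspace_iff, zero_smul]; exact hHt _ hx'H)
  rw [← hxx] at hx'H hef hxe hxf hxc hgen
  rw [Module.End.mem_eigenspace_iff, zero_smul] at hx
  have hyH : ∀ y, ⁅x, y⁆ ∈ R → π y ∈ H := fun y hy => hxc _ (by
    rw [← hπb, hπ0]; exact hy)
  refine ⟨x, e, f, hx, ?_, ?_, ?_, ?_, ?_, ?_, ?_⟩
  · rw [← hπ0, map_sub, hπb, hef, sub_self]
  · rw [← hπ0, map_sub, hπb, map_smul, hxe, sub_self]
  · rw [← hπ0, map_add, hπb, map_smul, hxf, neg_add_cancel]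
  · refine iSup_eigenMod x _ ?_
    rw [eq_top_iff, ← hgen, Submodule.span_le]
    rintro l ⟨c, hc⟩
    refine (le_iSup (fun c : ℤ => (LieAlgebra.ad K (L ⧸ R) (π x)).eigenspace ((2 * c : ℤ) : K)) c) ?_
    rw [Module.End.mem_eigenspace_iff]
    exact hc
  · intro y hy
    refine iSup_eigenMod y (fun μ => μ) ?_
    have := LieAlgebra.IsKilling.isSemisimple_ad_of_mem_isCartanSubalgebra (K := K) (hyH y hy)
    exact this.iSup_eigenspace_eq_top
  · intro y y' hy hy'
    rw [← hπ0, hπb]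
    have : ⁅(⟨_, hyH y hy⟩ : H), (⟨_, hyH y' hy'⟩ : H)⁆ = 0 := trivial_lie_zero H H _ _
    exact congrArg Subtype.val this
  · have h1 : Submodule.map π (Submodule.span K {l : L | ∃ a b : L, ⁅a, b⁆ = l} ⊔
        R.toSubmodule) = ⊤ := by
      rw [eq_top_iff, ← span_lie_eq_top (K := K) (L := L ⧸ R), Submodule.span_le]
      rintro _ ⟨a, b, rfl⟩
      obtain ⟨a, rfl⟩ := hsur a
      obtain ⟨b, rfl⟩ := hsur b
      exact ⟨⁅a, b⁆, Submodule.mem_sup_left (Submodule.subset_span ⟨a, b, rfl⟩), hπb a b⟩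
    have hker : LinearMap.ker π ≤ Submodule.span K {l : L | ∃ a b : L, ⁅a, b⁆ = l} ⊔
        R.toSubmodule := fun z hz => Submodule.mem_sup_right ((hπ0 z).1 hz)
    rw [← Submodule.comap_map_eq_self hker, h1, Submodule.comap_top]

end Grading

section OddRadical
attribute [local instance] LieRing.ofAssociativeRing
variable {L : Type} [LieRing L] [LieAlgebra K L] [FiniteDimensional K L]

/-- In a Lie algebra all of whose abelian ideals are central, a grading element of a principal
`sl₂` has only odd eigenvalues on the radical modulo the centre. -/
theorem mem_center_of_even (hab : ∀ I : LieIdeal K L, IsLieAbelian I → I ≤ LieAlgebra.center K L)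
    {x e f : L} (hef : ⁅e, f⁆ - x ∈ LieAlgebra.radical K L)
    (hxe : ⁅x, e⁆ - (2 : K) • e ∈ LieAlgebra.radical K L)
    (hxf : ⁅x, f⁆ + (2 : K) • f ∈ LieAlgebra.radical K L)
    (hgen : ⨆ c : ℤ, eigenMod x ((2 * c : ℤ) : K) = ⊤)
    (hcom : ∀ y y', ⁅x, y⁆ ∈ LieAlgebra.radical K L → ⁅x, y'⁆ ∈ LieAlgebra.radical K L →
        ⁅y, y'⁆ ∈ LieAlgebra.radical K L)
    (n : ℤ) (r : L) (hr : r ∈ LieAlgebra.radical K L)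
    (hxr : ⁅x, r⁆ - ((2 * n : ℤ) : K) • r ∈ LieAlgebra.center K L) :
    r ∈ LieAlgebra.center K L := by
  set R := LieAlgebra.radical K L with hR
  have hRR : ∀ a ∈ R, ∀ b ∈ R, ⁅a, b⁆ ∈ LieAlgebra.center K L := fun a ha b hb =>
    lie_radical_le_center hab (LieSubmodule.lie_mem_lie ha hb)
  let N : LieSubmodule K L R := LieSubmodule.comap (LieSubmodule.incl R) (LieAlgebra.center K L)
  let φ : L →ₗ⁅K⁆ Module.End K (R ⧸ N) := LieModule.toEnd K L (R ⧸ N)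
  let π : R →ₗ[K] R ⧸ N := (LieSubmodule.Quotient.mk' N).toLinearMap
  have hsur : Function.Surjective π := LieSubmodule.Quotient.surjective_mk' N
  have hπ0 : ∀ s : R, π s = 0 ↔ (s : L) ∈ LieAlgebra.center K L := fun s =>
    LieSubmodule.Quotient.mk_eq_zero N
  have hφ : ∀ l s, φ l (π s) = π ⁅l, s⁆ := fun l s => rfl
  have hφR : ∀ l ∈ R, φ l = 0 := by
    intro l hl
    ext u
    obtain ⟨s, rfl⟩ := hsur u
    rw [hφ, LinearMap.zero_apply, hπ0]
    exact hRR l hl s s.2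
  have hφeq : ∀ l l', l - l' ∈ R → φ l = φ l' := fun l l' h => by
    rw [← sub_eq_zero, ← map_sub, hφR _ h]
  have hφb : ∀ a b u, φ ⁅a, b⁆ u = φ a (φ b u) - φ b (φ a u) := by
    intro a b u
    rw [LieHom.map_lie]; rfl
  have hsl : SlTwo (φ x) (φ e) (φ f) := by
    refine SlTwo.of_finiteDimensional ?_ ?_ ?_
    · intro v
      rw [← hφeq _ _ hef, hφb]; abel
    · intro v
      have := congrArg (fun a => a v) (hφeq _ _ hxe)
      simp only [hφb, map_smul, LinearMap.smul_apply] at this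
      rw [← this]; abel
    · intro v
      have := congrArg (fun a => a v) (hφeq ⁅x, f⁆ (-((2 : K) • f)) (by rwa [sub_neg_eq_add]))
      simp only [hφb, map_smul, map_neg, LinearMap.neg_apply, LinearMap.smul_apply] at this
      rw [sub_eq_iff_eq_add] at this
      rw [this]; abel
  have hev : ∀ (c : ℤ) l, l ∈ eigenMod x ((2 * c : ℤ) : K) →
      ∀ u, φ x (φ l u) = φ l (φ x u) + ((2 * c : ℤ) : K) • φ l u := by
    intro c l hl u
    have := congrArg (fun a => a u) (hφeq _ _ (mem_eigenMod.1 hl))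
    simp only [hφb, map_smul, LinearMap.smul_apply] at this
    rw [← this]; abel
  let X2 : Module.End K (Module.End K (R ⧸ N)) :=
    LinearMap.mulLeft K (φ x) - LinearMap.mulRight K (φ x)
  have hlift : ∀ l, (∀ u, φ x (φ l u) = φ l (φ x u)) → ∃ l', ⁅x, l'⁆ ∈ R ∧ φ l' = φ l := by
    intro l hl
    have hinj : Function.Injective fun m : ℤ => ((2 * m : ℤ) : K) := fun a b h => by
      have : (2 * a : ℤ) = 2 * b := Int.cast_injective h
      omega
    obtain ⟨l', hl', h⟩ := exists_mem_of_iSupIndep (φ : L →ₗ[K] Module.End K (R ⧸ N))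
      (fun c : ℤ => eigenMod x ((2 * c : ℤ) : K)) (fun c : ℤ => X2.eigenspace ((2 * c : ℤ) : K))
      hgen ((Module.End.eigenspaces_iSupIndep X2).comp hinj) (fun c l hl => by
        rw [Module.End.mem_eigenspace_iff]
        ext1 u
        change φ x (φ l u) - φ l (φ x u) = ((2 * c : ℤ) : K) • φ l u
        rw [hev c l hl]; abel) 0 l (by
        rw [Module.End.mem_eigenspace_iff]
        ext1 u
        change φ x (φ l u) - φ l (φ x u) = ((2 * 0 : ℤ) : K) • φ l u
        rw [hl]; simp)
    refine ⟨l', ?_, h⟩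
    have := mem_eigenMod.1 hl'
    simpa using this
  let ω₀ : R →ₗ[K] R →ₗ[K] L :=
    LinearMap.mk₂ K (fun a b => ⁅(a : L), (b : L)⁆) (fun a b c => by simp) (fun a b c => by simp)
      (fun a b c => by simp) (fun a b c => by simp)
  let ω : (R ⧸ N) →ₗ[K] (R ⧸ N) →ₗ[K] L := ω₀.liftQ₂ N.toSubmodule N.toSubmodule
    (fun a ha => LinearMap.mem_ker.2 (LinearMap.ext fun s => by
      change ⁅(a : L), (s : L)⁆ = 0
      rw [← lie_skew, show ⁅(s : L), (a : L)⁆ = 0 from ha s, neg_zero]))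
    fun b hb => LinearMap.mem_ker.2 (LinearMap.ext fun a => hb a)
  have hω : ∀ a b : R, ω (π a) (π b) = ⁅(a : L), (b : L)⁆ := fun a b => rfl
  have key := no_even_eigenvector (A := LinearMap.range (φ : L →ₗ[K] Module.End K (R ⧸ N)))
    (X := φ x) (E := φ e) (F := φ f) ?_ ⟨e, rfl⟩ ⟨f, rfl⟩ hsl ?_ ?_ ω ?_ ⟨x, rfl⟩ ?_ ?_ n (π ⟨r, hr⟩) ?_
  · exact (hπ0 _).1 key
  · rintro _ ⟨a, rfl⟩ _ ⟨b, rfl⟩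
    exact ⟨⁅a, b⁆, LieHom.map_lie φ a b⟩
  · rintro _ ⟨a, rfl⟩
    have : (⊤ : Submodule K L) ≤ (Submodule.span K {a |
        a ∈ LinearMap.range (φ : L →ₗ[K] Module.End K (R ⧸ N)) ∧ ∃ c : ℤ,
        ∀ u, φ x (a u) = a (φ x u) + ((2 * c : ℤ) : K) • a u}).comap
        (φ : L →ₗ[K] Module.End K (R ⧸ N)) := by
      rw [← hgen]
      exact iSup_le fun c l hl => Submodule.subset_span ⟨⟨l, rfl⟩, c, hev c l hl⟩
    exact this (Submodule.mem_top (x := a))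
  · rintro _ ⟨a, rfl⟩ _ ⟨b, rfl⟩ ha hb u
    obtain ⟨a', ha', hφa⟩ := hlift a ha
    obtain ⟨b', hb', hφb'⟩ := hlift b hb
    change φ a (φ b u) = φ b (φ a u)
    rw [← hφa, ← hφb', ← sub_eq_zero, ← hφb, hφR _ (hcom _ _ ha' hb')]
    rfl
  · intro u
    obtain ⟨s, rfl⟩ := hsur u
    rw [hω, lie_self]
  · rintro _ ⟨a, rfl⟩ u w
    obtain ⟨u, rfl⟩ := hsur u
    obtain ⟨w, rfl⟩ := hsur w
    change ω (φ a _) _ = - ω _ (φ a _)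
    rw [hφ, hφ, hω, hω, LieSubmodule.coe_bracket, LieSubmodule.coe_bracket, ← add_eq_zero_iff_eq_neg,
      ← leibniz_lie]
    exact hRR _ u.2 _ w.2 a
  · intro P hP hiso
    let I : LieIdeal K L :=
      { carrier := {l | ∃ h : l ∈ R, π ⟨l, h⟩ ∈ P}
        add_mem' := fun {a b} ⟨ha, ha'⟩ ⟨hb, hb'⟩ => ⟨R.add_mem ha hb, P.add_mem ha' hb'⟩
        zero_mem' := ⟨R.zero_mem, P.zero_mem⟩
        smul_mem' := fun c a ⟨ha, ha'⟩ => ⟨R.smul_mem c ha, P.smul_mem c ha'⟩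
        lie_mem := fun {l a} ⟨ha, ha'⟩ => ⟨R.lie_mem ha, hP (φ l) ⟨l, rfl⟩ _ ha'⟩ }
    have hI : IsLieAbelian I := ⟨fun a b => Subtype.ext (by
      obtain ⟨a, ha, ha'⟩ := a
      obtain ⟨b, hb, hb'⟩ := b
      exact hiso _ ha' _ hb')⟩
    have hIc := hab I hI
    rw [eq_bot_iff]
    intro u hu
    obtain ⟨s, rfl⟩ := hsur u
    exact (Submodule.mem_bot K).2 ((hπ0 s).2 (hIc ⟨s.2, hu⟩))
  · rw [hφ, ← sub_eq_zero, ← map_smul, ← map_sub, hπ0]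
    exact hxr

end OddRadical

section SemisimpleCentralizer
variable {L : Type} [LieRing L] [LieAlgebra K L] [FiniteDimensional K L]

/-- The nilpotent part of an inner derivation vanishes as soon as it centralizes an adapted grading
element. -/
theorem iSup_eigenspace_ad_eq_top
    (hab : ∀ I : LieIdeal K L, IsLieAbelian I → I ≤ LieAlgebra.center K L)
    {x y : L} (hxy : ⁅x, y⁆ = 0)
    (hgen : ⨆ c : ℤ, eigenMod x ((2 * c : ℤ) : K) = ⊤)
    (hodd : ∀ (n : ℤ) (r : L), r ∈ LieAlgebra.radical K L →
      ⁅x, r⁆ - ((2 * n : ℤ) : K) • r ∈ LieAlgebra.center K L → r ∈ LieAlgebra.center K L)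
    (hss : ⨆ μ : K, eigenMod y μ = ⊤)
    (hperf : Submodule.span K {l : L | ∃ a b : L, ⁅a, b⁆ = l} ⊔
        (LieAlgebra.radical K L).toSubmodule = ⊤) :
    ⨆ μ : K, (LieAlgebra.ad K L y).eigenspace μ = ⊤ := by
  set R := LieAlgebra.radical K L with hR
  set Z := LieAlgebra.center K L with hZ
  have hZm : ∀ z, z ∈ Z ↔ ∀ l, ⁅l, z⁆ = 0 := fun z => Iff.rfl
  have hZm' : ∀ z ∈ Z, ∀ l : L, ⁅z, l⁆ = 0 := fun z hz l => by
    rw [← lie_skew, (hZm z).1 hz, neg_zero]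
  have hRR : ∀ a ∈ R, ∀ b ∈ R, ⁅a, b⁆ ∈ Z := fun a ha b hb =>
    lie_radical_le_center hab (LieSubmodule.lie_mem_lie ha hb)
  set D : Module.End K L := LieAlgebra.ad K L y with hD
  have hDl : ∀ l, D l = ⁅y, l⁆ := fun l => rfl
  obtain ⟨n, hn, s, hs, hnil, hsem, hns⟩ := D.exists_isNilpotent_isSemisimple
  have hcomm : ∀ P : Module.End K L, Commute D P → Commute n P := fun P hP => by
    refine Algebra.adjoin_induction (fun a ha => ?_) (fun r => ?_) (fun a b _ _ ha hb => ha.add_left hb)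
      (fun a b _ _ ha hb => ha.mul_left hb) hn
    · rw [Set.mem_singleton_iff.1 ha]; exact hP
    · exact Algebra.commute_algebraMap_left r P
  have hDs : Commute D s := by
    refine Algebra.adjoin_induction (fun a ha => ?_) (fun r => ?_)
      (fun a b _ _ ha hb => ha.add_right hb) (fun a b _ _ ha hb => ha.mul_right hb) hs
    · rw [Set.mem_singleton_iff.1 ha]
    · exact Algebra.commute_algebraMap_right r D
  have hnl : ∀ μ, ∀ l ∈ D.maxGenEigenspace μ, n l = ⁅y, l⁆ - μ • l := by
    intro μ l hl
    have h1 : s l = μ • l :=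
      Module.End.apply_eq_of_mem_of_comm_of_isFinitelySemisimple_of_isNil hl hDs
        ((Module.End.isFinitelySemisimple_iff_isSemisimple).2 hsem) (by rw [hns, add_sub_cancel_right]; exact hnil)
    rw [← h1, ← hDl, hns, LinearMap.add_apply, add_sub_cancel_right]
  have htop := D.iSup_maxGenEigenspace_eq_top
  have hder : ∀ a b, n ⁅a, b⁆ = ⁅n a, b⁆ + ⁅a, n b⁆ := by
    intro a b
    have ha : a ∈ ⨆ μ, D.maxGenEigenspace μ := htop ▸ Submodule.mem_top
    have hb : b ∈ ⨆ μ, D.maxGenEigenspace μ := htop ▸ Submodule.mem_top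
    induction ha using Submodule.iSup_induction' with
    | mem μ a ha =>
      induction hb using Submodule.iSup_induction' with
      | mem ν b hb =>
        have h1 := LieModule.lie_mem_maxGenEigenspace_toEnd ha hb
        rw [hnl _ _ ha, hnl _ _ hb, hnl _ _ h1, leibniz_lie, lie_sub, sub_lie, lie_smul, smul_lie,
          add_smul]
        abel
      | zero => simp
      | add b b' _ _ h h' => rw [lie_add, map_add, map_add, lie_add, lie_add, h, h']; abel
    | zero => simp
    | add b b' _ _ h h' => rw [add_lie, map_add, map_add, add_lie, add_lie, h, h']; abel
  have hnR : ∀ l, n l ∈ R := by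
    intro l
    have hl : l ∈ ⨆ μ, D.maxGenEigenspace μ := htop ▸ Submodule.mem_top
    induction hl using Submodule.iSup_induction' with
    | mem μ l hl =>
      let π : L →ₗ[K] L ⧸ R := (LieSubmodule.Quotient.mk' R).toLinearMap
      have hπD : ∀ l, π (D l) = LieAlgebra.ad K (L ⧸ R) (π y) (π l) := fun l => rfl
      have hπ : ∀ (ν : K) (k : ℕ) l, π (((D - algebraMap K _ ν) ^ k) l) =
          ((LieAlgebra.ad K (L ⧸ R) (π y) - algebraMap K _ ν) ^ k) (π l) := by
        intro ν k
        induction k with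
        | zero => intro l; rfl
        | succ k ih =>
          intro l
          rw [pow_succ, Module.End.mul_apply, ih, pow_succ, Module.End.mul_apply]
          rfl
      obtain ⟨l', hl', hll⟩ := exists_mem_of_iSupIndep π (fun μ : K => eigenMod y μ)
        (fun μ : K => (LieAlgebra.ad K (L ⧸ R) (π y)).maxGenEigenspace μ) hss
        (Module.End.independent_maxGenEigenspace _) (fun μ m hm => by
          refine Module.End.mem_maxGenEigenspace _ _ _ |>.2 ⟨1, ?_⟩
          have := mem_eigenMod_iff.1 hm
          rw [pow_one]
          change LieAlgebra.ad K (L ⧸ R) (π y) (π m) - μ • π m = 0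
          rw [sub_eq_zero]; exact this) μ l (by
          obtain ⟨k, hk⟩ := (Module.End.mem_maxGenEigenspace _ _ _).1 hl
          refine (Module.End.mem_maxGenEigenspace _ _ _).2 ⟨k, ?_⟩
          have := hπ μ k l
          rw [show ((D - algebraMap K _ μ) ^ k) l = 0 from hk, map_zero] at this
          exact this.symm)
      have h1 : l - l' ∈ R := (LieSubmodule.Quotient.mk_eq_zero R).1
        (show π (l - l') = 0 by rw [map_sub, hll, sub_self])
      have h2 := R.add_mem (mem_eigenMod.1 hl') (R.sub_mem (R.lie_mem (x := y) h1) (R.smul_mem μ h1))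
      rw [hnl μ l hl]
      rwa [lie_sub, smul_sub, sub_sub_sub_comm, add_sub_cancel] at h2
    | zero => rw [map_zero]; exact R.zero_mem
    | add b b' _ _ h h' => rw [map_add]; exact R.add_mem h h'
  have hnZ : ∀ z ∈ Z, n z = 0 := by
    intro z hz
    have h1 : D z = 0 := (hZm z).1 hz y
    rw [hnl 0 z ((Module.End.mem_maxGenEigenspace _ _ _).2 ⟨1, by simpa using h1⟩), zero_smul,
      sub_zero, ← hDl, h1]
  have hnJ : ∀ (k : ℕ) (J : LieIdeal K L), J ≤ R → (∀ r ∈ J, (n ^ k) r ∈ Z) →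
      ∀ r ∈ J, n r ∈ Z := by
    intro k
    induction k with
    | zero => exact fun J _ h r hr => by rw [hnZ r (h r hr)]; exact Z.zero_mem
    | succ k ih =>
      intro J hJ h
      let I : LieIdeal K L :=
        { J.toSubmodule.map n ⊔ Z.toSubmodule with
          lie_mem := fun {l _} hl => by
            obtain ⟨_, ⟨r, hr, rfl⟩, z, hz, rfl⟩ := Submodule.mem_sup.1 hl
            rw [lie_add, (hZm z).1 hz, add_zero, ← sub_eq_of_eq_add' (hder l r)]
            exact Submodule.sub_mem _ (Submodule.mem_sup_left ⟨_, J.lie_mem hr, rfl⟩)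
              (Submodule.mem_sup_right (hRR _ (hnR l) _ (hJ hr))) }
      have hnI : ∀ r ∈ J, n r ∈ I := fun r hr => Submodule.mem_sup_left ⟨r, hr, rfl⟩
      have h2 : ∀ r ∈ J, n (n r) ∈ Z := fun r hr => ih I
        (show J.toSubmodule.map n ⊔ Z.toSubmodule ≤ R.toSubmodule from
          sup_le (Submodule.map_le_iff_le_comap.2 fun r _ => hnR r)
            (LieAlgebra.center_le_radical K L))
        (fun l hl => by
          obtain ⟨_, ⟨r, hr, rfl⟩, z, hz, rfl⟩ := Submodule.mem_sup.1 hl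
          rw [map_add, ← Module.End.mul_apply, ← pow_succ]
          refine Z.add_mem (h r hr) ?_
          cases k with
          | zero => exact hz
          | succ k => rw [pow_succ, Module.End.mul_apply, hnZ z hz, map_zero]; exact Z.zero_mem)
        _ (hnI r hr)
      refine fun r hr => hab I ⟨fun a b => Subtype.ext ?_⟩ (hnI r hr)
      obtain ⟨_, ha⟩ := a
      obtain ⟨_, hb⟩ := b
      obtain ⟨_, ⟨r, hr, rfl⟩, z, hz, rfl⟩ := Submodule.mem_sup.1 ha
      obtain ⟨_, ⟨r', hr', rfl⟩, z', hz', rfl⟩ := Submodule.mem_sup.1 hb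
      change ⁅n r + z, n r' + z'⁆ = 0
      rw [lie_add, (hZm z').1 hz', add_lie, hZm' z hz, add_zero, add_zero,
        ← sub_eq_of_eq_add' (hder (n r) r'), hnZ _ (hRR _ (hnR r) _ (hJ hr')),
        hZm' _ (h2 r hr), sub_zero]
  have hnRZ : ∀ r ∈ R, n r ∈ Z := by
    obtain ⟨k, hk⟩ := hnil
    exact hnJ k R le_rfl fun r _ => by rw [hk]; exact Z.zero_mem
  have hxn : ∀ l, ⁅x, n l⁆ = n ⁅x, l⁆ := by
    intro l
    have h1 : Commute D (LieAlgebra.ad K L x) := by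
      ext l
      change ⁅y, ⁅x, l⁆⁆ = ⁅x, ⁅y, l⁆⁆
      rw [leibniz_lie x, hxy, zero_lie, zero_add]
    exact (LinearMap.congr_fun (hcomm _ h1).eq l).symm
  have hnLZ : ∀ l, n l ∈ Z := by
    intro l
    have hl : l ∈ ⨆ c : ℤ, eigenMod x ((2 * c : ℤ) : K) := hgen ▸ Submodule.mem_top
    refine map_mem_of_mem_iSup n (fun c l hl => ?_) hl
    refine hodd c _ (hnR l) ?_
    rw [hxn, ← map_smul, ← map_sub]
    exact hnRZ _ (mem_eigenMod.1 hl)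
  have hnb : ∀ a b, n ⁅a, b⁆ = 0 := fun a b => by
    rw [hder, hZm' _ (hnLZ a), (hZm _).1 (hnLZ b), add_zero]
  have hnr : ∀ r ∈ R, n r = 0 := by
    let P : Module.End K R := LieModule.toEnd K L R x
    have hP0 : ∀ r : R, ⁅x, (r : L)⁆ ∈ Z → (r : L) ∈ Z := fun r h => hodd 0 r r.2 (by simpa using h)
    have hdis : Disjoint (LinearMap.range P) (LinearMap.ker P) := by
      rw [Submodule.disjoint_def]
      rintro _ ⟨r, rfl⟩ hr
      have h1 : ⁅x, ((P r : R) : L)⁆ = 0 := congrArg Subtype.val (LinearMap.mem_ker.1 hr)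
      exact Subtype.ext ((hZm _).1 (hP0 r (hP0 (P r) (by rw [h1]; exact Z.zero_mem))) x)
    have htop := Submodule.eq_top_of_disjoint _ _ P.finrank_range_add_finrank_ker.ge hdis
    intro r hr
    obtain ⟨_, ⟨u, rfl⟩, v, hv, huv⟩ := Submodule.mem_sup.1 (htop ▸ Submodule.mem_top (x := (⟨r, hr⟩ : R)))
    have h1 : ⁅x, (v : L)⁆ = 0 := congrArg Subtype.val (LinearMap.mem_ker.1 hv)
    rw [show r = ⁅x, (u : L)⁆ + v from (congrArg Subtype.val huv).symm, map_add, hnb,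
      hnZ _ (hP0 v (by rw [h1]; exact Z.zero_mem)), add_zero]
  have hn0 : n = 0 := by
    rw [← LinearMap.ker_eq_top, eq_top_iff, ← hperf]
    refine sup_le (Submodule.span_le.2 ?_) fun r hr => hnr r hr
    rintro _ ⟨a, b, rfl⟩
    exact hnb a b
  rw [hns, hn0, zero_add]
  exact hsem.iSup_eigenspace_eq_top

end SemisimpleCentralizer

section MaximalToral
variable {L : Type} [LieRing L] [LieAlgebra K L] [FiniteDimensional K L]
variable {V : Type} [AddCommGroup V] [Module K V] {τ : V →ₗ[K] L}

lemma finite_adWt_ne_bot : {mu | adWt τ mu ≠ ⊥}.Finite :=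
  WellFoundedGT.finite_ne_bot_of_iSupIndep (iSupIndep_adWt τ)

/-- A toral subspace contains an element separating all the weights from zero. -/
lemma exists_regular : ∃ H₀ : V, ∀ mu, adWt τ mu ≠ ⊥ → mu ≠ 0 → mu H₀ ≠ 0 := by
  have hfin := finite_adWt_ne_bot (K := K) (τ := τ)
  have : Finite {mu : Module.Dual K V // adWt τ mu ≠ ⊥ ∧ mu ≠ 0} :=
    (hfin.subset (fun mu h => h.1 : {mu | adWt τ mu ≠ ⊥ ∧ mu ≠ 0} ⊆ _))
  obtain ⟨x, hx⟩ := Module.Dual.exists_forall_ne_zero_of_forall_exists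
    (fun mu : {mu : Module.Dual K V // adWt τ mu ≠ ⊥ ∧ mu ≠ 0} => mu.1) (fun mu => by
      by_contra! h
      exact mu.2.2 (LinearMap.ext h))
  exact ⟨x, fun mu h1 h2 => hx ⟨mu, h1, h2⟩⟩

/-- The part of a toral weight decomposition on which a given element acts by a scalar. -/
def adPart (τ : V →ₗ[K] L) (H : V) (c : K) : Submodule K L :=
  ⨆ mu : {mu : Module.Dual K V // mu H = c}, adWt τ mu.1

lemma adPart_le (H : V) (c : K) :
    adPart τ H c ≤ (LieAlgebra.ad K L (τ H)).eigenspace c := by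
  refine iSup_le fun mu x hx => ?_
  rw [Module.End.mem_eigenspace_iff, LieAlgebra.ad_apply, hx H, mu.2]

lemma iSup_adPart (hspan : ⨆ mu, adWt τ mu = ⊤) (H : V) : ⨆ c, adPart τ H c = ⊤ := by
  rw [eq_top_iff, ← hspan]
  exact iSup_le fun mu => le_trans
    (le_iSup (fun nu : {nu : Module.Dual K V // nu H = mu H} => adWt τ nu.1) ⟨mu, rfl⟩)
    (le_iSup (adPart τ H) (mu H))

lemma iSup_eigenspace_ad (hspan : ⨆ mu, adWt τ mu = ⊤) (H : V) :
    ⨆ c : K, (LieAlgebra.ad K L (τ H)).eigenspace c = ⊤ := by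
  rw [eq_top_iff, ← iSup_adPart hspan H]
  exact iSup_mono fun c => adPart_le H c

lemma adPart_zero_le {H₀ : V} (hreg : ∀ mu, adWt τ mu ≠ ⊥ → mu ≠ 0 → mu H₀ ≠ 0) :
    adPart τ H₀ 0 ≤ adWt τ 0 := by
  refine iSup_le fun mu => ?_
  by_cases h : mu.1 = 0
  · rw [h]
  · by_cases h1 : adWt τ mu.1 = ⊥
    · rw [h1]; exact bot_le
    · exact absurd mu.2 (hreg _ h1 h)

lemma mem_adWt_zero_of_regular (hspan : ⨆ mu, adWt τ mu = ⊤) {H₀ : V}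
    (hreg : ∀ mu, adWt τ mu ≠ ⊥ → mu ≠ 0 → mu H₀ ≠ 0) {y : L} (hy : ⁅τ H₀, y⁆ = 0) :
    y ∈ adWt τ 0 := by
  obtain ⟨y', hy', h⟩ := exists_mem_of_iSupIndep (LinearMap.id : L →ₗ[K] L) (adPart τ H₀)
    (fun c : K => (LieAlgebra.ad K L (τ H₀)).eigenspace c) (iSup_adPart hspan H₀)
    (Module.End.eigenspaces_iSupIndep _) (fun c m hm => adPart_le H₀ c hm) 0 y
    (by simpa [Module.End.mem_eigenspace_iff] using hy)
  have h : y' = y := h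
  exact h ▸ adPart_zero_le hreg hy'

/-- In a finite-dimensional Lie algebra all of whose abelian ideals are central, a maximal toral
subalgebra is its own centralizer. -/
theorem mem_range_of_adWt_zero
    (hab : ∀ I : LieIdeal K L, IsLieAbelian I → I ≤ LieAlgebra.center K L)
    (hspan : ⨆ mu, adWt τ mu = ⊤)
    (hmax : ∀ y, (∀ H, ⁅τ H, y⁆ = 0) → (⨆ c : K, (LieAlgebra.ad K L y).eigenspace c) = ⊤ →
      y ∈ LinearMap.range τ) {y : L} (hy : y ∈ adWt τ 0) : y ∈ LinearMap.range τ := by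
  obtain ⟨H₀, hreg⟩ := exists_regular (K := K) (τ := τ)
  obtain ⟨x, e, f, htx, hef, hxe, hxf, hgen, hss, hcom, hperf⟩ :=
    exists_grading (τ H₀) (iSup_eigenspace_ad hspan H₀)
  have hodd := mem_center_of_even hab hef hxe hxf hgen hcom
  have key : ∀ y, ⁅x, y⁆ = 0 → y ∈ adWt τ 0 → y ∈ LinearMap.range τ := fun y h1 h2 =>
    hmax y (fun H => by rw [h2 H]; simp)
      (iSup_eigenspace_ad_eq_top hab h1 hgen hodd (hss y (by rw [h1]; simp)) hperf)
  obtain ⟨X, rfl⟩ := key x (lie_self x) (mem_adWt_zero_of_regular hspan hreg htx)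
  exact key y (by rw [hy X]; simp) hy

/-- Modulo the radical, a maximal toral subalgebra becomes a Cartan subalgebra. -/
lemma exists_cartan_image
    (hab : ∀ I : LieIdeal K L, IsLieAbelian I → I ≤ LieAlgebra.center K L)
    (hspan : ⨆ mu, adWt τ mu = ⊤) (hcomm : ∀ H H', ⁅τ H, τ H'⁆ = 0)
    (hmax : ∀ y, (∀ H, ⁅τ H, y⁆ = 0) → (⨆ c : K, (LieAlgebra.ad K L y).eigenspace c) = ⊤ →
      y ∈ LinearMap.range τ) :
    ∃ T : LieSubalgebra K (L ⧸ LieAlgebra.radical K L), T.IsCartanSubalgebra ∧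
      T.toSubmodule = LinearMap.range
        ((LieSubmodule.Quotient.mk' (LieAlgebra.radical K L)).toLinearMap ∘ₗ τ) := by
  set R := LieAlgebra.radical K L
  let π : L →ₗ[K] L ⧸ R := (LieSubmodule.Quotient.mk' R).toLinearMap
  have hπ : ∀ a b : L, π ⁅a, b⁆ = ⁅π a, π b⁆ := fun a b => LieSubmodule.Quotient.mk_bracket _ _ _
  have hπs : Function.Surjective π := LieSubmodule.Quotient.surjective_mk' R
  let T : LieSubalgebra K (L ⧸ R) :=
    { LinearMap.range (π ∘ₗ τ) with
      lie_mem' := by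
        rintro _ _ ⟨a, rfl⟩ ⟨b, rfl⟩
        refine ⟨0, ?_⟩
        simp only [LinearMap.comp_apply, map_zero]
        rw [← hπ, hcomm, map_zero] }
  have hT : ∀ q, q ∈ T ↔ ∃ H, π (τ H) = q := fun q => Iff.rfl
  refine ⟨T, ?_, rfl⟩
  have habT : IsLieAbelian T := ⟨fun a b => by
    obtain ⟨H, hH⟩ := (hT _).1 a.2
    obtain ⟨H', hH'⟩ := (hT _).1 b.2
    apply Subtype.ext
    rw [LieSubalgebra.coe_bracket, ← hH, ← hH', ← hπ, hcomm, map_zero]; rfl⟩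
  obtain ⟨H₀, hreg⟩ := exists_regular (K := K) (τ := τ)
  have hdiag : ∀ c, ∀ m ∈ adPart τ H₀ c,
      π m ∈ (LieAlgebra.ad K (L ⧸ R) (π (τ H₀))).eigenspace c := by
    intro c m hm
    have := adPart_le H₀ c hm
    rw [Module.End.mem_eigenspace_iff, LieAlgebra.ad_apply] at this ⊢
    rw [← hπ, this, map_smul]
  have htop : ⨆ c : K, (LieAlgebra.ad K (L ⧸ R) (π (τ H₀))).eigenspace c = ⊤ := by
    rw [eq_top_iff]
    calc ⊤ = (⨆ c, adPart τ H₀ c).map π := by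
          rw [iSup_adPart hspan H₀, Submodule.map_top, LinearMap.range_eq_top.2 hπs]
      _ ≤ _ := by
          rw [Submodule.map_iSup]
          exact iSup_mono fun c => Submodule.map_le_iff_le_comap.2 fun m hm => hdiag c m hm
  refine ⟨inferInstance, ?_⟩
  refine le_antisymm (fun q hq => ?_) (LieSubalgebra.le_normalizer T)
  rw [LieSubalgebra.mem_normalizer_iff'] at hq
  obtain ⟨y, rfl⟩ := hπs q
  have h1 : ⁅π (τ H₀), π y⁆ = 0 := by
    apply lie_eq_zero_of_lie_lie htop
    obtain ⟨H, hH⟩ := (hT _).1 (hq (π (τ H₀)) ⟨H₀, rfl⟩)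
    rw [← hH, ← hπ, hcomm, map_zero]
  obtain ⟨y', hy', h⟩ := exists_mem_of_iSupIndep π (adPart τ H₀)
    (fun c : K => (LieAlgebra.ad K (L ⧸ R) (π (τ H₀))).eigenspace c) (iSup_adPart hspan H₀)
    (Module.End.eigenspaces_iSupIndep _) hdiag 0 y
    (by rw [Module.End.mem_eigenspace_iff, LieAlgebra.ad_apply, h1, zero_smul])
  obtain ⟨H, rfl⟩ := mem_range_of_adWt_zero hab hspan hmax (adPart_zero_le hreg hy')
  exact ⟨H, h⟩

/-- Root vectors outside the radical are part of an `sl₂`-triple of root vectors. -/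
theorem exists_sl2_of_adWt
    (hab : ∀ I : LieIdeal K L, IsLieAbelian I → I ≤ LieAlgebra.center K L)
    (hspan : ⨆ mu, adWt τ mu = ⊤) (hcomm : ∀ H H', ⁅τ H, τ H'⁆ = 0)
    (hmax : ∀ y, (∀ H, ⁅τ H, y⁆ = 0) → (⨆ c : K, (LieAlgebra.ad K L y).eigenspace c) = ⊤ →
      y ∈ LinearMap.range τ) {α : Module.Dual K V} (hα : α ≠ 0) {e : L} (he : e ∈ adWt τ α)
    (heR : e ∉ LieAlgebra.radical K L) :
    ∃ f ∈ adWt τ (-α), ∃ H, ⁅e, f⁆ = τ H ∧ α H = 2 := by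
  obtain ⟨T, hTC, hT⟩ := exists_cartan_image hab hspan hcomm hmax
  let R := LieAlgebra.radical K L
  let π : L →ₗ[K] L ⧸ R := (LieSubmodule.Quotient.mk' R).toLinearMap
  have hπ : ∀ a b : L, π ⁅a, b⁆ = ⁅π a, π b⁆ := fun a b => LieSubmodule.Quotient.mk_bracket _ _ _
  have hπs : Function.Surjective π := LieSubmodule.Quotient.surjective_mk' R
  have hπ0 : ∀ a, π a = 0 ↔ a ∈ R := fun a => LieSubmodule.Quotient.mk_eq_zero R
  have := isKilling_quotient_radical (K := K) (L := L)
  have hmemT : ∀ H, π (τ H) ∈ T := fun H => by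
    rw [← LieSubalgebra.mem_toSubmodule, hT]; exact ⟨H, rfl⟩
  let φ : V →ₗ[K] T := LinearMap.codRestrict T.toSubmodule (π ∘ₗ τ) hmemT
  have hφs : ∀ t : T, ∃ H, φ H = t := fun t => by
    have ht := t.2
    rw [← LieSubalgebra.mem_toSubmodule, hT] at ht
    obtain ⟨H, hH⟩ := ht
    exact ⟨H, Subtype.ext hH⟩
  have he0 : π e ≠ 0 := fun h => heR ((hπ0 e).1 h)
  have hker : α ∈ (LinearMap.ker φ).dualAnnihilator := by
    rw [Submodule.mem_dualAnnihilator]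
    intro H hH
    have h1 : π (τ H) = 0 := congrArg Subtype.val (LinearMap.mem_ker.1 hH)
    have h2 : π ⁅τ H, e⁆ = 0 := by rw [hπ, h1, zero_lie]
    rw [he H, map_smul] at h2
    exact (smul_eq_zero.1 h2).resolve_right he0
  rw [← LinearMap.range_dualMap_eq_dualAnnihilator_ker] at hker
  obtain ⟨β, hβ⟩ := hker
  have hβ' : ∀ H, β (φ H) = α H := fun H => LinearMap.congr_fun hβ H
  have hβe : π e ∈ LieAlgebra.rootSpace T β := by
    refine LieModule.weightSpace_le_genWeightSpace _ _ ?_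
    rw [LieModule.mem_weightSpace]
    intro t
    obtain ⟨H, rfl⟩ := hφs t
    change ⁅π (τ H), π e⁆ = _
    rw [← hπ, he H, map_smul, hβ']
  let w : LieModule.Weight K T (L ⧸ R) := ⟨β, fun h => he0 (by
    have h1 : π e ∈ LieModule.genWeightSpace (L ⧸ R) (β : T → K) := hβe
    rw [h] at h1
    simpa using h1)⟩
  have hw : w.IsNonZero := fun h => hα (by
    ext H
    rw [← hβ']
    exact congrFun h (φ H))
  obtain ⟨h', e', f', hsl, he', hf'⟩ :=
    LieAlgebra.IsKilling.exists_isSl2Triple_of_weight_isNonZero hw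
  have h1 := LieAlgebra.IsKilling.finrank_rootSpace_eq_one w hw
  obtain ⟨c, hc⟩ := (finrank_eq_one_iff_of_nonzero' (⟨π e, hβe⟩ : LieAlgebra.rootSpace T w)
    (fun h => he0 (congrArg Subtype.val h))).1 h1 ⟨e', he'⟩
  have hc : c • π e = e' := congrArg Subtype.val hc
  obtain ⟨f₀, hf₀⟩ := hπs f'
  have hτπ : ∀ mu, ∀ m ∈ adWt τ mu, π m ∈ adWt (π ∘ₗ τ) mu := fun mu m hm H => by
    rw [LinearMap.comp_apply, ← hπ, hm H, map_smul]
  obtain ⟨f, hf, hff⟩ := exists_mem_of_iSupIndep π (adWt τ) (adWt (π ∘ₗ τ)) hspan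
    (iSupIndep_adWt _) hτπ (-α) (c • f₀) (by
      rw [map_smul, hf₀]
      refine Submodule.smul_mem _ _ fun H => ?_
      have := LieAlgebra.IsKilling.lie_eq_smul_of_mem_rootSpace hf' (φ H)
      rw [show ((-(w : T → K)) (φ H)) = (-α) H by
        rw [Pi.neg_apply, LinearMap.neg_apply, ← hβ']; rfl] at this
      exact this)
  have hef : ⁅e, f⁆ ∈ adWt τ 0 := fun H => by
    rw [leibniz_lie, he H, hf H, lie_smul, smul_lie]
    simp
  obtain ⟨H, hH⟩ := mem_range_of_adWt_zero hab hspan hmax hef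
  refine ⟨f, hf, H, hH.symm, ?_⟩
  have h2 : π (τ H) = h' := by
    rw [hH, hπ, hff, map_smul, hf₀, lie_smul, ← smul_lie, hc, hsl.lie_e_f]
  have h3 : ⁅h', e'⁆ = α H • e' := by
    rw [← hc, lie_smul, ← h2, ← hπ, he H, map_smul, smul_comm]
  have he'0 : e' ≠ 0 := hsl.e_ne_zero
  rw [hsl.lie_h_e_nsmul, ← Nat.cast_smul_eq_nsmul K] at h3
  have h4 := smul_left_injective K he'0 h3
  exact_mod_cast h4.symm

end MaximalToral

section ToralFacts

/-- A common eigenvector of a subalgebra is a weight vector. -/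
lemma exists_mem_adWeightSpace {t : LieSubalgebra K g} {v : g} (hv : v ≠ 0)
    (h : ∀ x ∈ t, ∃ c : K, ⁅x, v⁆ = c • v) : ∃ α, v ∈ adWeightSpace K g t α := by
  choose! c hc using h
  have inj := smul_left_injective K hv
  refine ⟨{ toFun := fun x => c x, map_add' := fun x y => ?_, map_smul' := fun r x => ?_ },
    fun x => hc x x.2⟩
  · apply inj
    change c ((x : g) + y) • v = (c x + c y) • v
    rw [← hc _ (t.add_mem x.2 y.2), add_lie, hc _ x.2, hc _ y.2, add_smul]
  · apply inj
    change c (r • (x : g)) • v = (r * c x) • v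
    rw [← hc _ (t.smul_mem r x.2), smul_lie, hc _ x.2, mul_smul]

namespace Setup
variable (S : Setup K g)

instance (n : ℕ) : FiniteDimensional K (S.F n) := S.F_findim n

/-- The inclusion of `h ∩ g_n` into `g_n`. -/
def tau (n : ℕ) : S.hn n →ₗ[K] S.F n :=
  (LieSubalgebra.inclusion (inf_le_right : S.h ⊓ S.F n ≤ S.F n)).toLinearMap

lemma mem_adWt_tau {n : ℕ} {mu : Module.Dual K (S.hn n)} {x : S.F n} :
    x ∈ adWt (S.tau n) mu ↔ (x : g) ∈ adWeightSpace K g (S.hn n) mu :=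
  ⟨fun h H => congrArg Subtype.val (h H), fun h H => Subtype.ext (h H)⟩

lemma iSup_adWt_tau (n : ℕ) : ⨆ mu, adWt (S.tau n) mu = ⊤ := by
  have h := (S.h_maxToral n).1.2.2
  have hinj : Function.Injective (S.F n).toSubmodule.subtype := Subtype.val_injective
  refine Submodule.map_injective_of_injective hinj ?_
  refine le_antisymm (Submodule.map_mono le_top) ?_
  rw [Submodule.map_top, Submodule.range_subtype, Submodule.map_iSup]
  refine h.trans (iSup_mono fun mu x hx => ?_)
  exact ⟨⟨x, hx.1⟩, (S.mem_adWt_tau).2 hx.2, rfl⟩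

lemma lie_hn {n : ℕ} {x y : g} (hx : x ∈ S.hn n) (hy : y ∈ S.hn n) : ⁅x, y⁆ = 0 := by
  have h := (S.h_maxToral n).1.2.1
  exact congrArg Subtype.val (h.trivial (⟨x, hx⟩ : ↥(S.h ⊓ S.F n)) ⟨y, hy⟩)

lemma mem_range_tau {n : ℕ} (y : S.F n) (hy : ∀ H, ⁅S.tau n H, y⁆ = 0)
    (hss : ⨆ c : K, (LieAlgebra.ad K (S.F n) y).eigenspace c = ⊤) :
    y ∈ LinearMap.range (S.tau n) := by
  have hyh : ∀ x ∈ S.hn n, ⁅x, (y : g)⁆ = 0 := fun x hx =>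
    congrArg Subtype.val (hy ⟨x, hx⟩)
  have hlie : ∀ x ∈ (S.hn n).toSubmodule ⊔ K ∙ (y : g), ∀ z ∈ (S.hn n).toSubmodule ⊔ K ∙ (y : g),
      ⁅x, z⁆ = 0 := by
    intro x hx z hz
    obtain ⟨a, ha, b, hb, rfl⟩ := Submodule.mem_sup.1 hx
    obtain ⟨c, hc, d, hd, rfl⟩ := Submodule.mem_sup.1 hz
    obtain ⟨r, rfl⟩ := Submodule.mem_span_singleton.1 hb
    obtain ⟨q, rfl⟩ := Submodule.mem_span_singleton.1 hd
    have h1 : ⁅a, c⁆ = 0 := S.lie_hn ha hc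
    have h2 := hyh a ha
    have h3 := hyh c hc
    have h4 : ⁅(y : g), c⁆ = 0 := by rw [← lie_skew, h3, neg_zero]
    simp only [add_lie, lie_add, lie_smul, smul_lie, h1, h2, h4, lie_self, smul_zero, add_zero]
  let t' : LieSubalgebra K g :=
    { (S.hn n).toSubmodule ⊔ K ∙ (y : g) with
      lie_mem' := fun {x z} hx hz => by
        rw [hlie x hx z hz]; exact Submodule.zero_mem _ }
  have hmem : ∀ x, x ∈ t' ↔ x ∈ (S.hn n).toSubmodule ⊔ K ∙ (y : g) := fun x => Iff.rfl
  have hyt : (y : g) ∈ t' :=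
    (hmem _).2 (Submodule.mem_sup_right (Submodule.mem_span_singleton_self _))
  have hle : S.hn n ≤ t' := fun x hx => (hmem _).2 (Submodule.mem_sup_left hx)
  have htF : t' ≤ S.F n := by
    intro x hx
    obtain ⟨a, ha, b, hb, rfl⟩ := Submodule.mem_sup.1 ((hmem x).1 hx)
    obtain ⟨r, rfl⟩ := Submodule.mem_span_singleton.1 hb
    exact (S.F n).add_mem ha.2 ((S.F n).smul_mem r y.2)
  have hwt : ∀ mu : Module.Dual K (S.hn n), adWt (S.tau n) mu ≤
      (⨆ α : Module.Dual K t', (S.F n).toSubmodule ⊓ adWeightSpace K g t' α).comap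
        (S.F n).toSubmodule.subtype := by
    intro mu
    have hst : ∀ x ∈ adWt (S.tau n) mu, (LieAlgebra.ad K (S.F n) y) x ∈ adWt (S.tau n) mu := by
      intro x hx H
      rw [LieAlgebra.ad_apply, leibniz_lie, hy H, zero_lie, zero_add, hx H, lie_smul]
    have h1 := Submodule.inf_iSup_genEigenspace hst 1
    have h2 : ⨆ c : K, (LieAlgebra.ad K (S.F n) y).genEigenspace c 1 = ⊤ := hss
    rw [h2, inf_top_eq] at h1
    rw [h1]
    refine iSup_le fun c v hv => ?_
    rw [Submodule.mem_comap]
    by_cases hv0 : (v : g) = 0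
    · rw [Submodule.subtype_apply, hv0]; exact Submodule.zero_mem _
    · have hv2 : v ∈ (LieAlgebra.ad K (S.F n) y).eigenspace c := hv.2
      rw [Module.End.mem_eigenspace_iff, LieAlgebra.ad_apply] at hv2
      obtain ⟨α, hα⟩ := exists_mem_adWeightSpace (t := t') hv0 (fun x hx => by
        obtain ⟨a, ha, b, hb, rfl⟩ := Submodule.mem_sup.1 ((hmem x).1 hx)
        obtain ⟨r, rfl⟩ := Submodule.mem_span_singleton.1 hb
        refine ⟨mu ⟨a, ha⟩ + r * c, ?_⟩
        have h3 : ⁅a, (v : g)⁆ = mu ⟨a, ha⟩ • (v : g) := (S.mem_adWt_tau.1 hv.1) ⟨a, ha⟩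
        have h4 : ⁅(y : g), (v : g)⁆ = c • (v : g) := congrArg Subtype.val hv2
        rw [add_lie, smul_lie, h3, h4, add_smul, mul_smul])
      exact Submodule.mem_iSup_of_mem α ⟨v.2, hα⟩
  have htor : IsToralIn K g (S.F n) t' := by
    refine ⟨htF, ⟨fun a b => Subtype.ext (hlie a a.2 b b.2)⟩, fun x hx => ?_⟩
    have h1 : (⊤ : Submodule K (S.F n)) ≤ _ := (S.iSup_adWt_tau n).symm.le.trans (iSup_le hwt)
    exact h1 (show (⟨x, hx⟩ : S.F n) ∈ ⊤ from trivial)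
  have heq := (S.h_maxToral n).2 t' htor hle
  exact ⟨⟨y, by
    change (y : g) ∈ S.h ⊓ S.F n
    rw [← heq]; exact hyt⟩, rfl⟩

lemma mem_h_of_lie_hn {n : ℕ} {y : g} (hyn : y ∈ S.F n) (hy : ∀ x ∈ S.hn n, ⁅x, y⁆ = 0) :
    y ∈ S.h := by
  obtain ⟨H, hH⟩ := mem_range_of_adWt_zero (τ := S.tau n) (S.F_reductive n) (S.iSup_adWt_tau n)
    S.mem_range_tau (y := ⟨y, hyn⟩) (fun H => Subtype.ext (by
      rw [LinearMap.zero_apply, zero_smul]; exact hy H H.2))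
  rw [show y = (H : g) from (congrArg Subtype.val hH).symm]
  exact H.2.1

lemma exists_sl2_hn {n : ℕ} {α : Module.Dual K (S.hn n)} (hα : α ≠ 0) {e : S.F n}
    (he : (e : g) ∈ adWeightSpace K g (S.hn n) α)
    (heR : e ∉ LieAlgebra.radical K (S.F n)) :
    ∃ f ∈ S.F n, f ∈ adWeightSpace K g (S.hn n) (-α) ∧ ∃ H : S.hn n, ⁅(e : g), f⁆ = H ∧ α H = 2 := by
  obtain ⟨f, hf, H, hH, h2⟩ := exists_sl2_of_adWt (τ := S.tau n) (S.F_reductive n)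
    (S.iSup_adWt_tau n) (fun H H' => Subtype.ext (S.lie_hn H.2 H'.2)) S.mem_range_tau hα
    (S.mem_adWt_tau.2 he) heR
  exact ⟨f, f.2, S.mem_adWt_tau.1 hf, H, congrArg Subtype.val hH, h2⟩

lemma exists_mem_F (s : Finset g) : ∃ n, ∀ m, n ≤ m → ∀ x ∈ s, x ∈ S.F m := by
  classical
  induction s using Finset.induction_on with
  | empty => exact ⟨0, by simp⟩
  | insert a s _ ih =>
    obtain ⟨n, hn⟩ := ih
    obtain ⟨k, hk⟩ := S.F_exhaust a
    refine ⟨max n k, fun m hm x hx => ?_⟩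
    rcases Finset.mem_insert.1 hx with rfl | hx
    · exact S.F_mono ((le_max_right n k).trans hm) hk
    · exact hn m ((le_max_left n k).trans hm) x hx

lemma lie_h {x y : g} (hx : x ∈ S.h) (hy : y ∈ S.h) : ⁅x, y⁆ = 0 := by
  classical
  obtain ⟨n, hn⟩ := S.exists_mem_F {x, y}
  exact S.lie_hn (n := n) ⟨hx, hn n le_rfl x (by simp)⟩ ⟨hy, hn n le_rfl y (by simp)⟩

lemma mem_h_of_wt_zero {y : g} (hy : y ∈ adWeightSpace K g S.h 0) : y ∈ S.h := by
  obtain ⟨n, hn⟩ := S.F_exhaust y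
  exact S.mem_h_of_lie_hn hn fun x hx => by simpa using hy ⟨x, hx.1⟩

lemma wt_zero_of_mem_h {y : g} (hy : y ∈ S.h) : y ∈ adWeightSpace K g S.h 0 := fun H => by
  rw [S.lie_h H.2 hy]; simp

lemma lie_mem_wt {α β : Module.Dual K S.h} {x y : g} (hx : x ∈ adWeightSpace K g S.h α)
    (hy : y ∈ adWeightSpace K g S.h β) : ⁅x, y⁆ ∈ adWeightSpace K g S.h (α + β) := fun H => by
  rw [leibniz_lie, hx H, hy H, lie_smul, smul_lie, LinearMap.add_apply, add_smul]

lemma disjoint_wt {α β : Module.Dual K S.h} (h : α ≠ β) {x : g}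
    (hx : x ∈ adWeightSpace K g S.h α) (hy : x ∈ adWeightSpace K g S.h β) : x = 0 :=
  Submodule.disjoint_def.1 (S.h_indep.pairwiseDisjoint h) x hx hy

/-- The relations of `sl₂` in the adjoint representation. -/
lemma slTwo (S : Setup K g) {e f H : g} (hef : ⁅e, f⁆ = H) (he : ⁅H, e⁆ = (2 : K) • e)
    (hf : ⁅H, f⁆ = -((2 : K) • f)) :
    SlTwo (LieAlgebra.ad K g H) (LieAlgebra.ad K g e) (LieAlgebra.ad K g f) := by
  have hfin : ∀ a v : g, ∃ W : Submodule K g, FiniteDimensional K W ∧ v ∈ W ∧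
      ∀ w ∈ W, LieAlgebra.ad K g a w ∈ W := by
    classical
    intro a v
    obtain ⟨n, hn⟩ := S.exists_mem_F {a, v}
    exact ⟨(S.F n).toSubmodule, S.F_findim n, hn n le_rfl v (by simp), fun w hw =>
      (S.F n).lie_mem (hn n le_rfl a (by simp)) hw⟩
  have h1 : ∀ v, LieAlgebra.ad K g H (LieAlgebra.ad K g e v) =
      LieAlgebra.ad K g e (LieAlgebra.ad K g H v) + (2 : K) • LieAlgebra.ad K g e v := fun v => by
    simp only [LieAlgebra.ad_apply]
    rw [leibniz_lie H e v, he, smul_lie, add_comm]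
  have h2 : ∀ v, LieAlgebra.ad K g H (LieAlgebra.ad K g f v) =
      LieAlgebra.ad K g f (LieAlgebra.ad K g H v) - (2 : K) • LieAlgebra.ad K g f v := fun v => by
    simp only [LieAlgebra.ad_apply]
    rw [leibniz_lie H f v, hf, neg_lie, smul_lie]; abel
  refine ⟨fun v => ?_, h1, h2, fun v m hv => ?_, fun v m hv => ?_⟩
  · simp only [LieAlgebra.ad_apply]
    rw [leibniz_lie e f v, hef, add_comm]
  · obtain ⟨W, _, hvW, hW⟩ := hfin e v
    exact exists_pow_eq_zero_of_shift two_ne_zero h1 hv hvW hW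
  · obtain ⟨W, _, hvW, hW⟩ := hfin f v
    exact exists_pow_eq_zero_of_shift (c := -2) (by simp)
      (fun v => by rw [h2, neg_smul, sub_eq_add_neg]) hv hvW hW

end Setup
end ToralFacts

section LocalRadical
namespace Setup
variable (S : Setup K g)

/-- The radical of `g_n` as a subspace of `g`. -/
def rad (n : ℕ) : Submodule K g :=
  (LieAlgebra.radical K (S.F n)).toSubmodule.map (S.F n).toSubmodule.subtype

lemma mem_rad {n : ℕ} {x : g} : x ∈ S.rad n ↔ ∃ h : x ∈ S.F n,
    (⟨x, h⟩ : S.F n) ∈ LieAlgebra.radical K (S.F n) := by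
  constructor
  · rintro ⟨y, hy, rfl⟩; exact ⟨y.2, hy⟩
  · rintro ⟨h, hx⟩; exact ⟨⟨x, h⟩, hx, rfl⟩

lemma rad_anti {n m : ℕ} (hnm : n ≤ m) {x : g} (hx : x ∈ S.rad m) (hxn : x ∈ S.F n) :
    x ∈ S.rad n := by
  let j : S.F n →ₗ⁅K⁆ S.F m := LieSubalgebra.inclusion (S.F_mono hnm)
  let J : LieIdeal K (S.F n) := (LieAlgebra.radical K (S.F m)).comap j
  have hsol : LieAlgebra.IsSolvable J := by
    let φ : J →ₗ⁅K⁆ LieAlgebra.radical K (S.F m) :=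
      { toFun := fun x => ⟨j x, by have := x.2; rwa [LieIdeal.mem_comap] at this⟩
        map_add' := fun x y => rfl
        map_smul' := fun c x => rfl
        map_lie' := fun {x y} => rfl }
    have hφ : Function.Injective φ := fun a b h => by
      have h1 : j a = j b := congrArg Subtype.val h
      have h2 := congrArg Subtype.val h1
      exact Subtype.ext (Subtype.ext h2)
    exact hφ.lieAlgebra_isSolvable
  have hle : J ≤ LieAlgebra.radical K (S.F n) := (LieAlgebra.LieIdeal.solvable_iff_le_radical K (S.F n) J).1 hsol
  obtain ⟨h1, h2⟩ := S.mem_rad.1 hx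
  exact S.mem_rad.2 ⟨hxn, hle (show (⟨x, hxn⟩ : S.F n) ∈ J by rw [LieIdeal.mem_comap]; exact h2)⟩

lemma lie_mem_rad {n : ℕ} {x y : g} (hx : x ∈ S.rad n) (hy : y ∈ S.F n) : ⁅y, x⁆ ∈ S.rad n := by
  obtain ⟨h1, h2⟩ := S.mem_rad.1 hx
  exact S.mem_rad.2 ⟨(S.F n).lie_mem hy h1,
    (LieAlgebra.radical K (S.F n)).lie_mem (x := ⟨y, hy⟩) h2⟩

/-- The elements lying in the radical of every `g_n` containing them. -/
def nil : LieIdeal K g where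
  carrier := {x | ∀ n, x ∈ S.F n → x ∈ S.rad n}
  add_mem' {x y} hx hy n hn := by
    classical
    obtain ⟨m, hm⟩ := S.exists_mem_F {x, y}
    have hle := le_max_left m n
    exact S.rad_anti (le_max_right m n) (Submodule.add_mem _ (hx _ (hm _ hle x (by simp)))
      (hy _ (hm _ hle y (by simp)))) hn
  zero_mem' n _ := Submodule.zero_mem _
  smul_mem' c x hx n hn := by
    obtain ⟨m, hm⟩ := S.exists_mem_F {x}
    have hle := le_max_left m n
    exact S.rad_anti (le_max_right m n)
      (Submodule.smul_mem _ c (hx _ (hm _ hle x (by simp)))) hn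
  lie_mem {y x} hx n hn := by
    classical
    obtain ⟨m, hm⟩ := S.exists_mem_F {x, y}
    have hle := le_max_left m n
    exact S.rad_anti (le_max_right m n) (S.lie_mem_rad (hx _ (hm _ hle x (by simp)))
      (hm _ hle y (by simp))) hn

lemma mem_nil {x : g} : x ∈ S.nil ↔ ∀ n, x ∈ S.F n → x ∈ S.rad n := Iff.rfl

lemma lie_lie_nil {x y : g} (hx : x ∈ S.nil) (hy : y ∈ S.nil) (z : g) : ⁅z, ⁅x, y⁆⁆ = 0 := by
  classical
  obtain ⟨n, hn⟩ := S.exists_mem_F {x, y, z}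
  obtain ⟨hx1, hx2⟩ := S.mem_rad.1 (hx n (hn n le_rfl x (by simp)))
  obtain ⟨hy1, hy2⟩ := S.mem_rad.1 (hy n (hn n le_rfl y (by simp)))
  have h1 := lie_radical_le_center (S.F_reductive n) (LieSubmodule.lie_mem_lie hx2 hy2)
  have h2 := (LieModule.mem_maxTrivSubmodule _ _ _ _).1 h1 ⟨z, hn n le_rfl z (by simp)⟩
  exact congrArg Subtype.val h2

/-- Abelian ideals of `g` are central. -/
lemma lie_eq_zero_of_abelian (S : Setup K g) (I : LieIdeal K g) (hI : ∀ x ∈ I, ∀ y ∈ I, ⁅x, y⁆ = 0) {x : g}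
    (hx : x ∈ I) (z : g) : ⁅z, x⁆ = 0 := by
  classical
  obtain ⟨n, hn⟩ := S.exists_mem_F {x, z}
  have hx1 := hn n le_rfl x (by simp)
  have hz1 := hn n le_rfl z (by simp)
  let J : LieIdeal K (S.F n) := I.comap (S.F n).incl
  have hJ : ∀ a : S.F n, a ∈ J ↔ (a : g) ∈ I := fun a => LieIdeal.mem_comap
  have h1 : IsLieAbelian J := ⟨fun a b => by
    apply Subtype.ext; apply Subtype.ext
    exact hI _ ((hJ _).1 a.2) _ ((hJ _).1 b.2)⟩
  have h2 := S.F_reductive n J h1 ((hJ ⟨x, hx1⟩).2 hx)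
  exact congrArg Subtype.val ((LieModule.mem_maxTrivSubmodule _ _ _ _).1 h2 ⟨z, hz1⟩)

lemma nil_cartan_central {x : g} (hx : x ∈ S.nil) (hxh : x ∈ S.h) (z : g) : ⁅x, z⁆ = 0 := by
  have hz : z ∈ ⨆ α : Module.Dual K S.h, adWeightSpace K g S.h α := by rw [S.h_span]; trivial
  refine (iSup_le fun α y hy => ?_ : _ ≤ LinearMap.ker (LieAlgebra.ad K g x)) hz
  change ⁅x, y⁆ = 0
  have h1 : ⁅x, y⁆ = α ⟨x, hxh⟩ • y := hy ⟨x, hxh⟩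
  have h2 := S.lie_lie_nil hx (lie_mem_left K g S.nil x y hx) x
  simp only [h1, lie_smul, smul_eq_zero] at h2 ⊢
  tauto

/-- An `sl₂`-triple attached to a root. -/
structure Triple (α : Module.Dual K S.h) (e f : g) (H : S.h) : Prop where
  e_mem : e ∈ adWeightSpace K g S.h α
  f_mem : f ∈ adWeightSpace K g S.h (-α)
  ef : ⁅e, f⁆ = H
  two : α H = 2

variable {S}

namespace Triple
variable {α : Module.Dual K S.h} {e f : g} {H : S.h}

lemma symm (t : S.Triple α e f H) : S.Triple (-α) f e (-H) where
  e_mem := t.f_mem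
  f_mem := by rw [neg_neg]; exact t.e_mem
  ef := by rw [← lie_skew, t.ef]; rfl
  two := by simp [t.two]

lemma slTwo (t : S.Triple α e f H) :
    SlTwo (LieAlgebra.ad K g (H : g)) (LieAlgebra.ad K g e) (LieAlgebra.ad K g f) :=
  S.slTwo t.ef (by rw [t.e_mem H, t.two])
    (by rw [t.f_mem H, LinearMap.neg_apply, t.two, neg_smul])

lemma he (t : S.Triple α e f H) : ⁅(H : g), e⁆ = (2 : K) • e := by rw [t.e_mem H, t.two]

lemma hf (t : S.Triple α e f H) : ⁅(H : g), f⁆ = -((2 : K) • f) := by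
  rw [t.f_mem H, LinearMap.neg_apply, t.two, neg_smul]

lemma ne_zero (t : S.Triple α e f H) : α ≠ 0 := fun h => by
  have := t.two
  rw [h] at this
  simp at this

lemma e_ne_zero (t : S.Triple α e f H) : e ≠ 0 := fun h => by
  have h1 := t.ef
  rw [h, zero_lie] at h1
  have h2 : H = 0 := Subtype.ext h1.symm
  have := t.two
  rw [h2] at this
  simp at this

lemma f_ne_zero (t : S.Triple α e f H) : f ≠ 0 := t.symm.e_ne_zero

lemma isRoot (t : S.Triple α e f H) : IsRootOf K g S.h α :=
  ⟨t.ne_zero, fun h => t.e_ne_zero (by simpa [h] using t.e_mem)⟩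

/-- Root vectors in the local radical vanish when the root admits an `sl₂`-triple. -/
lemma eq_zero_of_mem_nil (t : S.Triple α e f H) {v : g} (hv : v ∈ adWeightSpace K g S.h α)
    (hN : v ∈ S.nil) : v = 0 := by
  have h1 : ⁅f, v⁆ ∈ S.h := S.mem_h_of_wt_zero (by
    have := S.lie_mem_wt t.f_mem hv
    rwa [neg_add_cancel] at this)
  refine t.slTwo.eq_zero_of_F_pow (r := 2) ?_ ?_
  · rw [LieAlgebra.ad_apply, hv H, t.two]; norm_num
  · rw [pow_two, Module.End.mul_apply]
    simp only [LieAlgebra.ad_apply]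
    rw [← lie_skew, S.nil_cartan_central (S.nil.lie_mem hN) h1, neg_zero]

lemma exists_smul (t : S.Triple α e f H) {v : g} (hv : v ∈ adWeightSpace K g S.h α) :
    ∃ c : K, v = c • e := by
  have h1 : ⁅f, v⁆ ∈ S.h := S.mem_h_of_wt_zero (by
    have := S.lie_mem_wt t.f_mem hv
    rwa [neg_add_cancel] at this)
  set H' : S.h := ⟨⁅f, v⁆, h1⟩ with hH'
  have h2 : ⁅f, ⁅f, v⁆⁆ = α H' • f := by
    have := t.f_mem H'
    rw [LinearMap.neg_apply] at this
    rw [← lie_skew, show ⁅f, v⁆ = (H' : g) from rfl, this, neg_smul, neg_neg]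
  have h3 : ⁅f, ⁅f, e⁆⁆ = (-2 : K) • f := by
    rw [← lie_skew f e, t.ef, lie_neg, lie_skew, t.hf, neg_smul]
  refine ⟨-(α H' / 2), sub_eq_zero.1 (t.slTwo.eq_zero_of_F_pow (r := 2) ?_ ?_)⟩
  · rw [LieAlgebra.ad_apply, lie_sub, lie_smul, hv H, t.he, t.two, smul_comm, ← smul_sub]
    norm_num
  · rw [pow_two, Module.End.mul_apply]
    simp only [LieAlgebra.ad_apply]
    rw [lie_sub, lie_sub, lie_smul, lie_smul, h2, h3, smul_smul, ← sub_smul]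
    rw [show α H' - -(α H' / 2) * -2 = 0 by ring, zero_smul]

/-- The coroot and the negative root vector are determined by the positive one. -/
lemma exists_int (t : S.Triple α e f H) {β : Module.Dual K S.h} (hβ : adWeightSpace K g S.h β ≠ ⊥) :
    ∃ n : ℤ, β H = n := by
  obtain ⟨v, hv, h0⟩ := Submodule.exists_mem_ne_zero_of_ne_bot hβ
  exact t.slTwo.int_of_ne (v := v) (by rw [LieAlgebra.ad_apply, hv H]) h0

end Triple

variable (S)

/-- Root vectors outside the local radical belong to `sl₂`-triples. -/
lemma exists_triple {α : Module.Dual K S.h} (hα : α ≠ 0) {e : g}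
    (he : e ∈ adWeightSpace K g S.h α) (heN : e ∉ S.nil) : ∃ f H, S.Triple α e f H := by
  classical
  rw [mem_nil] at heN
  push Not at heN
  obtain ⟨n, hen, hn⟩ := heN
  obtain ⟨X, hX⟩ : ∃ X : S.h, α X ≠ 0 := by
    by_contra! h
    exact hα (LinearMap.ext h)
  obtain ⟨k, hk⟩ := S.F_exhaust (X : g)
  have main : ∀ m, max n k ≤ m → ∃ f ∈ S.F m, (∀ x (hx : x ∈ S.hn m), ⁅x, f⁆ = -(α ⟨x, hx.1⟩ • f)) ∧
      ∃ H : S.h, (H : g) ∈ S.F m ∧ ⁅e, f⁆ = H ∧ α H = 2 := by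
    intro m hm
    have hem : e ∈ S.F m := S.F_mono ((le_max_left n k).trans hm) hen
    have h1 : (⟨e, hem⟩ : S.F m) ∉ LieAlgebra.radical K (S.F m) := fun h =>
      hn (S.rad_anti ((le_max_left n k).trans hm) (S.mem_rad.2 ⟨hem, h⟩) hen)
    have h2 : S.resDual m α ≠ 0 := fun h => hX (by
      exact LinearMap.congr_fun h ⟨X, X.2, S.F_mono ((le_max_right n k).trans hm) hk⟩)
    obtain ⟨f, hf, hf2, H, hH, hH2⟩ := S.exists_sl2_hn h2 (e := ⟨e, hem⟩)
      (fun H => he ⟨H, H.2.1⟩) h1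
    refine ⟨f, hf, fun x hx => ?_, ⟨H, H.2.1⟩, H.2.2, hH, hH2⟩
    have := hf2 ⟨x, hx⟩
    rw [LinearMap.neg_apply, neg_smul] at this
    exact this
  obtain ⟨f, hfm, hf, H, hHm, hef, h2⟩ := main _ le_rfl
  refine ⟨f, H, he, fun X' => ?_, hef, h2⟩
  obtain ⟨p, hp⟩ := S.F_exhaust (X' : g)
  have hle := le_max_left (max n k) p
  obtain ⟨f', hfm', hf', H', hHm', hef', h2'⟩ := main _ hle
  have hH : ⁅(H : g), f⁆ = -((2 : K) • f) := by rw [hf _ ⟨H.2, hHm⟩]; congr 2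
  have hHf' : ⁅(H : g), f'⁆ = -((2 : K) • f') := by
    rw [hf' _ ⟨H.2, S.F_mono hle hHm⟩]; congr 2
  have hsl := S.slTwo hef (by rw [he H, h2]) hH
  have h0 : f' - f = 0 := by
    refine hsl.eq_zero_of_E_pow (r := 2) ?_ ?_
    · rw [LieAlgebra.ad_apply, lie_sub, hH, hHf']; push_cast; module
    · rw [pow_two, Module.End.mul_apply]
      simp only [LieAlgebra.ad_apply]
      rw [lie_sub, hef, hef', ← lie_skew, sub_lie, he, he, h2, h2', sub_self, neg_zero]
  rw [← sub_eq_zero.1 h0, LinearMap.neg_apply, neg_smul]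
  exact hf' _ ⟨X'.2, S.F_mono (le_max_right _ _) hp⟩

end Setup
end LocalRadical

section SimpleRoots
namespace Setup
variable (S : Setup K g)

lemma b_le (hD : S.IsDynkin) {W : LieSubalgebra K g} (h1 : S.h ≤ W)
    (h2 : ∀ α, S.IsSimpleRoot α → ∀ x ∈ adWeightSpace K g S.h α, x ∈ W) : S.b ≤ W := by
  rw [hD, LieSubalgebra.lieSpan_le]
  rintro x (hx | hx)
  · exact h1 hx
  · obtain ⟨α, hα, hx⟩ := Set.mem_iUnion₂.1 hx
    exact h2 α hα x hx

lemma mem_b_of_pos {α : Module.Dual K S.h} (hα : α ∈ S.pos) {x : g}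
    (hx : x ∈ adWeightSpace K g S.h α) : x ∈ S.b := by
  rw [← LieSubalgebra.mem_toSubmodule, S.b_eq]
  exact Submodule.mem_sup_right
    (le_iSup₂_of_le (f := fun α _ => adWeightSpace K g S.h α) α hα le_rfl hx)

lemma mem_b_of_h {x : g} (hx : x ∈ S.h) : x ∈ S.b := by
  rw [← LieSubalgebra.mem_toSubmodule, S.b_eq]
  exact Submodule.mem_sup_left hx

variable {S}

lemma pos_ne_zero {α : Module.Dual K S.h} (hα : α ∈ S.pos) : α ≠ 0 := (S.pos_root α hα).1

lemma neg_notMem_pos {α : Module.Dual K S.h} (hα : α ∈ S.pos) : -α ∉ S.pos :=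
  (S.pos_polar α (S.pos_root α hα)).1 hα

lemma pos_or_neg {α : Module.Dual K S.h} (hα : IsRootOf K g S.h α) : α ∈ S.pos ∨ -α ∈ S.pos := by
  by_cases h : -α ∈ S.pos
  · exact Or.inr h
  · exact Or.inl ((S.pos_polar α hα).2 h)

lemma isRootOf_of_mem {α : Module.Dual K S.h} (hα : α ≠ 0) {x : g}
    (hx : x ∈ adWeightSpace K g S.h α) (h0 : x ≠ 0) : IsRootOf K g S.h α :=
  ⟨hα, fun h => h0 (by simpa [h] using hx)⟩

lemma not_simple_of_add {α β γ : Module.Dual K S.h} (hα : α ∈ S.pos) (hβ : β ∈ S.pos)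
    (h : α + β = γ) : ¬S.IsSimpleRoot γ := fun hs => hs.2
  ⟨{α, β}, by simp, by
    intro δ hδ
    simp only [Multiset.insert_eq_cons, Multiset.mem_cons, Multiset.mem_singleton] at hδ
    rcases hδ with rfl | rfl <;> assumption, by simpa using h⟩

/-- Subtracting a simple root from a positive root never leads to a negative root. -/
lemma sub_simple_pos {γ α : Module.Dual K S.h} (hγ : γ ∈ S.pos) (hα : S.IsSimpleRoot α)
    (h : IsRootOf K g S.h (γ - α)) : γ - α ∈ S.pos := by
  rcases pos_or_neg h with h1 | h1
  · exact h1
  · exact absurd hα (not_simple_of_add hγ h1 (by abel))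

lemma simple_sub_simple {γ α : Module.Dual K S.h} (hγ : S.IsSimpleRoot γ)
    (hα : S.IsSimpleRoot α) (hne : γ ≠ α) {x : g} (hx : x ∈ adWeightSpace K g S.h (γ - α)) :
    x = 0 := by
  by_contra h0
  have h1 := sub_simple_pos hγ.1 hα (isRootOf_of_mem (sub_ne_zero.2 hne) hx h0)
  exact not_simple_of_add h1 hα.1 (by abel) hγ

lemma wt_le_nplus {α : Module.Dual K S.h} (hα : α ∈ S.pos) :
    adWeightSpace K g S.h α ≤ S.nplus :=
  le_iSup₂_of_le (f := fun α _ => adWeightSpace K g S.h α) α hα le_rfl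

lemma lie_nplus {δ : Module.Dual K S.h} (hδ : δ ∈ S.pos) {x y : g}
    (hx : x ∈ adWeightSpace K g S.h δ) (hy : y ∈ S.nplus) : ⁅x, y⁆ ∈ S.nplus := by
  unfold nplus at hy
  rw [iSup_subtype'] at hy
  refine lie_mem_of_mem_iSup (fun α y hy => ?_) hy
  by_cases h0 : ⁅x, y⁆ = 0
  · rw [h0]; exact Submodule.zero_mem _
  · have h1 := S.lie_mem_wt hx hy
    have h2 : δ + α.1 ≠ 0 := fun h => neg_notMem_pos hδ (by
      rw [← eq_neg_of_add_eq_zero_right h]; exact α.2)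
    exact wt_le_nplus (S.pos_add δ hδ α.1 α.2 (isRootOf_of_mem h2 h1 h0)) h1

lemma lie_h_nplus {x y : g} (hx : x ∈ S.h) (hy : y ∈ S.nplus) : ⁅x, y⁆ ∈ S.nplus := by
  unfold nplus at hy
  rw [iSup_subtype'] at hy
  refine lie_mem_of_mem_iSup (fun α y hy => ?_) hy
  rw [show ⁅x, y⁆ = α.1 ⟨x, hx⟩ • y from hy ⟨x, hx⟩]
  exact Submodule.smul_mem _ _ (wt_le_nplus α.2 hy)

lemma lie_b_nplus {x y : g} (hx : x ∈ S.b) (hy : y ∈ S.nplus) : ⁅x, y⁆ ∈ S.nplus := by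
  rw [← LieSubalgebra.mem_toSubmodule, S.b_eq, iSup_subtype'] at hx
  obtain ⟨a, ha, b, hb, rfl⟩ := Submodule.mem_sup.1 hx
  rw [add_lie, ← lie_skew b y]
  exact Submodule.add_mem _ (lie_h_nplus ha hy) (neg_mem
    (lie_mem_of_mem_iSup (fun α z hz => by rw [← lie_skew]; exact neg_mem (lie_nplus α.2 hz hy)) hb))

lemma eq_zero_of_nplus_central {z : g} (hz : z ∈ S.nplus) (hc : ∀ y : g, ⁅y, z⁆ = 0) : z = 0 := by
  have h1 : z ∈ adWeightSpace K g S.h 0 := fun H => by rw [hc]; simp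
  have h2 := S.h_indep 0
  refine Submodule.disjoint_def.1 h2 z h1 ?_
  refine (iSup₂_mono' ?_ : S.nplus ≤ _) hz
  exact fun α hα => ⟨α, pos_ne_zero hα, le_rfl⟩

/-- The subspace generated by `e` under the Borel subalgebra. -/
def bSpan (S : Setup K g) (e : g) : Submodule K g :=
  sInf {W | e ∈ W ∧ ∀ b ∈ S.b, ∀ w ∈ W, ⁅b, w⁆ ∈ W}

lemma mem_bSpan_self (e : g) : e ∈ bSpan S e := Submodule.mem_sInf.2 fun _ hW => hW.1

lemma lie_mem_bSpan {e b w : g} (hb : b ∈ S.b) (hw : w ∈ bSpan S e) : ⁅b, w⁆ ∈ bSpan S e :=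
  Submodule.mem_sInf.2 fun W hW => hW.2 b hb w (Submodule.mem_sInf.1 hw W hW)

lemma bSpan_le {e : g} {W : Submodule K g} (h1 : e ∈ W) (h2 : ∀ b ∈ S.b, ∀ w ∈ W, ⁅b, w⁆ ∈ W) :
    bSpan S e ≤ W := sInf_le ⟨h1, h2⟩

/-- A root vector of the local radical vanishes if all negative root vectors map it to the
centre. -/
lemma eq_zero_of_lie_central {γ : Module.Dual K S.h} (hγ : γ ∈ S.pos) {e : g}
    (he : e ∈ adWeightSpace K g S.h γ) (heN : e ∈ S.nil)
    (hc : ∀ δ ∈ S.pos, ∀ f ∈ adWeightSpace K g S.h (-δ), ⁅f, e⁆ ∈ LieAlgebra.center K g) :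
    e = 0 := by
  set X := bSpan S e
  set Z := (LieAlgebra.center K g).toSubmodule
  have hZ : ∀ z, z ∈ Z → ∀ y : g, ⁅y, z⁆ = 0 := fun z hz =>
    (LieModule.mem_maxTrivSubmodule _ _ _ _).1 hz
  have hXN : X ≤ S.nplus ⊓ S.nil.toSubmodule := by
    refine bSpan_le ⟨wt_le_nplus hγ he, heN⟩ fun b hb w hw => ⟨lie_b_nplus hb hw.1, S.nil.lie_mem hw.2⟩
  have hXX : ∀ x ∈ X, ∀ y ∈ X, ⁅x, y⁆ = 0 := fun x hx y hy =>
    eq_zero_of_nplus_central (S := S)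
      (lie_b_nplus (by
        have := (hXN hx).1
        rw [← LieSubalgebra.mem_toSubmodule, S.b_eq]
        exact Submodule.mem_sup_right this) (hXN hy).1)
      (S.lie_lie_nil (hXN hx).2 (hXN hy).2)
  have hstab : ∀ x ∈ X, ∀ y : g, ⁅y, x⁆ ∈ X ⊔ Z := by
    let W : Submodule K g :=
      { carrier := {x | x ∈ X ∧ ∀ y : g, ⁅y, x⁆ ∈ X ⊔ Z}
        add_mem' := fun {a b} ha hb => ⟨X.add_mem ha.1 hb.1, fun y => by
          rw [lie_add]; exact Submodule.add_mem _ (ha.2 y) (hb.2 y)⟩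
        zero_mem' := ⟨X.zero_mem, fun y => by rw [lie_zero]; exact Submodule.zero_mem _⟩
        smul_mem' := fun c a ha => ⟨X.smul_mem c ha.1, fun y => by
          rw [lie_smul]; exact Submodule.smul_mem _ c (ha.2 y)⟩ }
    have hW : X ≤ W := by
      refine bSpan_le ⟨mem_bSpan_self e, fun y => ?_⟩ fun b hb w hw =>
        ⟨lie_mem_bSpan hb hw.1, fun y => ?_⟩
      · have hy : y ∈ ⨆ α : Module.Dual K S.h, adWeightSpace K g S.h α := by
          rw [S.h_span]; trivial
        rw [← lie_skew]
        refine neg_mem (lie_mem_of_mem_iSup (fun α y hy => ?_) hy)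
        rw [← lie_skew]
        apply neg_mem
        by_cases hα : α = 0
        · subst hα
          exact Submodule.mem_sup_left
            (lie_mem_bSpan (S.mem_b_of_h (S.mem_h_of_wt_zero hy)) (mem_bSpan_self e))
        · by_cases hy0 : y = 0
          · rw [hy0, zero_lie]; exact Submodule.zero_mem _
          · rcases pos_or_neg (isRootOf_of_mem hα hy hy0) with h | h
            · exact Submodule.mem_sup_left
                (lie_mem_bSpan (S.mem_b_of_pos h hy) (mem_bSpan_self e))
            · exact Submodule.mem_sup_right (hc _ h y (by rwa [neg_neg]))
      · rw [leibniz_lie]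
        refine Submodule.add_mem _ (hw.2 _) ?_
        obtain ⟨p, hp, z, hz, hpz⟩ := Submodule.mem_sup.1 (hw.2 y)
        rw [← hpz, lie_add, hZ z hz, add_zero]
        exact Submodule.mem_sup_left (lie_mem_bSpan hb hp)
    exact fun x hx => (hW hx).2
  let J : LieIdeal K g :=
    { X ⊔ Z with
      lie_mem := fun {y x} hx => by
        obtain ⟨p, hp, z, hz, rfl⟩ := Submodule.mem_sup.1 hx
        rw [lie_add, hZ z hz, add_zero]
        exact hstab p hp y }
  have hJ : ∀ x ∈ J, ∀ y ∈ J, ⁅x, y⁆ = 0 := by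
    intro x hx y hy
    obtain ⟨p, hp, z, hz, rfl⟩ := Submodule.mem_sup.1 hx
    obtain ⟨q, hq, z', hz', rfl⟩ := Submodule.mem_sup.1 hy
    rw [lie_add, hZ z' hz', add_zero, add_lie, hXX p hp q hq, ← lie_skew, hZ z hz, neg_zero,
      zero_add]
  have heJ : e ∈ J := Submodule.mem_sup_left (mem_bSpan_self e)
  exact eq_zero_of_nplus_central (S := S) (hXN (mem_bSpan_self e)).1
    (S.lie_eq_zero_of_abelian J hJ heJ)

/-- Root vectors of the local radical vanish if no simple root vector leads to their weight
from within the local radical. -/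
lemma eq_zero_of_mem_nil_of_simple (hD : S.IsDynkin) {γ : Module.Dual K S.h} (hγ : γ ∈ S.pos)
    (hs : ∀ α, S.IsSimpleRoot α → ∀ x ∈ adWeightSpace K g S.h α, ∀ v ∈ S.nil,
      v ∈ adWeightSpace K g S.h (γ - α) → ⁅x, v⁆ = 0) {e : g}
    (he : e ∈ adWeightSpace K g S.h γ) (heN : e ∈ S.nil) : e = 0 := by
  let Y : Submodule K g :=
    ⨆ β : {β : Module.Dual K S.h // β ≠ γ}, S.nil.toSubmodule ⊓ adWeightSpace K g S.h β.1
  have hYin : ∀ β, β ≠ γ → ∀ v ∈ S.nil, v ∈ adWeightSpace K g S.h β → v ∈ Y :=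
    fun β hβ v h1 h2 => Submodule.mem_iSup_of_mem ⟨β, hβ⟩ ⟨h1, h2⟩
  have hY0 : ∀ v ∈ Y, v ∈ adWeightSpace K g S.h γ → v = 0 := by
    intro v hv hvγ
    refine Submodule.disjoint_def.1 (S.h_indep γ) v hvγ ?_
    refine (iSup_le fun β => ?_ : Y ≤ _) hv
    exact inf_le_right.trans
      (le_iSup₂_of_le (f := fun β _ => adWeightSpace K g S.h β) β.1 β.2 le_rfl)
  have hb : S.b ≤ stab Y := by
    refine S.b_le hD (fun x hx y hy => ?_) fun α hα x hx y hy => ?_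
    · refine lie_mem_of_mem_iSup (fun β y hy => ?_) hy
      rw [show ⁅x, y⁆ = β.1 ⟨x, hx⟩ • y from hy.2 ⟨x, hx⟩]
      exact Submodule.smul_mem _ _ (hYin _ β.2 y hy.1 hy.2)
    · refine lie_mem_of_mem_iSup (fun β y hy => ?_) hy
      by_cases h : α + β.1 = γ
      · rw [hs α hα x hx y hy.1 (by rw [← h, add_sub_cancel_left]; exact hy.2)]
        exact Submodule.zero_mem _
      · exact hYin _ h _ (S.nil.lie_mem hy.1) (S.lie_mem_wt hx hy.2)
  refine eq_zero_of_lie_central hγ he heN fun δ hδ f hf => ?_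
  have hwt := S.lie_mem_wt hf he
  have hN : ⁅f, e⁆ ∈ S.nil := S.nil.lie_mem heN
  by_cases hfN : f ∈ S.nil
  · exact (LieModule.mem_maxTrivSubmodule _ _ _ _).2 (S.lie_lie_nil hfN heN)
  · obtain ⟨e', H, t⟩ := S.exists_triple (neg_ne_zero.2 (pos_ne_zero hδ)) hf hfN
    have he' := t.f_mem
    rw [neg_neg] at he'
    have h1 : ⁅e', ⁅f, e⁆⁆ = 0 := by
      refine hY0 _ (hb (S.mem_b_of_pos hδ he') _
        (hYin _ (fun h => pos_ne_zero hδ ?_) _ hN hwt)) ?_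
      · simpa using h
      · have := S.lie_mem_wt he' hwt
        rwa [add_neg_cancel_left] at this
    have h2 := t.slTwo.E_eq_zero (v := e) (m := γ H) (by rw [LieAlgebra.ad_apply, he H]) h1
    rw [LieAlgebra.ad_apply] at h2
    rw [h2]; exact Submodule.zero_mem _

/-- Simple roots admit `sl₂`-triples. -/
lemma exists_triple_of_simple (hD : S.IsDynkin) {α : Module.Dual K S.h}
    (hα : S.IsSimpleRoot α) : ∃ e f H, S.Triple α e f H := by
  obtain ⟨e, he, h0⟩ := Submodule.exists_mem_ne_zero_of_ne_bot (S.pos_root α hα.1).2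
  have heN : e ∉ S.nil := fun heN => h0 (by
    refine eq_zero_of_mem_nil_of_simple hD hα.1 (fun β hβ x hx v hv hvw => ?_) he heN
    by_cases h : α = β
    · subst h
      rw [sub_self] at hvw
      rw [← lie_skew, S.nil_cartan_central hv (S.mem_h_of_wt_zero hvw), neg_zero]
    · rw [simple_sub_simple hα hβ h hvw, lie_zero])
  obtain ⟨f, H, t⟩ := S.exists_triple (pos_ne_zero hα.1) he heN
  exact ⟨e, f, H, t⟩

lemma lie_simple_neg_simple {α β : Module.Dual K S.h} (hα : S.IsSimpleRoot α)
    (hβ : S.IsSimpleRoot β) (hne : α ≠ β) {x y : g} (hx : x ∈ adWeightSpace K g S.h α)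
    (hy : y ∈ adWeightSpace K g S.h (-β)) : ⁅x, y⁆ = 0 :=
  simple_sub_simple hα hβ hne (by rw [sub_eq_add_neg]; exact S.lie_mem_wt hx hy)

end Setup
end SimpleRoots

section TraceForm
namespace Setup
variable (S : Setup K g)

lemma exists_weights (n : ℕ) : ∃ (J : Type) (_ : Fintype J) (b : J → g)
    (β : J → Module.Dual K (S.hn n)), (∀ j, b j ≠ 0) ∧
    (∀ j, b j ∈ adWeightSpace K g (S.hn n) (β j)) ∧
    (∀ x y, killingForm K (S.F n) (S.tau n x) (S.tau n y) = ∑ j, β j x * β j y) ∧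
    ∀ x, (∀ j, β j x = 0) → ∀ y ∈ S.F n, ⁅(x : g), y⁆ = 0 := by
  classical
  set X : Set (S.F n) := {x | ∃ mu, x ∈ adWt (S.tau n) mu}
  have hX : ⊤ ≤ Submodule.span K X := by
    rw [← S.iSup_adWt_tau n]
    exact iSup_le fun mu x hx => Submodule.subset_span ⟨mu, hx⟩
  let B := Module.Basis.ofSpan hX
  have hB : ∀ j, ∃ mu, B j ∈ adWt (S.tau n) mu := fun j =>
    Module.Basis.ofSpan_subset hX ⟨j, rfl⟩
  choose β hβ using hB
  have hfin := Module.Finite.finite_basis B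
  refine ⟨_, Fintype.ofFinite _, fun j => (B j : g), β, fun j h => B.ne_zero j (Subtype.ext h),
    fun j => S.mem_adWt_tau.1 (hβ j), fun x y => ?_, fun x hx y hy => ?_⟩
  · rw [killingForm_apply_apply, LinearMap.trace_eq_matrix_trace K B, Matrix.trace]
    refine Finset.sum_congr rfl fun j _ => ?_
    rw [Matrix.diag_apply, LinearMap.toMatrix_apply, LinearMap.comp_apply, LieAlgebra.ad_apply,
      LieAlgebra.ad_apply, hβ j y, lie_smul, hβ j x]
    simp [mul_comm]
  · have h : LieAlgebra.ad K (S.F n) (S.tau n x) = 0 := B.ext fun j => by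
      rw [LieAlgebra.ad_apply, hβ j x, hx j, zero_smul, LinearMap.zero_apply]
    exact congrArg Subtype.val (LinearMap.congr_fun h ⟨y, hy⟩)

variable {S}

namespace Triple
variable {α : Module.Dual K S.h} {e f : g} {H : S.h}

lemma H_mem (t : S.Triple α e f H) {n : ℕ} (he : e ∈ S.F n) (hf : f ∈ S.F n) :
    (H : g) ∈ S.F n := by rw [← t.ef]; exact (S.F n).lie_mem he hf

lemma killing_H (t : S.Triple α e f H) {n : ℕ} (he : e ∈ S.F n) (hf : f ∈ S.F n)
    (x : S.hn n) :
    killingForm K (S.F n) ⟨H, t.H_mem he hf⟩ (S.tau n x) =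
      α ⟨x, x.2.1⟩ * killingForm K (S.F n) ⟨e, he⟩ ⟨f, hf⟩ := by
  have h1 : (⟨H, t.H_mem he hf⟩ : S.F n) = ⁅(⟨e, he⟩ : S.F n), (⟨f, hf⟩ : S.F n)⁆ :=
    Subtype.ext t.ef.symm
  have h2 : ⁅(⟨f, hf⟩ : S.F n), S.tau n x⁆ = α ⟨x, x.2.1⟩ • (⟨f, hf⟩ : S.F n) := by
    apply Subtype.ext
    have := t.f_mem ⟨x, x.2.1⟩
    rw [LinearMap.neg_apply, neg_smul] at this
    change ⁅f, (x : g)⁆ = α ⟨x, x.2.1⟩ • f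
    rw [← lie_skew, this, neg_neg]
  rw [h1, killingForm, LieModule.traceForm_apply_lie_apply, h2, map_smul, smul_eq_mul]

end Triple

lemma exists_gram {ι : Type} {a : ι → Module.Dual K S.h} {e f : ι → g} {H : ι → S.h}
    (t : ∀ i, S.Triple (a i) (e i) (f i) (H i)) (s : Finset ι) (n : ℕ)
    (he : ∀ i ∈ s, e i ∈ S.F n) (hf : ∀ i ∈ s, f i ∈ S.F n) :
    ∃ (d : ι → ℚ) (G : ι → ι → ℚ), (∀ i ∈ s, 0 < d i) ∧
      (∀ i (hi : i ∈ s), (d i : K) * killingForm K (S.F n) ⟨e i, he i hi⟩ ⟨f i, hf i hi⟩ = 1) ∧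
      (∀ i ∈ s, ∀ j ∈ s, ((G i j : ℚ) : K) = (d i : K) * a j (H i)) ∧
      (∀ i j, G i j = G j i) ∧
      (∀ c : ι → ℚ, 0 ≤ ∑ i ∈ s, ∑ j ∈ s, c i * G i j * c j) ∧
      (∀ c : ι → ℚ, ∑ i ∈ s, ∑ j ∈ s, c i * G i j * c j = 0 →
        ∀ x : S.h, (x : g) ∈ S.F n → ∑ i ∈ s, (c i : K) * a i x = 0) := by
  classical
  obtain ⟨J, _, b, β, hb0, hb, hB, hz⟩ := S.exists_weights n
  have hHn : ∀ i ∈ s, (H i : g) ∈ S.hn n := fun i hi =>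
    ⟨(H i).2, (t i).H_mem (he i hi) (hf i hi)⟩
  have hint : ∀ i j, ∃ z : ℤ, ∀ hi : i ∈ s, β j ⟨H i, hHn i hi⟩ = z := by
    intro i j
    by_cases hi : i ∈ s
    · obtain ⟨z, hz⟩ := (t i).slTwo.int_of_ne (v := b j) (m := β j ⟨H i, hHn i hi⟩)
        (by rw [LieAlgebra.ad_apply]; exact hb j ⟨H i, hHn i hi⟩) (hb0 j)
      exact ⟨z, fun _ => hz⟩
    · exact ⟨0, fun h => absurd h hi⟩
  choose z hzz using hint
  set N : ι → ℚ := fun i => ∑ k, (z i k : ℚ) ^ 2 with hN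
  set κ : ∀ i ∈ s, K := fun i hi => killingForm K (S.F n) ⟨e i, he i hi⟩ ⟨f i, hf i hi⟩ with hκ
  have hkil : ∀ i (hi : i ∈ s) (x : S.h) (hx : (x : g) ∈ S.F n),
      ∑ k, (z i k : K) * β k ⟨x, x.2, hx⟩ = a i x * κ i hi := by
    intro i hi x hx
    have h1 := (t i).killing_H (he i hi) (hf i hi) ⟨x, x.2, hx⟩
    have h2 := hB ⟨H i, hHn i hi⟩ ⟨x, x.2, hx⟩
    simp only [hzz _ _ hi] at h2
    rw [← h2]
    exact h1
  have hκN : ∀ i (hi : i ∈ s), (N i : K) = 2 * κ i hi := by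
    intro i hi
    have h1 := hkil i hi (H i) (hHn i hi).2
    simp only [hzz _ _ hi, (t i).two] at h1
    rw [← h1]
    simp [hN, sq]
  have hNpos : ∀ i ∈ s, 0 < N i := by
    intro i hi
    refine lt_of_le_of_ne (Finset.sum_nonneg fun k _ => sq_nonneg _) fun h0 => ?_
    have h1 := (Finset.sum_eq_zero_iff_of_nonneg (fun k _ => sq_nonneg (z i k : ℚ))).1 h0.symm
    have h2 := hz ⟨H i, hHn i hi⟩ (fun k => by
      have := h1 k (Finset.mem_univ k)
      have h3 : z i k = 0 := by exact_mod_cast pow_eq_zero_iff (two_ne_zero) |>.1 this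
      rw [hzz i k hi, h3, Int.cast_zero]) (e i) (he i hi)
    have h3 : ⁅(H i : g), e i⁆ = 0 := h2
    rw [(t i).he] at h3
    exact (t i).e_ne_zero ((smul_eq_zero.1 h3).resolve_left two_ne_zero)
  have hN0 : ∀ i ∈ s, (N i : K) ≠ 0 := fun i hi => by exact_mod_cast (hNpos i hi).ne'
  set w : ι → J → ℚ := fun i k => 2 / N i * z i k with hw
  have hwa : ∀ i (hi : i ∈ s) (x : S.h) (hx : (x : g) ∈ S.F n),
      ∑ k, (w i k : K) * β k ⟨x, x.2, hx⟩ = a i x := by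
    intro i hi x hx
    have h1 := hkil i hi x hx
    have h2 := hN0 i hi
    rw [show κ i hi = N i / 2 by rw [hκN i hi]; field_simp] at h1
    simp only [hw]
    push_cast
    simp only [mul_assoc]
    rw [← Finset.mul_sum, h1]
    field_simp
  set G : ι → ι → ℚ := fun i j => ∑ k, w i k * w j k with hG
  have hquad : ∀ c : ι → ℚ, ∑ i ∈ s, ∑ j ∈ s, c i * G i j * c j =
      ∑ k, (∑ i ∈ s, c i * w i k) ^ 2 := by
    intro c
    simp only [sq, Finset.sum_mul_sum]
    rw [Finset.sum_comm (s := Finset.univ)]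
    refine Finset.sum_congr rfl fun i _ => ?_
    rw [Finset.sum_comm (s := Finset.univ)]
    refine Finset.sum_congr rfl fun j _ => ?_
    simp only [hG]
    rw [Finset.mul_sum, Finset.sum_mul]
    exact Finset.sum_congr rfl fun k _ => by ring
  refine ⟨fun i => 2 / N i, G, fun i hi => div_pos two_pos (hNpos i hi), fun i hi => ?_,
    fun i hi j hj => ?_, fun i j => Finset.sum_congr rfl fun k _ => mul_comm _ _, fun c => ?_,
    fun c hc x hx => ?_⟩
  · have h1 := hκN i hi
    have h2 := hN0 i hi
    change _ * κ i hi = 1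
    push_cast
    rw [div_mul_eq_mul_div, ← h1, div_self h2]
  · rw [← hwa j hj (H i) (hHn i hi).2, Finset.mul_sum]
    simp only [hzz _ _ hi, hG]
    push_cast
    refine Finset.sum_congr rfl fun k _ => ?_
    simp only [hw]
    push_cast
    ring
  · rw [hquad]; exact Finset.sum_nonneg fun k _ => sq_nonneg _
  · rw [hquad] at hc
    have h1 : ∀ k, ∑ i ∈ s, c i * w i k = 0 := fun k =>
      pow_eq_zero_iff two_ne_zero |>.1
        ((Finset.sum_eq_zero_iff_of_nonneg (fun k _ => sq_nonneg _)).1 hc k (Finset.mem_univ k))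
    have h2 : ∀ i ∈ s, (c i : K) * a i x =
        ∑ k, ((c i * w i k : ℚ) : K) * β k ⟨x, x.2, hx⟩ := fun i hi => by
      rw [← hwa i hi x hx, Finset.mul_sum]
      exact Finset.sum_congr rfl fun k _ => by push_cast; ring
    rw [Finset.sum_congr rfl h2, Finset.sum_comm]
    refine Finset.sum_eq_zero fun k _ => ?_
    rw [← Finset.sum_mul, ← Rat.cast_sum, h1 k, Rat.cast_zero, zero_mul]

end Setup
end TraceForm

section SimpleIndependence
namespace Setup

/-- The type of simple roots. -/
abbrev Simple (S : Setup K g) : Type := {α : Module.Dual K S.h // S.IsSimpleRoot α}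

variable {S : Setup K g}

lemma pos_add_ne_zero {α β : Module.Dual K S.h} (hα : α ∈ S.pos) (hβ : β ∈ S.pos) :
    α + β ≠ 0 := fun h => neg_notMem_pos hα (by rwa [← eq_neg_of_add_eq_zero_right h])

/-- The cases where two triples at distinct simple roots interact. -/
lemma triple_lie_ne_zero {γ δ : Module.Dual K S.h} {e f e' f' : g} {H H' : S.h}
    (t : S.Triple γ e f H) (t' : S.Triple δ e' f' H') {k : ℕ} (hk : 0 < k)
    (h : δ H = -(k : K)) : ⁅e, e'⁆ ∉ S.nil := by
  intro hN
  have h1 : ⁅f, ⁅e, e'⁆⁆ = 0 := by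
    refine t'.eq_zero_of_mem_nil ?_ (S.nil.lie_mem hN)
    have := S.lie_mem_wt t.f_mem (S.lie_mem_wt t.e_mem t'.e_mem)
    rwa [neg_add_cancel_left] at this
  have hv : LieAlgebra.ad K g (H : g) e' = -(k : K) • e' := by
    rw [LieAlgebra.ad_apply, t'.e_mem H, h]
  have h2 := t.slTwo.E_eq_zero hv h1
  refine t'.e_ne_zero (t.slTwo.eq_zero_of_E_pow hv ?_)
  obtain ⟨r, rfl⟩ := Nat.exists_eq_succ_of_ne_zero hk.ne'
  rw [pow_succ, Module.End.mul_apply, h2, map_zero]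

lemma add_simple_sum_ne_zero (hD : S.IsDynkin) : ∀ (k : ℕ) {γ : Module.Dual K S.h} {e f : g}
    {H : S.h}, γ ∈ S.pos → S.Triple γ e f H → ∀ m : Multiset S.Simple, Multiset.card m = k →
    γ + (m.map Subtype.val).sum ≠ 0 := by
  intro k
  induction k with
  | zero =>
    intro γ e f H hγ t m hm
    rw [Multiset.card_eq_zero.1 hm]
    simpa using pos_ne_zero hγ
  | succ k ih =>
    intro γ e f H hγ t m hm h0
    have hint : ∃ j ∈ m, ∃ r : ℕ, 0 < r ∧ j.1 H = -(r : K) := by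
      by_contra! hcon
      have hnat : ∀ j ∈ m, j.1 H ∈ AddMonoidHom.mrange (Nat.castAddMonoidHom K) := by
        intro j hj
        obtain ⟨z, hz⟩ := t.exists_int (S.pos_root j.1 j.2.1).2
        obtain ⟨r, rfl | rfl⟩ := z.eq_nat_or_neg
        · exact ⟨r, by simp [hz]⟩
        · rcases Nat.eq_zero_or_pos r with rfl | hr
          · exact ⟨0, by simp [hz]⟩
          · exact absurd (by simpa using hz) (hcon j hj r hr)
      have hsum : ((m.map Subtype.val).sum : Module.Dual K S.h) H ∈
          AddMonoidHom.mrange (Nat.castAddMonoidHom K) := by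
        rw [← LinearMap.applyₗ_apply_apply, map_multiset_sum, Multiset.map_map]
        refine AddSubmonoid.multiset_sum_mem _ _ fun a ha => ?_
        obtain ⟨j, hj, rfl⟩ := Multiset.mem_map.1 ha
        exact hnat j hj
      obtain ⟨r, hr⟩ := hsum
      have h1 := LinearMap.congr_fun h0 H
      rw [LinearMap.add_apply, t.two, ← hr] at h1
      have h2 : ((2 + r : ℕ) : K) = 0 := by simpa using h1
      exact absurd (Nat.cast_eq_zero.1 h2) (by omega)
    obtain ⟨j, hj, r, hr, hjr⟩ := hint
    obtain ⟨e', f', H', t'⟩ := exists_triple_of_simple hD j.2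
    have hN := triple_lie_ne_zero t t' hr hjr
    have hwt := S.lie_mem_wt t.e_mem t'.e_mem
    have hne := pos_add_ne_zero hγ j.2.1
    obtain ⟨f'', H'', t''⟩ := S.exists_triple hne hwt hN
    obtain ⟨m', rfl⟩ := Multiset.exists_cons_of_mem hj
    refine ih (S.pos_add γ hγ j.1 j.2.1 t''.isRoot) t'' m' (by simpa using hm) ?_
    rw [← h0]
    simp [add_assoc]

lemma simple_sum_ne_zero (hD : S.IsDynkin) {m : Multiset S.Simple} (hm : m ≠ 0) :
    (m.map Subtype.val).sum ≠ 0 := by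
  obtain ⟨j, hj⟩ := Multiset.exists_mem_of_ne_zero hm
  obtain ⟨m', rfl⟩ := Multiset.exists_cons_of_mem hj
  obtain ⟨e, f, H, t⟩ := exists_triple_of_simple hD j.2
  rw [Multiset.map_cons, Multiset.sum_cons]
  exact add_simple_sum_ne_zero hD _ j.2.1 t m' rfl

lemma rat_simple_sum_ne_zero (hD : S.IsDynkin) (s : Finset S.Simple) (x : S.Simple → ℚ)
    (hx : ∀ i, 0 ≤ x i) (h : ∑ i ∈ s, (x i : K) • i.1 = 0) : ∀ i ∈ s, x i = 0 := by
  classical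
  lift x to S.Simple → ℚ≥0 using hx
  by_contra! hcon
  obtain ⟨i, hi, hxi⟩ := hcon
  set D : ℕ := ∏ j ∈ s, (x j).den
  have hDx : ∀ j ∈ s, ∃ r : ℕ, (D : ℚ) * x j = r := fun j hj => by
    obtain ⟨q, hq⟩ := Finset.dvd_prod_of_mem (fun j => (x j).den) hj
    refine ⟨(x j).num * q, ?_⟩
    have := NNRat.mul_den_eq_num (x j)
    rw [show D = (x j).den * q from hq]
    push_cast
    rw [mul_comm, ← mul_assoc]
    exact_mod_cast congrArg (· * (q : ℚ≥0)) this
  choose! r hr using hDx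
  refine simple_sum_ne_zero hD (m := ∑ j ∈ s, r j • {j}) ?_ ?_
  · intro h0
    have h2 : r i = 0 := by simpa using congrArg Multiset.card (Finset.sum_eq_zero_iff.1 h0 i hi)
    have h3 := hr i hi
    rw [h2, Nat.cast_zero, mul_eq_zero] at h3
    exact h3.elim (Nat.cast_ne_zero.2 (Finset.prod_ne_zero_iff.2 fun j _ => (x j).den_ne_zero)) hxi
  · have h1 : ((∑ j ∈ s, r j • ({j} : Multiset S.Simple)).map Subtype.val).sum =
        ∑ j ∈ s, (r j : K) • j.1 := by
      have h2 := map_sum ((Multiset.sumAddMonoidHom (M := Module.Dual K S.h)).comp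
        (Multiset.mapAddMonoidHom (Subtype.val : S.Simple → Module.Dual K S.h)))
        (fun j => r j • ({j} : Multiset S.Simple)) s
      refine h2.trans (Finset.sum_congr rfl fun j _ => ?_)
      rw [map_nsmul, Nat.cast_smul_eq_nsmul]
      simp
    rw [h1]
    rw [← smul_zero (D : K), ← h, Finset.smul_sum]
    refine Finset.sum_congr rfl fun j hj => ?_
    rw [smul_smul]
    congr 1
    have := congrArg (Rat.cast : ℚ → K) (hr j hj)
    push_cast at this ⊢
    exact this.symm

variable (hD : S.IsDynkin)

/-- Chosen simple root vectors. -/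
def chE (i : S.Simple) : g := (exists_triple_of_simple hD i.2).choose

/-- Chosen negative simple root vectors. -/
def chF (i : S.Simple) : g := (exists_triple_of_simple hD i.2).choose_spec.choose

/-- The simple coroots. -/
def chH (i : S.Simple) : S.h := (exists_triple_of_simple hD i.2).choose_spec.choose_spec.choose

lemma chT (i : S.Simple) : S.Triple i.1 (chE hD i) (chF hD i) (chH hD i) :=
  (exists_triple_of_simple hD i.2).choose_spec.choose_spec.choose_spec

lemma exists_nat_of_ne {i j : S.Simple} (hij : i ≠ j) :
    ∃ r : ℕ, j.1 (chH hD i) = -(r : K) := by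
  have t := chT hD i
  have h1 : ⁅chF hD i, chE hD j⁆ = 0 := by
    rw [← lie_skew, lie_simple_neg_simple j.2 i.2 (fun h => hij (Subtype.ext h.symm))
      (chT hD j).e_mem t.f_mem, neg_zero]
  obtain ⟨r, hr, _⟩ := t.slTwo.symm.nat_of_E (v := chE hD j) (m := -j.1 (chH hD i))
    (by rw [LinearMap.neg_apply, LieAlgebra.ad_apply, (chT hD j).e_mem, neg_smul]) h1
    (chT hD j).e_ne_zero
  exact ⟨r, by rw [← hr, neg_neg]⟩

/-- The symmetrized Cartan matrix of a finite set of simple roots is positive definite. -/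
lemma exists_gram_simple (s : Finset S.Simple) (n : ℕ)
    (he : ∀ i ∈ s, chE hD i ∈ S.F n) (hf : ∀ i ∈ s, chF hD i ∈ S.F n) :
    ∃ (d : S.Simple → ℚ) (G : S.Simple → S.Simple → ℚ), (∀ i (hi : i ∈ s),
        (d i : K) * killingForm K (S.F n) ⟨chE hD i, he i hi⟩ ⟨chF hD i, hf i hi⟩ = 1) ∧
      IsGram Subtype.val (chH hD) s d G := by
  classical
  obtain ⟨d, G, hd, hdk, hG, hsym, hnn, hdeg⟩ := exists_gram (chT hD) s n he hf
  refine ⟨d, G, hdk, hd, hG, hsym, hnn, ?_⟩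
  have hHn : ∀ i ∈ s, (chH hD i : g) ∈ S.F n := fun i hi => (chT hD i).H_mem (he i hi) (hf i hi)
  have hrow : ∀ c : S.Simple → ℚ, ∑ i ∈ s, ∑ j ∈ s, c i * G i j * c j = 0 →
      ∀ j ∈ s, ∑ i ∈ s, c i * G i j = 0 := by
    intro c hc j hj
    have h1 := hdeg c hc (chH hD j) (hHn j hj)
    have h2 : ((∑ i ∈ s, c i * G i j : ℚ) : K) =
        (d j : K) * ∑ i ∈ s, (c i : K) * i.1 (chH hD j) := by
      push_cast
      rw [Finset.mul_sum]
      refine Finset.sum_congr rfl fun i hi => ?_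
      rw [hsym i j, hG j hj i hi]
      ring
    rw [h1, mul_zero] at h2
    exact_mod_cast h2
  have hrel : ∀ c : S.Simple → ℚ, ∑ i ∈ s, ∑ j ∈ s, c i * G i j * c j = 0 →
      ∑ i ∈ s, (c i : K) • i.1 = 0 := by
    intro c hc
    ext x
    obtain ⟨p, hp⟩ := S.F_exhaust (x : g)
    have hle : n ≤ max n p := le_max_left _ _
    obtain ⟨d', G', hd', _, hG', _, _, hdeg'⟩ := exists_gram (chT hD) s (max n p)
      (fun i hi => S.F_mono hle (he i hi)) (fun i hi => S.F_mono hle (hf i hi))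
    have h1 : ∑ i ∈ s, ∑ j ∈ s, c i * G' i j * c j = 0 := by
      refine Finset.sum_eq_zero fun i hi => ?_
      have h2 : ∑ j ∈ s, c j * G j i = 0 := hrow c hc i hi
      have h3 : ∀ j ∈ s, G' i j = d' i / d i * G i j := by
        intro j hj
        have hdi : (d i : K) ≠ 0 := by exact_mod_cast (hd i hi).ne'
        have : ((G' i j : ℚ) : K) = ((d' i / d i * G i j : ℚ) : K) := by
          push_cast
          rw [hG' i hi j hj, hG i hi j hj]
          field_simp
        exact_mod_cast this
      calc ∑ j ∈ s, c i * G' i j * c j = c i * (d' i / d i) * ∑ j ∈ s, c j * G j i := by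
            rw [Finset.mul_sum]
            refine Finset.sum_congr rfl fun j hj => ?_
            rw [h3 j hj, hsym i j]; ring
        _ = 0 := by rw [h2, mul_zero]
    have h2 := hdeg' c h1 x (S.F_mono (le_max_right _ _) hp)
    simpa using h2
  have hoff : ∀ i ∈ s, ∀ j ∈ s, i ≠ j → G i j ≤ 0 := by
    intro i hi j hj hij
    obtain ⟨r, hr⟩ := exists_nat_of_ne hD hij
    have h1 : G i j = -(d i * r) := by
      have := hG i hi j hj
      rw [hr] at this
      have h2 : ((G i j : ℚ) : K) = ((-(d i * r) : ℚ) : K) := by rw [this]; push_cast; ring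
      exact_mod_cast h2
    rw [h1]
    have := mul_nonneg (hd i hi).le (Nat.cast_nonneg (α := ℚ) r)
    linarith
  have hpart : ∀ c : S.Simple → ℚ, ∑ i ∈ s, ∑ j ∈ s, c i * G i j * c j = 0 →
      ∀ i ∈ s, max (c i) 0 = 0 := by
    intro c h0
    set p := fun i => max (c i) 0
    set q := fun i => max (-c i) 0
    refine rat_simple_sum_ne_zero hD s p (fun i => le_max_right _ _)
      (hrel p (le_antisymm ?_ (hnn p)))
    have h1 : ∑ i ∈ s, ∑ j ∈ s, p i * G i j * p j = ∑ i ∈ s, ∑ j ∈ s, q i * G i j * p j := by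
      rw [← sub_eq_zero, ← Finset.sum_sub_distrib]
      simp only [← Finset.sum_sub_distrib]
      rw [Finset.sum_comm]
      refine Finset.sum_eq_zero fun j hj => ?_
      simp only [← sub_mul, p, q, max_zero_sub_max_neg_zero_eq_self]
      rw [← Finset.sum_mul, hrow c h0 j hj, zero_mul]
    rw [h1]
    refine Finset.sum_nonpos fun i hi => Finset.sum_nonpos fun j hj => ?_
    by_cases hij : i = j
    · subst hij
      rcases le_total 0 (c i) with h | h <;> simp [p, q, h]
    · exact mul_nonpos_of_nonpos_of_nonneg (mul_nonpos_of_nonneg_of_nonpos (le_max_right _ _)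
        (hoff i hi j hj hij)) (le_max_right _ _)
  intro c hc i hi
  have h1 := max_eq_right_iff.1 (hpart c hc i hi)
  have h2 := max_eq_right_iff.1 (hpart (fun i => -c i) (by simpa using hc) i hi)
  linarith

lemma exists_level (s : Finset S.Simple) : ∃ n, ∀ m, n ≤ m →
    (∀ i ∈ s, chE hD i ∈ S.F m) ∧ ∀ i ∈ s, chF hD i ∈ S.F m := by
  classical
  obtain ⟨n, hn⟩ := S.exists_mem_F (s.image (chE hD) ∪ s.image (chF hD))
  refine ⟨n, fun m hm => ⟨fun i hi => hn m hm _ ?_, fun i hi => hn m hm _ ?_⟩⟩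
  · exact Finset.mem_union_left _ (Finset.mem_image_of_mem _ hi)
  · exact Finset.mem_union_right _ (Finset.mem_image_of_mem _ hi)

include hD in
/-- The simple roots are linearly independent. -/
lemma linearIndependent_simple : LinearIndependent K (Subtype.val : S.Simple → _) := by
  classical
  rw [linearIndependent_iff']
  intro s c hc
  obtain ⟨n, hn⟩ := exists_level hD s
  obtain ⟨he, hf⟩ := hn n le_rfl
  obtain ⟨d, G, -, hd, hG, hsym, hnn, hdef⟩ := exists_gram_simple hD s n he hf
  let A : Matrix s s ℚ := fun i j => G i j
  have hA : A.det ≠ 0 := by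
    intro h0
    obtain ⟨v, hv0, hv⟩ := Matrix.exists_mulVec_eq_zero_iff.2 h0
    let c' : S.Simple → ℚ := fun i => if h : i ∈ s then v ⟨i, h⟩ else 0
    have hc' : ∀ i : s, c' i = v i := fun i => by simp [c']
    refine hv0 (funext fun i => ?_)
    rw [← hc']
    refine hdef c' (Finset.sum_eq_zero fun i hi => ?_) i i.2
    have h1 : ∑ j ∈ s, G i j * c' j = 0 := by
      have := congrFun hv ⟨i, hi⟩
      rw [← Finset.sum_coe_sort]
      simpa [Matrix.mulVec, dotProduct, hc', A] using this
    calc ∑ j ∈ s, c' i * G i j * c' j = c' i * ∑ j ∈ s, G i j * c' j := by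
          rw [Finset.mul_sum]
          exact Finset.sum_congr rfl fun j _ => by ring
      _ = 0 := by rw [h1, mul_zero]
  have hA' : (A.map (algebraMap ℚ K)).det ≠ 0 := by
    rw [← RingHom.mapMatrix_apply, ← RingHom.map_det]
    exact (map_ne_zero _).2 hA
  have h0 : (fun i : s => c i) = 0 := by
    by_contra hne
    refine hA' (Matrix.exists_mulVec_eq_zero_iff.1 ⟨_, hne, funext fun i => ?_⟩)
    have h1 := LinearMap.congr_fun hc (chH hD i)
    have h2 : ∑ j ∈ s, ((G i j : ℚ) : K) * c j = 0 := by
      calc ∑ j ∈ s, ((G i j : ℚ) : K) * c j = (d i : K) * ∑ j ∈ s, c j * j.1 (chH hD i) := by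
            rw [Finset.mul_sum]
            refine Finset.sum_congr rfl fun j hj => ?_
            rw [hG i i.2 j hj]; ring
        _ = 0 := by
            have h3 : ∑ j ∈ s, c j * j.1 (chH hD i) = 0 := by simpa using h1
            rw [h3, mul_zero]
    rw [← Finset.sum_coe_sort] at h2
    exact h2
  intro i hi
  exact congrFun h0 ⟨i, hi⟩

end Setup
end SimpleIndependence

section Heights
namespace Setup
variable {S : Setup K g}

/-- The sum of simple roots with given multiplicities. -/
def wt (S : Setup K g) : (S.Simple →₀ ℕ) →ₗ[ℕ] Module.Dual K S.h :=
  Finsupp.linearCombination ℕ Subtype.val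

@[simp] lemma wt_single (i : S.Simple) : S.wt (Finsupp.single i 1) = i.1 := by
  simp [wt]

lemma wt_add_single (c : S.Simple →₀ ℕ) (i : S.Simple) :
    S.wt (c + Finsupp.single i 1) = S.wt c + i.1 := by rw [map_add, wt_single]

lemma wt_injective (hD : S.IsDynkin) : Function.Injective S.wt := by
  have h := linearIndependent_simple hD
  refine h.restrict_scalars (R := ℕ) fun a b hab => ?_
  have h1 : a • (1 : K) = b • (1 : K) := hab
  rw [nsmul_one, nsmul_one] at h1
  exact Nat.cast_injective h1

/-- The subalgebra spanned by the weight spaces of an additive submonoid of weights. -/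
def wtSub (S : Setup K g) (Q : AddSubmonoid (Module.Dual K S.h)) : LieSubalgebra K g where
  toSubmodule := ⨆ β : Q, adWeightSpace K g S.h β.1
  lie_mem' {x y} hx hy := by
    change x ∈ ⨆ β : Q, adWeightSpace K g S.h β.1 at hx
    change y ∈ ⨆ β : Q, adWeightSpace K g S.h β.1 at hy
    change ⁅x, y⁆ ∈ ⨆ β : Q, adWeightSpace K g S.h β.1
    refine lie_mem_of_mem_iSup (fun γ y hy => ?_) hy
    rw [← lie_skew]
    refine neg_mem (lie_mem_of_mem_iSup (fun β x hx => ?_) hx)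
    exact Submodule.mem_iSup_of_mem (γ + β) (S.lie_mem_wt hy hx)

lemma mem_wtSub_of_mem {Q : AddSubmonoid (Module.Dual K S.h)} {β : Module.Dual K S.h}
    (hβ : β ∈ Q) {x : g} (hx : x ∈ adWeightSpace K g S.h β) : x ∈ S.wtSub Q :=
  show x ∈ ⨆ β : Q, adWeightSpace K g S.h β.1 from Submodule.mem_iSup_of_mem ⟨β, hβ⟩ hx

lemma mem_of_mem_wtSub {Q : AddSubmonoid (Module.Dual K S.h)} {β : Module.Dual K S.h}
    {x : g} (hx : x ∈ adWeightSpace K g S.h β) (h0 : x ≠ 0) (h : x ∈ S.wtSub Q) : β ∈ Q := by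
  by_contra hβ
  refine h0 (Submodule.disjoint_def.1 (S.h_indep β) x hx ?_)
  refine (iSup_le fun γ => ?_ : (⨆ β : Q, adWeightSpace K g S.h β.1) ≤ _) h
  exact le_iSup₂_of_le (f := fun β _ => adWeightSpace K g S.h β) γ.1
    (fun h => hβ (h ▸ γ.2)) le_rfl

/-- Positive roots are sums of simple roots. -/
lemma exists_wt (hD : S.IsDynkin) {γ : Module.Dual K S.h} (hγ : γ ∈ S.pos) :
    ∃ c, S.wt c = γ := by
  let Q : AddSubmonoid (Module.Dual K S.h) := AddMonoidHom.mrange S.wt.toAddMonoidHom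
  obtain ⟨e, he, h0⟩ := Submodule.exists_mem_ne_zero_of_ne_bot (S.pos_root γ hγ).2
  have hb : S.b ≤ S.wtSub Q := S.b_le hD
    (fun x hx => mem_wtSub_of_mem Q.zero_mem (S.wt_zero_of_mem_h hx))
    (fun α hα x hx => mem_wtSub_of_mem (Q := Q)
      ⟨Finsupp.single ⟨α, hα⟩ 1, wt_single _⟩ hx)
  exact mem_of_mem_wtSub he h0 (hb (S.mem_b_of_pos hγ he))

lemma exists_sub_simple (hD : S.IsDynkin) {c : S.Simple →₀ ℕ} (hc : S.wt c ∈ S.pos)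
    {i : S.Simple} (h : IsRootOf K g S.h (S.wt c - i.1)) :
    ∃ c', c = c' + Finsupp.single i 1 ∧ S.wt c' ∈ S.pos := by
  have h1 := sub_simple_pos hc i.2 h
  obtain ⟨c', hc'⟩ := exists_wt hD h1
  exact ⟨c', wt_injective hD (by rw [wt_add_single, hc', sub_add_cancel]), hc' ▸ h1⟩

lemma degree_add_single (c : S.Simple →₀ ℕ) (i : S.Simple) :
    (c + Finsupp.single i 1).degree = c.degree + 1 := by
  rw [map_add, Finsupp.degree_single]

lemma eq_zero_of_mem_nil_of_pos (hD : S.IsDynkin) {γ : Module.Dual K S.h} (hγ : γ ∈ S.pos)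
    {v : g} (hv : v ∈ adWeightSpace K g S.h γ) (hN : v ∈ S.nil) : v = 0 := by
  obtain ⟨c, rfl⟩ := exists_wt hD hγ
  obtain ⟨n, hn⟩ : ∃ n, c.degree = n := ⟨_, rfl⟩
  induction n using Nat.strong_induction_on generalizing c v with
  | _ n ih =>
    refine eq_zero_of_mem_nil_of_simple hD hγ (fun α hα x hx w hw hwt => ?_) hv hN
    by_cases h0 : w = 0
    · rw [h0, lie_zero]
    by_cases h : S.wt c - α = 0
    · rw [h] at hwt
      rw [← lie_skew, S.nil_cartan_central hw (S.mem_h_of_wt_zero hwt), neg_zero]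
    · obtain ⟨c', rfl, hc'⟩ := exists_sub_simple hD hγ (i := ⟨α, hα⟩) (isRootOf_of_mem h hwt h0)
      rw [wt_add_single, add_sub_cancel_right] at hwt
      rw [degree_add_single] at hn
      exact absurd (ih c'.degree (by omega) hw c' hc' hwt rfl) h0

lemma exists_triple_of_pos (hD : S.IsDynkin) {γ : Module.Dual K S.h} (hγ : γ ∈ S.pos) :
    ∃ e f H, S.Triple γ e f H := by
  obtain ⟨e, he, h0⟩ := Submodule.exists_mem_ne_zero_of_ne_bot (S.pos_root γ hγ).2
  obtain ⟨f, H, t⟩ := S.exists_triple (pos_ne_zero hγ) he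
    fun hN => h0 (eq_zero_of_mem_nil_of_pos hD hγ he hN)
  exact ⟨e, f, H, t⟩

lemma exists_triple_of_root (hD : S.IsDynkin) {γ : Module.Dual K S.h}
    (hγ : IsRootOf K g S.h γ) : ∃ e f H, S.Triple γ e f H := by
  rcases pos_or_neg hγ with h | h
  · exact exists_triple_of_pos hD h
  · obtain ⟨e, f, H, t⟩ := exists_triple_of_pos hD h
    have := t.symm
    rw [neg_neg] at this
    exact ⟨f, e, -H, this⟩

lemma mem_stab_span {x v : g} {c : K} (h : ⁅x, v⁆ = c • v) : x ∈ stab (K ∙ v) := by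
  intro y hy
  obtain ⟨r, rfl⟩ := Submodule.mem_span_singleton.1 hy
  rw [lie_smul, h]
  exact Submodule.smul_mem _ _ (Submodule.smul_mem _ _ (Submodule.mem_span_singleton_self _))

lemma Triple.lie_notMem_span {γ : Module.Dual K S.h} {e f : g} {H : S.h}
    (t : S.Triple γ e f H) : e ∉ stab (K ∙ f) := by
  intro h
  obtain ⟨r, hr⟩ := Submodule.mem_span_singleton.1 (h f (Submodule.mem_span_singleton_self f))
  have h1 : (H : g) ∈ adWeightSpace K g S.h (-γ) := by
    rw [← t.ef, ← hr]; exact Submodule.smul_mem _ _ t.f_mem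
  have h2 := S.disjoint_wt (fun h => t.ne_zero (neg_eq_zero.1 h)) h1 (S.wt_zero_of_mem_h H.2)
  have h3 : H = 0 := Subtype.ext h2
  have := t.two
  rw [h3] at this
  simp at this

/-- If `f₁` moves `e` into a subalgebra containing `e₁`, then the subalgebra contains `e`. -/
lemma Triple.mem_of_lie_mem {α β : Module.Dual K S.h} {e₁ f₁ e f : g} {H₁ H : S.h}
    (T : S.Triple α e₁ f₁ H₁) (t : S.Triple β e f H) {W : LieSubalgebra K g} (h0 : ⁅f₁, e⁆ ≠ 0)
    (h1 : ⁅f₁, e⁆ ∈ W) (h2 : e₁ ∈ W) : e ∈ W := by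
  have h3 : ⁅e₁, ⁅f₁, e⁆⁆ ≠ 0 := fun h => h0
    (T.slTwo.F_eq_zero (v := e) (by rw [LieAlgebra.ad_apply]; exact t.e_mem H₁) h)
  have h4 := W.lie_mem h2 h1
  have h5 := S.lie_mem_wt T.e_mem (S.lie_mem_wt T.f_mem t.e_mem)
  rw [add_neg_cancel_left] at h5
  obtain ⟨r, hr⟩ := t.exists_smul h5
  rw [hr] at h4 h3
  have := W.smul_mem r⁻¹ h4
  rwa [inv_smul_smul₀ fun h => h3 (by rw [h, zero_smul])] at this

/-- Negative root spaces are generated by negative simple root vectors. -/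
lemma neg_mem_of_chF (hD : S.IsDynkin) {W : LieSubalgebra K g} {s : Set S.Simple}
    (hW : ∀ i ∈ s, chF hD i ∈ W) {c : S.Simple →₀ ℕ} (hcs : ∀ i ∈ c.support, i ∈ s)
    (hc : S.wt c ∈ S.pos) {v : g} (hv : v ∈ adWeightSpace K g S.h (-S.wt c)) : v ∈ W := by
  obtain ⟨n, hn⟩ : ∃ n, c.degree = n := ⟨_, rfl⟩
  induction n using Nat.strong_induction_on generalizing c v with
  | _ n ih =>
    obtain ⟨e, f, H, t⟩ := exists_triple_of_pos hD hc
    obtain ⟨r, rfl⟩ := t.symm.exists_smul hv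
    refine W.smul_mem r ?_
    by_cases hi : ∃ i : S.Simple, ⁅chE hD i, f⁆ ≠ 0
    · obtain ⟨i, hi⟩ := hi
      have hwt := S.lie_mem_wt (chT hD i).e_mem t.f_mem
      by_cases h0 : S.wt c = i.1
      · have h1 : c = Finsupp.single i 1 := wt_injective hD (by rw [h0, wt_single])
        have h2 : i ∈ s := hcs i (by rw [h1]; simp)
        have h3 := t.f_mem
        rw [h0] at h3
        obtain ⟨r', hr'⟩ := (chT hD i).symm.exists_smul h3
        rw [hr']
        exact W.smul_mem r' (hW i h2)
      · have hroot := isRootOf_of_mem (fun h => h0 (by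
          rw [← sub_eq_add_neg, sub_eq_zero] at h; exact h.symm)) hwt hi
        have hneg : IsRootOf K g S.h (S.wt c - i.1) := by
          rcases pos_or_neg hroot with h | h
          · exact absurd i.2 (not_simple_of_add hc h (by abel))
          · have := S.pos_root _ h
            rwa [show -(i.1 + -S.wt c) = S.wt c - i.1 by abel] at this
        obtain ⟨c', rfl, hc'⟩ := exists_sub_simple hD hc hneg
        rw [degree_add_single] at hn
        have hi2 : i ∈ s := hcs i (by simp)
        have h1 : ⁅chE hD i, f⁆ ∈ W := by
          refine ih c'.degree (by omega) (fun j hj => hcs j ?_) hc' ?_ rfl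
          · simp only [Finsupp.mem_support_iff, Finsupp.add_apply] at hj ⊢
            omega
          · rwa [wt_add_single, show i.1 + -(S.wt c' + i.1) = -S.wt c' by abel] at hwt
        exact (chT hD i).symm.mem_of_lie_mem t.symm hi h1 (hW i hi2)
    · push Not at hi
      refine absurd ?_ t.lie_notMem_span
      refine S.b_le hD (fun x hx => mem_stab_span (c := (-S.wt c) ⟨x, hx⟩) (t.f_mem ⟨x, hx⟩))
        (fun α hα x hx => ?_) (S.mem_b_of_pos hc t.e_mem)
      obtain ⟨r, rfl⟩ := (chT hD ⟨α, hα⟩).exists_smul hx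
      exact mem_stab_span (c := 0) (by rw [smul_lie, hi, smul_zero, zero_smul])

/-- Positive root spaces are generated by simple root vectors. -/
lemma pos_mem_of_chE (hD : S.IsDynkin) {W : LieSubalgebra K g} {s : Set S.Simple}
    (hW : ∀ i ∈ s, chE hD i ∈ W) {c : S.Simple →₀ ℕ} (hcs : ∀ i ∈ c.support, i ∈ s)
    (hc : S.wt c ∈ S.pos) {v : g} (hv : v ∈ adWeightSpace K g S.h (S.wt c)) : v ∈ W := by
  obtain ⟨n, hn⟩ : ∃ n, c.degree = n := ⟨_, rfl⟩
  induction n using Nat.strong_induction_on generalizing c v with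
  | _ n ih =>
    obtain ⟨e, f, H, t⟩ := exists_triple_of_pos hD hc
    obtain ⟨r, rfl⟩ := t.exists_smul hv
    refine W.smul_mem r ?_
    by_cases hi : ∃ i : S.Simple, ⁅chF hD i, e⁆ ≠ 0
    · obtain ⟨i, hi⟩ := hi
      have hwt := S.lie_mem_wt (chT hD i).f_mem t.e_mem
      by_cases h0 : S.wt c = i.1
      · have h1 : c = Finsupp.single i 1 := wt_injective hD (by rw [h0, wt_single])
        have h2 : i ∈ s := hcs i (by rw [h1]; simp)
        have h3 := t.e_mem
        rw [h0] at h3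
        obtain ⟨r', hr'⟩ := (chT hD i).exists_smul h3
        rw [hr']
        exact W.smul_mem r' (hW i h2)
      · rw [neg_add_eq_sub] at hwt
        obtain ⟨c', rfl, hc'⟩ := exists_sub_simple hD hc
          (isRootOf_of_mem (sub_ne_zero.2 h0) hwt hi)
        rw [degree_add_single] at hn
        have hi2 : i ∈ s := hcs i (by simp)
        have h1 : ⁅chF hD i, e⁆ ∈ W := by
          refine ih c'.degree (by omega) (fun j hj => hcs j ?_) hc' ?_ rfl
          · simp only [Finsupp.mem_support_iff, Finsupp.add_apply] at hj ⊢
            omega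
          · rwa [wt_add_single, add_sub_cancel_right] at hwt
        exact (chT hD i).mem_of_lie_mem t hi h1 (hW i hi2)
    · push Not at hi
      refine absurd ?_ t.symm.lie_notMem_span
      exact neg_mem_of_chF hD (s := Set.univ)
        (fun i _ => mem_stab_span (c := 0) (by rw [hi, zero_smul]))
        (fun _ _ => trivial) hc t.f_mem

end Setup
end Heights

section ChevNil
namespace Setup
variable {S : Setup K g}

lemma isRootOf_neg (hD : S.IsDynkin) {γ : Module.Dual K S.h} (h : IsRootOf K g S.h γ) :
    IsRootOf K g S.h (-γ) := by
  obtain ⟨e, f, H, t⟩ := exists_triple_of_root hD h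
  exact t.symm.isRoot

lemma chE_chF_generate (hD : S.IsDynkin) {W : LieSubalgebra K g} (hh : ∀ x ∈ S.h, x ∈ W)
    (hE : ∀ i, chE hD i ∈ W) (hF : ∀ i, chF hD i ∈ W) (x : g) : x ∈ W := by
  have hx : x ∈ ⨆ α : Module.Dual K S.h, adWeightSpace K g S.h α := by rw [S.h_span]; trivial
  refine (iSup_le fun γ v hv => ?_ : _ ≤ W.toSubmodule) hx
  change v ∈ W
  by_cases h0 : γ = 0
  · exact hh v (S.mem_h_of_wt_zero (h0 ▸ hv))
  by_cases hv0 : v = 0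
  · rw [hv0]; exact W.zero_mem
  rcases pos_or_neg (isRootOf_of_mem h0 hv hv0) with h | h
  · obtain ⟨c, rfl⟩ := exists_wt hD h
    exact pos_mem_of_chE hD (s := Set.univ) (fun i _ => hE i) (fun _ _ => trivial) h hv
  · obtain ⟨c, hc⟩ := exists_wt hD h
    rw [← hc] at h
    rw [← neg_neg γ, ← hc] at hv
    exact neg_mem_of_chF hD (s := Set.univ) (fun i _ => hF i) (fun _ _ => trivial) h hv

lemma Triple.int_le_four {α β : Module.Dual K S.h} {e f e' f' : g} {H H' : S.h}
    (t : S.Triple α e f H) (t' : S.Triple β e' f' H') : ∃ p : ℤ, β H = p ∧ |p| ≤ 4 := by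
  classical
  obtain ⟨p, hp⟩ := t.exists_int t'.isRoot.2
  obtain ⟨q, hq⟩ := t'.exists_int t.isRoot.2
  refine ⟨p, hp, ?_⟩
  obtain ⟨n, hn⟩ := S.exists_mem_F {e, f, e', f'}
  have tt : ∀ b : Bool, S.Triple (bif b then α else β) (bif b then e else e')
      (bif b then f else f') (bif b then H else H') := by rintro (_ | _); exacts [t', t]
  obtain ⟨d, G, hd, -, hG, hs, hP, -⟩ := exists_gram tt Finset.univ n
    (by rintro (_ | _) _ <;> exact hn n le_rfl _ (by simp))
    (by rintro (_ | _) _ <;> exact hn n le_rfl _ (by simp))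
  have hdt := hd true (Finset.mem_univ _)
  have hdf := hd false (Finset.mem_univ _)
  have hG' : ∀ (i j : Bool) (z : ℚ), (bif j then α else β) (bif i then H else H') = z →
      G i j = d i * z := fun i j z hz => by
    have := hG i (Finset.mem_univ _) j (Finset.mem_univ _)
    rw [hz] at this
    exact_mod_cast this
  have h1 : G true false = d true * p := hG' _ _ _ (by simpa using hp)
  have h2 : G false true = d false * q := hG' _ _ _ (by simpa using hq)
  have h3 : G true true = d true * 2 := hG' _ _ _ (by simpa using t.two)
  have h4 : G false false = d false * 2 := hG' _ _ _ (by simpa using t'.two)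
  have h5 := hs true false
  have h6 := hP fun b => bif b then (p : ℚ) else -2
  simp only [Fintype.univ_bool, Finset.mem_singleton, Bool.true_eq_false, not_false_eq_true,
    Finset.sum_insert, Finset.sum_singleton, cond_true, cond_false, h3, h4, ← h5, h1] at h6
  rw [h1, h2] at h5
  have hpq : d true * (p * p) = d false * (p * q) := by linear_combination (p : ℚ) * h5
  have h7 : (p * q : ℤ) ≤ 4 := by
    have : (p * q : ℚ) ≤ 4 := le_of_mul_le_mul_left (by linarith) hdf
    exact_mod_cast this
  by_cases hp0 : p = 0
  · simp [hp0]
  have h8 : (0 : ℚ) < p * q := by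
    have : (0 : ℚ) < d true * (p * p) := mul_pos hdt (mul_self_pos.2 (by exact_mod_cast hp0))
    rw [hpq] at this
    exact pos_of_mul_pos_right this hdf.le
  have h9 : 0 < p * q := by exact_mod_cast h8
  have hq0 : q ≠ 0 := by rintro rfl; simp at h9
  calc |p| ≤ |p| * |q| := le_mul_of_one_le_right (abs_nonneg p) (Int.one_le_abs hq0)
    _ = p * q := by rw [← abs_mul, abs_of_pos h9]
    _ ≤ 4 := h7

lemma Triple.nilpotent (hD : S.IsDynkin) {α : Module.Dual K S.h} {e f : g} {H : S.h}
    (t : S.Triple α e f H) : IsNilpotent (LieAlgebra.ad K g e) := by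
  have hb : ∀ (γ : Module.Dual K S.h) (v : g), v ∈ adWeightSpace K g S.h γ → v ≠ 0 →
      ∃ p : ℤ, γ H = p ∧ |p| ≤ 4 := by
    intro γ v hv hv0
    by_cases h0 : γ = 0
    · exact ⟨0, by simp [h0], by simp⟩
    · obtain ⟨e', f', H', t'⟩ := exists_triple_of_root hD (isRootOf_of_mem h0 hv hv0)
      exact t.int_le_four t'
  have hpow : ∀ (γ : Module.Dual K S.h) (v : g), v ∈ adWeightSpace K g S.h γ → ∀ k : ℕ,
      (LieAlgebra.ad K g e ^ k) v ∈ adWeightSpace K g S.h (γ + k • α) := by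
    intro γ v hv k
    induction k with
    | zero => simpa using hv
    | succ k ih =>
      rw [pow_succ', Module.End.mul_apply, succ_nsmul, add_comm (k • α), add_left_comm]
      exact S.lie_mem_wt t.e_mem ih
  refine ⟨5, LinearMap.ext fun x => ?_⟩
  have hx : x ∈ ⨆ α : Module.Dual K S.h, adWeightSpace K g S.h α := by rw [S.h_span]; trivial
  refine (iSup_le fun γ v hv => ?_ : _ ≤ LinearMap.ker (LieAlgebra.ad K g e ^ 5)) hx
  rw [LinearMap.mem_ker]
  by_contra h5
  obtain ⟨p, hp, hp4⟩ := hb γ v hv (by rintro rfl; simp at h5)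
  obtain ⟨q, hq, hq4⟩ := hb _ _ (hpow γ v hv 5) h5
  rw [LinearMap.add_apply, LinearMap.smul_apply, t.two, hp] at hq
  have : p + 10 = q := by
    have h : ((p + 10 : ℤ) : K) = q := by rw [← hq]; push_cast; norm_num
    exact_mod_cast h
  rw [abs_le] at hp4 hq4
  omega

end Setup
end ChevNil

section Casimir

lemma sum_mul_comm_step {U ι : Type} [Ring U] [Algebra K U] {X Y : (ι →₀ ℕ) → U} {f R : U}
    {i : ι} {P : Finset (ι →₀ ℕ)} {A : (ι →₀ ℕ) → K} (h1 : Finsupp.single i 1 ∈ P) (h0 : 0 ∉ P)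
    (hP : ∀ c, c ∉ P → X c = 0 ∧ Y c = 0)
    (hX : ∀ c, c ≠ 0 → X (c + Finsupp.single i 1) * f - f * X (c + Finsupp.single i 1) = A c • X c)
    (hY : ∀ c, c ≠ 0 → Y c * f - f * Y c = -(A c • Y (c + Finsupp.single i 1)))
    (hXi : ∀ c ∈ P, c i = 0 → X c * f - f * X c = 0)
    (hR : Y (Finsupp.single i 1) *
      (X (Finsupp.single i 1) * f - f * X (Finsupp.single i 1)) = R) :
    (∑ c ∈ P, Y c * X c) * f = f * (∑ c ∈ P, Y c * X c) + R := by
  classical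
  have hsum : ∑ c ∈ P, A c • (Y (c + Finsupp.single i 1) * X c) =
      ∑ c ∈ P.erase (Finsupp.single i 1), Y c * (X c * f - f * X c) := by
    refine Finset.sum_bij_ne_zero (fun c _ _ => c + Finsupp.single i 1) (fun c hc hne => ?_)
      (fun a _ _ b _ _ hab => add_right_cancel hab) (fun b hb hne => ?_) (fun c hc _ => ?_)
    · refine Finset.mem_erase.2 ⟨fun h => h0 ?_, by_contra fun h => hne ?_⟩
      · rwa [← add_eq_right.1 h]
      · rw [(hP _ h).2, zero_mul, smul_zero]
    · obtain ⟨hb1, hb⟩ := Finset.mem_erase.1 hb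
      have hbi : b i ≠ 0 := fun h => hne (by rw [hXi b hb h, mul_zero])
      obtain ⟨c, rfl⟩ : ∃ c, b = c + Finsupp.single i 1 :=
        ⟨b - Finsupp.single i 1, (tsub_add_cancel_of_le
          (Finsupp.single_le_iff.2 (Nat.one_le_iff_ne_zero.2 hbi))).symm⟩
      have hc0 : c ≠ 0 := by rintro rfl; exact hb1 (zero_add _)
      rw [hX c hc0, mul_smul_comm] at hne
      refine ⟨c, by_contra fun h => hne ?_, hne, rfl⟩
      rw [(hP c h).1, mul_zero, smul_zero]
    · rw [hX c (by rintro rfl; exact h0 hc), mul_smul_comm]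
  have h2 : ∑ c ∈ P, Y c * (X c * f - f * X c) =
      R + ∑ c ∈ P, A c • (Y (c + Finsupp.single i 1) * X c) := by
    rw [hsum, ← hR, Finset.add_sum_erase _ (fun c => Y c * (X c * f - f * X c)) h1]
  have h3 : ∑ c ∈ P, (Y c * f - f * Y c) * X c =
      -∑ c ∈ P, A c • (Y (c + Finsupp.single i 1) * X c) := by
    rw [← Finset.sum_neg_distrib]
    refine Finset.sum_congr rfl fun c hc => ?_
    rw [hY c (by rintro rfl; exact h0 hc), neg_mul, smul_mul_assoc]
  rw [← sub_eq_iff_eq_add', Finset.sum_mul, Finset.mul_sum, ← Finset.sum_sub_distrib]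
  calc _ = ∑ c ∈ P, (Y c * (X c * f - f * X c) + (Y c * f - f * Y c) * X c) :=
        Finset.sum_congr rfl fun c _ => by noncomm_ring
    _ = R := by rw [Finset.sum_add_distrib, h2, h3, add_neg_cancel_right]

end Casimir

section Casimir2
attribute [local instance] LieRing.ofAssociativeRing
local notation "𝔦" => UniversalEnvelopingAlgebra.ι K
namespace Setup
variable {S : Setup K g}

lemma ι_mul_sub (x y : g) : 𝔦 x * 𝔦 y - 𝔦 y * 𝔦 x = 𝔦 ⁅x, y⁆ := by
  rw [LieHom.map_lie, LieRing.of_associative_ring_bracket]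

/-- The commutation relation of a partial Casimir element with a simple root vector. -/
lemma casimir_comm {ι : Type} {ω : (ι →₀ ℕ) → Module.Dual K S.h} {η : Module.Dual K S.h} {i : ι}
    {n : ℕ} {P : Finset (ι →₀ ℕ)} {x y : (ι →₀ ℕ) → g} {f : g} {R : Env K g}
    (hω : ∀ c, ω (c + Finsupp.single i 1) = ω c + η)
    (h1 : Finsupp.single i 1 ∈ P) (h0 : 0 ∉ P)
    (hP : ∀ c, c ∉ P → x c = 0 ∧ y c = 0)
    (hx : ∀ c ∈ P, x c ∈ adWeightSpace K g S.h (ω c))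
    (hy : ∀ c ∈ P, y c ∈ adWeightSpace K g S.h (-ω c))
    (hx1 : ∀ c ∈ P, ∀ v ∈ adWeightSpace K g S.h (ω c), ∃ r : K, v = r • x c)
    (hy1 : ∀ c ∈ P, ∀ v ∈ adWeightSpace K g S.h (-ω c), ∃ r : K, v = r • y c)
    (hxF : ∀ c, x c ∈ S.F n) (hyF : ∀ c, y c ∈ S.F n)
    (hxy : ∀ c ∈ P, killingForm K (S.F n) ⟨x c, hxF c⟩ ⟨y c, hyF c⟩ = 1)
    (hf : f ∈ adWeightSpace K g S.h (-η)) (hfF : f ∈ S.F n)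
    (hsub : ∀ c, c ≠ 0 → c + Finsupp.single i 1 ∈ P →
      adWeightSpace K g S.h (ω c) ≠ ⊥ → c ∈ P)
    (hadd : ∀ c ∈ P, adWeightSpace K g S.h (-(ω (c + Finsupp.single i 1))) ≠ ⊥ →
      c + Finsupp.single i 1 ∈ P)
    (hi : ∀ c ∈ P, c i = 0 → adWeightSpace K g S.h (ω c - η) = ⊥)
    (hR : 𝔦 (y (Finsupp.single i 1)) * 𝔦 ⁅x (Finsupp.single i 1), f⁆ = R) :
    (∑ c ∈ P, 𝔦 (y c) * 𝔦 (x c)) * 𝔦 f = 𝔦 f * (∑ c ∈ P, 𝔦 (y c) * 𝔦 (x c)) + R := by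
  have hA : ∀ c, ∃ A : K, c ≠ 0 → ⁅x (c + Finsupp.single i 1), f⁆ = A • x c ∧
      ⁅y c, f⁆ = -(A • y (c + Finsupp.single i 1)) := by
    intro c
    by_cases hc0 : c = 0
    · exact ⟨0, fun h => absurd hc0 h⟩
    have hX : ∃ r : K, ⁅x (c + Finsupp.single i 1), f⁆ = r • x c := by
      by_cases hci : c + Finsupp.single i 1 ∈ P
      · have h := S.lie_mem_wt (hx _ hci) hf
        rw [hω, add_neg_cancel_right] at h
        by_cases hv : ⁅x (c + Finsupp.single i 1), f⁆ = 0
        · exact ⟨0, by rw [hv, zero_smul]⟩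
        · exact hx1 c (hsub c hc0 hci fun hb => hv (by simpa [hb] using h)) _ h
      · exact ⟨0, by rw [(hP _ hci).1, zero_lie, zero_smul]⟩
    have hY : ∃ r : K, ⁅y c, f⁆ = r • y (c + Finsupp.single i 1) := by
      by_cases hc : c ∈ P
      · have h := S.lie_mem_wt (hy _ hc) hf
        rw [← _root_.neg_add, ← hω] at h
        by_cases hv : ⁅y c, f⁆ = 0
        · exact ⟨0, by rw [hv, zero_smul]⟩
        · exact hy1 _ (hadd c hc fun hb => hv (by simpa [hb] using h)) _ h
      · exact ⟨0, by rw [(hP _ hc).2, zero_lie, zero_smul]⟩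
    obtain ⟨r, hr⟩ := hX
    obtain ⟨r', hr'⟩ := hY
    by_cases hc : c ∈ P
    swap
    · refine ⟨0, fun _ => ⟨?_, ?_⟩⟩
      · rw [hr, (hP c hc).1, smul_zero, smul_zero]
      · rw [(hP c hc).2, zero_lie, zero_smul, neg_zero]
    by_cases hci : c + Finsupp.single i 1 ∈ P
    swap
    · refine ⟨0, fun _ => ⟨?_, ?_⟩⟩
      · rw [(hP _ hci).1, zero_lie, zero_smul]
      · rw [hr', (hP _ hci).2, smul_zero, smul_zero, neg_zero]
    have hk := LieModule.traceForm_apply_lie_apply K (S.F n) (S.F n)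
      ⟨x (c + Finsupp.single i 1), hxF _⟩ ⟨f, hfF⟩ ⟨y c, hyF c⟩
    have e1 : ⁅(⟨x (c + Finsupp.single i 1), hxF _⟩ : S.F n), (⟨f, hfF⟩ : S.F n)⁆ =
        r • ⟨x c, hxF c⟩ := Subtype.ext hr
    have e2 : ⁅(⟨f, hfF⟩ : S.F n), (⟨y c, hyF c⟩ : S.F n)⁆ =
        (-r') • ⟨y (c + Finsupp.single i 1), hyF _⟩ := Subtype.ext (by
      change ⁅f, y c⁆ = (-r') • y (c + Finsupp.single i 1)
      rw [← lie_skew, hr', neg_smul])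
    have k1 := hxy c hc
    have k2 := hxy _ hci
    rw [killingForm] at k1 k2
    rw [e1, e2, map_smul, map_smul, LinearMap.smul_apply, k1, k2] at hk
    have hk : r = -r' := by simpa using hk
    exact ⟨r, fun _ => ⟨hr, by rw [hr', hk, neg_smul, neg_neg]⟩⟩
  choose A hA using hA
  refine sum_mul_comm_step (K := K) (X := fun c => 𝔦 (x c)) (Y := fun c => 𝔦 (y c)) (i := i) (A := A)
    h1 h0 (fun c hc => ?_) (fun c hc => ?_) (fun c hc => ?_) (fun c hc hci => ?_) ?_
  · rw [(hP c hc).1, (hP c hc).2, map_zero]; exact ⟨rfl, rfl⟩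
  · rw [ι_mul_sub, (hA c hc).1, map_smul]
  · rw [ι_mul_sub, (hA c hc).2, map_neg, map_smul]
  · rw [ι_mul_sub]
    have h := S.lie_mem_wt (hx c hc) hf
    rw [← sub_eq_add_neg, hi c hc hci] at h
    rw [(Submodule.mem_bot K).1 h, map_zero]
  · rw [ι_mul_sub]; exact hR

/-- Elements whose images in the enveloping algebra lie in a left ideal. -/
def leftIdealSub (L : Submodule (Env K g) (Env K g)) : LieSubalgebra K g where
  carrier := {x | 𝔦 x ∈ L}
  zero_mem' := by
    change 𝔦 0 ∈ L
    rw [map_zero]; exact L.zero_mem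
  add_mem' {x y} hx hy := by
    change 𝔦 (x + y) ∈ L
    rw [map_add]; exact L.add_mem hx hy
  smul_mem' c x hx := by
    change 𝔦 (c • x) ∈ L
    rw [map_smul, Algebra.smul_def]; exact L.smul_mem _ hx
  lie_mem' {x y} hx hy := by
    change 𝔦 ⁅x, y⁆ ∈ L
    rw [← ι_mul_sub]; exact L.sub_mem (L.smul_mem _ hy) (L.smul_mem _ hx)

end Setup
end Casimir2

section Chev
attribute [local instance] LieRing.ofAssociativeRing
local notation "𝔦" => UniversalEnvelopingAlgebra.ι K
namespace Setup
variable {S : Setup K g}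

lemma finite_pos_support (hD : S.IsDynkin) {s : Finset S.Simple} {n : ℕ}
    (he : ∀ i ∈ s, chE hD i ∈ S.F n) :
    {c : S.Simple →₀ ℕ | (∀ i ∈ c.support, i ∈ s) ∧ S.wt c ∈ S.pos}.Finite := by
  have := S.F_findim n
  set P := {c : S.Simple →₀ ℕ | (∀ i ∈ c.support, i ∈ s) ∧ S.wt c ∈ S.pos}
  have h : ∀ c : P, ∃ v : S.F n, (v : g) ∈ adWeightSpace K g S.h (S.wt c) ∧ (v : g) ≠ 0 := by
    intro c
    obtain ⟨v, hv, h0⟩ := Submodule.exists_mem_ne_zero_of_ne_bot (S.pos_root _ c.2.2).2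
    exact ⟨⟨v, pos_mem_of_chE hD (s := s) he c.2.1 c.2.2 hv⟩, hv, h0⟩
  choose v hv h0 using h
  have hinj : Function.Injective fun c : P => S.wt c := fun a b hab =>
    Subtype.ext (wt_injective hD hab)
  have hli := (S.h_indep.comp hinj).linearIndependent _ hv h0
  have hli : LinearIndependent K v :=
    LinearIndependent.of_comp (S.F n).toSubmodule.subtype hli
  have : Finite P := hli.finite
  exact Set.toFinite P

lemma exists_dual_pair (hD : S.IsDynkin) {s : Finset S.Simple} {n : ℕ}
    (he : ∀ i ∈ s, chE hD i ∈ S.F n) (hf : ∀ i ∈ s, chF hD i ∈ S.F n) {d : S.Simple → ℚ}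
    (hdk : ∀ i (hi : i ∈ s),
      (d i : K) * killingForm K (S.F n) ⟨chE hD i, he i hi⟩ ⟨chF hD i, hf i hi⟩ = 1)
    {c : S.Simple →₀ ℕ} (hcs : ∀ i ∈ c.support, i ∈ s) (hc : S.wt c ∈ S.pos) :
    ∃ x y : S.F n, (x : g) ∈ adWeightSpace K g S.h (S.wt c) ∧
      (y : g) ∈ adWeightSpace K g S.h (-S.wt c) ∧ killingForm K (S.F n) x y = 1 ∧
      ∀ i, c = Finsupp.single i 1 → (x : g) = chE hD i ∧ (y : g) = (d i : K) • chF hD i := by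
  by_cases h : ∃ i, c = Finsupp.single i 1
  · obtain ⟨i, rfl⟩ := h
    have hi : i ∈ s := hcs i (by simp)
    refine ⟨⟨_, he i hi⟩, (d i : K) • ⟨_, hf i hi⟩, ?_, ?_, ?_, fun j hj => ?_⟩
    · rw [wt_single]; exact (chT hD i).e_mem
    · rw [wt_single]; exact Submodule.smul_mem _ _ (chT hD i).f_mem
    · rw [map_smul, smul_eq_mul]; exact hdk i hi
    · obtain rfl := (Finsupp.single_left_inj one_ne_zero).1 hj
      exact ⟨rfl, rfl⟩
  · obtain ⟨e, f, H, t⟩ := exists_triple_of_pos hD hc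
    have heF := pos_mem_of_chE hD (s := s) he hcs hc t.e_mem
    have hfF := neg_mem_of_chF hD (s := s) hf hcs hc t.f_mem
    obtain ⟨d', -, -, hd, -⟩ := exists_gram (fun _ : Unit => t) Finset.univ n
      (fun _ _ => heF) (fun _ _ => hfF)
    refine ⟨⟨e, heF⟩, (d' () : K) • ⟨f, hfF⟩, t.e_mem, Submodule.smul_mem _ _ t.f_mem, ?_,
      fun i hi => absurd ⟨i, hi⟩ h⟩
    rw [map_smul, smul_eq_mul]
    exact hd () (Finset.mem_univ _)

lemma exists_smul_of_ne_zero (hD : S.IsDynkin) {γ : Module.Dual K S.h} (hγ : IsRootOf K g S.h γ)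
    {x v : g} (hx : x ∈ adWeightSpace K g S.h γ) (h0 : x ≠ 0)
    (hv : v ∈ adWeightSpace K g S.h γ) : ∃ r : K, v = r • x := by
  obtain ⟨e, f, H, t⟩ := exists_triple_of_root hD hγ
  obtain ⟨a, rfl⟩ := t.exists_smul hx
  obtain ⟨b, rfl⟩ := t.exists_smul hv
  have ha : a ≠ 0 := by rintro rfl; simp at h0
  exact ⟨b * a⁻¹, by rw [smul_smul, inv_mul_cancel_right₀ ha]⟩

lemma exists_casimir (hD : S.IsDynkin) (s : Finset S.Simple) :
    ∃ (d : S.Simple → ℚ) (G : S.Simple → S.Simple → ℚ), IsGram Subtype.val (chH hD) s d G ∧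
    HasCasimir K (chE hD) (chF hD) (fun i => chH hD i) s d ∧
    HasCasimir K (chF hD) (chE hD) (fun i => ((-chH hD i : S.h) : g)) s d := by
  classical
  obtain ⟨n, hn⟩ := exists_level hD s
  obtain ⟨he, hf⟩ := hn n le_rfl
  obtain ⟨d, G, hdk, hG⟩ := exists_gram_simple hD s n he hf
  refine ⟨d, G, hG, ?_⟩
  have hfin := finite_pos_support hD he
  set P := hfin.toFinset with hPdef
  have hP : ∀ c, c ∈ P ↔ (∀ i ∈ c.support, i ∈ s) ∧ S.wt c ∈ S.pos := fun c =>
    hfin.mem_toFinset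
  have hxy : ∀ c, ∃ x y : S.F n, (c ∉ P → (x : g) = 0 ∧ (y : g) = 0) ∧ (c ∈ P →
      (x : g) ∈ adWeightSpace K g S.h (S.wt c) ∧
      (y : g) ∈ adWeightSpace K g S.h (-S.wt c) ∧ killingForm K (S.F n) x y = 1 ∧
      ∀ i, c = Finsupp.single i 1 → (x : g) = chE hD i ∧ (y : g) = (d i : K) • chF hD i) := by
    intro c
    by_cases hc : c ∈ P
    · obtain ⟨x, y, h⟩ := exists_dual_pair hD he hf hdk ((hP c).1 hc).1 ((hP c).1 hc).2
      exact ⟨x, y, fun h => absurd hc h, fun _ => h⟩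
    · exact ⟨0, 0, fun _ => ⟨rfl, rfl⟩, fun h => absurd h hc⟩
  choose x y hxy0 hxy using hxy
  have hroot : ∀ c ∈ P, IsRootOf K g S.h (S.wt c) := fun c hc => S.pos_root _ ((hP c).1 hc).2
  have hxy1 : ∀ c ∈ P, x c ≠ 0 ∧ y c ≠ 0 := fun c hc => by
    have := (hxy c hc).2.2.1
    constructor <;> intro h <;> simp [h] at this
  have h0 : (0 : S.Simple →₀ ℕ) ∉ P := fun h => (hroot 0 h).1 (map_zero _)
  have h1 : ∀ i ∈ s, Finsupp.single i 1 ∈ P := fun i hi => (hP _).2 ⟨fun j hj =>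
    Finset.mem_singleton.1 (Finsupp.support_single_subset hj) ▸ hi, by rw [wt_single]; exact i.2.1⟩
  have hne : ∀ c, c ≠ 0 → S.wt c ≠ 0 := fun c hc h =>
    hc (wt_injective hD (h.trans (map_zero _).symm))
  have hx1 : ∀ c ∈ P, ∀ v ∈ adWeightSpace K g S.h (S.wt c), ∃ r : K, v = r • (x c : g) :=
    fun c hc v hv => exists_smul_of_ne_zero hD (hroot c hc) (hxy c hc).1
      (Subtype.coe_injective.ne (hxy1 c hc).1) hv
  have hy1 : ∀ c ∈ P, ∀ v ∈ adWeightSpace K g S.h (-S.wt c), ∃ r : K, v = r • (y c : g) :=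
    fun c hc v hv => exists_smul_of_ne_zero hD (isRootOf_neg hD (hroot c hc)) (hxy c hc).2.1
      (Subtype.coe_injective.ne (hxy1 c hc).2) hv
  have hsub : ∀ i c, c ≠ 0 → c + Finsupp.single i 1 ∈ P → IsRootOf K g S.h (S.wt c) → c ∈ P := by
    intro i c hc hci hr
    obtain ⟨k1, k2⟩ := (hP _).1 hci
    refine (hP c).2 ⟨fun j hj => k1 j (Finsupp.support_mono le_self_add hj), ?_⟩
    have := sub_simple_pos k2 i.2 (by rwa [wt_add_single, add_sub_cancel_right])
    rwa [wt_add_single, add_sub_cancel_right] at this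
  have hadd : ∀ i ∈ s, ∀ c ∈ P, IsRootOf K g S.h (S.wt (c + Finsupp.single i 1)) →
      c + Finsupp.single i 1 ∈ P := by
    intro i hi c hc hr
    obtain ⟨k1, k2⟩ := (hP c).1 hc
    refine (hP _).2 ⟨fun j hj => ?_, ?_⟩
    · rcases Finset.mem_union.1 (Finsupp.support_add hj) with h | h
      · exact k1 j h
      · exact Finset.mem_singleton.1 (Finsupp.support_single_subset h) ▸ hi
    · rw [wt_add_single] at hr ⊢
      exact S.pos_add _ k2 _ i.2.1 hr
  have hi : ∀ i, ∀ c ∈ P, c i = 0 → ¬IsRootOf K g S.h (S.wt c - i.1) := by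
    intro i c hc hci hr
    obtain ⟨c', rfl, -⟩ := exists_sub_simple hD ((hP c).1 hc).2 hr
    simp at hci
  have hi' : ∀ i, ∀ c : S.Simple →₀ ℕ, c i = 0 → S.wt c - i.1 ≠ 0 := by
    intro i c hci h
    rw [sub_eq_zero, ← wt_single] at h
    rw [wt_injective hD h] at hci
    simp at hci
  have hsingle : ∀ i ∈ s, (x (Finsupp.single i 1) : g) = chE hD i ∧
      (y (Finsupp.single i 1) : g) = (d i : K) • chF hD i := fun i hi =>
    (hxy _ (h1 i hi)).2.2.2 i rfl
  have hnw : ∀ γ, γ ≠ 0 → adWeightSpace K g S.h (-γ) ≠ ⊥ → IsRootOf K g S.h γ := fun γ h h' => by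
    have := isRootOf_neg hD ⟨neg_ne_zero.2 h, h'⟩
    rwa [neg_neg] at this
  have hadd0 : ∀ (i : S.Simple) (c : S.Simple →₀ ℕ), c + Finsupp.single i 1 ≠ 0 := fun i c h => by
    have := DFunLike.congr_fun h i
    simp at this
  constructor
  · refine ⟨∑ c ∈ P, 𝔦 (y c : g) * 𝔦 (x c : g), Submodule.sum_mem _ fun c hc => ?_,
      fun i his => ?_⟩
    · refine Submodule.smul_mem _ (𝔦 (y c : g)) (?_ : 𝔦 (x c : g) ∈ _)
      exact pos_mem_of_chE hD (W := leftIdealSub (.span _ (Set.range fun i => 𝔦 (chE hD i))))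
        (s := s) (fun i _ => Submodule.subset_span (Set.mem_range_self i)) ((hP c).1 hc).1 ((hP c).1 hc).2 (hxy c hc).1
    · refine casimir_comm (ω := S.wt) (η := i.1) (x := fun c => x c) (y := fun c => y c)
        (fun c => wt_add_single c i) (h1 i his) h0 hxy0
        (fun c hc => (hxy c hc).1) (fun c hc => (hxy c hc).2.1) hx1 hy1 (fun c => (x c).2)
        (fun c => (y c).2) (fun c hc => (hxy c hc).2.2.1) (chT hD i).f_mem (hf i his)
        (fun c hc hci h => hsub i c hc hci ⟨hne c hc, h⟩)
        (fun c hc h => hadd i his c hc (hnw _ (hne _ (hadd0 i c)) h))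
        (fun c hc hci => by_contra fun h => hi i c hc hci ⟨hi' i c hci, h⟩) ?_
      rw [(hsingle i his).1, (hsingle i his).2, (chT hD i).ef, map_smul, smul_mul_assoc]
  · refine ⟨∑ c ∈ P, 𝔦 (x c : g) * 𝔦 (y c : g), Submodule.sum_mem _ fun c hc => ?_,
      fun i his => ?_⟩
    · refine Submodule.smul_mem _ (𝔦 (x c : g)) (?_ : 𝔦 (y c : g) ∈ _)
      exact neg_mem_of_chF hD (W := leftIdealSub (.span _ (Set.range fun i => 𝔦 (chF hD i))))
        (s := s) (fun i _ => Submodule.subset_span (Set.mem_range_self i)) ((hP c).1 hc).1 ((hP c).1 hc).2 (hxy c hc).2.1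
    · refine casimir_comm (ω := fun c => -S.wt c) (η := -i.1) (x := fun c => y c)
        (y := fun c => x c) (fun c => by rw [wt_add_single, _root_.neg_add]) (h1 i his) h0
        (fun c hc => (hxy0 c hc).symm) (fun c hc => (hxy c hc).2.1)
        (fun c hc => by rw [neg_neg]; exact (hxy c hc).1) hy1
        (fun c hc => by rw [neg_neg]; exact hx1 c hc) (fun c => (y c).2)
        (fun c => (x c).2)
        (fun c hc => by
          rw [killingForm, LieModule.traceForm_comm]; exact (hxy c hc).2.2.1)
        (by rw [neg_neg]; exact (chT hD i).e_mem) (he i his)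
        (fun c hc hci h => hsub i c hc hci (hnw _ (hne c hc) h))
        (fun c hc h => hadd i his c hc ⟨hne _ (hadd0 i c), by rwa [neg_neg] at h⟩)
        (fun c hc hci => by_contra fun h => hi i c hc hci (hnw _ (hi' i c hci) (by
          rwa [_root_.neg_sub_neg, ← neg_sub] at h))) ?_
      rw [(hsingle i his).1, (hsingle i his).2, smul_lie, ← lie_skew, (chT hD i).ef, map_smul,
        mul_smul_comm]
      rfl

/-- The Chevalley data attached to a Dynkin Borel subalgebra. -/
def chev (S : Setup K g) (hD : S.IsDynkin) : ChevData K g where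
  h := S.h
  I := S.Simple
  a := Subtype.val
  e := chE hD
  f := chF hD
  hc := chH hD
  h_comm H H' := S.lie_h H.2 H'.2
  he H i := (chT hD i).e_mem H
  hf H i := by rw [(chT hD i).f_mem H, LinearMap.neg_apply, neg_smul]
  ef i := (chT hD i).ef
  ef_ne i j hij := lie_simple_neg_simple i.2 j.2 (fun h => hij (Subtype.ext h)) (chT hD i).e_mem
    (chT hD j).f_mem
  a_hc i := (chT hD i).two
  gen := by
    refine eq_top_iff.2 fun x _ => chE_chF_generate hD (fun x hx => ?_) (fun i => ?_)
      (fun i => ?_) x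
    · exact LieSubalgebra.subset_lieSpan (Or.inl (Or.inl hx))
    · exact LieSubalgebra.subset_lieSpan (Or.inl (Or.inr ⟨i, rfl⟩))
    · exact LieSubalgebra.subset_lieSpan (Or.inr ⟨i, rfl⟩)
  nil_e i := (chT hD i).nilpotent hD
  nil_f i := (chT hD i).symm.nilpotent hD
  indep := linearIndependent_simple hD
  casimir := exists_casimir hD

end Setup
end Chev

section HalfSum
namespace Setup
variable {S : Setup K g}

lemma lie_mem_rootSpaceN {n : ℕ} {β γ : Module.Dual K (S.hn n)} {x y : g}
    (hx : x ∈ S.rootSpaceN n β) (hy : y ∈ S.rootSpaceN n γ) : ⁅x, y⁆ ∈ S.rootSpaceN n (β + γ) :=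
  ⟨(S.F n).lie_mem hx.1 hy.1, fun H => by
    rw [leibniz_lie, hx.2 H, hy.2 H, lie_smul, smul_lie, LinearMap.add_apply, add_smul]⟩

lemma mem_rootSpaceN_res {n : ℕ} {γ : Module.Dual K S.h} {x : g} (hx : x ∈ S.F n)
    (h : x ∈ adWeightSpace K g S.h γ) : x ∈ S.rootSpaceN n (S.resDual n γ) :=
  ⟨hx, fun H => h ⟨H, H.2.1⟩⟩

lemma finite_posRootsN (S : Setup K g) (n : ℕ) : (S.posRootsN n).Finite := by
  have := S.F_findim n
  refine (finite_adWt_ne_bot (τ := S.tau n)).subset fun β hβ => ?_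
  obtain ⟨x, hx, h0⟩ := Submodule.exists_mem_ne_zero_of_ne_bot hβ.2.1
  exact fun hb => h0 (congrArg Subtype.val
    ((Submodule.eq_bot_iff _).1 hb ⟨x, hx.1⟩ (S.mem_adWt_tau.2 hx.2)))

namespace Triple
variable {α : Module.Dual K S.h} {e f : g} {H : S.h} {n : ℕ}

lemma pow_mem_rootSpaceN (t : S.Triple α e f H) (he : e ∈ S.F n)
    {β : Module.Dual K (S.hn n)} {x : g} (hx : x ∈ S.rootSpaceN n β) (k : ℕ) :
    (LieAlgebra.ad K g e ^ k) x ∈ S.rootSpaceN n (β + k • S.resDual n α) := by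
  induction k with
  | zero => simpa using hx
  | succ k ih =>
    rw [pow_succ', Module.End.mul_apply, succ_nsmul, add_comm (k • _), add_left_comm]
    exact lie_mem_rootSpaceN (mem_rootSpaceN_res he t.e_mem) ih

lemma H_smul {β : Module.Dual K (S.hn n)} {x : g} (hx : x ∈ S.rootSpaceN n β)
    {hH : (H : g) ∈ S.hn n} {c : K} (hβ : β ⟨H, hH⟩ = c) :
    LieAlgebra.ad K g (H : g) x = c • x := by
  rw [← hβ]; exact hx.2 ⟨H, hH⟩

lemma exists_pow_eq (t : S.Triple α e f H) (he : e ∈ S.F n) (hf : f ∈ S.F n)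
    {β : Module.Dual K (S.hn n)} {hH : (H : g) ∈ S.hn n} {m : ℕ} (hβ : β ⟨H, hH⟩ = -(m : K)) :
    (∀ x ∈ S.rootSpaceN n β, (LieAlgebra.ad K g e ^ m) x = 0 → x = 0) ∧
    ∀ y ∈ S.rootSpaceN n (β + m • S.resDual n α),
      ∃ x ∈ S.rootSpaceN n β, (LieAlgebra.ad K g e ^ m) x = y := by
  have hfin : ∀ γ, FiniteDimensional K (S.rootSpaceN n γ) := fun γ =>
    haveI := S.F_findim n
    Submodule.finiteDimensional_of_le (S₂ := (S.F n).toSubmodule) inf_le_left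
  have hβ' : (β + m • S.resDual n α) ⟨H, hH⟩ = (m : K) := by
    have h2 : S.resDual n α ⟨H, hH⟩ = 2 := t.two
    rw [LinearMap.add_apply, LinearMap.smul_apply, h2, hβ, nsmul_eq_mul]
    ring
  let A : S.rootSpaceN n β →ₗ[K] S.rootSpaceN n (β + m • S.resDual n α) :=
    (LieAlgebra.ad K g e ^ m).restrict fun x hx => t.pow_mem_rootSpaceN he hx m
  let B : S.rootSpaceN n (β + m • S.resDual n α) →ₗ[K] S.rootSpaceN n β :=
    (LieAlgebra.ad K g f ^ m).restrict fun x hx => by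
      have := t.symm.pow_mem_rootSpaceN hf hx m
      rwa [show S.resDual n (-α) = -S.resDual n α from rfl, smul_neg, add_neg_cancel_right] at this
  have hA0 : ∀ x ∈ S.rootSpaceN n β, (LieAlgebra.ad K g e ^ m) x = 0 → x = 0 := fun x hx h =>
    t.slTwo.eq_zero_of_E_pow (H_smul hx hβ) h
  have hA : Function.Injective A := (injective_iff_map_eq_zero A).2 fun x hx =>
    Subtype.ext (hA0 x x.2 (congrArg Subtype.val hx))
  have hB : Function.Injective B := (injective_iff_map_eq_zero B).2 fun x hx =>
    Subtype.ext (t.slTwo.eq_zero_of_F_pow (H_smul x.2 hβ') (congrArg Subtype.val hx))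
  have hsurj := (LinearMap.injective_iff_surjective_of_finrank_eq_finrank
    (le_antisymm (LinearMap.finrank_le_finrank_of_injective hA)
      (LinearMap.finrank_le_finrank_of_injective hB))).1 hA
  refine ⟨hA0, fun y hy => ?_⟩
  obtain ⟨x, hx⟩ := hsurj ⟨y, hy⟩
  exact ⟨x, x.2, congrArg Subtype.val hx⟩

lemma exists_smul_rootSpaceN (t : S.Triple α e f H) (he : e ∈ S.F n) (hf : f ∈ S.F n)
    {v : g} (hv : v ∈ S.rootSpaceN n (S.resDual n α)) : ∃ c : K, v = c • e := by
  have hH : (H : g) ∈ S.hn n := ⟨H.2, t.H_mem he hf⟩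
  have key : ∀ v ∈ S.rootSpaceN n (S.resDual n α), ∃ h' : S.h, ⁅f, v⁆ = h' := fun v hv => by
    have := lie_mem_rootSpaceN (mem_rootSpaceN_res hf t.f_mem) hv
    rw [show S.resDual n (-α) = -S.resDual n α from rfl, neg_add_cancel] at this
    exact ⟨⟨_, S.mem_h_of_lie_hn this.1 fun x hx => by simpa using this.2 ⟨x, hx⟩⟩, rfl⟩
  obtain ⟨h', hh'⟩ := key v hv
  refine ⟨-(α h' / 2), ?_⟩
  set w := v + (α h' / 2) • e with hw
  have hwm : w ∈ S.rootSpaceN n (S.resDual n α) :=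
    Submodule.add_mem _ hv (Submodule.smul_mem _ _ (mem_rootSpaceN_res he t.e_mem))
  have hH2 : LieAlgebra.ad K g (H : g) w = (2 : K) • w := H_smul (hH := hH) hwm t.two
  have h1 : ⁅e, ⁅f, w⁆⁆ = 0 := by
    have h2 : ⁅f, w⁆ = ((h' - (α h' / 2) • H : S.h) : g) := by
      rw [hw, lie_add, lie_smul, hh', ← lie_skew, t.ef]
      push_cast
      rw [smul_neg, sub_eq_add_neg]
    rw [h2, ← lie_skew, t.e_mem, map_sub, map_smul, t.two, smul_eq_mul,
      div_mul_cancel₀ _ two_ne_zero, sub_self, zero_smul, neg_zero]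
  have h2 : LieAlgebra.ad K g f w = 0 := t.slTwo.F_eq_zero hH2 h1
  have h3 : w = 0 := t.slTwo.eq_zero_of_F_pow (r := 2) (by exact_mod_cast hH2) (by
    rw [pow_two, Module.End.mul_apply, h2, map_zero])
  rw [neg_smul, eq_neg_iff_add_eq_zero]
  exact h3

end Triple

/-- The positive root spaces other than that of a given root. -/
def nplusNe (S : Setup K g) (α : Module.Dual K S.h) : Submodule K g :=
  ⨆ γ : {γ // γ ∈ S.pos ∧ γ ≠ α}, adWeightSpace K g S.h γ.1

lemma mem_nplusNe {α γ : Module.Dual K S.h} (hγ : γ ∈ S.pos) (hne : γ ≠ α) {x : g}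
    (hx : x ∈ adWeightSpace K g S.h γ) : x ∈ nplusNe S α :=
  le_iSup (fun γ : {γ // γ ∈ S.pos ∧ γ ≠ α} => adWeightSpace K g S.h γ.1) ⟨γ, hγ, hne⟩ hx

lemma nplusNe_le (α : Module.Dual K S.h) : nplusNe S α ≤ S.b.toSubmodule :=
  iSup_le fun γ _ hx => S.mem_b_of_pos γ.2.1 hx

lemma lie_h_nplusNe {α : Module.Dual K S.h} {A v : g} (hA : A ∈ S.h) (hv : v ∈ nplusNe S α) :
    ⁅A, v⁆ ∈ nplusNe S α := by
  have h : nplusNe S α ≤ (nplusNe S α).comap (LieAlgebra.ad K g A) := iSup_le fun γ x hx => by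
    rw [Submodule.mem_comap, LieAlgebra.ad_apply, show ⁅A, x⁆ = _ from hx ⟨A, hA⟩]
    exact Submodule.smul_mem _ _ (mem_nplusNe γ.2.1 γ.2.2 hx)
  exact h hv

lemma Triple.lie_f_nplusNe {α : Module.Dual K S.h} {e f : g} {H : S.h} (t : S.Triple α e f H)
    (hα : S.IsSimpleRoot α) {v : g} (hv : v ∈ nplusNe S α) : ⁅f, v⁆ ∈ nplusNe S α := by
  have h : nplusNe S α ≤ (nplusNe S α).comap (LieAlgebra.ad K g f) := iSup_le fun γ x hx => by
    rw [Submodule.mem_comap]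
    by_cases h0 : LieAlgebra.ad K g f x = 0
    · rw [h0]; exact Submodule.zero_mem _
    have h1 : ⁅f, x⁆ ∈ adWeightSpace K g S.h (γ - α) := by
      have := S.lie_mem_wt t.f_mem hx
      rwa [neg_add_eq_sub] at this
    by_cases h2 : γ.1 - α = α
    · rw [h2] at h1
      obtain ⟨c, hc⟩ := t.exists_smul h1
      refine absurd (t.slTwo.F_eq_zero (m := γ.1 H) (hx H) ?_) h0
      simp only [LieAlgebra.ad_apply, hc, lie_smul, lie_self, smul_zero]
    · exact mem_nplusNe (sub_simple_pos γ.2.1 hα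
        (isRootOf_of_mem (sub_ne_zero.2 γ.2.2) h1 h0)) h2 h1
  exact h hv

lemma Triple.f_notMem_b {α : Module.Dual K S.h} {e f : g} {H : S.h} (t : S.Triple α e f H)
    (hα : α ∈ S.pos) : f ∉ S.b := fun hf => by
  refine t.f_ne_zero (Submodule.disjoint_def.1 (S.h_indep (-α)) f t.f_mem ?_)
  suffices h : S.b.toSubmodule ≤ ⨆ γ, ⨆ (_ : γ ≠ -α), adWeightSpace K g S.h γ from h hf
  rw [S.b_eq]
  refine sup_le ?_ (iSup₂_mono' ?_)
  · exact fun x hx => Submodule.mem_iSup_of_mem 0 (Submodule.mem_iSup_of_mem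
      (neg_ne_zero.2 t.ne_zero).symm (S.wt_zero_of_mem_h hx))
  · exact fun γ hγ => ⟨γ, fun h => neg_notMem_pos hα (h ▸ hγ), le_rfl⟩

lemma Triple.mem_nplusNe_of_mem_b {α : Module.Dual K S.h} {e f : g} {H : S.h}
    (t : S.Triple α e f H) {n : ℕ} {β : Module.Dual K (S.hn n)} (h0 : β ≠ 0)
    (hne : β ≠ S.resDual n α) {x : g} (hx : x ∈ S.rootSpaceN n β) (hb : x ∈ S.b) :
    x ∈ nplusNe S α := by
  have hle : S.b.toSubmodule ≤ S.h.toSubmodule ⊔ (K ∙ e ⊔ nplusNe S α) := by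
    rw [S.b_eq]
    refine sup_le_sup_left (iSup₂_le fun γ hγ y hy => ?_) _
    by_cases hγα : γ = α
    · subst hγα
      obtain ⟨c, rfl⟩ := t.exists_smul hy
      exact Submodule.mem_sup_left (Submodule.smul_mem _ _ (Submodule.mem_span_singleton_self _))
    · exact Submodule.mem_sup_right (mem_nplusNe hγ hγα hy)
  obtain ⟨A, hA⟩ : ∃ A, β A ≠ 0 := by
    by_contra! h
    exact h0 (LinearMap.ext h)
  obtain ⟨B, hB⟩ : ∃ B, β B ≠ S.resDual n α B := by
    by_contra! h
    exact hne (LinearMap.ext h)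
  obtain ⟨y, hy, z, hz, hyz⟩ := Submodule.mem_sup.1 (hle hb)
  have hz' : β A • x ∈ K ∙ e ⊔ nplusNe S α := by
    rw [← hx.2 A, ← hyz, lie_add, S.lie_h A.2.1 hy, zero_add]
    obtain ⟨u, hu, v, hv, rfl⟩ := Submodule.mem_sup.1 hz
    obtain ⟨c, rfl⟩ := Submodule.mem_span_singleton.1 hu
    rw [lie_add, lie_smul, show ⁅(A : g), e⁆ = _ from t.e_mem ⟨A, A.2.1⟩]
    exact Submodule.add_mem_sup (Submodule.smul_mem _ _ (Submodule.smul_mem _ _ (Submodule.mem_span_singleton_self _)))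
      (lie_h_nplusNe A.2.1 hv)
  rw [Submodule.smul_mem_iff _ hA] at hz'
  obtain ⟨u, hu, v, hv, huv⟩ := Submodule.mem_sup.1 hz'
  obtain ⟨c, rfl⟩ := Submodule.mem_span_singleton.1 hu
  refine (Submodule.smul_mem_iff _ (sub_ne_zero.2 hB)).1 ?_
  have h1 : ⁅(B : g), x⁆ = S.resDual n α B • c • e + ⁅(B : g), v⁆ := by
    rw [← huv, lie_add, lie_smul, show ⁅(B : g), e⁆ = _ from t.e_mem ⟨B, B.2.1⟩, smul_comm]
    rfl
  have h2 : (β B - S.resDual n α B) • x = ⁅(B : g), v⁆ - S.resDual n α B • v := by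
    rw [sub_smul, ← hx.2 B, h1, show x = c • e + v from huv.symm, smul_add]
    abel
  rw [h2]
  exact Submodule.sub_mem _ (lie_h_nplusNe B.2.1 hv) (Submodule.smul_mem _ _ hv)

/-- A simple reflection permutes the positive roots of `g_n` other than the simple root. -/
lemma Triple.reflect_mem_posRootsN {α : Module.Dual K S.h} {e f : g} {H : S.h}
    (t : S.Triple α e f H) (hα : S.IsSimpleRoot α) {n : ℕ} (he : e ∈ S.F n) (hf : f ∈ S.F n)
    {T : S.hn n} (hT : (T : g) = H) {β : Module.Dual K (S.hn n)} (hβ : β ∈ S.posRootsN n)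
    (hne : β ≠ S.resDual n α) :
    β - β T • S.resDual n α ∈ S.posRootsN n ∧ β - β T • S.resDual n α ≠ S.resDual n α := by
  obtain ⟨h0, hbot, hb⟩ := hβ
  have hH : (H : g) ∈ S.hn n := hT ▸ T.2
  obtain rfl : T = ⟨H, hH⟩ := Subtype.ext hT
  set a := S.resDual n α with ha
  have h2 : a ⟨H, hH⟩ = 2 := t.two
  obtain ⟨x, hx, hx0⟩ := Submodule.exists_mem_ne_zero_of_ne_bot hbot
  obtain ⟨z, hz⟩ := t.slTwo.int_of_ne (H_smul (hH := hH) hx rfl) hx0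
  have key : S.rootSpaceN n (β - β ⟨H, hH⟩ • a) ≠ ⊥ ∧
      S.rootSpaceN n (β - β ⟨H, hH⟩ • a) ≤ S.b.toSubmodule := by
    obtain ⟨m, rfl | rfl⟩ := z.eq_nat_or_neg
    · have hH' : ((-H : S.h) : g) ∈ S.hn n := (S.hn n).neg_mem hH
      have hβ' : β ⟨_, hH'⟩ = -(m : K) := by
        rw [show (⟨_, hH'⟩ : S.hn n) = -⟨H, hH⟩ from rfl, map_neg, hz, Int.cast_natCast]
      have hs : β - β ⟨H, hH⟩ • a = β + m • S.resDual n (-α) := by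
        rw [hz, Int.cast_natCast, Nat.cast_smul_eq_nsmul, sub_eq_add_neg,
          show S.resDual n (-α) = -a from rfl, smul_neg]
      obtain ⟨h3, h4⟩ := t.symm.exists_pow_eq hf he hβ'
      rw [hs]
      refine ⟨fun hb0 => hx0 (h3 x hx ?_), fun y hy => ?_⟩
      · have := t.symm.pow_mem_rootSpaceN hf hx m
        rwa [hb0, Submodule.mem_bot] at this
      · obtain ⟨x, hx, rfl⟩ := h4 y hy
        exact nplusNe_le α (Module.End.pow_apply_mem_of_forall_mem m
          (fun v hv => t.lie_f_nplusNe hα hv) x (t.mem_nplusNe_of_mem_b h0 hne hx (hb hx)))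
    · have hs : β - β ⟨H, hH⟩ • a = β + m • a := by
        rw [hz, Int.cast_neg, Int.cast_natCast, ← Nat.cast_smul_eq_nsmul K]
        generalize a = a'
        module
      obtain ⟨h3, h4⟩ := t.exists_pow_eq (β := β) (m := m) (hH := hH) he hf (by rw [hz]; simp)
      rw [hs]
      refine ⟨fun hb0 => hx0 (h3 x hx ?_), fun y hy => ?_⟩
      · have := t.pow_mem_rootSpaceN he hx m
        rwa [← ha, hb0, Submodule.mem_bot] at this
      · obtain ⟨x, hx, rfl⟩ := h4 y hy
        exact Module.End.pow_apply_mem_of_forall_mem (p := S.b.toSubmodule) m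
          (fun v hv => S.b.lie_mem (S.mem_b_of_pos hα.1 t.e_mem) hv) x (hb hx)
  refine ⟨⟨fun h => ?_, key⟩, fun h => ?_⟩
  · have h3 := LinearMap.congr_fun h ⟨H, hH⟩
    simp only [LinearMap.sub_apply, LinearMap.smul_apply, h2, smul_eq_mul,
      LinearMap.zero_apply] at h3
    rw [show β ⟨H, hH⟩ = 0 by linear_combination -h3, zero_smul, sub_zero] at h
    exact h0 h
  · have h3 := LinearMap.congr_fun h ⟨H, hH⟩
    simp only [LinearMap.sub_apply, LinearMap.smul_apply, h2, smul_eq_mul] at h3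
    have h4 : β = -a := by
      rw [show β ⟨H, hH⟩ = -2 by linear_combination -h3] at h
      rw [eq_neg_iff_add_eq_zero, ← sub_self a]
      nth_rewrite 2 [← h]
      generalize a = a'
      module
    refine t.f_notMem_b hα.1 (hb ?_)
    rw [h4, show -a = S.resDual n (-α) from rfl]
    exact mem_rootSpaceN_res hf t.f_mem

/-- The half sum of positive roots takes the value one at every simple coroot. -/
lemma rho_chH (hD : S.IsDynkin) {ρ : Module.Dual K S.h} (hρ : S.IsGlobalRho ρ) (i : S.Simple) :
    ρ (chH hD i) = 1 := by
  classical
  obtain ⟨n, hn⟩ := exists_level hD {i}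
  have he := (hn n le_rfl).1 i (by simp)
  have hf := (hn n le_rfl).2 i (by simp)
  have t := chT hD i
  let T : S.hn n := ⟨chH hD i, (chH hD i).2, t.H_mem he hf⟩
  set a := S.resDual n i.1 with ha
  have h2 : a T = 2 := t.two
  have hfin := S.finite_posRootsN n
  have haP : a ∈ S.posRootsN n := by
    refine ⟨fun h => ?_, fun h => t.e_ne_zero ?_, fun v hv => ?_⟩
    · rw [h, LinearMap.zero_apply] at h2
      exact two_ne_zero h2.symm
    · have := mem_rootSpaceN_res he t.e_mem
      rwa [← ha, h, Submodule.mem_bot] at this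
    · obtain ⟨c, rfl⟩ := t.exists_smul_rootSpaceN he hf hv
      exact S.b.smul_mem c (S.mem_b_of_pos i.2.1 t.e_mem)
  have hsum : ∑ β ∈ hfin.toFinset.erase a, β T = 0 := by
    refine Finset.sum_involution (fun β _ => β - β T • a) (fun β _ => ?_) (fun β _ h h' => ?_)
      (fun β hβ => ?_) (fun β _ => ?_)
    · rw [LinearMap.sub_apply, LinearMap.smul_apply, h2, smul_eq_mul]; ring
    · rw [sub_eq_self, smul_eq_zero_iff_left] at h'
      · exact h h'
      · exact haP.1
    · rw [Finset.mem_erase, hfin.mem_toFinset] at hβ ⊢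
      exact (t.reflect_mem_posRootsN i.2 he hf rfl hβ.2 hβ.1).symm
    · rw [LinearMap.sub_apply, LinearMap.smul_apply, h2, smul_eq_mul]
      module
  have h3 := LinearMap.congr_fun (hρ n) T
  rw [show S.resDual n ρ T = ρ (chH hD i) from rfl] at h3
  rw [h3, rhoN, finsum_mem_eq_finite_toFinset_sum _ hfin, LinearMap.smul_apply,
    LinearMap.sum_apply, ← Finset.add_sum_erase _ _ (hfin.mem_toFinset.2 haP), hsum, h2]
  norm_num

end Setup
end HalfSum

section Conclusion

attribute [local instance] LieRing.ofAssociativeRing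

local notation "𝔦" => UniversalEnvelopingAlgebra.ι K

namespace ChevData

variable {D : ChevData K g} {R : Type} [AddCommGroup R] [Module K R] [Module (Env K g) R]
  [IsScalarTower K (Env K g) R] {lam : Module.Dual K D.h} {w : R}

lemma map_word {R' : Type} [AddCommGroup R'] [Module K R'] [Module (Env K g) R']
    [IsScalarTower K (Env K g) R'] (φ : R →ₗ[Env K g] R') (l : List D.I) :
    φ (D.word w l) = D.word (φ w) l := by
  induction l with
  | nil => rfl
  | cons i l ih => exact (map_smul φ _ _).trans (congrArg _ ih)

lemma Sing.map {R' : Type} [AddCommGroup R'] [Module K R'] [Module (Env K g) R']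
    [IsScalarTower K (Env K g) R'] (φ : R →ₗ[Env K g] R') (hw : D.Sing w lam) :
    D.Sing (φ w) lam :=
  ⟨hWt_map φ hw.1, fun i => by rw [← map_smul, hw.2 i, map_zero]⟩

/-- A singular vector is not a combination of nontrivial words applied to it. -/
lemma Sing.notMem_span (hw : D.Sing w lam) (h0 : w ≠ 0) :
    w ∉ Submodule.span K (Set.range fun l : {l : List D.I // l ≠ []} => D.word w l) := by
  intro h
  have := mem_span_of_weight _ (fun l : {l : List D.I // l ≠ []} => lam - D.lwt l)
    (fun l => D.word_mem hw.1 l) hw.1 h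
  rw [show {l : {l : List D.I // l ≠ []} | lam - D.lwt l = lam} = ∅ from ?_, Set.image_empty,
    Submodule.span_empty, Submodule.mem_bot] at this
  · exact h0 this
  · refine Set.eq_empty_of_forall_notMem ?_
    rintro ⟨_ | ⟨i, l⟩, hl⟩ h
    · exact hl rfl
    · exact D.lwt_cons_ne_zero i l (sub_eq_self.1 h)

/-- The sum of the proper submodules of a highest weight module is proper. -/
lemma Sing.notMem_sSup (hw : D.Sing w lam) (h0 : w ≠ 0)
    (htop : Submodule.span (Env K g) {w} = ⊤) :
    w ∉ sSup {N : Submodule (Env K g) R | N ≠ ⊤} := by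
  set P := Submodule.span K (Set.range fun l : {l : List D.I // l ≠ []} => D.word w l) with hP
  obtain ⟨φ, h1, h2⟩ := Submodule.exists_le_ker_of_notMem (hw.notMem_span h0)
  have hle : Submodule.span K (Set.range (D.word w)) ≤ K ∙ w ⊔ P := by
    rw [Submodule.span_le]
    rintro _ ⟨_ | ⟨i, l⟩, rfl⟩
    · exact Submodule.mem_sup_left (Submodule.mem_span_singleton_self w)
    · exact Submodule.mem_sup_right (Submodule.subset_span ⟨⟨i :: l, List.cons_ne_nil _ _⟩, rfl⟩)
  have key : sSup {N : Submodule (Env K g) R | N ≠ ⊤} ≤ perp φ := sSup_le fun N hN x hx X => by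
    have hwN : N.mkQ w ≠ 0 := fun h => hN (top_le_iff.1 (htop ▸
      (Submodule.span_singleton_le_iff_mem _ _).2 ((Submodule.Quotient.mk_eq_zero N).1 h)))
    obtain ⟨y, hy, p, hp, hyp⟩ := Submodule.mem_sup.1
      (hle (D.mem_span_words hw (htop ▸ Submodule.mem_top : X • x ∈ _)))
    obtain ⟨c, rfl⟩ := Submodule.mem_span_singleton.1 hy
    have hpQ : N.mkQ p ∈ Submodule.span K
        (Set.range fun l : {l : List D.I // l ≠ []} => D.word (N.mkQ w) l) := by
      have h3 : P ≤ (Submodule.span K (Set.range fun l : {l : List D.I // l ≠ []} =>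
          D.word (N.mkQ w) l)).comap (N.mkQ.restrictScalars K) := by
        rw [hP, Submodule.span_le]
        rintro _ ⟨l, rfl⟩
        exact Submodule.subset_span ⟨l, (map_word N.mkQ _).symm⟩
      exact h3 hp
    have h4 : c • N.mkQ w + N.mkQ p = 0 := by
      have := (Submodule.Quotient.mk_eq_zero N).2 (N.smul_mem X hx)
      rw [← hyp] at this
      exact this
    have hc : c = 0 := by
      by_contra hc
      refine (hw.map N.mkQ).notMem_span hwN ((Submodule.smul_mem_iff _ hc).1 ?_)
      rw [eq_neg_of_add_eq_zero_left h4]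
      exact Submodule.neg_mem _ hpQ
    rw [← hyp, hc, zero_smul, zero_add]
    exact h2 hp
  intro h
  have := key h 1
  rw [one_smul] at this
  exact h1 this

/-- A primitive vector of a quotient yields a primitive weight. -/
lemma PrimWt.of_mem (hR : (⨆ mu, hWt D.h R mu) = ⊤) {A : Submodule (Env K g) R} {x : R}
    (hx : x ∉ A) (hw : ∀ H : D.h, (𝔦 (H : g) - algebraMap K _ (lam H)) • x ∈ A)
    (he : ∀ i, 𝔦 (D.e i) • x ∈ A) : D.PrimWt R lam := by
  obtain ⟨s, v, hv, hs⟩ := exists_wt_sum (h := D.h) (x := x) (hR ▸ Submodule.mem_top)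
  have h1 : A.mkQ x ∈ hWt D.h (R ⧸ A) lam := fun H => by
    rw [← sub_eq_zero, ← algebraMap_smul (Env K g) (lam H), ← sub_smul, ← map_smul]
    exact (Submodule.Quotient.mk_eq_zero A).2 (hw H)
  have h2 := mem_span_of_weight (fun mu => A.mkQ (v mu)) id (fun mu => hWt_map A.mkQ (hv mu)) h1
    (by
      rw [← hs, map_sum]
      exact Submodule.sum_mem _ fun mu _ => Submodule.subset_span ⟨mu, rfl⟩)
  rw [show {j | id j = lam} = {lam} from rfl, Set.image_singleton] at h2
  obtain ⟨c, hc⟩ := Submodule.mem_span_singleton.1 h2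
  have hc' : A.mkQ (c • v lam) = A.mkQ x := hc
  have hmem : x - c • v lam ∈ A := by
    rw [← Submodule.Quotient.mk_eq_zero]
    change A.mkQ _ = 0
    rw [map_sub, hc', sub_self]
  refine ⟨A, c • v lam, Submodule.smul_mem _ _ (hv lam), fun h => hx ?_, fun i => ?_⟩
  · have := A.add_mem hmem h
    rwa [sub_add_cancel] at this
  · have := A.sub_mem (he i) (A.smul_mem (𝔦 (D.e i)) hmem)
    rwa [smul_sub, sub_sub_cancel] at this

end ChevData

namespace Setup

variable {S : Setup K g} (hD : S.IsDynkin)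

lemma sing_nplus {R : Type} [AddCommGroup R] [Module K R] [Module (Env K g) R]
    [IsScalarTower K (Env K g) R] {lam : Module.Dual K S.h} {w : R}
    (hw : (S.chev hD).Sing w lam) {x : g} (hx : x ∈ S.nplus) : 𝔦 x • w = 0 := by
  have hwt : ∀ H : S.h, 𝔦 (H : g) • w = lam H • w := hw.1
  let W : LieSubalgebra K g :=
    { carrier := {x | ∃ c : K, 𝔦 x • w = c • w}
      add_mem' := by
        rintro a b ⟨c, hc⟩ ⟨d, hd⟩
        exact ⟨c + d, by rw [map_add, add_smul, hc, hd, add_smul]⟩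
      zero_mem' := ⟨0, by rw [map_zero, zero_smul, zero_smul]⟩
      smul_mem' := by
        rintro r a ⟨c, hc⟩
        exact ⟨r * c, by rw [iota_smul_smul, hc, mul_smul]⟩
      lie_mem' := by
        rintro a b ⟨c, hc⟩ ⟨d, hd⟩
        refine ⟨0, ?_⟩
        have := iota_smul_comm (K := K) a b w
        rw [hc, hd, env_smul_comm, env_smul_comm, hc, hd, smul_comm, left_eq_add] at this
        rw [this, zero_smul] }
  have hb : S.b ≤ W := b_le S hD (fun H hH => ⟨lam ⟨H, hH⟩, hwt ⟨H, hH⟩⟩) fun α hα x hx => by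
    obtain ⟨c, rfl⟩ := (chT hD ⟨α, hα⟩).exists_smul hx
    refine ⟨0, ?_⟩
    rw [iota_smul_smul, show 𝔦 (chE hD ⟨α, hα⟩) • w = 0 from hw.2 ⟨α, hα⟩, smul_zero, zero_smul]
  suffices h : S.nplus ≤ LinearMap.ker ((LinearMap.toSpanSingleton (Env K g) R w).restrictScalars K
      ∘ₗ (𝔦 : g →ₗ⁅K⁆ Env K g).toLinearMap) from h hx
  refine iSup₂_le fun γ hγ x hx => ?_
  obtain ⟨H, hH⟩ : ∃ H, γ H ≠ 0 := by
    by_contra! h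
    exact pos_ne_zero hγ (LinearMap.ext h)
  obtain ⟨c, hc⟩ : ∃ c : K, 𝔦 x • w = c • w := hb (S.mem_b_of_pos hγ hx)
  have := iota_smul_comm (K := K) (H : g) x w
  rw [hc, hwt, env_smul_comm, env_smul_comm, hc, hwt, smul_comm, left_eq_add, hx H,
    iota_smul_smul, smul_eq_zero] at this
  exact this.resolve_left hH

lemma sing_verma (lam : Module.Dual K S.h) :
    (S.chev hD).Sing (Submodule.Quotient.mk 1 : S.Verma lam) lam := by
  have hmk : ∀ X : Env K g, X • (Submodule.Quotient.mk 1 : S.Verma lam) =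
      Submodule.Quotient.mk X := fun X => by
    rw [← Submodule.Quotient.mk_smul, smul_eq_mul, mul_one]
  refine ⟨fun H => ?_, fun i => ?_⟩
  · rw [← algebraMap_smul (Env K g), hmk, hmk]
    exact (Submodule.Quotient.eq _).2 (Submodule.subset_span (Or.inr ⟨H, rfl⟩))
  · rw [hmk, Submodule.Quotient.mk_eq_zero]
    exact Submodule.subset_span (Or.inl ⟨_, wt_le_nplus i.2.1 (chT hD i).e_mem, rfl⟩)

include hD in
lemma verma_mk_one_ne_zero (lam : Module.Dual K S.h) :
    (Submodule.Quotient.mk 1 : S.Verma lam) ≠ 0 := by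
  intro h
  rw [Submodule.Quotient.mk_eq_zero] at h
  obtain ⟨V, _, _, _, _, w, hw, h0⟩ := (S.chev hD).exists_sing (lam := lam)
  have hle : S.vermaIdeal lam ≤ LinearMap.ker (LinearMap.toSpanSingleton (Env K g) V w) := by
    refine Submodule.span_le.2 ?_
    rintro _ (⟨x, hx, rfl⟩ | ⟨H, rfl⟩)
    · exact sing_nplus hD hw hx
    · change (𝔦 (H : g) - algebraMap K (Env K g) (lam H)) • w = 0
      rw [sub_smul, algebraMap_smul, sub_eq_zero]
      exact hw.1 H
  exact h0 (by simpa using hle h)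

include hD in
lemma mk_one_notMem_maxSub (lam : Module.Dual K S.h) :
    (Submodule.Quotient.mk 1 : S.Verma lam) ∉ S.maxSub lam := by
  refine (sing_verma hD lam).notMem_sSup (verma_mk_one_ne_zero hD lam) (eq_top_iff.2 ?_)
  rintro ⟨X⟩ -
  refine Submodule.mem_span_singleton.2 ⟨X, ?_⟩
  rw [← Submodule.Quotient.mk_smul, smul_eq_mul, mul_one]
  rfl

variable {M : Type} [AddCommGroup M] [Module K M] [Module (Env K g) M]
  [IsScalarTower K (Env K g) M]

lemma InO.adm (hM : S.InO M) : (S.chev hD).Adm M where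
  span := hM.span
  finite := hM.finite
  locFin v := by
    obtain ⟨N, h1, h2, h3⟩ := hM.locFin v
    exact ⟨N, h1, h2, fun i => h3 _ (wt_le_nplus i.2.1 (chT hD i).e_mem)⟩

/-- The highest weight of a composition factor is a primitive weight. -/
lemma IsCompFactor.primWt (hM : S.InO M) {lam : Module.Dual K S.h} (h : S.IsCompFactor M lam) :
    (S.chev hD).PrimWt M lam := by
  obtain ⟨_, _, T, -, -, j, -, ⟨φ⟩⟩ := h
  set v : S.SimpleL lam := (S.maxSub lam).mkQ (Submodule.Quotient.mk 1) with hv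
  have hsing : (S.chev hD).Sing v lam := (sing_verma hD lam).map _
  have hv0 : v ≠ 0 := fun h =>
    mk_one_notMem_maxSub hD lam ((Submodule.Quotient.mk_eq_zero _).1 h)
  obtain ⟨x, hx⟩ := Submodule.mkQ_surjective _ (φ.symm v)
  have key : ∀ X : Env K g, X • v = 0 ↔ X • (x : M) ∈ T.c j.castSucc := fun X => by
    rw [← φ.symm.map_eq_zero_iff, map_smul, ← hx, ← map_smul]
    exact Submodule.Quotient.mk_eq_zero _
  refine ChevData.PrimWt.of_mem (hM.adm hD).span (A := T.c j.castSucc) (x := x) (fun h => hv0 ?_)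
    (fun H => (key _).1 ?_) fun i => (key _).1 (hsing.2 i)
  · rw [← one_smul (Env K g) v, key, one_smul]
    exact h
  · rw [sub_smul, algebraMap_smul, sub_eq_zero]
    exact hsing.1 H

/-- Blocks are contained in orbits of the integral Weyl group. -/
lemma exists_weylGroup_of_blk {ρ : Module.Dual K S.h} (hρ : S.IsGlobalRho ρ)
    {lam mu : Module.Dual K S.h} (h : (S.chev hD).Blk lam mu) :
    ∃ w ∈ S.weylGroup, S.dotAct ρ w lam - lam ∈ S.rootLattice ∧ mu = S.dotAct ρ w lam := by
  obtain ⟨ho, hl⟩ := h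
  have horb : ∃ w ∈ S.weylGroup, mu = S.dotAct ρ w lam := by
    clear hl
    induction ho with
    | refl => exact ⟨1, one_mem _, (add_sub_cancel_right lam ρ).symm⟩
    | @tail x y _ hxy ih =>
      obtain ⟨w, hw, hx⟩ := ih
      obtain ⟨(i : S.Simple), hi⟩ := hxy
      have t := chT hD i
      have hc : S.IsCoroot i.1 (chH hD i) := ⟨t.two, _, t.e_mem, _, t.f_mem, t.ef.symm⟩
      refine ⟨S.reflection i.1 (chH hD i) hc.1 * w,
        mul_mem (Subgroup.subset_closure ⟨_, _, hc, t.isRoot, rfl⟩) hw, ?_⟩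
      have hx' : w (lam + ρ) = x + ρ := (sub_eq_iff_eq_add.1 hx.symm)
      change y = S.reflectionMap i.1 (chH hD i) (w (lam + ρ)) - ρ
      rw [hx', hi]
      change x - (x (chH hD i) + 1) • i.1 = x + ρ - (x (chH hD i) + ρ (chH hD i)) • i.1 - ρ
      rw [rho_chH hD hρ]
      abel
  obtain ⟨w, hw, rfl⟩ := horb
  refine ⟨w, hw, ?_, rfl⟩
  refine Submodule.span_mono ?_ hl
  rintro _ ⟨i, rfl⟩
  exact S.pos_root _ i.2.1

end Setup
end Conclusion

/-- If `M` is an indecomposable object of `O-bar` having `L(lam)` as a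
composition factor, then every composition factor of `M` is of the form `L(mu)` with
`mu ∈ W[lam] · lam`. -/
theorem indecomposable_compFactors_in_orbit
    (K : Type) [Field K] [IsAlgClosed K] [CharZero K]
    (g : Type) [LieRing g] [LieAlgebra K g] (S : Setup K g) (hDynkin : S.IsDynkin)
    (M : Type) [AddCommGroup M] [Module K M] [Module (Env K g) M]
    [IsScalarTower K (Env K g) M] (hM : S.InO M)
    (hInd : Indecomposable (K := K) (g := g) M)
    (ρ : Module.Dual K S.h) (hρ : S.IsGlobalRho ρ) (lam : Module.Dual K S.h)
    (hlam : S.IsCompFactor M lam) :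
    ∀ mu : Module.Dual K S.h, S.IsCompFactor M mu →
      ∃ w ∈ S.weylGroup, S.dotAct ρ w lam - lam ∈ S.rootLattice ∧
        mu = S.dotAct ρ w lam := by
  intro mu hmu
  exact Setup.exists_weylGroup_of_blk hDynkin hρ (ChevData.PrimWt.blk (hM.adm hDynkin) hInd.2
    (hlam.primWt hDynkin hM) (hmu.primWt hDynkin hM))

end Paper
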